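/- Lipshitz–Robinson: Let X be a reduced quasi-compact rigid analytic variety and let Σ be a subanalytic set in X. Then the complement X \ Σ and the closure of Σ in the canonical topology are again subanalytic in X. -/

import Mathlib

/-!  Prelude: rigid-analytic basics over a complete non-archimedean
algebraically closed field `K`. -/

open scoped BoundedContinuousFunction

noncomputable section

namespace RigidQE

variable (K : Type) [NormedField K] [CompleteSpace K] [IsAlgClosed K] [IsUltrametricDist K]

/-- The valuation ring `R = {x : K | ‖x‖ ≤ 1}` of `K`. -/
def Ro : Subring K where
  carrier := {x | ‖x‖ ≤ 1}
  zero_mem' := by simp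
  one_mem' := by simp
  add_mem' := fun {a b} ha hb => le_trans (IsUltrametricDist.norm_add_le_max a b) (max_le ha hb)
  neg_mem' := fun {a} ha => by simpa using ha
  mul_mem' := fun {a b} ha hb => le_trans (norm_mul_le a b)
    (by simpa using mul_le_one₀ ha (norm_nonneg b) hb)

/-- The maximal ideal `℘ = {x : K | ‖x‖ < 1}` of the valuation ring. -/
def RoMax : Ideal (Ro K) where
  carrier := {x | ‖(x : K)‖ < 1}
  zero_mem' := by simp
  add_mem' := fun {a b} ha hb =>
    lt_of_le_of_lt (IsUltrametricDist.norm_add_le_max (a : K) (b : K)) (max_lt ha hb)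
  smul_mem' := fun c x hx => by
    have h1 : ‖(c : K)‖ ≤ 1 := c.2
    have : ‖(c : K) * (x : K)‖ ≤ 1 * ‖(x : K)‖ := le_trans (norm_mul_le _ _) (by gcongr)
    simpa using lt_of_le_of_lt (by simpa using this) hx

/-- The closed unit polydisc `R^m ⊆ K^m`. -/
def UnitBall (m : ℕ) : Set (Fin m → K) := {x | ∀ i, ‖x i‖ ≤ 1}

/-- The `i`-th coordinate function on the unit polydisc, as a bounded continuous function. -/
def coordFn (m : ℕ) (i : Fin m) : (UnitBall K m) →ᵇ K :=
  BoundedContinuousFunction.ofNormedAddCommGroup (fun x => x.1 i)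
    ((continuous_apply i).comp continuous_subtype_val) 1 (fun x => x.2 i)

/-- The Tate algebra `K⟨S₁,…,Sₘ⟩` of strictly convergent power series, realised concretely
as the closure, with respect to the supremum norm, of the algebra of polynomial functions
on the unit polydisc. -/
def TateAlg (m : ℕ) : Subalgebra K ((UnitBall K m) →ᵇ K) :=
  (Algebra.adjoin K (Set.range (coordFn K m))).topologicalClosure

end RigidQE

end

noncomputable section
namespace RigidQE

variable (K : Type) [NormedField K] [CompleteSpace K] [IsAlgClosed K] [IsUltrametricDist K]

/-- The projection `R^{m+N} → R^m` on the first `m` coordinates. -/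
def ballProj (m N : ℕ) (z : UnitBall K (m + N)) : UnitBall K m :=
  ⟨fun i => z.1 (Fin.castAdd N i), fun i => z.2 _⟩

lemma ballProj_continuous (m N : ℕ) : Continuous (ballProj K m N) := by
  apply Continuous.subtype_mk
  exact continuous_pi fun i => (continuous_apply _).comp continuous_subtype_val

/-- Pullback of bounded functions along the projection of polydiscs. -/
def ballPull (m N : ℕ) : ((UnitBall K m) →ᵇ K) →ₐ[K] ((UnitBall K (m + N)) →ᵇ K) where
  toFun f := f.compContinuous ⟨ballProj K m N, ballProj_continuous K m N⟩
  map_one' := by ext z; simp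
  map_mul' f g := by ext z; simp
  map_zero' := by ext z; simp
  map_add' f g := by ext z; simp
  commutes' c := by ext z; simp

lemma ballPull_lipschitz (m N : ℕ) : LipschitzWith 1 (ballPull K m N) := by
  apply LipschitzWith.of_dist_le_mul
  intro f g
  simp only [NNReal.coe_one, one_mul]
  refine (BoundedContinuousFunction.dist_le (dist_nonneg (x := f) (y := g))).2 ?_
  intro z
  exact BoundedContinuousFunction.dist_coe_le_dist (f := f) (g := g) (ballProj K m N z)

lemma ballPull_mem_TateAlg (m N : ℕ) {f : (UnitBall K m) →ᵇ K} (hf : f ∈ TateAlg K m) :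
    ballPull K m N f ∈ TateAlg K (m + N) := by
  have hsub : (ballPull K m N) '' (Algebra.adjoin K (Set.range (coordFn K m)) : Set _)
      ⊆ (Algebra.adjoin K (Set.range (coordFn K (m + N))) : Set _) := by
    rintro g ⟨g', hg', rfl⟩
    have : ballPull K m N g' ∈ (Algebra.adjoin K (Set.range (coordFn K m))).map
        (ballPull K m N) := Subalgebra.mem_map.2 ⟨g', hg', rfl⟩
    rw [AlgHom.map_adjoin] at this
    refine Algebra.adjoin_mono ?_ this
    rintro h ⟨h', ⟨i, rfl⟩, rfl⟩
    exact ⟨Fin.castAdd N i, by ext z; rfl⟩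
  have := (image_closure_subset_closure_image (s := (Algebra.adjoin K (Set.range (coordFn K m)) :
      Set _)) (ballPull_lipschitz K m N).continuous) (Set.mem_image_of_mem _ hf)
  exact closure_mono hsub this

/-- An affinoid variety, realised concretely as the zero locus, inside a closed unit
polydisc, of a set of strictly convergent power series. -/
structure Affinoid where
  m : ℕ
  carrier : Set (UnitBall K m)
  isZeroLocus : ∃ S : Set ((UnitBall K m) →ᵇ K),
    (∀ f ∈ S, f ∈ TateAlg K m) ∧ carrier = {x | ∀ f ∈ S, f x = 0}

variable {K}

/-- Restriction of (bounded continuous) functions on the polydisc to a subset, as plain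
functions. -/
def resHom {m : ℕ} (Z : Set (UnitBall K m)) : ((UnitBall K m) →ᵇ K) →ₐ[K] (Z → K) where
  toFun f := fun z => f z.1
  map_one' := rfl
  map_mul' f g := rfl
  map_zero' := rfl
  map_add' f g := rfl
  commutes' c := rfl

/-- The affinoid algebra of `X`, realised concretely as the algebra of functions on `X`
which are restrictions of strictly convergent power series.  (Since `K` is algebraically
closed, this faithfully represents the reduced affinoid algebra.) -/
def Affinoid.O (X : Affinoid K) : Subalgebra K (X.carrier → K) :=
  (TateAlg K X.m).map (resHom X.carrier)

/-- A basic semianalytic subset of an affinoid variety. -/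
def IsBasicSemianalytic (X : Affinoid K) (S : Set X.carrier) : Prop :=
  ∃ (mm n : ℕ) (p q : Fin mm → X.O), n ≤ mm ∧
    S = {x | (∀ i : Fin mm, (i : ℕ) < n → ‖(p i : X.carrier → K) x‖ ≤ ‖(q i : X.carrier → K) x‖)
      ∧ (∀ i : Fin mm, n ≤ (i : ℕ) → ‖(p i : X.carrier → K) x‖ < ‖(q i : X.carrier → K) x‖)}

/-- A semianalytic subset of an affinoid variety: a finite union of basic sets. -/
def IsSemianalytic (X : Affinoid K) (S : Set X.carrier) : Prop :=
  ∃ (k : ℕ) (B : Fin k → Set X.carrier),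
    (∀ j, IsBasicSemianalytic X (B j)) ∧ S = ⋃ j, B j

variable (K)

/-- The product `X × R^N` of an affinoid variety with a closed unit polydisc. -/
def Affinoid.prod (X : Affinoid K) (N : ℕ) : Affinoid K where
  m := X.m + N
  carrier := {z | ballProj K X.m N z ∈ X.carrier}
  isZeroLocus := by
    obtain ⟨S, hS, hXS⟩ := X.isZeroLocus
    refine ⟨(ballPull K X.m N) '' S, ?_, ?_⟩
    · rintro f ⟨f', hf', rfl⟩
      exact ballPull_mem_TateAlg K X.m N (hS f' hf')
    · ext z
      simp only [Set.mem_setOf_eq, hXS, Set.forall_mem_image]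
      rfl

variable {K}

/-- The projection map `X × R^N → X` on points. -/
def Affinoid.projFun (X : Affinoid K) (N : ℕ) (z : (X.prod K N).carrier) : X.carrier :=
  ⟨ballProj K X.m N z.1, z.2⟩

/-- A subanalytic subset of an affinoid variety: the image of a semianalytic subset of
`X × R^N` under the projection `X × R^N → X`. -/
def IsSubanalytic (X : Affinoid K) (S : Set X.carrier) : Prop :=
  ∃ (N : ℕ) (T : Set (X.prod K N).carrier),
    IsSemianalytic (X.prod K N) T ∧ S = (X.projFun N) '' T

end RigidQE
end

noncomputable section
namespace RigidQE

variable {K : Type} [NormedField K] [CompleteSpace K] [IsAlgClosed K] [IsUltrametricDist K]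

/-- A map of affinoid varieties: a map on points which pulls analytic functions back to
analytic functions (equivalently, a map induced by a `K`-algebra morphism of the
corresponding affinoid algebras). -/
structure AffinoidMap (Y X : Affinoid K) where
  toFun : Y.carrier → X.carrier
  pullback : ∀ p : X.O, (fun y => (p : X.carrier → K) (toFun y)) ∈ Y.O

/-- The `K`-algebra morphism of affinoid algebras corresponding to a map of affinoid
varieties. -/
def AffinoidMap.algHom {Y X : Affinoid K} (f : AffinoidMap Y X) : X.O →ₐ[K] Y.O where
  toFun p := ⟨fun y => (p : X.carrier → K) (f.toFun y), f.pullback p⟩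
  map_one' := by ext y; simp
  map_mul' p q := by ext y; simp
  map_zero' := by ext y; simp
  map_add' p q := by ext y; simp
  commutes' c := by ext y; simp

/-- A map of affinoid varieties is flat if the corresponding morphism of affinoid algebras
is flat. -/
def AffinoidMap.Flat {Y X : Affinoid K} (f : AffinoidMap Y X) : Prop :=
  RingHom.Flat f.algHom.toRingHom

open Classical in
/-- The truncated division function `D` of Denef–van den Dries:
`D (a, b) = a / b` if `‖a‖ ≤ ‖b‖ ≠ 0`, and `D (a, b) = 0` otherwise. -/
def Ddiv (a b : K) : K := if ‖a‖ ≤ ‖b‖ ∧ b ≠ 0 then a / b else 0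

/-- The point `(x, t) ∈ X × R^N` determined by `x ∈ X` and `t ∈ R^N`. -/
def extendPt (X : Affinoid K) (N : ℕ) (x : X.carrier) (t : Fin N → K)
    (ht : ∀ i, ‖t i‖ ≤ 1) : (X.prod K N).carrier := by
  have hmem : Fin.append (fun i => x.1.1 i) t ∈ UnitBall K (X.m + N) := by
    intro j
    refine Fin.addCases (motive := fun j => ‖Fin.append (fun i => x.1.1 i) t j‖ ≤ 1)
      (fun i => ?_) (fun i => ?_) j
    · simp only [Fin.append_left]; exact x.1.2 i
    · simp only [Fin.append_right]; exact ht i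
  refine ⟨⟨Fin.append (fun i => x.1.1 i) t, hmem⟩, ?_⟩
  show ballProj K X.m N ⟨Fin.append (fun i => x.1.1 i) t, hmem⟩ ∈ X.carrier
  have h : ballProj K X.m N ⟨Fin.append (fun i => x.1.1 i) t, hmem⟩ = x.1 := by
    apply Subtype.ext; funext i
    show Fin.append (fun i => x.1.1 i) t (Fin.castAdd N i) = x.1.1 i
    rw [Fin.append_left]
  rw [h]; exact x.2

/-- The algebra `A^D` of `D`-functions on an affinoid variety `X = Sp A`: the smallest
`K`-algebra of `K`-valued functions on `X` containing `A` and closed under truncated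
division `D` and under composition with strictly convergent power series over `A`
(the latter being realised as analytic functions on `X × R^N`). -/
inductive IsDFun (X : Affinoid K) : (X.carrier → K) → Prop
  | base (p : X.O) : IsDFun X (p : X.carrier → K)
  | smul (c : K) {p : X.carrier → K} : IsDFun X p → IsDFun X (c • p)
  | add {p q : X.carrier → K} : IsDFun X p → IsDFun X q → IsDFun X (p + q)
  | mul {p q : X.carrier → K} : IsDFun X p → IsDFun X q → IsDFun X (p * q)
  | div {p q : X.carrier → K} : IsDFun X p → IsDFun X q →
      IsDFun X (fun x => Ddiv (p x) (q x))
  | comp (N : ℕ) (p : (X.prod K N).O) (q : Fin N → (X.carrier → K))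
      (hq : ∀ i, IsDFun X (q i)) (hq1 : ∀ i x, ‖q i x‖ ≤ 1) :
      IsDFun X (fun x =>
        (p : (X.prod K N).carrier → K) (extendPt X N x (fun i => q i x) (fun i => hq1 i x)))

/-- A basic `D`-semianalytic subset of an affinoid variety. -/
def IsBasicDSemianalytic (X : Affinoid K) (S : Set X.carrier) : Prop :=
  ∃ (mm n : ℕ) (p q : Fin mm → (X.carrier → K)), n ≤ mm ∧
    (∀ i, IsDFun X (p i) ∧ IsDFun X (q i)) ∧
    S = {x | (∀ i : Fin mm, (i : ℕ) < n → ‖p i x‖ ≤ ‖q i x‖)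
      ∧ (∀ i : Fin mm, n ≤ (i : ℕ) → ‖p i x‖ < ‖q i x‖)}

/-- A `D`-semianalytic subset of an affinoid variety: a finite union of basic
`D`-semianalytic sets. -/
def IsDSemianalytic (X : Affinoid K) (S : Set X.carrier) : Prop :=
  ∃ (k : ℕ) (B : Fin k → Set X.carrier),
    (∀ j, IsBasicDSemianalytic X (B j)) ∧ S = ⋃ j, B j

end RigidQE
end

set_option synthInstance.maxHeartbeats 1000000
set_option maxHeartbeats 1000000

noncomputable section
namespace RigidQE

variable (K : Type) [NormedField K] [CompleteSpace K] [IsAlgClosed K] [IsUltrametricDist K]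

/-- A `K`-analytic space datum: a topological space of points together with a `K`-algebra
of `K`-valued analytic functions.  Rigid analytic varieties (and, with suitable
separation hypotheses, Berkovich spaces) are modelled by such data. -/
structure Space where
  P : Type
  [top : TopologicalSpace P]
  O : Subalgebra K (P → K)
  cont : ∀ f ∈ O, Continuous f

attribute [instance] Space.top

variable {K}

/-- A map of spaces: continuous on points and pulling analytic functions back to
analytic functions. -/
structure FMap (Y X : Space K) where
  toFun : Y.P → X.P
  cont : Continuous toFun
  pullback : ∀ p ∈ X.O, (p ∘ toFun) ∈ Y.O

/-- Composition of maps of spaces. -/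
def FMap.comp {W Y X : Space K} (f : FMap Y X) (g : FMap W Y) : FMap W X where
  toFun := f.toFun ∘ g.toFun
  cont := f.cont.comp g.cont
  pullback := fun p hp => g.pullback _ (f.pullback p hp)

/-- The identity map of a space. -/
def FMap.id (X : Space K) : FMap X X where
  toFun := fun x => x
  cont := continuous_id
  pullback := fun p hp => hp

/-- An isomorphism of spaces. -/
def FMap.IsIso {Y X : Space K} (f : FMap Y X) : Prop :=
  ∃ g : FMap X Y, f.comp g = FMap.id X ∧ g.comp f = FMap.id Y

/-- Evaluation of analytic functions at a point, as a `K`-algebra morphism. -/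
def Space.evalHom (X : Space K) (x : X.P) : X.O →ₐ[K] K :=
  (Pi.evalAlgHom K (fun _ : X.P => K) x).comp X.O.val

lemma Space.evalHom_surjective (X : Space K) (x : X.P) :
    Function.Surjective (X.evalHom x) :=
  fun c => ⟨algebraMap K _ c, (X.evalHom x).commutes c⟩

/-- The maximal ideal of functions vanishing at a point. -/
def Space.mIdeal (X : Space K) (x : X.P) : Ideal X.O :=
  RingHom.ker (X.evalHom x)

lemma Space.mIdeal_isMaximal (X : Space K) (x : X.P) : (X.mIdeal x).IsMaximal :=
  RingHom.ker_isMaximal_of_surjective _ (X.evalHom_surjective x)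

/-- The morphism of function algebras induced by a map of spaces. -/
def FMap.algHom {Y X : Space K} (f : FMap Y X) : X.O →ₐ[K] Y.O where
  toFun p := ⟨p.1 ∘ f.toFun, f.pullback p.1 p.2⟩
  map_one' := by ext y; simp
  map_mul' p q := by ext y; simp
  map_zero' := by ext y; simp
  map_add' p q := by ext y; simp
  commutes' c := by ext y; simp

lemma FMap.mIdeal_comap {Y X : Space K} (f : FMap Y X) (y : Y.P) :
    X.mIdeal (f.toFun y) = (Y.mIdeal y).comap f.algHom.toRingHom := by
  ext p
  simp only [Space.mIdeal, RingHom.mem_ker, Ideal.mem_comap]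
  rfl

/-- A map of spaces is flat at a point `y` if the induced morphism of local rings
(realised as localizations of the function algebras at the corresponding maximal
ideals) is flat. -/
def FMap.IsFlatAt {Y X : Space K} (f : FMap Y X) (y : Y.P) : Prop := by
  haveI := (X.mIdeal_isMaximal (f.toFun y)).isPrime
  haveI := (Y.mIdeal_isMaximal y).isPrime
  have φ : Localization.AtPrime (X.mIdeal (f.toFun y)) →+* Localization.AtPrime (Y.mIdeal y) :=
    Localization.localRingHom (X.mIdeal (f.toFun y)) (Y.mIdeal y)
      f.algHom.toRingHom (f.mIdeal_comap y)
  exact RingHom.Flat (R := Localization.AtPrime (X.mIdeal (f.toFun y)))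
    (S := Localization.AtPrime (Y.mIdeal y)) φ

/-- A map of spaces is flat if it is flat at every point. -/
def FMap.IsFlat {Y X : Space K} (f : FMap Y X) : Prop := ∀ y, f.IsFlatAt y

/-- Restriction of functions to a subset, as a morphism of `K`-algebras. -/
def restrictAlgHom {P : Type} (Z : Set P) : (P → K) →ₐ[K] (Z → K) where
  toFun p := fun z => p z.1
  map_one' := rfl
  map_mul' p q := rfl
  map_zero' := rfl
  map_add' p q := rfl
  commutes' c := rfl

/-- The (closed analytic) subspace structure induced on a subset of a space. -/
def Space.restrict (X : Space K) (Z : Set X.P) : Space K where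
  P := Z
  O := X.O.map (restrictAlgHom Z)
  cont := by
    rintro f ⟨p, hp, rfl⟩
    exact (X.cont p hp).comp continuous_subtype_val

/-- The restriction `f⁻¹(Z) → Z` of a map of spaces `f : Y → X` to the preimage of a
subset `Z ⊆ X`. -/
def FMap.restrictOver {Y X : Space K} (f : FMap Y X) (Z : Set X.P) :
    FMap (Y.restrict (f.toFun ⁻¹' Z)) (X.restrict Z) where
  toFun := fun y => ⟨f.toFun y.1, y.2⟩
  cont := (f.cont.comp continuous_subtype_val).subtype_mk _
  pullback := by
    rintro q ⟨p, hp, rfl⟩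
    exact ⟨p ∘ f.toFun, f.pullback p hp, rfl⟩

/-- A closed analytic subset of a space: the common zero locus of a set of analytic
functions. -/
def Space.IsClosedAnalytic (X : Space K) (Z : Set X.P) : Prop :=
  ∃ S : Set X.O, Z = {x | ∀ p ∈ S, (p : X.P → K) x = 0}

/-- The ideal of functions vanishing on a subset. -/
def Space.vanishingIdeal (X : Space K) (Z : Set X.P) : Ideal X.O :=
  ⨅ (z : X.P) (_ : z ∈ Z), X.mIdeal z

/-- The inverse image ideal of (the ideal of) a subset `Z ⊆ X` under a map `h : W → X`. -/
def FMap.pullbackIdeal {W X : Space K} (h : FMap W X) (Z : Set X.P) : Ideal W.O :=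
  Ideal.map h.algHom.toRingHom (X.vanishingIdeal Z)

/-- An ideal of the function algebra is invertible at a point `w` if, in the local ring
at `w`, it is principal, generated by a nonzerodivisor. -/
def Space.IsInvertibleAt (W : Space K) (I : Ideal W.O) (w : W.P) : Prop :=
  haveI := (W.mIdeal_isMaximal w).isPrime
  ∃ g : W.O, g ∈ I ∧
    Ideal.map (algebraMap W.O (Localization.AtPrime (W.mIdeal w))) I
      = Ideal.span {algebraMap W.O (Localization.AtPrime (W.mIdeal w)) g} ∧
    algebraMap W.O (Localization.AtPrime (W.mIdeal w)) g
      ∈ nonZeroDivisors (Localization.AtPrime (W.mIdeal w))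

/-- A map `h : W → X` renders the ideal of `Z ⊆ X` invertible if the inverse image
ideal is invertible at every point of `W`. -/
def FMap.MakesInvertible {W X : Space K} (h : FMap W X) (Z : Set X.P) : Prop :=
  ∀ w, W.IsInvertibleAt (h.pullbackIdeal Z) w

/-- A blowing up map with centre `Z`: it renders the coherent ideal of `Z` invertible and
is universal with this property. -/
def FMap.IsBlowUp {X' X : Space K} (π : FMap X' X) (Z : Set X.P) : Prop :=
  X.IsClosedAnalytic Z ∧ π.MakesInvertible Z ∧
    ∀ (W : Space K) (h : FMap W X), h.MakesInvertible Z →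
      ∃! g : FMap W X', π.comp g = h

/-- An open immersion of spaces. -/
def FMap.IsOpenImmersion {U X : Space K} (ι : FMap U X) : Prop :=
  Function.Injective ι.toFun ∧ IsOpenMap ι.toFun ∧ Topology.IsEmbedding ι.toFun

variable (K)

/-- The space associated to an affinoid variety. -/
def Affinoid.toSpace (X : Affinoid K) : Space K where
  P := X.carrier
  O := X.O
  cont := by
    rintro f ⟨g, hg, rfl⟩
    exact g.continuous.comp continuous_subtype_val

variable {K}

/-- A space is affinoid if it is isomorphic to the space of an affinoid variety. -/
def Space.IsAffinoid (W : Space K) : Prop :=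
  ∃ (A : Affinoid K) (f : FMap W (A.toSpace K)), f.IsIso

/-- A local blowing up: the composition of a blowing up map of an affinoid subdomain
`U ↪ X` with centre a closed analytic subvariety `Z' ⊆ U`, followed by the open
immersion `U ↪ X`.  The set `Z` is the centre, viewed inside `X`. -/
def FMap.IsLocalBlowUp {X' X : Space K} (π : FMap X' X) (Z : Set X.P) : Prop :=
  ∃ (U : Space K) (ι : FMap U X) (p : FMap X' U) (Z' : Set U.P),
    ι.IsOpenImmersion ∧ U.IsAffinoid ∧ p.IsBlowUp Z' ∧ π = ι.comp p ∧ Z = ι.toFun '' Z'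

/-- A finite affinoid atlas on a space: finitely many open immersions of affinoid spaces
whose images cover the space. -/
def FinAtlas (W : Space K) {n : ℕ} (A : Fin n → Affinoid K)
    (j : ∀ i, FMap ((A i).toSpace K) W) : Prop :=
  (∀ i, (j i).IsOpenImmersion) ∧ ∀ w, ∃ i x, (j i).toFun x = w

/-- A space is a quasi-compact rigid analytic variety if it admits a finite admissible
affinoid cover. -/
def Space.IsQuasiCompactRigid (W : Space K) : Prop :=
  ∃ (n : ℕ) (A : Fin n → Affinoid K) (j : ∀ i, FMap ((A i).toSpace K) W), FinAtlas W A j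

/-- A subset of a (quasi-compact) rigid analytic space is semianalytic if its preimage
under each member of a finite admissible affinoid cover is semianalytic. -/
def Space.IsSemianalyticSp (W : Space K) (S : Set W.P) : Prop :=
  ∃ (n : ℕ) (A : Fin n → Affinoid K) (j : ∀ i, FMap ((A i).toSpace K) W),
    FinAtlas W A j ∧ ∀ i, IsSemianalytic (A i) ((j i).toFun ⁻¹' S)

/-- A subset of a (quasi-compact) rigid analytic space is `D`-semianalytic if its
preimage under each member of a finite admissible affinoid cover is `D`-semianalytic. -/
def Space.IsDSemianalyticSp (W : Space K) (S : Set W.P) : Prop :=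
  ∃ (n : ℕ) (A : Fin n → Affinoid K) (j : ∀ i, FMap ((A i).toSpace K) W),
    FinAtlas W A j ∧ ∀ i, IsDSemianalytic (A i) ((j i).toFun ⁻¹' S)

/-- A regular local ring: a Noetherian local ring whose maximal ideal is generated by
as many elements as its Krull dimension. -/
def IsRegularLocal (A : Type) [CommRing A] : Prop :=
  IsNoetherianRing A ∧
    ∃ _ : IsLocalRing A, ∃ s : Finset A,
      Ideal.span (s : Set A) = IsLocalRing.maximalIdeal A ∧
        (s.card : WithBot (WithTop ℕ)) = ringKrullDim A

/-- A space is a manifold at a point if its local ring there is regular. -/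
def Space.IsManifoldAt (W : Space K) (w : W.P) : Prop :=
  haveI := (W.mIdeal_isMaximal w).isPrime
  IsRegularLocal (Localization.AtPrime (W.mIdeal w))

/-- A closed analytic subset is smooth if the induced subspace is a manifold at each of
its points. -/
def Space.IsSmoothSet (X : Space K) (Z : Set X.P) : Prop :=
  ∀ z : (X.restrict Z).P, (X.restrict Z).IsManifoldAt z

/-- The dimension of a space: the supremum of the Krull dimensions of its local rings. -/
def Space.dim (W : Space K) : WithBot (WithTop ℕ) :=
  ⨆ w : W.P,
    haveI := (W.mIdeal_isMaximal w).isPrime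
    ringKrullDim (Localization.AtPrime (W.mIdeal w))

end RigidQE
end

noncomputable section
namespace RigidQE

variable {K : Type} [NormedField K] [CompleteSpace K] [IsAlgClosed K] [IsUltrametricDist K]

/-- A subset of a (quasi-compact) rigid analytic space is subanalytic if its preimage
under each member of a finite admissible affinoid cover is subanalytic. -/
def Space.IsSubanalyticSp (W : Space K) (S : Set W.P) : Prop :=
  ∃ (n : ℕ) (A : Fin n → Affinoid K) (j : ∀ i, FMap ((A i).toSpace K) W),
    FinAtlas W A j ∧ ∀ i, IsSubanalytic (A i) ((j i).toFun ⁻¹' S)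

/-- A rigid analytic submanifold of a space `W`: a locally closed analytic subvariety
(a closed analytic subvariety `Z` of an admissible open `U ↪ W`) all of whose local
rings are regular. -/
def Space.IsSubmanifold (W : Space K) (Y : Set W.P) : Prop :=
  ∃ (U : Space K) (ι : FMap U W), ι.IsOpenImmersion ∧
    ∃ Z : Set U.P, U.IsClosedAnalytic Z ∧ Y = ι.toFun '' Z ∧ U.IsSmoothSet Z

/-- The dimension of a submanifold `Y ⊆ W`, computed from a representation of `Y` as a
closed analytic subset `Z` of an admissible open `U ↪ W`. -/
def Space.submanifoldDim (W : Space K) (Y : Set W.P) : WithBot (WithTop ℕ) :=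
  ⨆ (U : Space K) (ι : FMap U W) (_ : ι.IsOpenImmersion) (Z : Set U.P)
    (_ : U.IsClosedAnalytic Z ∧ Y = ι.toFun '' Z ∧ U.IsSmoothSet Z),
    (U.restrict Z).dim

/-- The dimension of a subanalytic set `Σ ⊆ W`: the supremum of the dimensions of all
rigid analytic submanifolds of `W` contained in `Σ`. -/
def Space.subanDim (W : Space K) (S : Set W.P) : WithBot (WithTop ℕ) :=
  ⨆ (Y : Set W.P) (_ : W.IsSubmanifold Y ∧ Y ⊆ S), W.submanifoldDim Y

end RigidQE
end

noncomputable section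
namespace SubQE
open RigidQE

/-- The Boolean algebra of subsets of `P` generated by the sets `{‖f‖ ≤ ‖g‖}`, `f, g ∈ F`. -/
inductive VB {K : Type*} [NormedField K] {P : Type*} (F : Set (P → K)) : Set P → Prop
  | univ : VB F Set.univ
  | base {f g : P → K} (hf : f ∈ F) (hg : g ∈ F) : VB F {x | ‖f x‖ ≤ ‖g x‖}
  | compl {S : Set P} : VB F S → VB F Sᶜ
  | inter {S T : Set P} : VB F S → VB F T → VB F (S ∩ T)

namespace VB
variable {K : Type*} [NormedField K] {P : Type*} {F : Set (P → K)}

lemma union {S T : Set P} (hS : VB F S) (hT : VB F T) : VB F (S ∪ T) := by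
  have := (hS.compl.inter hT.compl).compl
  rwa [Set.compl_inter, compl_compl, compl_compl] at this

lemma empty : VB F (∅ : Set P) := by
  simpa using (VB.univ (F := F)).compl

lemma const (p : Prop) : VB F {_x : P | p} := by
  by_cases h : p
  · simpa [h] using (VB.univ (F := F))
  · simpa [h] using (VB.empty (F := F))

lemma and {p q : P → Prop} (hp : VB F {x | p x}) (hq : VB F {x | q x}) :
    VB F {x | p x ∧ q x} := hp.inter hq

lemma or {p q : P → Prop} (hp : VB F {x | p x}) (hq : VB F {x | q x}) :
    VB F {x | p x ∨ q x} := hp.union hq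

lemma not {p : P → Prop} (hp : VB F {x | p x}) : VB F {x | ¬ p x} := hp.compl

lemma imp {p q : P → Prop} (hp : VB F {x | p x}) (hq : VB F {x | q x}) :
    VB F {x | p x → q x} := by
  simp only [imp_iff_not_or]
  exact hp.not.or hq

lemma finset_all {ι : Type*} (s : Finset ι) {p : ι → P → Prop}
    (h : ∀ i ∈ s, VB F {x | p i x}) : VB F {x | ∀ i ∈ s, p i x} := by
  classical
  induction s using Finset.induction_on with
  | empty => simpa using VB.univ (F := F)
  | insert a s ha ih =>
    simp only [Finset.forall_mem_insert]
    exact (h a (by simp)).and (ih fun i hi => h i (by simp [hi]))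

lemma all {ι : Type*} [Finite ι] {p : ι → P → Prop} (h : ∀ i, VB F {x | p i x}) :
    VB F {x | ∀ i, p i x} := by
  have := Fintype.ofFinite ι
  simpa using finset_all (F := F) Finset.univ (p := p) fun i _ => h i

lemma finset_ex {ι : Type*} (s : Finset ι) {p : ι → P → Prop}
    (h : ∀ i ∈ s, VB F {x | p i x}) : VB F {x | ∃ i ∈ s, p i x} := by
  have := (finset_all (F := F) s (p := fun i x => ¬ p i x) fun i hi => (h i hi).not).not
  simpa using this

lemma ex {ι : Type*} [Finite ι] {p : ι → P → Prop} (h : ∀ i, VB F {x | p i x}) :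
    VB F {x | ∃ i, p i x} := by
  have := Fintype.ofFinite ι
  simpa using finset_ex (F := F) Finset.univ (p := p) fun i _ => h i

lemma le {f g : P → K} (hf : f ∈ F) (hg : g ∈ F) : VB F {x | ‖f x‖ ≤ ‖g x‖} := base hf hg

lemma lt {f g : P → K} (hf : f ∈ F) (hg : g ∈ F) : VB F {x | ‖f x‖ < ‖g x‖} := by
  simpa using (base (F := F) hg hf).not

lemma eq_zero {f : P → K} (hf : f ∈ F) (h0 : (fun _ => 0) ∈ F) : VB F {x | f x = 0} := by
  simpa using base hf h0

lemma preimage_gen {P' : Type*} {F' : Set (P' → K)} (φ : P → P')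
    (h : ∀ f ∈ F', ∀ g ∈ F', VB F {x | ‖f (φ x)‖ ≤ ‖g (φ x)‖}) {S : Set P'} (hS : VB F' S) :
    VB F (φ ⁻¹' S) := by
  induction hS with
  | univ => exact VB.univ
  | base hf hg => exact h _ hf _ hg
  | compl _ ih => exact ih.compl
  | inter _ _ ih1 ih2 => exact ih1.inter ih2

lemma preimage {P' : Type*} {F' : Set (P' → K)} (φ : P → P')
    (h : ∀ f ∈ F', f ∘ φ ∈ F) {S : Set P'} (hS : VB F' S) : VB F (φ ⁻¹' S) :=
  preimage_gen φ (fun f hf g hg => base (h f hf) (h g hg)) hS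

/-- every member of `VB F` is a pullback along a map `P → Kʳ` of a member of the algebra
generated by the coordinates -/
lemma exists_coord {S : Set P} (hS : VB F S) : ∃ (r : ℕ) (h : Fin r → P → K)
    (B : Set (Fin r → K)), (∀ i, h i ∈ F) ∧ VB (Set.range fun (i : Fin r) (y : Fin r → K) => y i) B ∧
      S = {x | (fun i => h i x) ∈ B} := by
  induction hS with
  | univ => exact ⟨0, Fin.elim0, Set.univ, fun i => i.elim0, VB.univ, by simp⟩
  | @base f g hf hg =>
    refine ⟨2, ![f, g], {y | ‖y 0‖ ≤ ‖y 1‖}, ?_, base ⟨0, rfl⟩ ⟨1, rfl⟩, ?_⟩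
    · intro i; fin_cases i <;> simpa
    · ext; simp
  | compl _ ih =>
    obtain ⟨r, h, B, h1, h2, rfl⟩ := ih
    exact ⟨r, h, Bᶜ, h1, h2.compl, rfl⟩
  | inter _ _ ih1 ih2 =>
    obtain ⟨r, h, B, h1, h2, rfl⟩ := ih1
    obtain ⟨r', h', B', h1', h2', rfl⟩ := ih2
    refine ⟨r + r', Fin.append h h', {y | (fun i => y (Fin.castAdd r' i)) ∈ B} ∩
      {y | (fun i => y (Fin.natAdd r i)) ∈ B'}, ?_, ?_, ?_⟩
    · intro i
      refine Fin.addCases (fun i => ?_) (fun i => ?_) i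
      · simpa using h1 i
      · simpa using h1' i
    · refine inter (preimage (fun (y : Fin (r + r') → K) i => y (Fin.castAdd r' i)) ?_ h2)
        (preimage (fun (y : Fin (r + r') → K) i => y (Fin.natAdd r i)) ?_ h2')
      · rintro _ ⟨i, rfl⟩; exact ⟨Fin.castAdd r' i, rfl⟩
      · rintro _ ⟨i, rfl⟩; exact ⟨Fin.natAdd r i, rfl⟩
    · ext x; simp

lemma mono {F' : Set (P → K)} (h : F ⊆ F') {S : Set P} (hS : VB F S) : VB F' S :=
  preimage (id : P → P) (fun f hf => h hf) hS

end VB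

section

open Polynomial

section
variable {K : Type*} [NormedField K] [IsUltrametricDist K]

lemma norm_sum_le_of {ι : Type*} (s : Finset ι) (f : ι → K) {C : ℝ} (hC : 0 ≤ C)
    (h : ∀ i ∈ s, ‖f i‖ ≤ C) : ‖∑ i ∈ s, f i‖ ≤ C :=
  IsUltrametricDist.norm_sum_le_of_forall_le_of_nonneg hC h

lemma norm_sum_lt_of {ι : Type*} (s : Finset ι) (f : ι → K) {C : ℝ} (hC : 0 < C)
    (h : ∀ i ∈ s, ‖f i‖ < C) : ‖∑ i ∈ s, f i‖ < C := by
  rcases s.eq_empty_or_nonempty with rfl | hs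
  · simpa
  · obtain ⟨i, hi, hle⟩ := IsUltrametricDist.exists_norm_finsetSum_le_of_nonempty hs f
    exact hle.trans_lt (h i hi)

lemma norm_add_eq_left {a b : K} (h : ‖b‖ < ‖a‖) : ‖a + b‖ = ‖a‖ := by
  rw [IsUltrametricDist.norm_add_eq_max_of_norm_ne_norm h.ne', max_eq_left h.le]

/-- `k` is the largest index at which the coefficients of `p` attain their maximal norm. -/
def TopAt (p : K[X]) (k : ℕ) : Prop :=
  p.coeff k ≠ 0 ∧ (∀ j, ‖p.coeff j‖ ≤ ‖p.coeff k‖) ∧ ∀ j, k < j → ‖p.coeff j‖ < ‖p.coeff k‖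

lemma TopAt.unique {p : K[X]} {k l : ℕ} (hk : TopAt p k) (hl : TopAt p l) : k = l := by
  rcases lt_trichotomy k l with h | h | h
  · exact absurd (hk.2.2 l h) (not_lt.2 (hl.2.1 k))
  · exact h
  · exact absurd (hl.2.2 k h) (not_lt.2 (hk.2.1 l))

lemma TopAt.mul {p q : K[X]} {k l : ℕ} (hk : TopAt p k) (hl : TopAt q l) :
    TopAt (p * q) (k + l) := by
  have hp : 0 < ‖p.coeff k‖ := norm_pos_iff.2 hk.1
  have hq : 0 < ‖q.coeff l‖ := norm_pos_iff.2 hl.1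
  have key : ‖(p * q).coeff (k + l)‖ = ‖p.coeff k‖ * ‖q.coeff l‖ := by
    rw [coeff_mul, ← Finset.add_sum_erase _ _ (Finset.HasAntidiagonal.mem_antidiagonal.2 (show (k, l).1 + (k, l).2 = k + l from rfl))]
    rw [norm_add_eq_left, norm_mul]
    rw [norm_mul]
    refine norm_sum_lt_of _ _ (by positivity) ?_
    rintro ⟨i, j⟩ hij
    simp only [Finset.mem_erase, Finset.HasAntidiagonal.mem_antidiagonal, ne_eq, Prod.mk.injEq] at hij
    rw [norm_mul]
    rcases lt_or_ge k i with h | h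
    · exact mul_lt_mul_of_lt_of_le_of_nonneg_of_pos (hk.2.2 i h) (hl.2.1 j) (norm_nonneg _) hq
    · have hj : l < j := by omega
      exact (mul_le_mul_of_nonneg_right (hk.2.1 i) (norm_nonneg _)).trans_lt
        (mul_lt_mul_of_pos_left (hl.2.2 j hj) hp)
  refine ⟨?_, ?_, ?_⟩
  · rw [← norm_pos_iff, key]; positivity
  · intro n
    rw [key, coeff_mul]
    refine norm_sum_le_of _ _ (by positivity) ?_
    rintro ⟨i, j⟩ -
    rw [norm_mul]
    exact mul_le_mul (hk.2.1 i) (hl.2.1 j) (norm_nonneg _) (norm_nonneg _)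
  · intro n hn
    rw [key, coeff_mul]
    refine norm_sum_lt_of _ _ (by positivity) ?_
    rintro ⟨i, j⟩ hij
    simp only [Finset.HasAntidiagonal.mem_antidiagonal] at hij
    rw [norm_mul]
    rcases lt_or_ge k i with h | h
    · exact mul_lt_mul_of_lt_of_le_of_nonneg_of_pos (hk.2.2 i h) (hl.2.1 j) (norm_nonneg _) hq
    · have hj : l < j := by omega
      exact (mul_le_mul_of_nonneg_right (hk.2.1 i) (norm_nonneg _)).trans_lt
        (mul_lt_mul_of_pos_left (hl.2.2 j hj) hp)

lemma topAt_C {a : K} (ha : a ≠ 0) : TopAt (C a) 0 := by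
  refine ⟨by simpa, fun j => ?_, fun j hj => ?_⟩
  · rcases j with _ | j <;> simp
  · rw [coeff_C, if_neg hj.ne']; simpa

lemma TopAt.prod {ι : Type*} (s : Finset ι) (f : ι → K[X]) (k : ι → ℕ)
    (h : ∀ i ∈ s, TopAt (f i) (k i)) : TopAt (∏ i ∈ s, f i) (∑ i ∈ s, k i) := by
  classical
  induction s using Finset.induction_on with
  | empty => simpa using topAt_C (one_ne_zero (α := K))
  | insert a s ha ih =>
    rw [Finset.prod_insert ha, Finset.sum_insert ha]
    exact (h a (by simp)).mul (ih fun i hi => h i (by simp [hi]))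

open Classical in
lemma topAt_linear {q p : K} (h : ¬ (q = 0 ∧ p = 0)) :
    TopAt (C q * X - C p) (if q ≠ 0 ∧ ‖p‖ ≤ ‖q‖ then 1 else 0) := by
  have c0 : (C q * X - C p).coeff 0 = -p := by simp
  have c1 : (C q * X - C p).coeff 1 = q := by simp
  have c2 : ∀ j, (C q * X - C p).coeff (j + 2) = 0 := fun j => by
    simp
  have hlt : ¬ (q ≠ 0 ∧ ‖p‖ ≤ ‖q‖) → p ≠ 0 ∧ ‖q‖ < ‖p‖ := by
    intro hc
    by_cases hq : q = 0
    · have hp : p ≠ 0 := fun hp => h ⟨hq, hp⟩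
      exact ⟨hp, by simpa [hq]⟩
    · have : ‖q‖ < ‖p‖ := by
        by_contra hh; exact hc ⟨hq, not_lt.1 hh⟩
      exact ⟨norm_pos_iff.1 ((norm_nonneg q).trans_lt this), this⟩
  split_ifs with hc
  · refine ⟨by rw [c1]; exact hc.1, fun j => ?_, fun j hj => ?_⟩
    · rw [c1]
      rcases j with _ | _ | j
      · rw [c0, norm_neg]; exact hc.2
      · rw [c1]
      · rw [c2]; simp
    · obtain ⟨j, rfl⟩ : ∃ i, j = i + 2 := ⟨j - 2, by omega⟩
      rw [c1, c2, norm_zero]; exact norm_pos_iff.2 hc.1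
  · obtain ⟨hp, hpq⟩ := hlt hc
    refine ⟨by rw [c0]; simpa, fun j => ?_, fun j hj => ?_⟩
    · rw [c0, norm_neg]
      rcases j with _ | _ | j
      · rw [c0, norm_neg]
      · rw [c1]; exact hpq.le
      · rw [c2]; simp
    · rw [c0, norm_neg]
      rcases j with _ | _ | j
      · omega
      · rw [c1]; exact hpq
      · rw [c2]; simpa

/-- a polynomial recording whether `Q ≠ 0`, `‖P‖ ≤ ‖Q‖` -/
def fac {R : Type*} [CommRing R] (Q P : R) : R[X][X] :=
  C (C Q * X - C P) + X

lemma fac_map {R S : Type*} [CommRing R] [CommRing S] (φ : R →+* S) (Q P : R) :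
    (fac Q P).map (mapRingHom φ) = fac (φ Q) (φ P) := by
  simp [fac]

open Classical in
lemma trailing_fac (Q P : K) :
    TopAt (fac Q P).trailingCoeff (if Q ≠ 0 ∧ ‖P‖ ≤ ‖Q‖ then 1 else 0) := by
  by_cases h : Q = 0 ∧ P = 0
  · simpa [fac, h.1, h.2, trailingCoeff] using topAt_C (one_ne_zero (α := K))
  · have h2 : (C Q * X - C P : K[X]) ≠ 0 := by
      intro h0
      have := topAt_linear h
      rw [h0] at this
      exact this.1 (by simp)
    have h3 : (fac Q P).natTrailingDegree = 0 := by
      apply natTrailingDegree_eq_zero_of_constantCoeff_ne_zero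
      simpa [fac] using h2
    have h4 : (fac Q P).trailingCoeff = C Q * X - C P := by
      rw [trailingCoeff, h3]; simp [fac]
    rw [h4]
    exact topAt_linear h

lemma trailingCoeff_prod {ι : Type*} (s : Finset ι) (f : ι → K[X][X]) :
    (∏ i ∈ s, f i).trailingCoeff = ∏ i ∈ s, (f i).trailingCoeff := by
  classical
  induction s using Finset.induction_on with
  | empty => simp [trailingCoeff]
  | insert a s ha ih => rw [Finset.prod_insert ha, Finset.prod_insert ha, trailingCoeff_mul, ih]

lemma topAt_trailingCoeff_iff {f : K[X][X]} {k : ℕ} : TopAt f.trailingCoeff k ↔ ∃ w,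
    (∀ w', w' < w → f.coeff w' = 0) ∧ TopAt (f.coeff w) k := by
  constructor
  · intro h
    exact ⟨f.natTrailingDegree, fun w' hw' => coeff_eq_zero_of_lt_natTrailingDegree hw', h⟩
  · rintro ⟨w, hw, h⟩
    have h1 : f.coeff w ≠ 0 := fun h0 => h.1 (by rw [h0]; simp)
    have h2 : f ≠ 0 := fun h0 => h1 (by rw [h0]; simp)
    have h4 : f.natTrailingDegree = w :=
      le_antisymm (natTrailingDegree_le_of_ne_zero h1) (le_natTrailingDegree h2 hw)
    rwa [trailingCoeff, h4]

end

section
variable {K : Type*} [NormedField K] [IsUltrametricDist K]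

lemma exists_unit_nodes [IsAlgClosed K] (M : ℕ) : ∃ Z : Finset K, M ≤ Z.card ∧ (∀ z ∈ Z, ‖z‖ ≤ 1) ∧
    ∀ z ∈ Z, ∀ z' ∈ Z, z ≠ z' → ‖z - z'‖ = 1 := by
  classical
  suffices ∃ Z : Finset K, Z.Nonempty ∧ M ≤ Z.card ∧ (∀ z ∈ Z, ‖z‖ ≤ 1) ∧
      ∀ z ∈ Z, ∀ z' ∈ Z, z ≠ z' → ‖z - z'‖ = 1 by
    obtain ⟨Z, -, h⟩ := this; exact ⟨Z, h⟩
  induction M with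
  | zero => exact ⟨{0}, by simp, by simp, by simp, by simp⟩
  | succ M ih =>
    obtain ⟨Z, hne, hM, h1, h2⟩ := ih
    have hdeg : (∏ z ∈ Z, (X - C z) - 1 : K[X]).degree ≠ 0 := by
      rw [degree_sub_eq_left_of_degree_lt]
      · rw [degree_prod]; simp [hne.ne_empty]
      · rw [degree_prod]; simp [hne.card_pos]
    obtain ⟨a, ha⟩ := IsAlgClosed.exists_root _ hdeg
    have ha' : ∏ z ∈ Z, ‖a - z‖ = 1 := by
      have : ∏ z ∈ Z, (a - z) = 1 := by
        simpa [IsRoot, eval_prod, sub_eq_zero] using ha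
      rw [← norm_prod, this, norm_one]
    have ha1 : ‖a‖ ≤ 1 := by
      by_contra! h
      have : ∀ z ∈ Z, ‖a - z‖ = ‖a‖ := fun z hz => by
        rw [sub_eq_add_neg]
        exact norm_add_eq_left (by rw [norm_neg]; exact (h1 z hz).trans_lt h)
      rw [Finset.prod_congr rfl this, Finset.prod_const] at ha'
      exact (one_lt_pow₀ h hne.card_ne_zero).ne' ha'
    have hle : ∀ z ∈ Z, ‖a - z‖ ≤ 1 := fun z hz => by
      rw [sub_eq_add_neg]
      refine (IsUltrametricDist.norm_add_le_max _ _).trans (max_le ha1 ?_)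
      rw [norm_neg]; exact h1 z hz
    have heq : ∀ z ∈ Z, ‖a - z‖ = 1 := by
      intro z hz
      refine le_antisymm (hle z hz) ?_
      rw [← ha', ← Finset.mul_prod_erase _ _ hz]
      exact mul_le_of_le_one_right (norm_nonneg _)
        (Finset.prod_le_one (fun _ _ => norm_nonneg _) fun i hi => hle i (Finset.mem_of_mem_erase hi))
    have haZ : a ∉ Z := fun h => by simpa using heq a h
    refine ⟨insert a Z, by simp, by rw [Finset.card_insert_of_notMem haZ]; omega, ?_, ?_⟩
    · intro z hz
      rcases Finset.mem_insert.1 hz with rfl | hz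
      · exact ha1
      · exact h1 z hz
    · intro z hz z' hz' hne
      rcases Finset.mem_insert.1 hz with rfl | hz <;> rcases Finset.mem_insert.1 hz' with rfl | hz'
      · exact absurd rfl hne
      · exact heq _ hz'
      · rw [norm_sub_rev]; exact heq _ ‹z ∈ Z›
      · exact h2 z hz z' hz' hne

lemma coeff_mul_norm_le {p q : K[X]} {a b : ℝ} (ha : 0 ≤ a) (hb : 0 ≤ b)
    (hp : ∀ n, ‖p.coeff n‖ ≤ a) (hq : ∀ n, ‖q.coeff n‖ ≤ b) (n : ℕ) :
    ‖(p * q).coeff n‖ ≤ a * b := by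
  rw [coeff_mul]
  refine norm_sum_le_of _ _ (by positivity) fun i _ => ?_
  rw [norm_mul]
  exact mul_le_mul (hp _) (hq _) (norm_nonneg _) ha

/-- a polynomial that is small at sufficiently many nodes has small coefficients -/
lemma coeff_le_of_nodes {p : K[X]} {r : ℕ} (hp : p.degree < r) {μ : ℝ} (hμ : 0 ≤ μ)
    {Z : Finset K} (hZ : r ≤ Z.card) (h1 : ∀ z ∈ Z, ‖z‖ ≤ 1)
    (h2 : ∀ z ∈ Z, ∀ z' ∈ Z, z ≠ z' → ‖z - z'‖ = 1) (h : ∀ z ∈ Z, ‖p.eval z‖ ≤ μ) (n : ℕ) :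
    ‖p.coeff n‖ ≤ μ := by
  classical
  have key := Lagrange.eq_interpolate (s := Z) (v := (id : K → K)) (f := p)
    (Function.injective_id.injOn) (hp.trans_le (by exact_mod_cast hZ))
  rw [key, Lagrange.interpolate_apply, finsetSum_coeff]
  refine norm_sum_le_of _ _ hμ fun i hi => ?_
  rw [coeff_C_mul, norm_mul]
  have hb : ‖(Lagrange.basis Z id i).coeff n‖ ≤ 1 := by
    rw [Lagrange.basis]
    have : ∀ t ⊆ Z.erase i, ∀ n, ‖(∏ j ∈ t, Lagrange.basisDivisor (id i) (id j)).coeff n‖ ≤ 1 := by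
      intro t
      induction t using Finset.induction_on with
      | empty =>
        intro _ n
        rw [Finset.prod_empty, coeff_one]
        split_ifs <;> simp
      | insert a s ha ih =>
        intro hs n
        rw [Finset.prod_insert ha]
        have haZ := Finset.mem_erase.1 (hs (Finset.mem_insert_self a s))
        have hd : ∀ n, ‖(Lagrange.basisDivisor (id i) (id a)).coeff n‖ ≤ 1 := by
          intro n
          rw [Lagrange.basisDivisor, coeff_C_mul, norm_mul, norm_inv, id, id,
            h2 i hi a haZ.2 haZ.1.symm, inv_one, one_mul]
          rcases n with _ | _ | n
          · simpa using h1 a haZ.2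
          · simp
          · simp [coeff_X]
        simpa using coeff_mul_norm_le zero_le_one zero_le_one hd
          (ih ((Finset.subset_insert a s).trans hs)) n
    exact this _ subset_rfl n
  calc _ ≤ μ * 1 := mul_le_mul (h i hi) hb (norm_nonneg _) hμ
    _ = μ := mul_one μ

end

section
variable {K : Type*} [NormedField K] {ι : Type*} {n : ℕ}

/-- evaluation of polynomials with polynomial coefficients -/
def ev2 (z : (ι → K) × (Fin n → K)) :
    MvPolynomial (Fin n) (MvPolynomial ι K) →+* K :=
  MvPolynomial.eval₂Hom (MvPolynomial.eval z.1) z.2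

variable (K ι n) in
/-- functions given by polynomials in two groups of variables -/
def F2 : Set ((ι → K) × (Fin n → K) → K) :=
  Set.range fun (p : MvPolynomial (Fin n) (MvPolynomial ι K)) z => ev2 z p

variable (K ι n) in
/-- functions given by polynomials, symmetric in the second group of variables -/
def F2sym : Set ((ι → K) × (Fin n → K) → K) :=
  {f | ∃ p : MvPolynomial (Fin n) (MvPolynomial ι K), p.IsSymmetric ∧ f = fun z => ev2 z p}

lemma ev2_comp (z : (ι → K) × (Fin n → K)) (g : Fin n → Fin n)
    (p : MvPolynomial (Fin n) (MvPolynomial ι K)) :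
    ev2 (z.1, z.2 ∘ g) p = ev2 z (MvPolynomial.rename g p) := by
  simp only [ev2, MvPolynomial.eval₂Hom_rename]

/-- an integer valued function with finitely many values and constructible level sets -/
def Level {P : Type*} (F : Set (P → K)) (φ : P → ℤ) : Prop :=
  (∃ B : ℕ, ∀ x, |φ x| ≤ B) ∧ ∀ k, VB F {x | φ x = k}

lemma Level.add {P : Type*} {F : Set (P → K)} {φ ψ : P → ℤ} (h : Level F φ) (h' : Level F ψ) :
    Level F (fun x => φ x + ψ x) := by
  obtain ⟨⟨B, hB⟩, h⟩ := h
  obtain ⟨⟨B', hB'⟩, h'⟩ := h'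
  refine ⟨⟨B + B', fun x => (abs_add_le _ _).trans (by push_cast; exact add_le_add (hB x) (hB' x))⟩, fun k => ?_⟩
  have : {x | φ x + ψ x = k} = {x | ∃ a ∈ Finset.Icc (-(B : ℤ)) B, φ x = a ∧ ψ x = k - a} := by
    ext x
    simp only [Set.mem_ofPred_eq, Finset.mem_Icc]
    constructor
    · intro hx; exact ⟨φ x, abs_le.1 (hB x), rfl, by omega⟩
    · rintro ⟨a, -, h1, h2⟩; omega
  rw [this]
  exact VB.finset_ex _ fun a _ => (h a).and (h' _)

lemma Level.neg {P : Type*} {F : Set (P → K)} {φ : P → ℤ} (h : Level F φ) :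
    Level F (fun x => - φ x) := by
  refine ⟨by simpa using h.1, fun k => ?_⟩
  simpa [neg_eq_iff_eq_neg] using h.2 (-k)

/-- the basic set of the symmetric-function argument -/
def Cset {r : ℕ} (Q : MvPolynomial (Fin n) (MvPolynomial ι K))
    (p : Fin r → MvPolynomial (Fin n) (MvPolynomial ι K)) : Set ((ι → K) × (Fin n → K)) :=
  {z | ev2 z Q ≠ 0 ∧ ∀ i, ‖ev2 z (p i)‖ ≤ ‖ev2 z Q‖}

variable [IsUltrametricDist K]

open Classical in
lemma level_count_single (Q P : MvPolynomial (Fin n) (MvPolynomial ι K)) (k : ℕ) :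
    VB (F2sym K ι n) {z | (∑ g : Equiv.Perm (Fin n),
      if ev2 (z.1, z.2 ∘ g) Q ≠ 0 ∧ ‖ev2 (z.1, z.2 ∘ g) P‖ ≤ ‖ev2 (z.1, z.2 ∘ g) Q‖
        then 1 else 0) = k} := by
  set F : (MvPolynomial (Fin n) (MvPolynomial ι K))[X][X] := ∏ g : Equiv.Perm (Fin n),
    fac (MvPolynomial.rename g Q) (MvPolynomial.rename g P) with hF
  have hsym : ∀ i j, ((F.coeff i).coeff j).IsSymmetric := by
    intro i j h
    have : F.map (mapRingHom (MvPolynomial.rename h : MvPolynomial (Fin n) (MvPolynomial ι K) →ₐ[_] _).toRingHom) = F := by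
      rw [hF, Polynomial.map_prod]
      simp only [fac_map]
      refine Fintype.prod_equiv (Equiv.mulLeft h) _ _ fun g => ?_
      simp [MvPolynomial.rename_rename]
    conv_rhs => rw [← this]
    simp [coeff_map]
  have hev : ∀ z, TopAt (F.map (mapRingHom (ev2 z))).trailingCoeff (∑ g : Equiv.Perm (Fin n),
      if ev2 (z.1, z.2 ∘ g) Q ≠ 0 ∧ ‖ev2 (z.1, z.2 ∘ g) P‖ ≤ ‖ev2 (z.1, z.2 ∘ g) Q‖
        then 1 else 0) := by
    intro z
    rw [hF, Polynomial.map_prod, trailingCoeff_prod]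
    refine TopAt.prod _ _ _ fun g _ => ?_
    rw [fac_map, ev2_comp, ev2_comp]
    exact trailing_fac _ _
  obtain ⟨D, hD⟩ : ∃ D, ∀ i j, (D ≤ i ∨ D ≤ j) → (F.coeff i).coeff j = 0 := by
    refine ⟨F.natDegree + 1 + (∑ i ∈ Finset.range (F.natDegree + 1), ((F.coeff i).natDegree + 1)),
      fun i j hij => ?_⟩
    by_cases hi : F.natDegree + 1 ≤ i
    · rw [coeff_eq_zero_of_natDegree_lt (p := F) (by omega)]; simp
    · have := Finset.single_le_sum (f := fun i => (F.coeff i).natDegree + 1)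
        (fun _ _ => Nat.zero_le _) (Finset.mem_range.2 (not_le.1 hi))
      rw [coeff_eq_zero_of_natDegree_lt]
      have h3 : (F.coeff i).natDegree + 1 ≤ _ := this
      omega
  have hc : ∀ z i j, ((F.map (mapRingHom (ev2 z))).coeff i).coeff j = ev2 z ((F.coeff i).coeff j) := by
    intro z i j; rw [coeff_map, coe_mapRingHom, coeff_map]
  have hmem : ∀ i j, (fun z => ev2 z ((F.coeff i).coeff j)) ∈ F2sym K ι n :=
    fun i j => ⟨_, hsym i j, rfl⟩
  have h0 : (fun _ => 0) ∈ F2sym K ι n := ⟨0, MvPolynomial.IsSymmetric.zero, by simp⟩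
  have : {z : (ι → K) × (Fin n → K) | (∑ g : Equiv.Perm (Fin n),
      if ev2 (z.1, z.2 ∘ g) Q ≠ 0 ∧ ‖ev2 (z.1, z.2 ∘ g) P‖ ≤ ‖ev2 (z.1, z.2 ∘ g) Q‖
        then 1 else 0) = k} = {z | ∃ w ∈ Finset.range D,
        (∀ w' ∈ Finset.range D, w' < w → ∀ j ∈ Finset.range D, ev2 z ((F.coeff w').coeff j) = 0) ∧
        ev2 z ((F.coeff w).coeff k) ≠ 0 ∧
        (∀ j ∈ Finset.range D, ‖ev2 z ((F.coeff w).coeff j)‖ ≤ ‖ev2 z ((F.coeff w).coeff k)‖) ∧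
        ∀ j ∈ Finset.range D, k < j →
          ‖ev2 z ((F.coeff w).coeff j)‖ < ‖ev2 z ((F.coeff w).coeff k)‖} := by
    ext z
    simp only [Set.mem_ofPred_eq, Finset.mem_range]
    have hz : ∀ i j, D ≤ i ∨ D ≤ j → ev2 z ((F.coeff i).coeff j) = 0 := fun i j h => by
      rw [hD i j h, map_zero]
    constructor
    · rintro rfl
      obtain ⟨w, hw, h1, h2, h3⟩ := topAt_trailingCoeff_iff.1 (hev z)
      simp only [hc] at h1 h2 h3
      refine ⟨w, ?_, fun w' _ hw' j _ => ?_, h1, fun j _ => h2 j, fun j _ => h3 j⟩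
      · by_contra! h; exact h1 (hz _ _ (Or.inl h))
      · rw [← hc, hw w' hw']; simp
    · rintro ⟨w, hwD, hw, h1, h2, h3⟩
      refine TopAt.unique (hev z) (topAt_trailingCoeff_iff.2 ⟨w, fun w' hw' => ?_, ?_, ?_, ?_⟩)
      · ext j
        rw [hc, coeff_zero]
        by_cases hj : D ≤ j
        · exact hz _ _ (Or.inr hj)
        · exact hw w' (hw'.trans hwD) hw' j (not_le.1 hj)
      · rwa [hc]
      · intro j
        rw [hc, hc]
        by_cases hj : D ≤ j
        · rw [hz _ _ (Or.inr hj)]; simp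
        · exact h2 j (not_le.1 hj)
      · intro j hkj
        rw [hc, hc]
        by_cases hj : D ≤ j
        · rw [hz _ _ (Or.inr hj)]; simpa using h1
        · exact h3 j (not_le.1 hj) hkj
  rw [this]
  refine VB.finset_ex _ fun w _ => VB.and (VB.finset_all _ fun w' _ => VB.imp (VB.const _)
    (VB.finset_all _ fun j _ => VB.eq_zero (hmem _ _) h0)) (VB.and (VB.eq_zero (hmem _ _) h0).not
    (VB.and (VB.finset_all _ fun j _ => VB.le (hmem _ _) (hmem _ _))
    (VB.finset_all _ fun j _ => VB.imp (VB.const _) (VB.lt (hmem _ _) (hmem _ _)))))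

end

section
variable {K : Type*} [NormedField K] [IsUltrametricDist K] [IsAlgClosed K] {ι : Type*} {n : ℕ}

open Classical in
lemma level_count {r : ℕ} (Q : MvPolynomial (Fin n) (MvPolynomial ι K))
    (p : Fin r → MvPolynomial (Fin n) (MvPolynomial ι K)) :
    Level (F2sym K ι n) (fun z => ∑ g : Equiv.Perm (Fin n),
      if (z.1, z.2 ∘ g) ∈ Cset Q p then (1 : ℤ) else 0) := by
  let N : ((ι → K) × (Fin n → K)) → ℕ := fun z =>
    ∑ g : Equiv.Perm (Fin n), if (z.1, z.2 ∘ g) ∈ Cset Q p then 1 else 0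
  have hN : ∀ z, (∑ g : Equiv.Perm (Fin n),
      if (z.1, z.2 ∘ g) ∈ Cset Q p then (1 : ℤ) else 0) = N z := by
    intro z; simp only [N]; push_cast; rfl
  have hle : ∀ z, N z ≤ Fintype.card (Equiv.Perm (Fin n)) := by
    intro z
    refine (Finset.sum_le_sum (g := fun _ => 1) fun g _ => by split_ifs <;> simp).trans ?_
    simp
  simp only [hN]
  refine ⟨⟨Fintype.card (Equiv.Perm (Fin n)), fun z => ?_⟩, fun k => ?_⟩
  · show |(N z : ℤ)| ≤ _
    rw [abs_of_nonneg (by positivity)]; exact_mod_cast hle z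
  suffices ∀ k : ℕ, VB (F2sym K ι n) {z | N z = k} by
    rcases k with k | k
    · simpa using this k
    · convert VB.empty using 1
      ext z
      simp only [Set.mem_ofPred_eq, Set.mem_empty_iff_false, iff_false]
      intro h; have : (0 : ℤ) ≤ N z := by positivity
      rw [h] at this; exact absurd this (by simp)
  intro k
  obtain ⟨Z, hZ, hZ1, hZ2⟩ := exists_unit_nodes (K := K)
    (Fintype.card (Equiv.Perm (Fin n)) * r + 1)
  let pz : K → MvPolynomial (Fin n) (MvPolynomial ι K) := fun ζ =>
    ∑ i, p i * MvPolynomial.C (MvPolynomial.C (ζ ^ (i : ℕ)))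
  have hpz : ∀ ζ z, ev2 z (pz ζ) = ∑ i, ev2 z (p i) * ζ ^ (i : ℕ) := by
    intro ζ z; simp [pz, ev2]
  let Nz : K → ((ι → K) × (Fin n → K)) → ℕ := fun ζ z => ∑ g : Equiv.Perm (Fin n),
      if ev2 (z.1, z.2 ∘ g) Q ≠ 0 ∧ ‖ev2 (z.1, z.2 ∘ g) (pz ζ)‖ ≤ ‖ev2 (z.1, z.2 ∘ g) Q‖
        then 1 else 0
  have hNz : ∀ ζ k, VB (F2sym K ι n) {z | Nz ζ z = k} := fun ζ k => level_count_single Q (pz ζ) k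
  have h1 : ∀ ζ ∈ Z, ∀ z, N z ≤ Nz ζ z := by
    intro ζ hζ z
    refine Finset.sum_le_sum fun g _ => ?_
    by_cases h : (z.1, z.2 ∘ g) ∈ Cset Q p
    · rw [if_pos h, if_pos]
      refine ⟨h.1, ?_⟩
      rw [hpz]
      refine norm_sum_le_of _ _ (norm_nonneg _) fun i _ => ?_
      rw [norm_mul, norm_pow]
      exact (mul_le_of_le_one_right (norm_nonneg _) (pow_le_one₀ (norm_nonneg _) (hZ1 ζ hζ))).trans
        (h.2 i)
    · rw [if_neg h]; exact Nat.zero_le _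
  have h2 : ∀ z, ∃ ζ ∈ Z, N z = Nz ζ z := by
    intro z
    by_contra! hcon
    have hbad : ∀ ζ ∈ Z, ∃ g : Equiv.Perm (Fin n), (z.1, z.2 ∘ g) ∉ Cset Q p ∧
        (ev2 (z.1, z.2 ∘ g) Q ≠ 0 ∧ ‖ev2 (z.1, z.2 ∘ g) (pz ζ)‖ ≤ ‖ev2 (z.1, z.2 ∘ g) Q‖) := by
      intro ζ hζ
      by_contra! hg
      refine hcon ζ hζ (le_antisymm (h1 ζ hζ z) (Finset.sum_le_sum fun g _ => ?_))
      by_cases h : (z.1, z.2 ∘ g) ∈ Cset Q p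
      · rw [if_pos h]; split_ifs <;> simp
      · rw [if_neg (c := _ ∧ _)]
        · exact Nat.zero_le _
        · rintro ⟨ha, hb⟩; exact absurd hb (not_le.2 (hg g h ha))
    choose! g hg using hbad
    obtain ⟨g0, -, hg0⟩ := Finset.exists_lt_card_fiber_of_mul_lt_card_of_maps_to
      (s := Z) (t := Finset.univ) (f := g) (n := r) (fun _ _ => Finset.mem_univ _)
      (by rw [Finset.card_univ]; omega)
    set Z' := Z.filter fun x => g x = g0 with hZ'
    have hsub : ∀ ζ ∈ Z', ζ ∈ Z ∧ g ζ = g0 := fun ζ h => by simpa [hZ'] using h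
    have hne : Z'.Nonempty := Finset.card_pos.1 (by omega)
    obtain ⟨ζ0, hζ0⟩ := hne
    have hQ := hg ζ0 (hsub ζ0 hζ0).1
    rw [(hsub ζ0 hζ0).2] at hQ
    refine hQ.1 ⟨hQ.2.1, ?_⟩
    set z' := (z.1, z.2 ∘ g0)
    let P : K[X] := ∑ i : Fin r, C (ev2 z' (p i)) * X ^ (i : ℕ)
    have hc : ∀ i : Fin r, P.coeff i = ev2 z' (p i) := by
      intro i
      simp [P, coeff_X_pow, ← Fin.ext_iff]
    intro i
    rw [← hc]
    refine coeff_le_of_nodes (r := r) (Z := Z') ?_ (norm_nonneg _) hg0.le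
      (fun ζ h => hZ1 ζ (hsub ζ h).1) (fun ζ h ζ' h' => hZ2 ζ (hsub ζ h).1 ζ' (hsub ζ' h').1) ?_ i
    · exact degree_sum_fin_lt _
    · intro ζ hζ
      have := (hg ζ (hsub ζ hζ).1).2.2
      rw [(hsub ζ hζ).2, hpz] at this
      simpa [P, eval_finsetSum] using this
  have : {z | N z = k} = {z | (∀ ζ ∈ Z, ∃ k' ∈ Finset.Icc k (Fintype.card (Equiv.Perm (Fin n))),
      Nz ζ z = k') ∧ ∃ ζ ∈ Z, Nz ζ z = k} := by
    have hle' : ∀ ζ z, Nz ζ z ≤ Fintype.card (Equiv.Perm (Fin n)) := by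
      intro ζ z
      refine (Finset.sum_le_sum (g := fun _ => 1) fun g _ => by split_ifs <;> simp).trans ?_
      simp
    ext z
    simp only [Set.mem_ofPred_eq, Finset.mem_Icc]
    constructor
    · rintro rfl
      obtain ⟨ζ, h, h'⟩ := h2 z
      exact ⟨fun ζ h => ⟨_, ⟨h1 ζ h z, hle' ζ z⟩, rfl⟩, ζ, h, h'.symm⟩
    · rintro ⟨ha, ζ, hζ, hb⟩
      obtain ⟨ζ', hζ', h'⟩ := h2 z
      obtain ⟨k', hk', h''⟩ := ha ζ' hζ'
      have := h1 ζ hζ z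
      omega
  rw [this]
  exact (VB.finset_all _ fun ζ _ => VB.finset_ex _ fun k' _ => hNz ζ k').and
    (VB.finset_ex _ fun ζ _ => hNz ζ k)

open Classical in
/-- the sets `Cset` are closed under intersection -/
def CsetMonoid (K ι : Type*) [NormedField K] (n : ℕ) :
    Submonoid ((ι → K) × (Fin n → K) → ℤ) where
  carrier := {φ | ∃ (r : ℕ) (Q : MvPolynomial (Fin n) (MvPolynomial ι K))
    (p : Fin r → MvPolynomial (Fin n) (MvPolynomial ι K)),
      φ = fun z => if z ∈ Cset Q p then 1 else 0}
  one_mem' := ⟨0, 1, Fin.elim0, by ext z; simp [Cset]⟩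
  mul_mem' := by
    rintro _ _ ⟨r, Q, p, rfl⟩ ⟨r', Q', p', rfl⟩
    refine ⟨r + r', Q * Q', Fin.append (fun i => p i * Q') (fun i => p' i * Q), ?_⟩
    have : ∀ z, z ∈ Cset (Q * Q') (Fin.append (fun i => p i * Q') (fun i => p' i * Q)) ↔
        z ∈ Cset Q p ∧ z ∈ Cset Q' p' := by
      intro z
      simp only [Cset, Set.mem_ofPred_eq, map_mul, mul_ne_zero_iff]
      constructor
      · rintro ⟨⟨h1, h2⟩, h3⟩
        refine ⟨⟨h1, fun i => ?_⟩, h2, fun i => ?_⟩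
        · have := h3 (Fin.castAdd r' i)
          simp only [Fin.append_left, map_mul, norm_mul] at this
          exact le_of_mul_le_mul_right this (norm_pos_iff.2 h2)
        · have := h3 (Fin.natAdd r i)
          simp only [Fin.append_right, map_mul, norm_mul, mul_comm ‖ev2 z Q‖] at this
          exact le_of_mul_le_mul_right this (norm_pos_iff.2 h1)
      · rintro ⟨⟨h1, h2⟩, h3, h4⟩
        refine ⟨⟨h1, h3⟩, fun i => Fin.addCases (fun i => ?_) (fun i => ?_) i⟩
        · simp only [Fin.append_left, map_mul, norm_mul]
          exact mul_le_mul_of_nonneg_right (h2 i) (norm_nonneg _)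
        · simp only [Fin.append_right, map_mul, norm_mul, mul_comm ‖ev2 z Q‖]
          exact mul_le_mul_of_nonneg_right (h4 i) (norm_nonneg _)
    ext z
    simp only [Pi.mul_apply, this]
    by_cases h1 : z ∈ Cset Q p <;> by_cases h2 : z ∈ Cset Q' p' <;> simp [h1, h2]

open Classical in
lemma indicator_mem {S : Set ((ι → K) × (Fin n → K))} (hS : VB (F2 K ι n) S) :
    (fun z => if z ∈ S then (1 : ℤ) else 0) ∈
      Subring.closure (CsetMonoid K ι n : Set ((ι → K) × (Fin n → K) → ℤ)) := by
  have hb : ∀ {r : ℕ} (Q : MvPolynomial (Fin n) (MvPolynomial ι K))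
    (p : Fin r → MvPolynomial (Fin n) (MvPolynomial ι K)),
      (fun z => if z ∈ Cset Q p then (1 : ℤ) else 0) ∈
      Subring.closure (CsetMonoid K ι n : Set ((ι → K) × (Fin n → K) → ℤ)) :=
    fun Q p => Subring.subset_closure ⟨_, Q, p, rfl⟩
  induction hS with
  | univ =>
    convert one_mem (Subring.closure (CsetMonoid K ι n : Set ((ι → K) × (Fin n → K) → ℤ)))
    simp
  | base hf hg =>
    obtain ⟨P, rfl⟩ := hf
    obtain ⟨Q, rfl⟩ := hg
    convert add_mem (hb Q ![P]) (mul_mem (sub_mem (one_mem _) (hb P ![P]))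
      (sub_mem (one_mem _) (hb Q ![Q]))) using 1
    ext z
    by_cases hQ : ev2 z Q = 0 <;> by_cases hP : ev2 z P = 0 <;> simp [Cset, hQ, hP]
  | compl _ ih =>
    convert sub_mem (one_mem _) ih using 1
    ext z; simp only [Set.mem_compl_iff, Pi.sub_apply, Pi.one_apply]; split_ifs <;> simp_all
  | @inter S T _ _ ih1 ih2 =>
    convert mul_mem ih1 ih2 using 1
    ext z
    by_cases h1 : z ∈ S <;> by_cases h2 : z ∈ T <;> simp [h1, h2]

open Classical in
lemma exists_perm_mem {S : Set ((ι → K) × (Fin n → K))} (hS : VB (F2 K ι n) S) :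
    VB (F2sym K ι n) {z | ∃ g : Equiv.Perm (Fin n), (z.1, z.2 ∘ g) ∈ S} := by
  have key : ∀ φ : (ι → K) × (Fin n → K) → ℤ,
      φ ∈ Subring.closure (CsetMonoid K ι n : Set ((ι → K) × (Fin n → K) → ℤ)) →
      Level (F2sym K ι n) (fun z => ∑ g : Equiv.Perm (Fin n), φ (z.1, z.2 ∘ g)) := by
    intro φ hφ
    rw [Subring.mem_closure_iff, Submonoid.closure_eq] at hφ
    induction hφ using AddSubgroup.closure_induction with
    | mem x hx =>
      obtain ⟨r, Q, p, rfl⟩ := hx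
      exact level_count Q p
    | zero => exact ⟨⟨0, by simp⟩, fun k => by simpa using VB.const _⟩
    | add x y _ _ hx hy => simpa [Finset.sum_add_distrib] using hx.add hy
    | neg x _ hx => simpa using hx.neg
  have := ((key _ (indicator_mem hS)).2 0).not
  convert this using 1
  ext z
  simp only [Set.mem_ofPred_eq]
  rw [Finset.sum_eq_zero_iff_of_nonneg (fun g _ => by split_ifs <;> simp)]
  simp

/-- symmetrisation of a constructible set, in terms of elementary symmetric functions -/
lemma exists_esymm {S : Set ((ι → K) × (Fin n → K))} (hS : VB (F2 K ι n) S) :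
    ∃ T, VB (F2 K ι n) T ∧ ∀ (y : ι → K) (α : Fin n → K),
      (∃ g : Equiv.Perm (Fin n), (y, α ∘ g) ∈ S) ↔
        (y, fun i : Fin n => MvPolynomial.eval α (MvPolynomial.esymm (Fin n) K (i + 1))) ∈ T := by
  suffices ∀ S, VB (F2sym K ι n) S → ∃ T, VB (F2 K ι n) T ∧ ∀ (y : ι → K) (α : Fin n → K),
      (y, α) ∈ S ↔
        (y, fun i : Fin n => MvPolynomial.eval α (MvPolynomial.esymm (Fin n) K (i + 1))) ∈ T from
    this _ (exists_perm_mem hS)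
  have hp : ∀ p : MvPolynomial (Fin n) (MvPolynomial ι K), p.IsSymmetric →
      ∃ q : MvPolynomial (Fin n) (MvPolynomial ι K), ∀ (y : ι → K) (α : Fin n → K),
        ev2 (y, α) p =
        ev2 (y, fun i : Fin n => MvPolynomial.eval α (MvPolynomial.esymm (Fin n) K (i + 1))) q := by
    intro p hp
    obtain ⟨q, hq⟩ := MvPolynomial.esymmAlgHom_surjective (σ := Fin n) (MvPolynomial ι K)
      (n := n) (by simp) ⟨p, hp⟩
    refine ⟨q, fun y α => ?_⟩
    have h : p = MvPolynomial.aeval (fun i : Fin n =>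
      MvPolynomial.esymm (Fin n) (MvPolynomial ι K) (i + 1)) q := by
      rw [← MvPolynomial.esymmAlgHom_apply, hq]
    have h2 : ∀ i, ev2 (y, α) (MvPolynomial.esymm (Fin n) (MvPolynomial ι K) i) =
        MvPolynomial.eval α (MvPolynomial.esymm (Fin n) K i) := by
      intro i; simp [MvPolynomial.esymm, ev2]
    have h3 : (ev2 (y, α)).comp (MvPolynomial.aeval (fun i : Fin n =>
      MvPolynomial.esymm (Fin n) (MvPolynomial ι K) (i + 1)) :
        MvPolynomial (Fin n) (MvPolynomial ι K) →ₐ[_] _).toRingHom =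
        ev2 (y, fun i : Fin n => MvPolynomial.eval α (MvPolynomial.esymm (Fin n) K (i + 1))) := by
      refine MvPolynomial.ringHom_ext (fun r => ?_) fun i => ?_
      · simp [ev2]
      · simp only [RingHom.comp_apply, AlgHom.toRingHom_eq_coe, RingHom.coe_coe,
          MvPolynomial.aeval_X, h2]
        simp [ev2]
    rw [← h3, h]; rfl
  intro S hS
  induction hS with
  | univ => exact ⟨_, VB.univ, by simp⟩
  | base hf hg =>
    obtain ⟨p, hp1, rfl⟩ := hf
    obtain ⟨q, hq1, rfl⟩ := hg
    obtain ⟨p', hp'⟩ := hp p hp1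
    obtain ⟨q', hq'⟩ := hp q hq1
    refine ⟨_, VB.base ⟨p', rfl⟩ ⟨q', rfl⟩, fun y α => ?_⟩
    simp [hp', hq']
  | compl _ ih =>
    obtain ⟨T, hT, h⟩ := ih
    exact ⟨_, hT.compl, fun y α => by simp [h]⟩
  | inter _ _ ih1 ih2 =>
    obtain ⟨T, hT, h⟩ := ih1
    obtain ⟨T', hT', h'⟩ := ih2
    exact ⟨_, hT.inter hT', fun y α => by simp [h, h']⟩

end

end

section
variable {K : Type*} [NormedField K] {P : Type*}

lemma VB.congr {F : Set (P → K)} {x x' : P}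
    (h : ∀ f ∈ F, ∀ g ∈ F, ‖f x‖ ≤ ‖g x‖ ↔ ‖f x'‖ ≤ ‖g x'‖) {S : Set P} (hS : VB F S) :
    x ∈ S ↔ x' ∈ S := by
  induction hS with
  | univ => simp
  | base hf hg => exact h _ hf _ hg
  | compl _ ih => exact not_congr ih
  | inter _ _ ih1 ih2 => exact and_congr ih1 ih2

variable (K) in
/-- the algebra of sets generated by the coordinates on `Kʳ` -/
abbrev VBc {r : ℕ} : Set (Fin r → K) → Prop :=
  VB (Set.range fun (i : Fin r) (y : Fin r → K) => y i)

lemma VB.congr_coord {r : ℕ} {B : Set (Fin r → K)} (hB : VBc K B) {y y' : Fin r → K}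
    (h : ∀ i j, ‖y i‖ ≤ ‖y j‖ ↔ ‖y' i‖ ≤ ‖y' j‖) : y ∈ B ↔ y' ∈ B := by
  refine VB.congr ?_ hB
  rintro _ ⟨i, rfl⟩ _ ⟨j, rfl⟩
  exact h i j

lemma VB.of_coord {F : Set (P → K)} {r : ℕ} {B : Set (Fin r → K)} (hB : VBc K B)
    {f : Fin r → P → K} (hf : ∀ i, f i ∈ F) : VB F {x | (fun i => f i x) ∈ B} := by
  refine VB.preimage (fun x i => f i x) ?_ hB
  rintro _ ⟨i, rfl⟩
  exact hf i

/-- a set of functions that is a `K`-algebra -/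
structure IsAlg (F : Set (P → K)) : Prop where
  const : ∀ c : K, (fun _ => c) ∈ F
  mul : ∀ {f g : P → K}, f ∈ F → g ∈ F → (fun x => f x * g x) ∈ F
  sub : ∀ {f g : P → K}, f ∈ F → g ∈ F → (fun x => f x - g x) ∈ F

lemma IsAlg.pow {F : Set (P → K)} (hF : IsAlg F) {f : P → K} (hf : f ∈ F) (n : ℕ) :
    (fun x => f x ^ n) ∈ F := by
  induction n with
  | zero => simpa using hF.const 1
  | succ n ih => simpa [pow_succ] using hF.mul ih hf

lemma IsAlg.prod {F : Set (P → K)} (hF : IsAlg F) {ι : Type*} (s : Finset ι) {f : ι → P → K}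
    (hf : ∀ i ∈ s, f i ∈ F) : (fun x => ∏ i ∈ s, f i x) ∈ F := by
  classical
  induction s using Finset.induction_on with
  | empty => simpa using hF.const 1
  | insert a s ha ih =>
    simp only [Finset.prod_insert ha]
    exact hF.mul (hf a (by simp)) (ih fun i hi => hf i (by simp [hi]))

/-- a sample point in every cell of the line cut by finitely many positive reals -/
lemma exists_test {V : Set ℝ} (hV : V.Finite) (hpos : ∀ v ∈ V, 0 < v) {s : ℝ} (hs : 0 < s) {w : ℝ}
    (hw : 0 < w) (hw1 : w < 1 ∨ (s = 1 ∧ ∀ v ∈ V, v = 1)) :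
    ∃ q, (q = 1 ∨ (∃ v ∈ V, ∃ v' ∈ V, q = v * v') ∨ (∃ v ∈ V, q = w * (v * v)) ∨
      (∃ v ∈ V, q * w = v * v)) ∧
      ∀ v ∈ V, (s ≤ v ↔ q ≤ v ^ 2) ∧ (v ≤ s ↔ v ^ 2 ≤ q) := by
  by_cases hsV : s ∈ V
  · refine ⟨s * s, Or.inr (Or.inl ⟨s, hsV, s, hsV, rfl⟩), fun v hv => ?_⟩
    rw [← sq, pow_le_pow_iff_left₀ hs.le (hpos v hv).le two_ne_zero,
      pow_le_pow_iff_left₀ (hpos v hv).le hs.le two_ne_zero]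
    simp
  rcases V.eq_empty_or_nonempty with rfl | hne
  · exact ⟨1, Or.inl rfl, by simp⟩
  have hw1 : w < 1 := by
    rcases hw1 with h | ⟨h, h'⟩
    · exact h
    · obtain ⟨v, hv⟩ := hne
      rw [h, ← h' v hv] at hsV
      exact absurd hv hsV
  have hlt : ∀ v ∈ V, v ≤ s → v < s := fun v hv h => lt_of_le_of_ne h fun h' => hsV (h' ▸ hv)
  have hgt : ∀ v ∈ V, s ≤ v → s < v := fun v hv h => lt_of_le_of_ne h fun h' => hsV (h' ▸ hv)
  suffices ∃ q, ((∃ v ∈ V, ∃ v' ∈ V, q = v * v') ∨ (∃ v ∈ V, q = w * (v * v)) ∨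
      (∃ v ∈ V, q * w = v * v)) ∧ ∀ v ∈ V, (s < v → q < v ^ 2) ∧ (v < s → v ^ 2 < q) by
    obtain ⟨q, hq, h⟩ := this
    refine ⟨q, Or.inr hq, fun v hv => ?_⟩
    rcases le_total s v with hsv | hsv
    · have h1 := (h v hv).1 (hgt v hv hsv)
      exact ⟨⟨fun _ => h1.le, fun _ => hsv⟩, ⟨fun h2 => absurd h2 (not_le.2 (hgt v hv hsv)), fun h2 => absurd h2 (not_le.2 h1)⟩⟩
    · have h1 := (h v hv).2 (hlt v hv hsv)
      exact ⟨⟨fun h2 => absurd h2 (not_le.2 (hlt v hv hsv)), fun h2 => absurd h2 (not_le.2 h1)⟩, ⟨fun _ => h1.le, fun _ => hsv⟩⟩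
  have hL : (V ∩ {v | v < s}).Finite := hV.inter_of_left _
  have hU : (V ∩ {v | s < v}).Finite := hV.inter_of_left _
  rcases (V ∩ {v | v < s}).eq_empty_or_nonempty with hLe | hLn
  · have hall : ∀ v ∈ V, s < v := by
      intro v hv
      by_contra! h
      have : v ∈ V ∩ {v | v < s} := ⟨hv, hlt v hv h⟩
      rw [hLe] at this; exact this
    obtain ⟨u, hu, hmin⟩ := hV.exists_minimalFor id V hne
    have hmin : ∀ v ∈ V, u ≤ v := fun v hv => by
      rcases le_total u v with h | h
      · exact h
      · exact hmin hv h
    refine ⟨w * (u * u), Or.inr (Or.inl ⟨u, hu, rfl⟩), fun v hv => ⟨fun _ => ?_, fun h => ?_⟩⟩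
    · have hu0 := hpos u hu
      have := hmin v hv
      have h2 : u * u ≤ v ^ 2 := by rw [sq]; exact mul_le_mul this this hu0.le (hpos v hv).le
      have h3 : 0 < u * u := by positivity
      nlinarith
    · exact absurd h (hall v hv).le.not_gt
  · obtain ⟨l, hl, hmax⟩ := hL.exists_maximalFor id _ hLn
    have hmax : ∀ v ∈ V, v < s → v ≤ l := fun v hv h => by
      rcases le_total v l with h' | h'
      · exact h'
      · exact hmax ⟨hv, h⟩ h'
    have hl0 := hpos l hl.1
    rcases (V ∩ {v | s < v}).eq_empty_or_nonempty with hUe | hUn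
    · have hall : ∀ v ∈ V, v < s := by
        intro v hv
        by_contra! h
        have : v ∈ V ∩ {v | s < v} := ⟨hv, hgt v hv h⟩
        rw [hUe] at this; exact this
      refine ⟨l * l / w, Or.inr (Or.inr ⟨l, hl.1, by field_simp⟩), fun v hv =>
        ⟨fun h => absurd h (hall v hv).le.not_gt, fun h => ?_⟩⟩
      have := hmax v hv h
      have h2 : v ^ 2 ≤ l * l := by rw [sq]; exact mul_le_mul this this (hpos v hv).le hl0.le
      rw [lt_div_iff₀ hw]
      have := hpos v hv
      have : 0 < v ^ 2 := by positivity
      nlinarith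
    · obtain ⟨u, hu, hmin⟩ := hU.exists_minimalFor id _ hUn
      have hmin : ∀ v ∈ V, s < v → u ≤ v := fun v hv h => by
        rcases le_total u v with h' | h'
        · exact h'
        · exact hmin ⟨hv, h⟩ h'
      have hlu : l < u := lt_trans hl.2 hu.2
      have hu0 := hpos u hu.1
      refine ⟨l * u, Or.inl ⟨l, hl.1, u, hu.1, rfl⟩, fun v hv => ⟨fun h => ?_, fun h => ?_⟩⟩
      · have := hmin v hv h; nlinarith
      · have := hmax v hv h; have := hpos v hv; nlinarith

end

section
variable {K : Type*} [NormedField K] {P : Type*}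

lemma VB.root_test {F : Set (P → K)} (hF : IsAlg F) {r : ℕ} {B : Set (Fin r → K)} (hB : VBc K B)
    {c : Fin r → P → K} (hc : ∀ i, c i ∈ F) (n : Fin r → ℕ) {D : ℕ} (hD : ∀ i, n i ≤ D) {M : ℕ}
    (hM : M ≠ 0) [IsAlgClosed K] {num den : P → K} (hnum : num ∈ F) (hden : den ∈ F) :
    VB F {x | den x ≠ 0 ∧ ∃ t, t ^ M * den x = num x ∧ (fun i => c i x * t ^ n i) ∈ B} := by
  have : {x | den x ≠ 0 ∧ ∃ t, t ^ M * den x = num x ∧ (fun i => c i x * t ^ n i) ∈ B} =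
      {x | den x ≠ 0 ∧ (fun i => c i x ^ M * num x ^ n i * den x ^ (D - n i)) ∈ B} := by
    ext x
    simp only [Set.mem_ofPred_eq]
    refine and_congr_right fun hd => ?_
    have key : ∀ t, t ^ M * den x = num x → ((fun i => c i x * t ^ n i) ∈ B ↔
        (fun i => c i x ^ M * num x ^ n i * den x ^ (D - n i)) ∈ B) := by
      intro t ht
      refine hB.congr_coord fun i j => ?_
      have h : ∀ i, ‖c i x ^ M * num x ^ n i * den x ^ (D - n i)‖ =
          ‖c i x * t ^ n i‖ ^ M * ‖den x‖ ^ D := by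
        intro i
        have : den x ^ D = den x ^ n i * den x ^ (D - n i) := by
          rw [← pow_add, Nat.add_sub_cancel' (hD i)]
        rw [← norm_pow, ← norm_pow, ← norm_mul, this, ← ht]
        congr 1
        ring
      rw [h, h, mul_le_mul_iff_left₀ (pow_pos (norm_pos_iff.2 hd) _),
        pow_le_pow_iff_left₀ (norm_nonneg _) (norm_nonneg _) hM]
    constructor
    · rintro ⟨t, ht, h⟩
      exact (key t ht).1 h
    · intro h
      obtain ⟨t, ht⟩ := IsAlgClosed.exists_pow_nat_eq (num x / den x) (Nat.pos_of_ne_zero hM)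
      have ht : t ^ M * den x = num x := by rw [ht]; field_simp
      exact ⟨t, ht, (key t ht).2 h⟩
  rw [this]
  refine VB.and (VB.eq_zero hden (hF.const 0)).not (VB.of_coord hB fun i => ?_)
  exact hF.mul (hF.mul (hF.pow (hc i) _) (hF.pow hnum _)) (hF.pow hden _)

lemma exists_norm_lt_or_trivial (K : Type*) [NormedField K] :
    ∃ ϖ : K, ϖ ≠ 0 ∧ (‖ϖ‖ < 1 ∨ ∀ x : K, x ≠ 0 → ‖x‖ = 1) := by
  by_cases h : ∀ x : K, x ≠ 0 → ‖x‖ = 1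
  · exact ⟨1, one_ne_zero, Or.inr h⟩
  · push Not at h
    obtain ⟨x, hx, h1⟩ := h
    rcases lt_or_gt_of_ne h1 with h | h
    · exact ⟨x, hx, Or.inl h⟩
    · exact ⟨x⁻¹, inv_ne_zero hx, Or.inl (by rw [norm_inv]; exact inv_lt_one_of_one_lt₀ h)⟩

/-- elimination of one variable in monomial conditions -/
lemma VB.monomial_elim [IsAlgClosed K] {F : Set (P → K)} (hF : IsAlg F) {r : ℕ}
    {B : Set (Fin r → K)} (hB : VBc K B) {c : Fin r → P → K} (hc : ∀ i, c i ∈ F) (n : Fin r → ℕ) :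
    VB F {x | ∃ t, (fun i => c i x * t ^ n i) ∈ B} := by
  classical
  obtain ⟨D, hD⟩ : ∃ D, ∀ i, n i ≤ D := ⟨∑ i, n i, fun i =>
    Finset.single_le_sum (f := n) (fun _ _ => Nat.zero_le _) (Finset.mem_univ i)⟩
  obtain ⟨ϖ, hϖ0, hϖ⟩ := exists_norm_lt_or_trivial K
  set N := D.factorial with hN
  have hN0 : N ≠ 0 := Nat.factorial_ne_zero D
  -- the breakpoint of the pair `p` is `‖up p‖ / ‖dn p‖`
  let e : Fin r × Fin r → ℕ := fun p => N / (n p.1 - n p.2)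
  let up : Fin r × Fin r → P → K := fun p x => c p.2 x ^ e p
  let dn : Fin r × Fin r → P → K := fun p x => c p.1 x ^ e p
  have hup : ∀ p, up p ∈ F := fun p => hF.pow (hc _) _
  have hdn : ∀ p, dn p ∈ F := fun p => hF.pow (hc _) _
  let W : (P → K) → (P → K) → Set P := fun num den =>
    {x | den x ≠ 0 ∧ ∃ t, t ^ (2 * N) * den x = num x ∧ (fun i => c i x * t ^ n i) ∈ B}
  have hW : ∀ {num den}, num ∈ F → den ∈ F → VB F (W num den) := fun h h' =>
    VB.root_test hF hB hc n hD (mul_ne_zero two_ne_zero hN0) h h'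
  have main : {x | ∃ t, (fun i => c i x * t ^ n i) ∈ B} =
      {x | (fun i => c i x * 0 ^ n i) ∈ B} ∪ (W (fun _ => 1) (fun _ => 1) ∪
        ({x | ∃ p p', x ∈ W (fun x => up p x * up p' x) (fun x => dn p x * dn p' x)} ∪
        ({x | ∃ p, x ∈ W (fun x => ϖ * (up p x * up p x)) (fun x => dn p x * dn p x)} ∪
        {x | ∃ p, x ∈ W (fun x => up p x * up p x) (fun x => ϖ * (dn p x * dn p x))}))) := by
    ext x
    constructor
    · rintro ⟨t, ht⟩
      by_cases ht0 : t = 0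
      · exact Or.inl (by simpa [ht0] using ht)
      refine Or.inr ?_
      have htn : 0 < ‖t‖ := norm_pos_iff.2 ht0
      let I : Set (Fin r × Fin r) := {p | n p.2 < n p.1 ∧ c p.1 x ≠ 0 ∧ c p.2 x ≠ 0}
      let v : Fin r × Fin r → ℝ := fun p => ‖up p x‖ / ‖dn p x‖
      have hvI : ∀ p ∈ I, up p x ≠ 0 ∧ dn p x ≠ 0 := fun p hp =>
        ⟨pow_ne_zero _ hp.2.2, pow_ne_zero _ hp.2.1⟩
      obtain ⟨q, hq, hq2⟩ := exists_test (V := v '' I) ((Set.toFinite I).image v)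
        (by rintro _ ⟨p, hp, rfl⟩
            exact div_pos (norm_pos_iff.2 (hvI p hp).1) (norm_pos_iff.2 (hvI p hp).2))
        (pow_pos htn N) (norm_pos_iff.2 hϖ0)
        (by
          refine hϖ.imp id fun h => ⟨by rw [h t ht0, one_pow], ?_⟩
          rintro _ ⟨p, hp, rfl⟩
          simp only [v, h _ (hvI p hp).1, h _ (hvI p hp).2, div_one])
      have key : ∀ t' : K, ‖t'‖ ^ (2 * N) = q → t' ≠ 0 → (fun i => c i x * t' ^ n i) ∈ B := by
        intro t' hq' ht'0
        have ht'n : 0 < ‖t'‖ := norm_pos_iff.2 ht'0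
        refine (hB.congr_coord (fun i j => ?_)).1 ht
        have hbr : ∀ i j, n j < n i → c i x ≠ 0 → c j x ≠ 0 →
            ∀ s : K, s ≠ 0 → ((‖c i x * s ^ n i‖ ≤ ‖c j x * s ^ n j‖ ↔ ‖s‖ ^ N ≤ v (i, j)) ∧
              (‖c j x * s ^ n j‖ ≤ ‖c i x * s ^ n i‖ ↔ v (i, j) ≤ ‖s‖ ^ N)) := by
          intro i j hij hi hj s hs
          have hsn : 0 < ‖s‖ := norm_pos_iff.2 hs
          have hcn : 0 < ‖c i x‖ := norm_pos_iff.2 hi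
          have hdvd : (n i - n j) ∣ N := Nat.dvd_factorial (by omega) (by have := hD i; omega)
          have he : (n i - n j) * e (i, j) = N := Nat.mul_div_cancel' hdvd
          have he0 : e (i, j) ≠ 0 := fun h => hN0 (by rw [← he, h, mul_zero])
          have hv : v (i, j) = (‖c j x‖ / ‖c i x‖) ^ e (i, j) := by
            simp [v, up, dn, div_pow]
          have hsN : ‖s‖ ^ N = (‖s‖ ^ (n i - n j)) ^ e (i, j) := by rw [← pow_mul, he]
          have hmul : ‖c i x * s ^ n i‖ = ‖s‖ ^ (n i - n j) * ‖c i x‖ * ‖s‖ ^ n j := by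
            rw [norm_mul, norm_pow, mul_right_comm, ← pow_add, Nat.sub_add_cancel hij.le, mul_comm]
          rw [hv, hsN, pow_le_pow_iff_left₀ (by positivity) (by positivity) he0,
            pow_le_pow_iff_left₀ (by positivity) (by positivity) he0, hmul, norm_mul, norm_pow,
            le_div_iff₀ hcn, div_le_iff₀ hcn, mul_le_mul_iff_left₀ (by positivity),
            mul_le_mul_iff_left₀ (by positivity)]
          exact ⟨Iff.rfl, Iff.rfl⟩
        have hpos : ∀ p ∈ I, (‖t‖ ^ N ≤ v p ↔ ‖t'‖ ^ N ≤ v p) ∧ (v p ≤ ‖t‖ ^ N ↔ v p ≤ ‖t'‖ ^ N) := by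
          intro p hp
          have h1 := hq2 (v p) ⟨p, hp, rfl⟩
          have h2 : 0 ≤ v p := div_nonneg (norm_nonneg _) (norm_nonneg _)
          rw [← hq', mul_comm, pow_mul, pow_le_pow_iff_left₀ (by positivity) h2 two_ne_zero,
            pow_le_pow_iff_left₀ h2 (by positivity) two_ne_zero] at h1
          exact h1
        by_cases hi : c i x = 0
        · simp only [hi, zero_mul, norm_zero, norm_nonneg]
        by_cases hj : c j x = 0
        · simp only [hj, zero_mul, norm_zero, norm_le_zero_iff, mul_eq_zero, hi,
            pow_ne_zero _ ht0, pow_ne_zero _ ht'0]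
        rcases lt_trichotomy (n j) (n i) with h | h | h
        · rw [(hbr i j h hi hj t ht0).1, (hbr i j h hi hj t' ht'0).1]
          exact (hpos (i, j) ⟨h, hi, hj⟩).1
        · rw [h, norm_mul, norm_mul, norm_mul, norm_mul, mul_le_mul_iff_left₀, mul_le_mul_iff_left₀]
          · rw [norm_pow]; positivity
          · rw [norm_pow]; positivity
        · rw [(hbr j i h hj hi t ht0).2, (hbr j i h hj hi t' ht'0).2]
          exact (hpos (j, i) ⟨h, hj, hi⟩).2
      have fin : ∀ num den : P → K, num x ≠ 0 → den x ≠ 0 → q * ‖den x‖ = ‖num x‖ →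
          x ∈ W num den := by
        intro num den hnum hden hqd
        obtain ⟨t', ht'⟩ := IsAlgClosed.exists_pow_nat_eq (num x / den x)
          (Nat.pos_of_ne_zero (mul_ne_zero two_ne_zero hN0))
        refine ⟨hden, t', by rw [ht']; field_simp, key t' ?_ ?_⟩
        · rw [← norm_pow, ht', norm_div, ← hqd, mul_div_cancel_right₀ _ (norm_ne_zero_iff.2 hden)]
        · rintro rfl
          rw [zero_pow (mul_ne_zero two_ne_zero hN0)] at ht'
          exact div_ne_zero hnum hden ht'.symm
      rcases hq with rfl | ⟨_, ⟨p, hp, rfl⟩, _, ⟨p', hp', rfl⟩, rfl⟩ | ⟨_, ⟨p, hp, rfl⟩, rfl⟩ |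
        ⟨_, ⟨p, hp, rfl⟩, hq⟩
      · exact Or.inl (fin _ _ one_ne_zero one_ne_zero (by simp))
      · have h1 := hvI p hp
        have h2 := hvI p' hp'
        have h1' := norm_ne_zero_iff.2 h1.2
        have h2' := norm_ne_zero_iff.2 h2.2
        refine Or.inr (Or.inl ⟨p, p', fin _ _ (mul_ne_zero h1.1 h2.1) (mul_ne_zero h1.2 h2.2) ?_⟩)
        simp only [norm_mul, v]
        field_simp
      · have h1 := hvI p hp
        have h1' := norm_ne_zero_iff.2 h1.2
        refine Or.inr (Or.inr (Or.inl ⟨p, fin _ _ (mul_ne_zero hϖ0 (mul_ne_zero h1.1 h1.1))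
          (mul_ne_zero h1.2 h1.2) ?_⟩))
        simp only [norm_mul, v]
        field_simp
      · have h1 := hvI p hp
        have h1' := norm_ne_zero_iff.2 h1.2
        refine Or.inr (Or.inr (Or.inr ⟨p, fin _ _ (mul_ne_zero h1.1 h1.1)
          (mul_ne_zero hϖ0 (mul_ne_zero h1.2 h1.2)) ?_⟩))
        simp only [norm_mul, ← mul_assoc, hq, v]
        field_simp
    · rintro (h | ⟨-, t, -, h⟩ | ⟨_, _, -, t, -, h⟩ | ⟨_, -, t, -, h⟩ | ⟨_, -, t, -, h⟩)
      · exact ⟨0, h⟩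
      all_goals exact ⟨t, h⟩
  rw [main]
  refine VB.union (VB.of_coord hB fun i => hF.mul (hc i) (hF.const _)) (VB.union
    (hW (hF.const 1) (hF.const 1)) (VB.union (VB.ex fun p => VB.ex fun p' =>
    hW (hF.mul (hup _) (hup _)) (hF.mul (hdn _) (hdn _))) (VB.union (VB.ex fun p =>
    hW (hF.mul (hF.const _) (hF.mul (hup _) (hup _))) (hF.mul (hdn _) (hdn _))) (VB.ex fun p =>
    hW (hF.mul (hup _) (hup _)) (hF.mul (hF.const _) (hF.mul (hdn _) (hdn _)))))))

end

section

open Polynomial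

section
variable {K : Type*} [NormedField K] [IsAlgClosed K] {P : Type*}

lemma VB.elim_monomials {F : Set (P → K)} (hF : IsAlg F) {S : Set (P × K)}
    (hS : VB {f : P × K → K | ∃ c ∈ F, ∃ n : ℕ, f = fun z => c z.1 * z.2 ^ n} S) :
    VB F {x | ∃ t, (x, t) ∈ S} := by
  obtain ⟨r, h, B, hh, hB, rfl⟩ := hS.exists_coord
  choose c hc n hn using hh
  have := VB.monomial_elim hF hB hc n
  simpa [hn] using this

variable [IsUltrametricDist K]

lemma VB.elim_roots {F : Set (P → K)} (hF : IsAlg F) {n r : ℕ} {B : Set (Fin r → K)}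
    (hB : VBc K B) {α : Fin n → P → K} (hα : ∀ j, α j ∈ F) {l : Fin r → P → K}
    (hl : ∀ i, l i ∈ F) (b : Fin r → Finset (Fin n)) :
    VB F {x | ∃ w, (fun i => l i x * ∏ j ∈ b i, (w - α j x)) ∈ B} := by
  classical
  let c : Fin n → Finset (Fin n) → Fin r → P → K := fun j0 J i x =>
    l i x * ∏ j ∈ b i \ J, (α j0 x - α j x)
  have hc : ∀ j0 J i, c j0 J i ∈ F := fun j0 J i =>
    hF.mul (hl i) (hF.prod _ fun j _ => hF.sub (hα _) (hα _))
  -- `w` behaves like a point at distance `‖t‖` from `α j0` in general position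
  have key : ∀ (x : P) (w t : K) (j0 : Fin n) (J : Finset (Fin n)),
      (∀ j ∈ J, ‖w - α j x‖ = ‖t‖) → (∀ j ∉ J, ‖w - α j x‖ = ‖α j0 x - α j x‖) →
      ((fun i => l i x * ∏ j ∈ b i, (w - α j x)) ∈ B ↔
        (fun i => c j0 J i x * t ^ (b i ∩ J).card) ∈ B) := by
    intro x w t j0 J h1 h2
    have : ∀ i, ‖l i x * ∏ j ∈ b i, (w - α j x)‖ = ‖c j0 J i x * t ^ (b i ∩ J).card‖ := by
      intro i
      rw [← Finset.sdiff_union_inter (b i) J, Finset.prod_union (Finset.disjoint_sdiff_inter _ _)]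
      simp only [c, norm_mul, norm_prod, norm_pow, Finset.sdiff_union_inter]
      rw [Finset.prod_congr rfl fun j hj => h1 j (Finset.mem_inter.1 hj).2,
        Finset.prod_congr rfl fun j hj => h2 j (Finset.mem_sdiff.1 hj).2, Finset.prod_const, mul_assoc]
    refine hB.congr_coord fun i j => ?_
    rw [this, this]
  have main : {x | ∃ w, (fun i => l i x * ∏ j ∈ b i, (w - α j x)) ∈ B} =
      {x | n = 0 ∧ (fun i => l i x) ∈ B} ∪ {x | ∃ (j0 : Fin n) (J : Finset (Fin n)), ∃ t,
        (x, t) ∈ {z : P × K | (∀ j ∈ J, ‖α j0 z.1 - α j z.1‖ ≤ ‖z.2‖) ∧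
        (∀ j ∉ J, ‖z.2‖ < ‖α j0 z.1 - α j z.1‖) ∧
        (fun i => c j0 J i z.1 * z.2 ^ (b i ∩ J).card) ∈ B}} := by
    ext x
    constructor
    · rintro ⟨w, hw⟩
      rcases Nat.eq_zero_or_pos n with rfl | hn
      · refine Or.inl ⟨rfl, ?_⟩
        simpa [Finset.eq_empty_of_isEmpty] using hw
      · have : Nonempty (Fin n) := ⟨⟨0, hn⟩⟩
        obtain ⟨j0, hj0⟩ := Finite.exists_min (fun j => ‖w - α j x‖)
        refine Or.inr ⟨j0, Finset.univ.filter fun j => ‖α j0 x - α j x‖ ≤ ‖w - α j0 x‖, w - α j0 x,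
          by simp, by simp, ?_⟩
        have hsub : ∀ j, w - α j x = (w - α j0 x) + (α j0 x - α j x) := fun j => by ring
        refine (key x w (w - α j0 x) j0 _ ?_ ?_).1 hw
        · intro j hj
          simp only [Finset.mem_filter, Finset.mem_univ, true_and] at hj
          refine le_antisymm ?_ (hj0 j)
          rw [hsub]
          exact (IsUltrametricDist.norm_add_le_max _ _).trans (max_le le_rfl hj)
        · intro j hj
          simp only [Finset.mem_filter, Finset.mem_univ, true_and, not_le] at hj
          rw [hsub, add_comm]
          exact norm_add_eq_left hj
    · rintro (⟨rfl, h⟩ | ⟨j0, J, t, h1, h2, h3⟩)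
      · refine ⟨0, ?_⟩
        simpa [Finset.eq_empty_of_isEmpty] using h
      · simp only at h1 h2 h3
        obtain ⟨Z, hZ, hZ1, hZ2⟩ := exists_unit_nodes (K := K) (n + 1)
        suffices ∃ ζ ∈ Z, ∀ j, max ‖t‖ ‖α j0 x - α j x‖ ≤ ‖ζ * t + (α j0 x - α j x)‖ by
          obtain ⟨ζ, hζ, h⟩ := this
          have heq : ∀ j, ‖(α j0 x + ζ * t) - α j x‖ = max ‖t‖ ‖α j0 x - α j x‖ := by
            intro j
            have : (α j0 x + ζ * t) - α j x = ζ * t + (α j0 x - α j x) := by ring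
            rw [this]
            refine le_antisymm ((IsUltrametricDist.norm_add_le_max _ _).trans
              (max_le_max_right _ ?_)) (h j)
            rw [norm_mul]
            exact mul_le_of_le_one_left (norm_nonneg _) (hZ1 ζ hζ)
          refine ⟨α j0 x + ζ * t, (key x _ t j0 J (fun j hj => ?_) fun j hj => ?_).2 h3⟩
          · rw [heq, max_eq_left (h1 j hj)]
          · rw [heq, max_eq_right (h2 j hj).le]
        by_contra! hcon
        have : Nonempty (Fin n) := ⟨j0⟩
        choose! j hj using hcon
        obtain ⟨ζ, hζ, ζ', hζ', hne, hjj⟩ := Finset.exists_ne_map_eq_of_card_lt_of_maps_to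
          (s := Z) (t := (Finset.univ : Finset (Fin n))) (f := j) (by simpa using hZ)
          (fun _ _ => Finset.mem_univ _)
        have e1 := hj ζ hζ
        have e2 := hj ζ' hζ'
        rw [← hjj] at e2
        set a := α j0 x - α (j ζ) x
        have e3 : ‖t‖ < max ‖t‖ ‖a‖ := by
          calc ‖t‖ = ‖(ζ * t + a) - (ζ' * t + a)‖ := by
                rw [show (ζ * t + a) - (ζ' * t + a) = (ζ - ζ') * t by ring, norm_mul,
                  hZ2 ζ hζ ζ' hζ' hne, one_mul]
            _ ≤ max ‖ζ * t + a‖ ‖ζ' * t + a‖ := by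
                rw [sub_eq_add_neg, ← norm_neg (ζ' * t + a)]
                exact IsUltrametricDist.norm_add_le_max _ _
            _ < _ := max_lt e1 e2
        have e4 : ‖t‖ < ‖a‖ := by simpa using e3
        rw [max_eq_right e4.le, add_comm, norm_add_eq_left] at e1
        · exact lt_irrefl _ e1
        · rw [norm_mul]
          exact (mul_le_of_le_one_left (norm_nonneg _) (hZ1 ζ hζ)).trans_lt e4
  rw [main]
  refine VB.union (VB.and (VB.const _) (VB.of_coord hB hl)) (VB.ex fun j0 => VB.ex fun J =>
    VB.elim_monomials hF ?_)
  have m1 : ∀ {f : P → K}, f ∈ F → (fun z : P × K => f z.1) ∈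
      {f : P × K → K | ∃ c ∈ F, ∃ n : ℕ, f = fun z => c z.1 * z.2 ^ n} :=
    fun hf => ⟨_, hf, 0, by simp⟩
  have m2 : (fun z : P × K => z.2) ∈
      {f : P × K → K | ∃ c ∈ F, ∃ n : ℕ, f = fun z => c z.1 * z.2 ^ n} :=
    ⟨_, hF.const 1, 1, by simp⟩
  refine VB.and (VB.finset_all J fun j _ => VB.le (m1 (hF.sub (hα _) (hα _))) m2) (VB.and
    (VB.all fun j => VB.imp (VB.const _) (VB.lt m2 (m1 (hF.sub (hα _) (hα _)))))
    (VB.of_coord hB fun i => ⟨_, hc j0 J i, _, rfl⟩))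

end

section
variable {K : Type*} [NormedField K] [IsAlgClosed K] {ι : Type*}

lemma exists_linear_factors (f : K[X]) {m : ℕ} (hm : f.natDegree = m) :
    ∃ β : Fin m → K, f = C (f.coeff m) * ∏ k, (X - C (β k)) := by
  have h := (IsAlgClosed.splits f)
  have hc : f.roots.toList.length = m := by
    rw [Multiset.length_toList, ← h.natDegree_eq_card_roots, hm]
  subst hc
  refine ⟨fun k => f.roots.toList[k], ?_⟩
  have h1 := h.eq_prod_roots
  have h2 : (f.roots.map fun a => X - C a).prod =
      ∏ k : Fin f.roots.toList.length, (X - C (f.roots.toList[k])) := by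
    conv_lhs => rw [← Multiset.coe_toList f.roots, Multiset.map_coe, Multiset.prod_coe]
    rw [← List.prod_ofFn]
    congr 1
    apply List.ext_getElem <;> simp
  rw [← h2]
  conv_lhs => rw [h1]
  rw [← hm]
  rfl

lemma eval_esymm_of_coeff {n : ℕ} (α : Fin n → K) {G : K[X]} {L : K} (hL : L ≠ 0)
    (hG : G = C L * ∏ j, (X - C (α j))) (i : Fin n) :
    MvPolynomial.eval (fun j => L * α j) (MvPolynomial.esymm (Fin n) K (i + 1)) =
      (-1) ^ ((i : ℕ) + 1) * G.coeff (n - (i + 1)) * L ^ (i : ℕ) := by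
  have h1 : MvPolynomial.eval (fun j => L * α j) (MvPolynomial.esymm (Fin n) K (i + 1)) =
      L ^ ((i : ℕ) + 1) * MvPolynomial.eval α (MvPolynomial.esymm (Fin n) K (i + 1)) := by
    rw [MvPolynomial.esymm, map_sum, map_sum, Finset.mul_sum]
    refine Finset.sum_congr rfl fun t ht => ?_
    simp [Finset.prod_mul_distrib, (Finset.mem_powersetCard.1 ht).2]
  have h2 : MvPolynomial.eval α (MvPolynomial.esymm (Fin n) K (i + 1)) =
      (Finset.univ.val.map α).esymm (i + 1) := by
    rw [← MvPolynomial.aeval_esymm_eq_multiset_esymm (Fin n) K, ← MvPolynomial.coe_aeval_eq_eval]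
    rfl
  have hc : Multiset.card (Finset.univ.val.map α) = n := by simp
  have h3 := Multiset.prod_X_sub_C_coeff (Finset.univ.val.map α) (k := n - (i + 1))
    (by rw [hc]; omega)
  have h4 : ((Finset.univ.val.map α).map fun t => X - C t).prod = ∏ j, (X - C (α j)) := by
    rw [Multiset.map_map]; rfl
  rw [h4, hc, show n - (n - ((i : ℕ) + 1)) = i + 1 by omega] at h3
  rw [h1, h2, hG, coeff_C_mul, h3, ← mul_assoc, ← mul_assoc, mul_comm _ L, mul_assoc L, ← mul_pow]
  simp [pow_succ]
  ring

variable (K ι) in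
/-- polynomial functions on `K^ι` -/
def PB : Set ((ι → K) → K) := Set.range fun (p : MvPolynomial ι K) y => MvPolynomial.eval y p

lemma isAlg_F2 {n : ℕ} : IsAlg (F2 K ι n) where
  const c := ⟨MvPolynomial.C (MvPolynomial.C c), by ext; simp [ev2]⟩
  mul := by rintro _ _ ⟨p, rfl⟩ ⟨q, rfl⟩; exact ⟨p * q, by ext; simp⟩
  sub := by rintro _ _ ⟨p, rfl⟩ ⟨q, rfl⟩; exact ⟨p - q, by ext; simp⟩

lemma isAlg_PB : IsAlg (PB K ι) where
  const c := ⟨MvPolynomial.C c, by ext; simp⟩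
  mul := by rintro _ _ ⟨p, rfl⟩ ⟨q, rfl⟩; exact ⟨p * q, by ext; simp⟩
  sub := by rintro _ _ ⟨p, rfl⟩ ⟨q, rfl⟩; exact ⟨p - q, by ext; simp⟩

lemma VB.poly_eq_zero {P R : Type*} [CommRing R] {F : Set (P → K)} (hF : IsAlg F) (e : P → R →+* K)
    (he : ∀ a : R, (fun z => e z a) ∈ F) (p : R[X]) : VB F {z | p.map (e z) = 0} := by
  have : {z | p.map (e z) = 0} = {z | ∀ k ∈ p.support, e z (p.coeff k) = 0} := by
    ext z
    simp only [Set.mem_ofPred_eq, Polynomial.ext_iff, coeff_map, coeff_zero]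
    refine ⟨fun h k _ => h k, fun h k => ?_⟩
    by_cases hk : k ∈ p.support
    · exact h k hk
    · rw [notMem_support_iff.1 hk, map_zero]
  rw [this]
  exact VB.finset_all _ fun k _ => VB.eq_zero (he _) (hF.const 0)

variable [IsUltrametricDist K]

theorem exists_eval_mem {r : ℕ} (p : Fin r → (MvPolynomial ι K)[X]) {B : Set (Fin r → K)}
    (hB : VBc K B) :
    VB (PB K ι) {y | ∃ w, (fun i => ((p i).map (MvPolynomial.eval y)).eval w) ∈ B} := by
  classical
  obtain ⟨D, hD⟩ : ∃ D, ∀ i, (p i).natDegree ≤ D :=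
    ⟨Finset.univ.sup fun i => (p i).natDegree, fun i =>
      Finset.le_sup (f := fun i => (p i).natDegree) (Finset.mem_univ i)⟩
  have hD' : ∀ i y, ((p i).map (MvPolynomial.eval y)).natDegree < D + 1 := fun i y =>
    Nat.lt_succ_of_le (natDegree_map_le.trans (hD i))
  suffices ∀ d : Fin r → Fin (D + 1), VB (PB K ι)
      {y | (∀ i, ((p i).map (MvPolynomial.eval y)).natDegree = d i) ∧
        ∃ w, (fun i => ((p i).map (MvPolynomial.eval y)).eval w) ∈ B} by
    have h := VB.ex this
    refine (congrArg (VB (PB K ι)) (Set.ext fun y => ?_)).mp h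
    exact ⟨fun ⟨_, _, h⟩ => h, fun h => ⟨fun i => ⟨_, hD' i y⟩, fun i => rfl, h⟩⟩
  intro d
  have hpat : VB (PB K ι) {y | ∀ i, ((p i).map (MvPolynomial.eval y)).natDegree = d i} := by
    refine VB.all fun i => ?_
    have : {y : ι → K | ((p i).map (MvPolynomial.eval y)).natDegree = d i} =
        {y | (∀ k ∈ Finset.Ioc (d i : ℕ) D, MvPolynomial.eval y ((p i).coeff k) = 0) ∧
          ((d i : ℕ) = 0 ∨ ¬ MvPolynomial.eval y ((p i).coeff (d i)) = 0)} := by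
      ext y
      simp only [Set.mem_ofPred_eq, Finset.mem_Ioc]
      constructor
      · intro h
        refine ⟨fun k hk => ?_, ?_⟩
        · rw [← coeff_map]; exact coeff_eq_zero_of_natDegree_lt (h ▸ hk.1)
        · rcases Nat.eq_zero_or_pos (d i : ℕ) with h0 | h0
          · exact Or.inl h0
          · refine Or.inr ?_
            rw [← coeff_map, ← h, coeff_natDegree, leadingCoeff_eq_zero]
            rintro h'
            rw [h', natDegree_zero] at h
            omega
      · rintro ⟨h1, h2⟩
        have hle : ((p i).map (MvPolynomial.eval y)).natDegree ≤ d i := by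
          rw [natDegree_le_iff_coeff_eq_zero]
          intro k hk
          by_cases hkD : k ≤ D
          · rw [coeff_map]; exact h1 k ⟨hk, hkD⟩
          · exact coeff_eq_zero_of_natDegree_lt ((Nat.lt_succ_iff.1 (hD' i y)).trans_lt (not_le.1 hkD))
        rcases h2 with h2 | h2
        · omega
        · refine le_antisymm hle (le_natDegree_of_ne_zero ?_)
          rwa [coeff_map]
    rw [this]
    exact VB.and (VB.finset_all _ fun k _ => VB.eq_zero ⟨_, rfl⟩ (isAlg_PB.const 0))
      (VB.or (VB.const _) (VB.not (VB.eq_zero ⟨_, rfl⟩ (isAlg_PB.const 0))))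
  let n := ∑ i, (d i : ℕ)
  let idx : (Σ i : Fin r, Fin (d i : ℕ)) ≃ Fin n := finSigmaFinEquiv
  let b : Fin r → Finset (Fin n) := fun i => Finset.univ.image fun k => idx ⟨i, k⟩
  have hb : ∀ (i : Fin r) {M : Type _} [CommMonoid M] (f : Fin n → M),
      ∏ j ∈ b i, f j = ∏ k, f (idx ⟨i, k⟩) := by
    intro i M _ f
    refine Finset.prod_image ?_
    intro k _ k' _ h
    simpa using idx.injective h
  let pp : Fin r → (MvPolynomial ι K)[X] := fun i => if (d i : ℕ) = 0 then 1 else p i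
  let lc : Fin r → MvPolynomial ι K := fun i => if (d i : ℕ) = 0 then 1 else (p i).coeff (d i)
  let L : MvPolynomial ι K := ∏ i, lc i
  let G : (MvPolynomial ι K)[X] := ∏ i, pp i
  let q : Fin r → (MvPolynomial ι K)[X] := fun i =>
    ∑ k ∈ Finset.range (D + 1), C ((p i).coeff k * L ^ (D - k)) * X ^ k
  have hq : ∀ i y (w : K), ((q i).map (MvPolynomial.eval y)).eval (MvPolynomial.eval y L * w) =
      MvPolynomial.eval y L ^ D * ((p i).map (MvPolynomial.eval y)).eval w := by
    intro i y w
    rw [eval_eq_sum_range' (hD' i y)]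
    simp only [q, Polynomial.map_sum, eval_finsetSum, Finset.mul_sum]
    refine Finset.sum_congr rfl fun k hk => ?_
    have : k + (D - k) = D := by have := Finset.mem_range.1 hk; omega
    simp only [Polynomial.map_mul, map_C, Polynomial.map_pow, map_X, eval_mul, eval_C, eval_pow,
      eval_X, map_mul, map_pow, coeff_map, mul_pow]
    rw [← this, pow_add]
    simp only [this]
    ring
  let lam : Fin r → MvPolynomial ι K := fun i => (p i).coeff (d i) * L ^ (D - d i)
  let T : Set ((ι → K) × (Fin n → K)) := {z |
    (∀ i, (q i).map (MvPolynomial.eval z.1) = C (MvPolynomial.eval z.1 (lam i)) *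
      ∏ j ∈ b i, (X - C (z.2 j))) ∧
    ∃ w, (fun i => MvPolynomial.eval z.1 (lam i) * ∏ j ∈ b i, (w - z.2 j)) ∈ B}
  have hc : ∀ a : MvPolynomial ι K, (fun z => MvPolynomial.eval z.1 a) ∈ F2 K ι n := fun a =>
    ⟨MvPolynomial.C a, by ext z; simp [ev2]⟩
  have hX : ∀ j, (fun z => z.2 j) ∈ F2 K ι n := fun j => ⟨MvPolynomial.X j, by ext z; simp [ev2]⟩
  have hT : VB (F2 K ι n) T := by
    refine VB.and (VB.all fun i => ?_) (VB.elim_roots isAlg_F2 hB hX (fun i => hc (lam i)) b)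
    have := VB.poly_eq_zero (isAlg_F2 (K := K) (ι := ι) (n := n)) ev2 (fun a => ⟨a, rfl⟩)
      ((q i).map MvPolynomial.C - C (MvPolynomial.C (lam i)) *
        ∏ j ∈ b i, (X - C (MvPolynomial.X j)))
    refine (congrArg (VB (F2 K ι n)) (Set.ext fun z => ?_)).mp this
    have hcomp : (ev2 z).comp MvPolynomial.C = MvPolynomial.eval z.1 := by
      ext <;> simp [ev2]
    have hC' : ∀ a, ev2 z (MvPolynomial.C a) = MvPolynomial.eval z.1 a := fun a => by simp [ev2]
    have hX' : ∀ j, ev2 z (MvPolynomial.X j) = z.2 j := fun j => by simp [ev2]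
    simp only [Set.mem_ofPred_eq, Polynomial.map_sub, Polynomial.map_map, hcomp, Polynomial.map_mul,
      map_C, Polynomial.map_prod, map_X, hC', hX', sub_eq_zero]
  obtain ⟨T', hT', hTT'⟩ := exists_esymm hT
  let e : Fin n → MvPolynomial ι K := fun i =>
    (-1) ^ ((i : ℕ) + 1) * G.coeff (n - (i + 1)) * L ^ (i : ℕ)
  have hfin : VB (PB K ι) ((fun y : ι → K => (y, fun i => MvPolynomial.eval y (e i))) ⁻¹' T') := by
    refine VB.preimage _ ?_ hT'
    rintro _ ⟨a, rfl⟩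
    refine ⟨MvPolynomial.eval₂Hom (RingHom.id _) e a, ?_⟩
    ext y
    have : (MvPolynomial.eval y).comp (MvPolynomial.eval₂Hom (RingHom.id _) e) =
      ev2 (y, fun i => MvPolynomial.eval y (e i)) := by
      ext <;> simp [ev2]
    exact congrArg (fun f => f a) this
  refine (congrArg (VB (PB K ι)) (Set.ext fun y => ?_)).mp (hpat.inter hfin)
  refine and_congr_right fun hy => ?_
  have hy : ∀ i, ((p i).map (MvPolynomial.eval y)).natDegree = d i := hy
  choose β hβ using fun i => exists_linear_factors _ (hy i)
  simp only [coeff_map] at hβ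
  let α : Fin n → K := fun j => β (idx.symm j).1 (idx.symm j).2
  have hα : ∀ i k, α (idx ⟨i, k⟩) = β i k := fun i k => by
    change (fun s : Σ i : Fin r, Fin (d i : ℕ) => β s.1 s.2) (idx.symm (idx ⟨i, k⟩)) = _
    rw [Equiv.symm_apply_apply]
  have hl0 : ∀ i, MvPolynomial.eval y (lc i) ≠ 0 := by
    intro i
    by_cases h0 : (d i : ℕ) = 0
    · simp only [lc, if_pos h0, map_one]; exact one_ne_zero
    · simp only [lc, h0, if_false]
      intro h
      have := hβ i
      rw [h] at this
      have h1 := hy i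
      rw [this] at h1
      simp at h1
      omega
  have hL0 : MvPolynomial.eval y L ≠ 0 := by
    simp only [L, map_prod]
    exact Finset.prod_ne_zero_iff.2 fun i _ => hl0 i
  have hpp : ∀ i, (pp i).map (MvPolynomial.eval y) = C (MvPolynomial.eval y (lc i)) *
      ∏ k, (X - C (β i k)) := by
    intro i
    by_cases h0 : (d i : ℕ) = 0
    · have : IsEmpty (Fin (d i)) := by rw [h0]; infer_instance
      rw [Fintype.prod_empty]
      simp only [pp, lc, if_pos h0, map_one, Polynomial.map_one, mul_one]
    · simp only [pp, lc, h0, if_false]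
      exact hβ i
  have hG : G.map (MvPolynomial.eval y) = C (MvPolynomial.eval y L) * ∏ j, (X - C (α j)) := by
    simp only [G, L, Polynomial.map_prod, hpp, map_prod, Finset.prod_mul_distrib]
    congr 1
    rw [← idx.prod_comp, Fintype.prod_sigma]
    simp only [hα]
  have he : (fun i => MvPolynomial.eval y (e i)) = fun i : Fin n => MvPolynomial.eval
      (fun j => MvPolynomial.eval y L * α j) (MvPolynomial.esymm (Fin n) K (i + 1)) := by
    funext i
    rw [eval_esymm_of_coeff α hL0 hG]
    simp [e]
  have hqy : ∀ i, (q i).map (MvPolynomial.eval y) = C (MvPolynomial.eval y (lam i)) *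
      ∏ j ∈ b i, (X - C (MvPolynomial.eval y L * α j)) := by
    intro i
    refine Polynomial.funext fun w => ?_
    obtain ⟨w, rfl⟩ : ∃ w', w = MvPolynomial.eval y L * w' :=
      ⟨(MvPolynomial.eval y L)⁻¹ * w, by field_simp⟩
    have hdD : (d i : ℕ) ≤ D := Nat.lt_succ_iff.1 (d i).2
    rw [hq, hβ i, hb]
    simp only [eval_mul, eval_C, eval_prod, eval_sub, eval_X, hα, lam, map_mul, map_pow, eval_pow, ← mul_sub,
      Finset.prod_mul_distrib, Finset.prod_const, Finset.card_univ, Fintype.card_fin]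
    rw [show MvPolynomial.eval y L ^ D = MvPolynomial.eval y L ^ (D - d i) *
      MvPolynomial.eval y L ^ (d i : ℕ) by rw [← pow_add]; congr 1; omega]
    ring
  have hscale : ∀ w, (fun i => ((q i).map (MvPolynomial.eval y)).eval
      (MvPolynomial.eval y L * w)) ∈ B ↔
      (fun i => ((p i).map (MvPolynomial.eval y)).eval w) ∈ B := by
    intro w
    refine hB.congr_coord fun i j => ?_
    simp only [hq, norm_mul]
    exact mul_le_mul_iff_right₀ (by simpa using pow_pos (norm_pos_iff.2 hL0) D)
  change (y, fun i => MvPolynomial.eval y (e i)) ∈ T' ↔ _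
  rw [he, ← hTT']
  constructor
  · rintro ⟨g, hg1, w, hw⟩
    refine ⟨(MvPolynomial.eval y L)⁻¹ * w, (hscale _).1 ?_⟩
    rw [mul_inv_cancel_left₀ hL0]
    convert hw using 2 with i
    rw [hg1 i]
    simp [eval_prod]
  · rintro ⟨w, hw⟩
    refine ⟨1, hqy, MvPolynomial.eval y L * w, ?_⟩
    have := (hscale w).2 hw
    convert this using 2 with i
    rw [hqy i]
    simp [eval_prod]

end

end

section MvPS
variable {I A B : Type*} [CommRing A] [CommRing B]

/-- The power series with given coefficients. -/
def mvMk {A : Type*} (f : (I →₀ ℕ) → A) : MvPowerSeries I A := f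

@[simp] lemma coeff_mvMk {A : Type*} [Semiring A] (f : (I →₀ ℕ) → A) (e : I →₀ ℕ) :
    MvPowerSeries.coeff e (mvMk f) = f e := rfl

/-- Every power series is its constant coefficient plus multiples of the variables. -/
lemma mvPowerSeries_decomp [Finite I] (F : MvPowerSeries I A) :
    ∃ G : I → MvPowerSeries I A,
      F = MvPowerSeries.C (MvPowerSeries.constantCoeff F) +
        ∑ᶠ t, MvPowerSeries.X t * G t ∧
      ∀ t e, MvPowerSeries.coeff e (G t) = MvPowerSeries.coeff (e + Finsupp.single t 1) F ∨
        MvPowerSeries.coeff e (G t) = 0 := by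
  classical
  have := Fintype.ofFinite I
  have hp : ∀ e : I →₀ ℕ, e ≠ 0 → ∃ t, e t ≠ 0 := fun e he => by
    by_contra! h
    exact he (Finsupp.ext h)
  rcases isEmpty_or_nonempty I with hI | hI
  · refine ⟨fun _ => 0, ?_, fun _ _ => Or.inr (by simp)⟩
    ext e
    have he : e = 0 := Subsingleton.elim _ _
    subst he
    simp
  choose! pick hpick using hp
  refine ⟨fun t => mvMk fun e => if pick (e + Finsupp.single t 1) = t then
    MvPowerSeries.coeff (e + Finsupp.single t 1) F else 0, ?_, fun t e => ?_⟩
  swap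
  · rw [coeff_mvMk]
    split_ifs <;> simp
  rw [finsum_eq_sum_of_fintype]
  ext e
  rw [map_add, map_sum]
  by_cases he : e = 0
  · subst he
    rw [Finset.sum_eq_zero]
    · simp
    · intro t _
      rw [MvPowerSeries.coeff_zero_X_mul]
  · rw [MvPowerSeries.coeff_C_of_ne_zero he, zero_add]
    simp only [MvPowerSeries.X, MvPowerSeries.coeff_monomial_mul, one_mul, coeff_mvMk]
    rw [Finset.sum_eq_single (pick e)]
    · have h1 : Finsupp.single (pick e) 1 ≤ e := by
        rw [Finsupp.single_le_iff]
        exact Nat.one_le_iff_ne_zero.2 (hpick e he)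
      rw [if_pos h1, tsub_add_cancel_of_le h1, if_pos rfl]
    · intro t _ ht
      split_ifs with h h2
      · rw [tsub_add_cancel_of_le h] at h2
        exact absurd h2.symm ht
      · rfl
      · rfl
    · simp

/-- Two additive maps on power series agreeing on constants and multiplying
variables to the same small elements agree. -/
lemma mvPowerSeries_addHom_ext [Finite I] {ξ : I → B} {c : B} (hξ : ∀ t, c ∣ ξ t)
    (hB : ∀ b : B, (∀ n : ℕ, c ^ n ∣ b) → b = 0)
    (L L' : MvPowerSeries I A →+ B)
    (hX : ∀ t F, L (MvPowerSeries.X t * F) = ξ t * L F)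
    (hX' : ∀ t F, L' (MvPowerSeries.X t * F) = ξ t * L' F)
    (hC : ∀ a, L (MvPowerSeries.C a) = L' (MvPowerSeries.C a)) : L = L' := by
  have := Fintype.ofFinite I
  have key : ∀ n : ℕ, ∀ F, c ^ n ∣ L F - L' F := by
    intro n
    induction n with
    | zero => simp
    | succ n ih =>
      intro F
      obtain ⟨G, hG, -⟩ := mvPowerSeries_decomp F
      rw [hG, finsum_eq_sum_of_fintype, map_add, map_add, hC, map_sum, map_sum,
        add_sub_add_left_eq_sub, ← Finset.sum_sub_distrib]
      refine Finset.dvd_sum fun t _ => ?_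
      rw [hX, hX', ← mul_sub, pow_succ']
      exact mul_dvd_mul (hξ t) (ih _)
  ext F
  exact sub_eq_zero.1 (hB _ fun n => key n F)

end MvPS

section Top
variable {I A B : Type*} [Finite I] [CommRing A] [CommRing B] [UniformSpace B]
  [IsTopologicalRing B] [IsUniformAddGroup B] [CompleteSpace B] [T2Space B] [IsLinearTopology B B]

lemma exists_eval_powerSeries (g : A →+* B) (ξ : I → B)
    (hξ : ∀ t, IsTopologicallyNilpotent (ξ t)) :
    ∃ L : MvPowerSeries I A →+* B, (∀ a, L (MvPowerSeries.C a) = g a) ∧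
      ∀ t, L (MvPowerSeries.X t) = ξ t := by
  let : UniformSpace A := ⊥
  have : DiscreteUniformity A := ⟨rfl⟩
  have : DiscreteTopology A := inferInstance
  have : IsTopologicalRing A := inferInstance
  have : IsUniformAddGroup A := inferInstance
  have hg : Continuous g := continuous_of_discreteTopology
  have he : MvPowerSeries.HasEval ξ := ⟨hξ, by simp [Filter.cofinite_eq_bot]⟩
  refine ⟨MvPowerSeries.eval₂Hom hg he, fun a => ?_, fun t => ?_⟩
  · rw [MvPowerSeries.coe_eval₂Hom, MvPowerSeries.eval₂_C]
  · rw [MvPowerSeries.coe_eval₂Hom, MvPowerSeries.eval₂_X]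

end Top

section RoFacts

instance (priority := 2000) Ro.instCommSemiring {K : Type} [NormedField K] [CompleteSpace K]
    [IsAlgClosed K] [IsUltrametricDist K] : CommSemiring (Ro K) := CommRing.toCommSemiring

variable {K : Type} [NormedField K] [CompleteSpace K] [IsAlgClosed K] [IsUltrametricDist K]

lemma Ro.norm_le (a : Ro K) : ‖(a : K)‖ ≤ 1 := a.2

lemma Ro.dvd_iff {a b : Ro K} : a ∣ b ↔ ‖(b : K)‖ ≤ ‖(a : K)‖ := by
  constructor
  · rintro ⟨c, rfl⟩
    simp only [Subring.coe_mul, norm_mul]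
    exact mul_le_of_le_one_right (norm_nonneg _) c.2
  · intro h
    by_cases ha : (a : K) = 0
    · rw [ha, norm_zero, norm_le_zero_iff] at h
      exact ⟨0, Subtype.ext (by simp [h])⟩
    · refine ⟨⟨(b : K) / a, ?_⟩, Subtype.ext ?_⟩
      · change ‖(b : K) / a‖ ≤ 1
        rw [norm_div]
        exact div_le_one_of_le₀ h (norm_nonneg _)
      · simp only [Subring.coe_mul]
        field_simp

lemma Ro.pow_dvd_eq_zero {c : Ro K} (hc : ‖(c : K)‖ < 1) {b : Ro K} (h : ∀ n : ℕ, c ^ n ∣ b) :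
    b = 0 := by
  have h1 : ∀ n : ℕ, ‖(b : K)‖ ≤ ‖(c : K)‖ ^ n := fun n => by
    have := Ro.dvd_iff.1 (h n)
    simpa using this
  have h2 := ge_of_tendsto' (tendsto_pow_atTop_nhds_zero_of_lt_one (norm_nonneg _) hc) h1
  exact Subtype.ext (by simpa using h2)

lemma Ro.exists_pow_dvd {c d : Ro K} (hd : ‖(d : K)‖ < 1) (hc : c ≠ 0) : ∃ n : ℕ, c ∣ d ^ n := by
  have : 0 < ‖(c : K)‖ := norm_pos_iff.2 fun h => hc (Subtype.ext h)
  obtain ⟨n, hn⟩ := exists_pow_lt_of_lt_one this hd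
  exact ⟨n, Ro.dvd_iff.2 (by simpa using hn.le)⟩

instance Ro.instComplete : CompleteSpace (Ro K) := by
  have : IsClosed ((Ro K : Subring K) : Set K) := isClosed_le continuous_norm continuous_const
  exact this.completeSpace_coe

lemma Ro.hasBasis : (nhds (0 : Ro K)).HasBasis (fun ε : ℝ => 0 < ε)
    (fun ε => {x : Ro K | ‖(x : K)‖ < ε}) := by
  have := Metric.nhds_basis_ball (x := (0 : Ro K))
  convert this using 2
  ext x
  simp [Metric.mem_ball, dist_zero_right]

instance Ro.instLinear : IsLinearTopology (Ro K) (Ro K) := by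
  refine IsLinearTopology.mk_of_hasBasis (R := Ro K) (M := Ro K) (ι := ℝ) (S := Submodule (Ro K) (Ro K))
    (p := fun ε => 0 < ε)
    (s := fun ε => if h : 0 < ε then
      { carrier := {x : Ro K | ‖(x : K)‖ < ε}
        zero_mem' := by simpa using h
        add_mem' := fun {a b} ha hb =>
          lt_of_le_of_lt (IsUltrametricDist.norm_add_le_max (a : K) (b : K)) (max_lt ha hb)
        smul_mem' := fun c x hx => by
          have h1 : ‖(c : K)‖ ≤ 1 := c.2
          have : ‖(c : K) * (x : K)‖ ≤ 1 * ‖(x : K)‖ := le_trans (norm_mul_le _ _) (by gcongr)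
          simpa using lt_of_le_of_lt (by simpa using this) hx } else ⊤) ?_
  refine Ro.hasBasis.congr (fun _ => Iff.rfl) ?_
  intro ε hε
  rw [dif_pos hε]
  rfl

lemma Ro.topNilp {c : Ro K} (hc : ‖(c : K)‖ < 1) : IsTopologicallyNilpotent c := by
  rw [IsTopologicallyNilpotent, Ro.hasBasis.tendsto_right_iff]
  intro ε hε
  obtain ⟨n, hn⟩ := exists_pow_lt_of_lt_one hε hc
  filter_upwards [Filter.eventually_ge_atTop n] with m hm
  simp only [Subring.coe_pow, norm_pow]
  exact lt_of_le_of_lt (pow_le_pow_of_le_one (norm_nonneg _) hc.le hm) hn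

variable (K) in
/-- Power series in `N` variables over the valuation ring. -/
abbrev Pow (N : ℕ) := MvPowerSeries (Fin N) (Ro K)

lemma Pow.pow_dvd_eq_zero {N : ℕ} {c : Ro K} (hc : ‖(c : K)‖ < 1) {b : Pow K N}
    (h : ∀ n : ℕ, (MvPowerSeries.C c) ^ n ∣ b) : b = 0 := by
  ext1 ν
  refine Ro.pow_dvd_eq_zero hc fun n => ?_
  obtain ⟨g, hg⟩ := h n
  rw [hg, ← map_pow, MvPowerSeries.coeff_C_mul]
  exact dvd_mul_right _ _

lemma exists_max_dvd {I : Type*} [Finite I] (π : Ro K) (hπ : ‖(π : K)‖ < 1) (ξ : I → Ro K)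
    (hξ : ∀ t, ‖(ξ t : K)‖ < 1) : ∃ c : Ro K, ‖(c : K)‖ < 1 ∧ c ∣ π ∧ ∀ t, c ∣ ξ t := by
  classical
  have := Fintype.ofFinite I
  let ξ' : Option I → Ro K := fun o => o.elim π ξ
  obtain ⟨t, -, ht⟩ := Finset.exists_max_image Finset.univ (fun t => ‖(ξ' t : K)‖)
    ⟨none, Finset.mem_univ _⟩
  refine ⟨ξ' t, ?_, Ro.dvd_iff.2 (ht none (Finset.mem_univ _)),
    fun s => Ro.dvd_iff.2 (ht (some s) (Finset.mem_univ _))⟩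
  cases t with
  | none => exact hπ
  | some t => exact hξ t

lemma exists_evO {I A : Type*} [Finite I] [CommRing A] (g : A →+* Ro K) (ξ : I → Ro K)
    (hξ : ∀ t, ‖(ξ t : K)‖ < 1) :
    ∃ L : MvPowerSeries I A →+* Ro K, (∀ a, L (MvPowerSeries.C a) = g a) ∧
      ∀ t, L (MvPowerSeries.X t) = ξ t :=
  exists_eval_powerSeries g ξ fun t => Ro.topNilp (hξ t)

open scoped MvPowerSeries.WithPiTopology in
lemma exists_evPow {N : ℕ} {I A : Type*} [Finite I] [CommRing A] (g : A →+* Pow K N) (ξ : I → Ro K)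
    (hξ : ∀ t, ‖(ξ t : K)‖ < 1) :
    ∃ L : MvPowerSeries I A →+* Pow K N, (∀ a, L (MvPowerSeries.C a) = g a) ∧
      ∀ t, L (MvPowerSeries.X t) = MvPowerSeries.C (ξ t) := by
  have : CompleteSpace (Pow K N) := inferInstanceAs (CompleteSpace ((Fin N →₀ ℕ) → Ro K))
  have : T2Space (Pow K N) := inferInstanceAs (T2Space ((Fin N →₀ ℕ) → Ro K))
  have : IsUniformAddGroup (Pow K N) := MvPowerSeries.WithPiTopology.instIsUniformAddGroup
  have : IsLinearTopology (Ro K)ᵐᵒᵖ (Ro K) := inferInstance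
  have : IsLinearTopology (Pow K N) (Pow K N) := inferInstance
  refine exists_eval_powerSeries g (fun t => MvPowerSeries.C (ξ t)) fun t => ?_
  exact (Ro.topNilp (hξ t)).map MvPowerSeries.WithPiTopology.continuous_C

end RoFacts

variable {K : Type} [NormedField K] [CompleteSpace K] [IsAlgClosed K] [IsUltrametricDist K]

lemma Ro.norm_mul (a b : Ro K) : ‖((a * b : Ro K) : K)‖ = ‖(a : K)‖ * ‖(b : K)‖ := by simp

lemma Ro.exists_inv {b : Ro K} (hb : ‖(b : K)‖ = 1) : ∃ c : Ro K, ‖(c : K)‖ = 1 ∧ b * c = 1 := by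
  obtain ⟨c, hc⟩ : b ∣ 1 := Ro.dvd_iff.2 (by simp [hb])
  refine ⟨c, ?_, hc.symm⟩
  have := Ro.norm_mul b c
  rw [← hc, hb] at this
  simpa using this.symm

/-- The subring generated by `s`, localized at the elements of norm one. -/
def Loc (s : Finset (Ro K)) : Subring (Ro K) where
  carrier := {x | ∃ a ∈ Algebra.adjoin ℤ (s : Set (Ro K)), ∃ b ∈ Algebra.adjoin ℤ (s : Set (Ro K)),
    ‖(b : K)‖ = 1 ∧ x * b = a}
  zero_mem' := ⟨0, zero_mem _, 1, one_mem _, by simp, by simp⟩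
  one_mem' := ⟨1, one_mem _, 1, one_mem _, by simp, by simp⟩
  add_mem' := by
    rintro x x' ⟨a, ha, b, hb, h1, rfl⟩ ⟨a', ha', b', hb', h1', rfl⟩
    refine ⟨(x * b) * b' + (x' * b') * b, add_mem (mul_mem ha hb') (mul_mem ha' hb), b * b',
      mul_mem hb hb', by simp [h1, h1'], by ring⟩
  neg_mem' := by
    rintro x ⟨a, ha, b, hb, h1, rfl⟩
    exact ⟨_, neg_mem ha, b, hb, h1, by ring⟩
  mul_mem' := by
    rintro x x' ⟨a, ha, b, hb, h1, rfl⟩ ⟨a', ha', b', hb', h1', rfl⟩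
    refine ⟨_, mul_mem ha ha', b * b', mul_mem hb hb', by simp [h1, h1'], by ring⟩

lemma Loc.subset {s : Finset (Ro K)} {x : Ro K} (hx : x ∈ s) : x ∈ Loc s :=
  ⟨x, Algebra.subset_adjoin hx, 1, one_mem _, by simp, by simp⟩

lemma Loc.mono {s t : Finset (Ro K)} (h : s ⊆ t) : Loc s ≤ Loc t := by
  rintro x ⟨a, ha, b, hb, h1⟩
  have := Algebra.adjoin_mono (R := ℤ) (A := Ro K) (Finset.coe_subset.2 h)
  exact ⟨a, this ha, b, this hb, h1⟩

lemma Loc.exists_inv {s : Finset (Ro K)} {x : Ro K} (hx : x ∈ Loc s) (h : ‖(x : K)‖ = 1) :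
    ∃ y ∈ Loc s, x * y = 1 := by
  obtain ⟨a, ha, b, hb, h1, rfl⟩ := hx
  obtain ⟨y, hy, hxy⟩ := Ro.exists_inv h
  refine ⟨y, ⟨b, hb, x * b, ha, by simp [h, h1], ?_⟩, hxy⟩
  rw [← mul_assoc, mul_comm y, hxy, one_mul]

/-- Elements of norm one in the finitely generated subring. -/
def Loc.units (s : Finset (Ro K)) : Submonoid (Algebra.adjoin ℤ (s : Set (Ro K))) where
  carrier := {b | ‖((b : Ro K) : K)‖ = 1}
  one_mem' := by simp
  mul_mem' := fun {a b} ha hb => by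
    simp only [Set.mem_ofPred_eq] at ha hb ⊢
    simp [ha, hb]

lemma Loc.adjoin_le (s : Finset (Ro K)) {x : Ro K} (hx : x ∈ Algebra.adjoin ℤ (s : Set (Ro K))) :
    x ∈ Loc s := ⟨x, hx, 1, one_mem _, by simp, by simp⟩

instance Loc.isNoetherianRing (s : Finset (Ro K)) : IsNoetherianRing (Loc s) := by
  let S := Algebra.adjoin ℤ (s : Set (Ro K))
  let f : S →+* Loc s :=
    { toFun := fun x => ⟨x, Loc.adjoin_le s x.2⟩
      map_one' := rfl
      map_mul' := fun _ _ => rfl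
      map_zero' := rfl
      map_add' := fun _ _ => rfl }
  let : Algebra S (Loc s) := f.toAlgebra
  have hf : ∀ x : S, ((algebraMap S (Loc s) x : Loc s) : Ro K) = x := fun x => rfl
  have : IsNoetherianRing S := by
    have : Algebra.FiniteType ℤ S :=
      (Subalgebra.fg_iff_finiteType _).1 ⟨s, rfl⟩
    exact Algebra.FiniteType.isNoetherianRing ℤ S
  have : IsLocalization (Loc.units s) (Loc s) := by
    refine (isLocalization_iff _ _).2 ⟨?_, ?_, ?_⟩
    · rintro ⟨b, hb⟩
      obtain ⟨y, hy, h⟩ := Loc.exists_inv (Loc.adjoin_le s b.2) hb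
      exact IsUnit.of_mul_eq_one ⟨y, hy⟩ (Subtype.ext h)
    · rintro ⟨x, a, ha, b, hb, h1, h⟩
      exact ⟨(⟨a, ha⟩, ⟨⟨b, hb⟩, h1⟩), Subtype.ext h⟩
    · rintro x y h
      have h1 : x = y := Subtype.ext (congrArg (fun z : Loc s => (z : Ro K)) h)
      exact ⟨1, by rw [h1]⟩
  exact IsLocalization.isNoetherianRing (Loc.units s) (Loc s) inferInstance

/-- The elements of `Loc s` of norm at most `v`. -/
def Loc.ball (s : Finset (Ro K)) {v : ℝ} (hv : 0 ≤ v) : Ideal (Loc s) where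
  carrier := {x | ‖((x : Ro K) : K)‖ ≤ v}
  zero_mem' := by simpa using hv
  add_mem' := fun {a b} ha hb =>
    le_trans (IsUltrametricDist.norm_add_le_max _ _) (max_le ha hb)
  smul_mem' := fun c x hx => by
    have h1 : ‖((c : Ro K) : K)‖ ≤ 1 := (c : Ro K).2
    simp only [smul_eq_mul, Subring.coe_mul, norm_mul, Set.mem_ofPred_eq] at hx ⊢
    exact le_trans (mul_le_of_le_one_left (norm_nonneg _) h1) hx

lemma Loc.isLocalRing (s : Finset (Ro K)) : IsLocalRing (Loc s) := by
  refine IsLocalRing.of_nonunits_add ?_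
  have key : ∀ x : Loc s, x ∈ nonunits (Loc s) ↔ ‖((x : Ro K) : K)‖ < 1 := by
    intro x
    rw [mem_nonunits_iff, ← not_iff_not, not_not, not_lt]
    constructor
    · intro h
      obtain ⟨y, hy⟩ := h.exists_right_inv
      have h2 := congrArg (fun z : Loc s => ‖((z : Ro K) : K)‖) hy
      simp only [Subring.coe_mul, norm_mul, Subring.coe_one, norm_one] at h2
      have h3 : ‖((y : Ro K) : K)‖ ≤ 1 := (y : Ro K).2
      nlinarith [norm_nonneg ((x : Ro K) : K)]
    · intro h
      obtain ⟨y, hy, h2⟩ := Loc.exists_inv x.2 (le_antisymm (x : Ro K).2 h)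
      exact IsUnit.of_mul_eq_one ⟨y, hy⟩ (Subtype.ext h2)
  intro a b ha hb
  rw [key] at *
  exact lt_of_le_of_lt (IsUltrametricDist.norm_add_le_max _ _) (max_lt ha hb)

lemma Loc.finite_norms (s : Finset (Ro K)) {v : ℝ} (hv : 0 < v) :
    {r : ℝ | v ≤ r ∧ ∃ c ∈ Loc s, ‖(c : K)‖ = r}.Finite := by
  classical
  have := Loc.isLocalRing s
  let J := Loc.ball s hv.le
  by_cases hv1 : 1 ≤ v
  · refine (Set.finite_singleton (1 : ℝ)).subset ?_
    rintro r ⟨h1, c, -, rfl⟩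
    exact le_antisymm c.2 (hv1.trans h1)
  push Not at hv1
  have hJ : J ≠ ⊤ := by
    intro h
    have h1 : (1 : Loc s) ∈ J := h ▸ Submodule.mem_top
    have h2 : ‖(((1 : Loc s) : Ro K) : K)‖ ≤ v := h1
    simp at h2
    linarith
  have : Nontrivial (Loc s ⧸ J) := Ideal.Quotient.nontrivial_iff.2 hJ
  have : IsLocalRing (Loc s ⧸ J) := IsLocalRing.of_surjective' _ Ideal.Quotient.mk_surjective
  have hmem : ∀ x : Loc s, ‖((x : Ro K) : K)‖ < 1 → ∃ n : ℕ, x ^ n ∈ J := by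
    intro x hx
    obtain ⟨n, hn⟩ := exists_pow_lt_of_lt_one hv hx
    exact ⟨n, by change ‖_‖ ≤ v; simpa using hn.le⟩
  have hnil : IsNilpotent (IsLocalRing.maximalIdeal (Loc s ⧸ J)) := by
    rw [Ideal.FG.isNilpotent_iff_le_nilradical (IsNoetherian.noetherian _)]
    intro x hx
    obtain ⟨x, rfl⟩ := Ideal.Quotient.mk_surjective x
    have hx1 : ‖((x : Ro K) : K)‖ < 1 := by
      by_contra h
      obtain ⟨y, hy, h2⟩ := Loc.exists_inv x.2 (le_antisymm (x : Ro K).2 (not_lt.1 h))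
      refine (IsLocalRing.mem_maximalIdeal _).1 hx (IsUnit.map _ ?_)
      exact IsUnit.of_mul_eq_one ⟨y, hy⟩ (Subtype.ext h2)
    obtain ⟨n, hn⟩ := hmem x hx1
    rw [mem_nilradical]
    exact ⟨n, by rw [← map_pow, Ideal.Quotient.eq_zero_iff_mem]; exact hn⟩
  have : IsArtinianRing (Loc s ⧸ J) :=
    (isArtinianRing_iff_isNilpotent_maximalIdeal _).2 hnil
  let V := {r : ℝ | v ≤ r ∧ ∃ c ∈ Loc s, ‖(c : K)‖ = r}
  let f : V → Ideal (Loc s ⧸ J) := fun r =>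
    (Loc.ball s (hv.le.trans r.2.1)).map (Ideal.Quotient.mk J)
  have hf : StrictMono f := by
    intro r r' hr
    refine lt_of_le_of_ne (Ideal.map_mono fun x hx => le_trans hx (Subtype.coe_le_coe.2 hr.le)) ?_
    intro h
    obtain ⟨c, hc, hcr⟩ := r'.2.2
    have h1 : (Ideal.Quotient.mk J) ⟨c, hc⟩ ∈ f r' := Ideal.mem_map_of_mem _ (by
      change ‖(c : K)‖ ≤ _; exact hcr.le)
    rw [← h] at h1
    obtain ⟨y, hy, hyc⟩ := (Ideal.mem_map_iff_of_surjective _ Ideal.Quotient.mk_surjective).1 h1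
    rw [Ideal.Quotient.eq] at hyc
    have h2 : ‖((y : Ro K) : K)‖ ≤ r := hy
    have h3 : ‖((y : Ro K) : K) - c‖ ≤ v := hyc
    have h4 : ‖(c : K)‖ ≤ r := by
      have : (c : K) = (y : Ro K) - (((y : Ro K) : K) - c) := by ring
      rw [this, sub_eq_add_neg]
      exact (IsUltrametricDist.norm_add_le_max _ _).trans (max_le h2 (by rw [norm_neg]; exact h3.trans r.2.1))
    rw [hcr] at h4
    exact absurd hr (not_lt.2 h4)
  have : WellFoundedLT V := hf.wellFoundedLT
  have : WellFoundedGT V := hf.wellFoundedGT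
  exact Set.finite_coe_iff.1 (Finite.of_wellFoundedLT_wellFoundedGT V)

section Coef
variable {I J A B : Type*} [CommRing A] [CommRing B]

/-- The polynomial with prescribed finitely supported coefficients. -/
lemma exists_mvPolynomial_coeff (f : (J →₀ ℕ) → A) (hf : {d | f d ≠ 0}.Finite) :
    ∃ p : MvPolynomial J A, ∀ d, p.coeff d = f d := by
  classical
  refine ⟨∑ d ∈ hf.toFinset, MvPolynomial.monomial d (f d), fun d => ?_⟩
  simp only [MvPolynomial.coeff_sum, MvPolynomial.coeff_monomial]
  rw [Finset.sum_ite_eq']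
  split_ifs with h
  · rfl
  · by_contra h2
    exact h (by simpa using Ne.symm h2)

lemma exists_mp (p : A → B) (h0 : p 0 = 0) (q : MvPolynomial J A) :
    ∃ q' : MvPolynomial J B, ∀ d, q'.coeff d = p (q.coeff d) := by
  refine exists_mvPolynomial_coeff _ (q.support.finite_toSet.subset fun d hd => ?_)
  simp only [Set.mem_ofPred_eq] at hd
  simp only [Finset.mem_coe, MvPolynomial.mem_support_iff]
  intro h
  exact hd (by rw [h, h0])

/-- Apply a function fixing zero to all coefficients of a polynomial. -/
def mp (p : A → B) (h0 : p 0 = 0) (q : MvPolynomial J A) : MvPolynomial J B :=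
  (exists_mp p h0 q).choose

@[simp] lemma coeff_mp (p : A → B) (h0 : p 0 = 0) (q : MvPolynomial J A) (d : J →₀ ℕ) :
    (mp p h0 q).coeff d = p (q.coeff d) := (exists_mp p h0 q).choose_spec d

@[simp] lemma mp_zero (p : A → B) (h0 : p 0 = 0) : mp (J := J) p h0 0 = 0 := by
  ext d; simp [h0]

/-- Polynomials with coefficients in a subring. -/
def polyIn (J : Type*) (P : Subring A) : Subring (MvPolynomial J A) where
  carrier := {p | ∀ d, p.coeff d ∈ P}
  zero_mem' := by simp
  one_mem' := by
    classical
    intro d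
    rw [MvPolynomial.coeff_one]
    split_ifs
    exacts [P.one_mem, P.zero_mem]
  add_mem' := fun {a b} ha hb d => by
    rw [MvPolynomial.coeff_add]
    exact P.add_mem (ha d) (hb d)
  neg_mem' := fun {a} ha d => by
    rw [MvPolynomial.coeff_neg]
    exact P.neg_mem (ha d)
  mul_mem' := fun {a b} ha hb d => by
    classical
    rw [MvPolynomial.coeff_mul]
    exact P.sum_mem fun x _ => P.mul_mem (ha _) (hb _)

lemma polyIn_mono {P Q : Subring A} (h : P ≤ Q) : polyIn J P ≤ polyIn J Q := fun _ hp d => h (hp d)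

lemma C_mem_polyIn {P : Subring A} {a : A} (h : a ∈ P) : (MvPolynomial.C a) ∈ polyIn J P := by
  classical
  intro d
  rw [MvPolynomial.coeff_C]
  split_ifs
  exacts [h, P.zero_mem]

lemma X_mem_polyIn {P : Subring A} (j : J) : (MvPolynomial.X j) ∈ polyIn J P := by
  classical
  intro d
  rw [MvPolynomial.coeff_X']
  split_ifs
  exacts [P.one_mem, P.zero_mem]

lemma monomial_mem_polyIn {P : Subring A} {a : A} (h : a ∈ P) (e : J →₀ ℕ) :
    (MvPolynomial.monomial e a) ∈ polyIn J P := by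
  classical
  intro d
  rw [MvPolynomial.coeff_monomial]
  split_ifs
  exacts [h, P.zero_mem]

/-- The coefficient of `u^ν`, applied to all coefficients of a power series. -/
def cfu (ν : J →₀ ℕ) : MvPowerSeries I (MvPolynomial J A) →+ MvPowerSeries I A where
  toFun F := mvMk fun e => (MvPowerSeries.coeff e F).coeff ν
  map_zero' := by ext; simp
  map_add' F G := by ext; simp

@[simp] lemma coeff_cfu (ν : J →₀ ℕ) (F : MvPowerSeries I (MvPolynomial J A)) (e : I →₀ ℕ) :
    MvPowerSeries.coeff e (cfu ν F) = (MvPowerSeries.coeff e F).coeff ν := rfl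

/-- The inclusion of power series into power series with polynomial coefficients. -/
abbrev incl (I J A : Type*) [CommRing A] :
    MvPowerSeries I A →+* MvPowerSeries I (MvPolynomial J A) :=
  MvPowerSeries.map (MvPolynomial.C)

lemma cfu_mul_incl (ν : J →₀ ℕ) (F : MvPowerSeries I (MvPolynomial J A)) (f : MvPowerSeries I A) :
    cfu ν (F * incl I J A f) = cfu ν F * f := by
  classical
  ext e
  simp only [coeff_cfu, MvPowerSeries.coeff_mul, MvPolynomial.coeff_sum, MvPowerSeries.coeff_map]
  refine Finset.sum_congr rfl fun x _ => ?_
  rw [mul_comm, MvPolynomial.coeff_C_mul, mul_comm]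

lemma cfu_ext {F G : MvPowerSeries I (MvPolynomial J A)} (h : ∀ ν, cfu ν F = cfu ν G) : F = G := by
  ext e ν
  simpa using congrArg (MvPowerSeries.coeff e) (h ν)

/-- The ideal generated by the variables. -/
def varIdeal (I A : Type*) [CommRing A] : Ideal (MvPowerSeries I A) :=
  Ideal.span (Set.range MvPowerSeries.X)

lemma mem_varIdeal_pow [Finite I] (n : ℕ) : ∀ (F : MvPowerSeries I A),
    (∀ e : I →₀ ℕ, e.degree < n → MvPowerSeries.coeff e F = 0) → F ∈ varIdeal I A ^ n := by
  have := Fintype.ofFinite I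
  induction n with
  | zero => simp
  | succ n ih =>
    intro F hF
    obtain ⟨G, hG, hG2⟩ := mvPowerSeries_decomp F
    rw [hG, finsum_eq_sum_of_fintype]
    refine Ideal.add_mem _ ?_ (Ideal.sum_mem _ fun t _ => ?_)
    · rw [← MvPowerSeries.coeff_zero_eq_constantCoeff_apply, hF 0 (by simp), map_zero]
      exact Ideal.zero_mem _
    · rw [pow_succ']
      refine Ideal.mul_mem_mul (Ideal.subset_span ⟨t, rfl⟩) (ih _ fun e he => ?_)
      rcases hG2 t e with h | h
      · rw [h]
        refine hF _ ?_
        rw [map_add, Finsupp.degree_single]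
        omega
      · exact h

lemma coeff_of_mem_varIdeal_pow (n : ℕ) : ∀ F ∈ varIdeal I A ^ n,
    ∀ e : I →₀ ℕ, e.degree < n → MvPowerSeries.coeff e F = 0 := by
  classical
  induction n with
  | zero => intro F _ e he; omega
  | succ n ih =>
    intro F hF
    rw [pow_succ'] at hF
    refine Submodule.mul_induction_on hF ?_ ?_
    · intro a ha b hb e he
      have ha0 : MvPowerSeries.constantCoeff a = 0 := by
        have : varIdeal I A ≤ RingHom.ker (MvPowerSeries.constantCoeff (σ := I) (R := A)) := by
          rw [varIdeal, Ideal.span_le]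
          rintro _ ⟨t, rfl⟩
          simp [RingHom.mem_ker]
        exact this ha
      rw [MvPowerSeries.coeff_mul]
      refine Finset.sum_eq_zero fun x hx => ?_
      rw [Finset.HasAntidiagonal.mem_antidiagonal] at hx
      by_cases h0 : x.1 = 0
      · rw [h0, MvPowerSeries.coeff_zero_eq_constantCoeff_apply, ha0, zero_mul]
      · rw [ih b hb x.2, mul_zero]
        rw [← hx, map_add] at he
        have : x.1.degree ≠ 0 := by simpa [Finsupp.degree_eq_zero_iff] using h0
        omega
    · intro a b ha hb e he
      rw [map_add, ha e he, hb e he, add_zero]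

/-- A power series with polynomial coefficients all of whose coefficient series lie in an ideal
is a combination of the generators. -/
lemma exists_combination [Finite I] [IsNoetherianRing A] {ι : Type*} [Fintype ι]
    (b : ι → MvPowerSeries I A) (F : MvPowerSeries I (MvPolynomial J A))
    (hF : ∀ ν, cfu ν F ∈ Ideal.span (Set.range b)) :
    ∃ G : ι → MvPowerSeries I (MvPolynomial J A), F = ∑ i, G i * incl I J A (b i) := by
  classical
  obtain ⟨k, hk⟩ := Ideal.exists_pow_inf_eq_pow_smul (varIdeal I A) (Ideal.span (Set.range b))
  have h1 : ∀ ν, ∃ q : ι → MvPowerSeries I A, cfu ν F = ∑ i, q i * b i ∧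
      ∀ i e, MvPowerSeries.coeff e (q i) ≠ 0 →
        ∃ e' : I →₀ ℕ, e'.degree ≤ e.degree + k ∧ MvPowerSeries.coeff e' (cfu ν F) ≠ 0 := by
    intro ν
    by_cases h0 : cfu ν F = 0
    · exact ⟨fun _ => 0, by simp [h0], by simp⟩
    have hex : ∃ n, ∃ e : I →₀ ℕ, e.degree = n ∧ MvPowerSeries.coeff e (cfu ν F) ≠ 0 := by
      by_contra! h
      exact h0 (MvPowerSeries.ext fun e => by simpa using h e.degree e rfl)
    let n := Nat.find hex
    obtain ⟨e', he', hne⟩ := Nat.find_spec hex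
    have hmem : cfu ν F ∈ varIdeal I A ^ n := mem_varIdeal_pow n _ fun e he => by
      by_contra hh
      exact Nat.find_min hex he ⟨e, rfl, hh⟩
    have hsm : cfu ν F ∈ varIdeal I A ^ (n - k) • Ideal.span (Set.range b) := by
      by_cases hnk : k ≤ n
      · have h2 : cfu ν F ∈ varIdeal I A ^ n • (⊤ : Ideal (MvPowerSeries I A)) ⊓
            Ideal.span (Set.range b) := ⟨by simpa using hmem, hF ν⟩
        rw [hk n hnk] at h2
        exact Submodule.smul_mono le_rfl inf_le_right h2
      · rw [Nat.sub_eq_zero_of_le (by omega), pow_zero, Ideal.one_eq_top, Submodule.top_smul]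
        exact hF ν
    obtain ⟨a, ha, hsum⟩ := (Submodule.mem_ideal_smul_span_iff_exists_sum _ _ _).1 hsm
    refine ⟨a, ?_, fun i e hne2 => ⟨e', ?_, hne⟩⟩
    · rw [← hsum, Finsupp.sum_fintype _ _ (by simp)]
      simp
    · rw [he']
      by_contra hlt
      exact hne2 (coeff_of_mem_varIdeal_pow _ _ (ha i) e (by
        change e.degree < n - k
        change ¬ (n ≤ _) at hlt
        omega))
  choose q hq hq2 using h1
  have hfin : ∀ i (e : I →₀ ℕ), {ν | MvPowerSeries.coeff e (q ν i) ≠ 0}.Finite := by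
    intro i e
    refine (Set.Finite.biUnion (Finsupp.finite_of_degree_le (σ := I) (e.degree + k))
      (t := fun e' => ((MvPowerSeries.coeff e' F).support : Set (J →₀ ℕ)))
      fun e' _ => Finset.finite_toSet _).subset ?_
    intro ν hν
    obtain ⟨e', h1, h2⟩ := hq2 ν i e hν
    simp only [Set.mem_iUnion]
    exact ⟨e', h1, by simpa using h2⟩
  choose G hG using fun i e => exists_mvPolynomial_coeff _ (hfin i e)
  refine ⟨fun i => mvMk (G i), cfu_ext fun ν => ?_⟩
  rw [map_sum, hq ν]
  refine Finset.sum_congr rfl fun i _ => ?_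
  rw [cfu_mul_incl]
  congr 1
  ext e
  simp [hG]

end Coef

section Chain
variable {τ A : Type*} [CommRing A] {S : Type*} [DecidableEq S]

/-- Power series whose coefficients, for each exponent of the distinguished variable, lie in one
member of a directed family of subrings. -/
def chain (τ : Type*) (P : Finset S → Subring A) (hP : Monotone P) :
    Subring (MvPowerSeries (Option τ) A) where
  carrier := {F | ∀ n : ℕ, ∃ s, ∀ e : Option τ →₀ ℕ, e none ≤ n → MvPowerSeries.coeff e F ∈ P s}
  zero_mem' := fun n => ⟨∅, by simp⟩
  one_mem' := fun n => ⟨∅, fun e _ => by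
    classical
    rw [MvPowerSeries.coeff_one]
    split_ifs
    exacts [Subring.one_mem _, Subring.zero_mem _]⟩
  add_mem' := fun {F G} hF hG n => by
    obtain ⟨s, hs⟩ := hF n
    obtain ⟨t, ht⟩ := hG n
    refine ⟨s ∪ t, fun e he => ?_⟩
    rw [map_add]
    exact Subring.add_mem _ (hP Finset.subset_union_left (hs e he))
      (hP Finset.subset_union_right (ht e he))
  neg_mem' := fun {F} hF n => by
    obtain ⟨s, hs⟩ := hF n
    refine ⟨s, fun e he => ?_⟩
    rw [map_neg]
    exact Subring.neg_mem _ (hs e he)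
  mul_mem' := fun {F G} hF hG n => by
    classical
    obtain ⟨s, hs⟩ := hF n
    obtain ⟨t, ht⟩ := hG n
    refine ⟨s ∪ t, fun e he => ?_⟩
    rw [MvPowerSeries.coeff_mul]
    refine Subring.sum_mem _ fun x hx => ?_
    rw [Finset.HasAntidiagonal.mem_antidiagonal] at hx
    have hx1 : x.1 none + x.2 none = e none := by rw [← hx]; rfl
    exact Subring.mul_mem _ (hP Finset.subset_union_left (hs _ (by omega)))
      (hP Finset.subset_union_right (ht _ (by omega)))

lemma C_mem_chain {P : Finset S → Subring A} {hP : Monotone P} {a : A} (h : ∃ s, a ∈ P s) :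
    MvPowerSeries.C a ∈ chain τ P hP := fun n => by
  classical
  obtain ⟨s, hs⟩ := h
  refine ⟨s, fun e _ => ?_⟩
  rw [MvPowerSeries.coeff_C]
  split_ifs
  exacts [hs, Subring.zero_mem _]

lemma X_mem_chain {P : Finset S → Subring A} {hP : Monotone P} (t : Option τ) :
    MvPowerSeries.X t ∈ chain τ P hP := fun n => by
  classical
  refine ⟨∅, fun e _ => ?_⟩
  rw [MvPowerSeries.coeff_X]
  split_ifs
  exacts [Subring.one_mem _, Subring.zero_mem _]

lemma chain_of_levels {P : Finset S → Subring A} {hP : Monotone P} {F : MvPowerSeries (Option τ) A}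
    (h : ∀ n : ℕ, ∃ s, ∀ e : Option τ →₀ ℕ, e none = n → MvPowerSeries.coeff e F ∈ P s) :
    F ∈ chain τ P hP := by
  intro n
  choose s hs using h
  refine ⟨(Finset.range (n + 1)).biUnion s, fun e he => ?_⟩
  exact hP (Finset.subset_biUnion_of_mem s (Finset.mem_range.2 (by omega))) (hs _ e rfl)

end Chain

section Trunc
variable {τ A B : Type*} [CommRing A] [CommRing B]

/-- The part of a power series free of the distinguished variable. -/
def z0 : MvPowerSeries (Option τ) A →+ MvPowerSeries (Option τ) A where
  toFun F := mvMk fun e => if e none = 0 then MvPowerSeries.coeff e F else 0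
  map_zero' := by ext; simp
  map_add' F G := by
    ext e
    simp only [coeff_mvMk, map_add]
    split_ifs <;> simp

lemma coeff_z0 (F : MvPowerSeries (Option τ) A) (e : Option τ →₀ ℕ) :
    MvPowerSeries.coeff e (z0 F) = if e none = 0 then MvPowerSeries.coeff e F else 0 := rfl

/-- The part of a power series divisible by the distinguished variable, divided by it. -/
def sh : MvPowerSeries (Option τ) A →+ MvPowerSeries (Option τ) A where
  toFun F := mvMk fun e => MvPowerSeries.coeff (e + Finsupp.single none 1) F
  map_zero' := by ext; simp
  map_add' F G := by ext; simp

lemma coeff_sh (F : MvPowerSeries (Option τ) A) (e : Option τ →₀ ℕ) :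
    MvPowerSeries.coeff e (sh F) = MvPowerSeries.coeff (e + Finsupp.single none 1) F := rfl

lemma coeff_T_mul (F : MvPowerSeries (Option τ) A) (e : Option τ →₀ ℕ) :
    MvPowerSeries.coeff e (MvPowerSeries.X none * F) =
      if e none = 0 then 0 else MvPowerSeries.coeff (e - Finsupp.single none 1) F := by
  classical
  rw [MvPowerSeries.X_def, MvPowerSeries.coeff_monomial_mul, one_mul]
  have : Finsupp.single none 1 ≤ e ↔ ¬ e none = 0 := by
    rw [Finsupp.single_le_iff]
    omega
  by_cases h : e none = 0 <;> simp [this, h]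

lemma z0_add_T_mul_sh (F : MvPowerSeries (Option τ) A) :
    z0 F + MvPowerSeries.X none * sh F = F := by
  ext e
  rw [map_add, coeff_z0, coeff_T_mul, coeff_sh]
  split_ifs with h
  · simp
  · rw [zero_add, tsub_add_cancel_of_le]
    rw [Finsupp.single_le_iff]
    omega

lemma z0_mul (F G : MvPowerSeries (Option τ) A) : z0 (F * G) = z0 F * z0 G := by
  classical
  ext e
  rw [coeff_z0, MvPowerSeries.coeff_mul, MvPowerSeries.coeff_mul]
  split_ifs with h
  · refine Finset.sum_congr rfl fun x hx => ?_
    rw [Finset.HasAntidiagonal.mem_antidiagonal] at hx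
    have hx1 : x.1 none + x.2 none = e none := by rw [← hx]; rfl
    rw [coeff_z0, coeff_z0, if_pos (by omega), if_pos (by omega)]
  · symm
    refine Finset.sum_eq_zero fun x hx => ?_
    rw [Finset.HasAntidiagonal.mem_antidiagonal] at hx
    have hx1 : x.1 none + x.2 none = e none := by rw [← hx]; rfl
    rw [coeff_z0, coeff_z0]
    split_ifs
    · omega
    all_goals simp

lemma z0_T_mul (F : MvPowerSeries (Option τ) A) : z0 (MvPowerSeries.X none * F) = 0 := by
  ext e
  rw [coeff_z0, coeff_T_mul]
  split_ifs <;> simp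

lemma z0_z0 (F : MvPowerSeries (Option τ) A) : z0 (z0 F) = z0 F := by
  ext e
  rw [coeff_z0, coeff_z0]
  split_ifs <;> simp

lemma z0_map (f : A →+* B) (F : MvPowerSeries (Option τ) A) :
    z0 (MvPowerSeries.map f F) = MvPowerSeries.map f (z0 F) := by
  ext e
  rw [coeff_z0, MvPowerSeries.coeff_map, MvPowerSeries.coeff_map, coeff_z0]
  split_ifs <;> simp

/-- The series `∑ T ^ k * g (n + k)` of `T`-free series. -/
def stack (g : ℕ → MvPowerSeries (Option τ) A) (n : ℕ) : MvPowerSeries (Option τ) A :=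
  mvMk fun e => MvPowerSeries.coeff (e.erase none) (g (n + e none))

lemma coeff_stack (g : ℕ → MvPowerSeries (Option τ) A) (n : ℕ) (e : Option τ →₀ ℕ) :
    MvPowerSeries.coeff e (stack g n) = MvPowerSeries.coeff (e.erase none) (g (n + e none)) := rfl

lemma stack_eq (g : ℕ → MvPowerSeries (Option τ) A) (hg : ∀ n, z0 (g n) = g n) (n : ℕ) :
    stack g n = g n + MvPowerSeries.X none * stack g (n + 1) := by
  classical
  ext e
  rw [map_add, coeff_T_mul, ← hg n, coeff_z0]
  split_ifs with h
  · rw [coeff_stack, h, Finsupp.erase_of_notMem_support (by simpa using h), add_zero, add_zero]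
  · rw [coeff_stack, coeff_stack, zero_add]
    have h1 : (e - Finsupp.single none 1 : Option τ →₀ ℕ) none = e none - 1 := by simp
    have h2 : (e - Finsupp.single none 1 : Option τ →₀ ℕ).erase none = e.erase none := by
      ext t
      cases t <;> simp [Finsupp.erase]
    rw [h1, h2]
    congr 2
    omega

/-- Divisibility by all powers of the distinguished variable. -/
lemma eq_zero_of_T_mul (D : ℕ → MvPowerSeries (Option τ) A)
    (h : ∀ n, D n = MvPowerSeries.X none * D (n + 1)) : D 0 = 0 := by
  have : ∀ k n (e : Option τ →₀ ℕ), e none = k → MvPowerSeries.coeff e (D n) = 0 := by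
    intro k
    induction k with
    | zero => intro n e he; rw [h, coeff_T_mul, if_pos he]
    | succ k ih =>
      intro n e he
      rw [h, coeff_T_mul, if_neg (by omega)]
      exact ih _ _ (by simp [he])
  ext e
  simpa using this _ 0 e rfl

end Trunc

section Lin
variable {J I A : Type*} [CommRing A]

lemma mp_add {p : A → A} (h0 : p 0 = 0) (hadd : ∀ a b, p (a + b) = p a + p b)
    (F G : MvPolynomial J A) : mp p h0 (F + G) = mp p h0 F + mp p h0 G := by
  ext d; simp [hadd]

lemma map_finset_sum {A B ι : Type*} [AddCommMonoid A] [AddCommMonoid B] {p : A → B}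
    (h0 : p 0 = 0) (hadd : ∀ a b, p (a + b) = p a + p b) (s : Finset ι) (f : ι → A) :
    p (∑ i ∈ s, f i) = ∑ i ∈ s, p (f i) :=
  map_sum (⟨⟨p, h0⟩, hadd⟩ : A →+ B) f s

lemma mp_mul {p : A → A} (h0 : p 0 = 0) (hadd : ∀ a b, p (a + b) = p a + p b) {S : Subring A}
    (hS : ∀ a, ∀ s ∈ S, p (a * s) = p a * s) (F : MvPolynomial J A) {G : MvPolynomial J A}
    (hG : G ∈ polyIn J S) : mp p h0 (F * G) = mp p h0 F * G := by
  classical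
  ext d
  rw [coeff_mp, MvPolynomial.coeff_mul, MvPolynomial.coeff_mul, map_finset_sum h0 hadd]
  refine Finset.sum_congr rfl fun x _ => ?_
  rw [hS _ _ (hG _), coeff_mp]

/-- Apply a function to all coefficients of a power series. -/
def pcw {A B : Type*} (p : A → B) (F : MvPowerSeries I A) : MvPowerSeries I B :=
  fun e => p (F e)

@[simp] lemma coeff_pcw {A B : Type*} [CommRing A] [CommRing B] (p : A → B)
    (F : MvPowerSeries I A) (e : I →₀ ℕ) :
    MvPowerSeries.coeff e (pcw p F) = p (MvPowerSeries.coeff e F) := rfl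

lemma pcw_mul {p : A → A} (h0 : p 0 = 0) (hadd : ∀ a b, p (a + b) = p a + p b) {S : Subring A}
    (hS : ∀ a, ∀ s ∈ S, p (a * s) = p a * s) (F : MvPowerSeries I A) {G : MvPowerSeries I A}
    (hG : ∀ e, MvPowerSeries.coeff e G ∈ S) : pcw p (F * G) = pcw p F * G := by
  classical
  ext d
  rw [coeff_pcw, MvPowerSeries.coeff_mul, MvPowerSeries.coeff_mul, map_finset_sum h0 hadd]
  refine Finset.sum_congr rfl fun x _ => ?_
  rw [hS _ _ (hG _), coeff_pcw]

lemma pcw_sum {p : A → A} (h0 : p 0 = 0) (hadd : ∀ a b, p (a + b) = p a + p b) {ι : Type*}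
    (s : Finset ι) (F : ι → MvPowerSeries I A) :
    pcw p (∑ i ∈ s, F i) = ∑ i ∈ s, pcw p (F i) := by
  ext e
  rw [coeff_pcw, map_sum, map_finset_sum h0 hadd, map_sum]
  rfl

end Lin

section Div

open Classical in
/-- Exact division in the valuation ring, and zero where it is impossible. -/
def dv (c a : Ro K) : Ro K := if h : c ∣ a then h.choose else 0

lemma mul_dv {c a : Ro K} (h : ‖(a : K)‖ ≤ ‖(c : K)‖) : c * dv c a = a := by
  have h' := Ro.dvd_iff.2 h
  rw [dv, dif_pos h']
  exact h'.choose_spec.symm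

lemma dv_zero {c : Ro K} (hc : c ≠ 0) : dv c 0 = 0 := by
  have := mul_dv (c := c) (a := 0) (by simp)
  exact (mul_eq_zero.1 this).resolve_left hc

/-- Quotients by a fixed element stay in one finitely generated localisation. -/
lemma Loc.exists_div (s : Finset (Ro K)) {c : Ro K} (hc : c ≠ 0) : ∃ s', s ⊆ s' ∧
    ∀ a ∈ Loc s, ‖(a : K)‖ ≤ ‖(c : K)‖ → dv c a ∈ Loc s' := by
  classical
  obtain ⟨n, g, hg⟩ := Submodule.fg_iff_exists_fin_generating_family.1
    ((isNoetherianRing_iff_ideal_fg _).1 (Loc.isNoetherianRing s)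
      (Loc.ball s (norm_nonneg (c : K))))
  have hgm : ∀ i, ‖((g i : Ro K) : K)‖ ≤ ‖(c : K)‖ := fun i => by
    have : g i ∈ Loc.ball s (norm_nonneg (c : K)) := hg ▸ Submodule.subset_span ⟨i, rfl⟩
    exact this
  refine ⟨s ∪ Finset.univ.image fun i => dv c (g i), Finset.subset_union_left, fun a ha hac => ?_⟩
  have hmem : (⟨a, ha⟩ : Loc s) ∈ Submodule.span (Loc s) (Set.range g) := by
    rw [hg]; exact hac
  obtain ⟨q, hq⟩ := (Submodule.mem_span_range_iff_exists_fun _).1 hmem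
  have hq' : a = ∑ i, (q i : Ro K) * (g i : Ro K) := by
    have := congrArg (Subtype.val) hq
    simpa using this.symm
  have h2 : c * dv c a = c * ∑ i, (q i : Ro K) * dv c (g i) := by
    rw [mul_dv hac, Finset.mul_sum, hq']
    refine Finset.sum_congr rfl fun i _ => ?_
    rw [mul_left_comm, mul_dv (hgm i)]
  rw [mul_left_cancel₀ hc h2]
  refine Subring.sum_mem _ fun i _ => Subring.mul_mem _ (Loc.mono Finset.subset_union_left (q i).2)
    (Loc.subset (Finset.mem_union_right _ (Finset.mem_image_of_mem _ (Finset.mem_univ i))))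

end Div

lemma RoMax.mem_iff {a : Ro K} : a ∈ RoMax K ↔ ‖(a : K)‖ < 1 := Iff.rfl

instance RoMax.isMaximal : (RoMax K).IsMaximal := by
  rw [Ideal.isMaximal_iff]
  refine ⟨by simp [RoMax.mem_iff], fun J x hJ hx hxJ => ?_⟩
  have h1 : ‖(x : K)‖ = 1 := le_antisymm (Ro.norm_le x) (not_lt.1 hx)
  obtain ⟨c, -, hc⟩ := Ro.exists_inv h1
  exact hc ▸ J.mul_mem_right c hxJ

variable (K) in
/-- The residue field. -/
abbrev Kap := Ro K ⧸ RoMax K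

instance : Field (Kap K) := Ideal.Quotient.field (RoMax K)

/-- The reduction map. -/
abbrev rd : Ro K →+* Kap K := Ideal.Quotient.mk (RoMax K)

lemma rd_eq_zero {a : Ro K} : rd a = 0 ↔ ‖(a : K)‖ < 1 := by
  rw [Ideal.Quotient.eq_zero_iff_mem]; rfl

lemma dv_add {c a b : Ro K} (hc : c ≠ 0) (ha : ‖(a : K)‖ ≤ ‖(c : K)‖) (hb : ‖(b : K)‖ ≤ ‖(c : K)‖) :
    dv c (a + b) = dv c a + dv c b := by
  refine mul_left_cancel₀ hc ?_
  rw [mul_dv (le_trans (IsUltrametricDist.norm_add_le_max _ _) (max_le ha hb)), mul_add, mul_dv ha,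
    mul_dv hb]

lemma dv_mul {c a : Ro K} (x : Ro K) (hc : c ≠ 0) (ha : ‖(a : K)‖ ≤ ‖(c : K)‖) :
    dv c (x * a) = x * dv c a := by
  refine mul_left_cancel₀ hc ?_
  rw [mul_dv, mul_left_comm, mul_dv ha]
  rw [Ro.norm_mul]
  exact le_trans (mul_le_of_le_one_left (norm_nonneg _) (Ro.norm_le x)) ha

lemma dv_cancel {c : Ro K} (x : Ro K) (hc : c ≠ 0) : dv c (c * x) = x := by
  refine mul_left_cancel₀ hc ?_
  rw [mul_dv]
  rw [Ro.norm_mul]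
  exact mul_le_of_le_one_right (norm_nonneg _) (Ro.norm_le x)

/-- The residue field of `Loc s` inside the residue field. -/
def kloc (s : Finset (Ro K)) : Subfield (Kap K) where
  __ := (Loc s).map rd
  inv_mem' := by
    rintro _ ⟨x, hx, rfl⟩
    by_cases h : rd x = 0
    · rw [h, inv_zero]; exact ⟨0, Subring.zero_mem _, by simp⟩
    · rw [rd_eq_zero, not_lt] at h
      obtain ⟨c, hc, hxc⟩ := Loc.exists_inv hx (le_antisymm (Ro.norm_le x) h)
      refine ⟨c, hc, ?_⟩
      change rd c = (rd x)⁻¹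
      refine eq_inv_of_mul_eq_one_right ?_
      rw [← map_mul, hxc, map_one]

/-- A projection of the residue field onto the reductions of the elements of `Loc s` of bounded
norm, divided by a fixed element. -/
lemma exists_proj (s : Finset (Ro K)) {c : Ro K} (hc : c ≠ 0) : ∃ p : Kap K → Kap K,
    p 0 = 0 ∧ (∀ a b, p (a + b) = p a + p b) ∧ (∀ a, ∀ x ∈ (Loc s).map rd, p (a * x) = p a * x) ∧
    (∀ a ∈ Loc s, ‖(a : K)‖ ≤ ‖(c : K)‖ → p (rd (dv c a)) = rd (dv c a)) ∧
    ∀ a, ∃ x ∈ Loc s, ‖(x : K)‖ ≤ ‖(c : K)‖ ∧ p a = rd (dv c x) := by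
  let E : Submodule (kloc s) (Kap K) :=
    { carrier := {a | ∃ x ∈ Loc s, ‖(x : K)‖ ≤ ‖(c : K)‖ ∧ a = rd (dv c x)}
      zero_mem' := ⟨0, Subring.zero_mem _, by simp, by rw [dv_zero hc, map_zero]⟩
      add_mem' := by
        rintro _ _ ⟨x, hx, hxc, rfl⟩ ⟨y, hy, hyc, rfl⟩
        exact ⟨x + y, Subring.add_mem _ hx hy,
          le_trans (IsUltrametricDist.norm_add_le_max _ _) (max_le hxc hyc),
          by rw [dv_add hc hxc hyc, map_add]⟩
      smul_mem' := by
        rintro ⟨_, y, hy, rfl⟩ _ ⟨x, hx, hxc, rfl⟩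
        refine ⟨y * x, Subring.mul_mem _ hy hx, ?_, ?_⟩
        · rw [Ro.norm_mul]
          exact le_trans (mul_le_of_le_one_left (norm_nonneg _) (Ro.norm_le y)) hxc
        · rw [dv_mul y hc hxc, map_mul]; rfl }
  obtain ⟨p, hp⟩ := E.subtype.exists_leftInverse_of_injective E.ker_subtype
  have hpE : ∀ a (h : a ∈ E), p a = ⟨a, h⟩ := fun a h => LinearMap.congr_fun hp ⟨a, h⟩
  refine ⟨fun a => p a, by simp, by simp, ?_, ?_, fun a => (p a).2⟩
  · intro a x hx
    have := p.map_smul (⟨x, hx⟩ : kloc s) a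
    have h2 : (⟨x, hx⟩ : kloc s) • a = a * x := mul_comm _ _
    rw [h2] at this
    change ((p (a * x) : E) : Kap K) = _
    rw [this]
    exact mul_comm _ _
  · intro a ha hac
    change ((p (rd (dv c a)) : E) : Kap K) = _
    rw [hpE _ ⟨a, ha, hac, rfl⟩]

section

variable {σ τ J : Type}

lemma polyIn_Loc_mono (J σ : Type) :
    Monotone fun s : Finset (Ro K) => polyIn J (polyIn σ (Loc s)) :=
  fun _ _ h => polyIn_mono (polyIn_mono (Loc.mono h))

variable (K) in
/-- Formal series in open parameters over polynomials in closed parameters. -/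
abbrev RS (σ τ : Type) := MvPowerSeries (Option τ) (MvPolynomial σ (Ro K))

variable (K) in
/-- Formal series in open parameters over polynomials in closed parameters and the variables. -/
abbrev RJ (σ τ J : Type) := MvPowerSeries (Option τ) (MvPolynomial J (MvPolynomial σ (Ro K)))

open Classical in
variable (K) in
/-- The quasi-noetherian subring. -/
def Q0 (σ τ : Type) : Subring (RS K σ τ) :=
  chain τ (fun s => polyIn σ (Loc s)) fun _ _ h => polyIn_mono (Loc.mono h)

open Classical in
variable (K) in
/-- The quasi-noetherian subring, with variables. -/
def QJ (σ τ J : Type) : Subring (RJ K σ τ J) :=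
  chain τ (fun s => polyIn J (polyIn σ (Loc s))) (polyIn_Loc_mono J σ)

/-- Reduction of coefficients. -/
abbrev red0 : RS K σ τ →+* MvPowerSeries (Option τ) (MvPolynomial σ (Kap K)) :=
  MvPowerSeries.map (MvPolynomial.map rd)

/-- Reduction of coefficients. -/
abbrev redJ :
    RJ K σ τ J →+* MvPowerSeries (Option τ) (MvPolynomial J (MvPolynomial σ (Kap K))) :=
  MvPowerSeries.map (MvPolynomial.map (MvPolynomial.map rd))

/-- Scalar coefficients. -/
def tc (F : RJ K σ τ J) (e : Option τ →₀ ℕ) (ν : J →₀ ℕ) (α : σ →₀ ℕ) : Ro K :=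
  ((MvPowerSeries.coeff e F).coeff ν).coeff α

/-- Constants. -/
abbrev c0 (σ τ : Type) (c : Ro K) : RS K σ τ := MvPowerSeries.C (MvPolynomial.C c)

/-- The inclusion of series without variables. -/
abbrev inJ (J : Type) : RS K σ τ →+* RJ K σ τ J :=
  incl (Option τ) J (MvPolynomial σ (Ro K))

lemma tc_add (F G : RJ K σ τ J) (e ν α) : tc (F + G) e ν α = tc F e ν α + tc G e ν α := by simp [tc]
lemma tc_sub (F G : RJ K σ τ J) (e ν α) : tc (F - G) e ν α = tc F e ν α - tc G e ν α := by simp [tc]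

lemma tc_c (c : Ro K) (F : RJ K σ τ J) (e ν α) : tc (inJ J (c0 σ τ c) * F) e ν α = c * tc F e ν α := by
  rw [tc, MvPowerSeries.map_C, MvPowerSeries.coeff_C_mul, MvPolynomial.coeff_C_mul,
    MvPolynomial.coeff_C_mul]
  rfl

lemma tc_ext {F G : RJ K σ τ J} (h : ∀ e ν α, tc F e ν α = tc G e ν α) : F = G := by
  refine MvPowerSeries.ext fun e => MvPolynomial.ext _ _ fun ν => MvPolynomial.ext _ _ fun α => ?_
  exact h e ν α

lemma tc_z0 (F : RJ K σ τ J) (e ν α) : tc (z0 F) e ν α = if e none = 0 then tc F e ν α else 0 := by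
  change ((if e none = 0 then MvPowerSeries.coeff e F else 0).coeff ν).coeff α = _
  split_ifs <;> simp [tc]

lemma mem_QJ {F : RJ K σ τ J} : F ∈ QJ K σ τ J ↔
    ∀ n : ℕ, ∃ s : Finset (Ro K), ∀ e : Option τ →₀ ℕ, e none ≤ n → ∀ ν α, tc F e ν α ∈ Loc s := by
  rfl

lemma mem_QJ_of_levels {F : RJ K σ τ J} (h : ∀ n : ℕ, ∃ s : Finset (Ro K),
    ∀ e : Option τ →₀ ℕ, e none = n → ∀ ν α, tc F e ν α ∈ Loc s) : F ∈ QJ K σ τ J := by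
  classical
  rw [QJ]
  exact chain_of_levels h

lemma cfu_mem_Q0 {F : RJ K σ τ J} (h : F ∈ QJ K σ τ J) (ν : J →₀ ℕ) : cfu ν F ∈ Q0 K σ τ := by
  intro n
  obtain ⟨s, hs⟩ := mem_QJ.1 h n
  exact ⟨s, fun e he α => hs e he ν α⟩

lemma c0_mem (c : Ro K) : c0 σ τ c ∈ Q0 K σ τ := by
  classical
  rw [Q0]
  exact C_mem_chain ⟨{c}, C_mem_polyIn (Loc.subset (by simp))⟩

lemma inJ_mem {F : RS K σ τ} (h : F ∈ Q0 K σ τ) : inJ J F ∈ QJ K σ τ J := by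
  intro n
  obtain ⟨s, hs⟩ := h n
  refine ⟨s, fun e he => ?_⟩
  rw [MvPowerSeries.coeff_map]
  exact C_mem_polyIn (hs e he)

lemma sh_mem {F : RJ K σ τ J} (h : F ∈ QJ K σ τ J) : sh F ∈ QJ K σ τ J := by
  intro n
  obtain ⟨s, hs⟩ := h (n + 1)
  refine ⟨s, fun e he => ?_⟩
  rw [coeff_sh]
  exact hs _ (by simpa using he)

lemma mem_QJ_of_level_zero {F : RJ K σ τ J} (hz : z0 F = F) {s : Finset (Ro K)}
    (h : ∀ e : Option τ →₀ ℕ, e none = 0 → ∀ ν α, tc F e ν α ∈ Loc s) : F ∈ QJ K σ τ J := by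
  intro n
  refine ⟨s, fun e _ ν α => ?_⟩
  by_cases he : e none = 0
  · exact h e he ν α
  · change tc F e ν α ∈ Loc s
    rw [← hz, tc_z0, if_neg he]
    exact Subring.zero_mem _

lemma tc_pcw {A : Type*} [CommRing A] {p : A → Ro K} (h0 : p 0 = 0)
    (F : MvPowerSeries (Option τ) (MvPolynomial J (MvPolynomial σ A))) (e ν α) :
    tc (pcw (mp (mp p h0) (mp_zero p h0)) F) e ν α =
      p (((MvPowerSeries.coeff e F).coeff ν).coeff α) := by
  change ((mp (mp p h0) (mp_zero p h0) (MvPowerSeries.coeff e F)).coeff ν).coeff α = _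
  simp

/-- Dividing the level zero part by a constant. -/
lemma exists_div_level_zero {c : Ro K} (hc : c ≠ 0) {r : RJ K σ τ J} (hr : r ∈ QJ K σ τ J)
    (hn : ∀ e : Option τ →₀ ℕ, e none = 0 → ∀ ν α, ‖(tc r e ν α : K)‖ ≤ ‖(c : K)‖) :
    ∃ a ∈ QJ K σ τ J, z0 a = a ∧ inJ J (c0 σ τ c) * a = z0 r ∧
      ∀ e : Option τ →₀ ℕ, e none = 0 → ∀ ν α, tc a e ν α = dv c (tc r e ν α) := by
  obtain ⟨s, hs⟩ := mem_QJ.1 hr 0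
  obtain ⟨s', -, hs'⟩ := Loc.exists_div s hc
  let a : RJ K σ τ J := z0 (pcw (mp (mp (dv c) (dv_zero hc)) (mp_zero _ (dv_zero hc))) r)
  have h1 : ∀ e : Option τ →₀ ℕ, e none = 0 → ∀ ν α, tc a e ν α = dv c (tc r e ν α) := by
    intro e he ν α
    simp only [a]
    rw [tc_z0, if_pos he, tc_pcw]; rfl
  refine ⟨a, mem_QJ_of_level_zero (s := s') (z0_z0 _) ?_, z0_z0 _, tc_ext fun e ν α => ?_, h1⟩
  · intro e he ν α
    rw [h1 e he]
    exact hs' _ (hs e he.le ν α) (hn e he ν α)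
  · rw [tc_c, tc_z0 r]
    split_ifs with he
    · rw [h1 e he, mul_dv (hn e he ν α)]
    · rw [tc_z0, if_neg he, mul_zero]

lemma z0_c_mul (c : Ro K) (F : RJ K σ τ J) :
    z0 (inJ J (c0 σ τ c) * F) = inJ J (c0 σ τ c) * z0 F := by
  refine tc_ext fun e ν α => ?_
  rw [tc_z0, tc_c, tc_c, tc_z0]
  split_ifs <;> simp

lemma exists_level_zero {F : RS K σ τ} (h : F ∈ Q0 K σ τ) : ∃ s : Finset (Ro K),
    ∀ e : Option τ →₀ ℕ, e none = 0 → ∀ α, (MvPowerSeries.coeff e F).coeff α ∈ Loc s := by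
  obtain ⟨s, hs⟩ := h 0
  exact ⟨s, fun e he => hs e he.le⟩

lemma redJ_eq_zero {F : RJ K σ τ J} : redJ F = 0 ↔ ∀ e ν α, ‖(tc F e ν α : K)‖ < 1 := by
  simp only [← rd_eq_zero]
  constructor
  · intro h e ν α
    have := congrArg (fun G => ((MvPowerSeries.coeff e G).coeff ν).coeff α) h
    simpa [tc, MvPolynomial.coeff_map] using this
  · intro h
    ext e ν α
    simpa [tc, MvPolynomial.coeff_map] using h e ν α

lemma redJ_pcw {p : Kap K → Kap K} (h0 : p 0 = 0) {m : Kap K → Ro K} (hm0 : m 0 = 0)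
    (hm : ∀ x, rd (m x) = p x)
    (F : MvPowerSeries (Option τ) (MvPolynomial J (MvPolynomial σ (Kap K)))) :
    redJ (pcw (mp (mp m hm0) (mp_zero m hm0)) F) = pcw (mp (mp p h0) (mp_zero p h0)) F := by
  ext e ν α
  rw [MvPowerSeries.coeff_map, MvPolynomial.coeff_map, MvPolynomial.coeff_map]
  change rd (tc (pcw (mp (mp m hm0) (mp_zero m hm0)) F) e ν α) =
    ((mp (mp p h0) (mp_zero p h0) (MvPowerSeries.coeff e F)).coeff ν).coeff α
  rw [tc_pcw, hm]
  simp

lemma z0_pcw {A : Type*} [CommRing A] {p : A → Ro K} (h0 : p 0 = 0)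
    (F : MvPowerSeries (Option τ) (MvPolynomial J (MvPolynomial σ A))) :
    z0 (pcw (mp (mp p h0) (mp_zero p h0)) (z0 F)) = pcw (mp (mp p h0) (mp_zero p h0)) (z0 F) := by
  refine tc_ext fun e ν α => ?_
  rw [tc_z0, tc_pcw, coeff_z0]
  split_ifs
  · rfl
  · simp [h0]

lemma redJ_inJ (F : RS K σ τ) : redJ (inJ J F) = incl (Option τ) J _ (red0 F) := by
  ext e ν α
  simp

lemma cfu_redJ (ν : J →₀ ℕ) (F : RJ K σ τ J) : cfu ν (redJ F) = red0 (cfu ν F) := by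
  ext e α
  simp [MvPolynomial.coeff_map]

/-- `T - π`. -/
abbrev Tpi (σ τ : Type) (π : Ro K) : RS K σ τ := MvPowerSeries.X none - c0 σ τ π

/-- Saturated ideals containing `T - π`. -/
structure Sat (π : Ro K) (M : Ideal (RS K σ τ)) : Prop where
  sat : ∀ c : Ro K, c ≠ 0 → ∀ g, c0 σ τ c * g ∈ M → g ∈ M
  tpi : Tpi σ τ π ∈ M

lemma cfu_c_mul (c : RS K σ τ) (F : RJ K σ τ J) (ν : J →₀ ℕ) :
    cfu ν (inJ J c * F) = c * cfu ν F := by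
  rw [mul_comm, cfu_mul_incl, mul_comm]

lemma redJ_c_eq_zero {c : Ro K} (hc : ‖(c : K)‖ < 1) : redJ (inJ J (c0 σ τ c)) = 0 := by
  rw [redJ_inJ, MvPowerSeries.map_C, MvPolynomial.map_C, rd_eq_zero.2 hc]
  simp

lemma inJ_X : inJ (K := K) (σ := σ) J (MvPowerSeries.X (none : Option τ)) = MvPowerSeries.X none :=
  MvPowerSeries.map_X _ _

lemma aux_sub {R : Type*} [CommRing R] {t p z s r : R} (h : z + t * s = r) :
    z + p * s = r - (t - p) * s := by
  linear_combination h

lemma aux_sum {R ι : Type*} [CommRing R] (s : Finset ι) {c a z : R} (P f : ι → R)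
    (h : c * a = z) : c * (a - ∑ i ∈ s, P i * f i) = z - ∑ i ∈ s, c * P i * f i := by
  rw [mul_sub, h, Finset.mul_sum]
  simp only [mul_assoc]

lemma exists_reduction_step [Finite σ] [Finite τ] {π : Ro K}
    {M : Ideal (RS K σ τ)} (hM : Sat π M) {l : ℕ} (f : Fin l → RS K σ τ)
    (hspan : ∀ g ∈ M, g ∈ Q0 K σ τ → red0 g ∈ Ideal.span (Set.range fun o : Option (Fin l) =>
      o.elim (MvPowerSeries.X none) fun i => red0 (f i)))
    {s : Finset (Ro K)} (hf : ∀ i, ∀ e : Option τ →₀ ℕ, e none = 0 → ∀ α,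
      (MvPowerSeries.coeff e (f i)).coeff α ∈ Loc s)
    {r : RJ K σ τ J} (hr : r ∈ QJ K σ τ J) (hrM : ∀ ν, cfu ν r ∈ M)
    (hrs : ∀ e : Option τ →₀ ℕ, e none = 0 → ∀ ν α, tc r e ν α ∈ Loc s)
    {c : Ro K} (hc : ‖(π : K)‖ < ‖(c : K)‖)
    (hrc : ∀ e : Option τ →₀ ℕ, e none = 0 → ∀ ν α, ‖(tc r e ν α : K)‖ ≤ ‖(c : K)‖) :
    ∃ Q : Fin l → RJ K σ τ J, (∀ i, z0 (Q i) = Q i) ∧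
      (∀ i, ∀ e : Option τ →₀ ℕ, e none = 0 → ∀ ν α, tc (Q i) e ν α ∈ Loc s) ∧
      (∀ e : Option τ →₀ ℕ, e none = 0 → ∀ ν α,
        ‖(tc (r - ∑ i, Q i * inJ J (f i)) e ν α : K)‖ < ‖(c : K)‖) := by
  classical
  have hc0 : c ≠ 0 := by
    rintro rfl
    exact absurd hc (not_lt.2 (by simp))
  obtain ⟨a, haQ, haz, hca, hadv⟩ := exists_div_level_zero hc0 hr hrc
  let π' := dv c π
  have hπ' : c * π' = π := mul_dv hc.le
  have hπ'1 : ‖(π' : K)‖ < 1 := by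
    have h1 : ‖(π : K)‖ = ‖(c : K)‖ * ‖(π' : K)‖ := by rw [← Ro.norm_mul, hπ']
    have h2 : 0 < ‖(c : K)‖ := lt_of_le_of_lt (norm_nonneg _) hc
    by_contra h
    rw [not_lt] at h
    nlinarith
  let ρ := a + inJ J (c0 σ τ π') * sh r
  have hρQ : ρ ∈ QJ K σ τ J := Subring.add_mem _ haQ
    (Subring.mul_mem _ (inJ_mem (c0_mem π')) (sh_mem hr))
  have hcρ : inJ J (c0 σ τ c) * ρ = r - inJ J (Tpi σ τ π) * sh r := by
    have h1 : inJ J (c0 σ τ c) * inJ J (c0 σ τ π') = inJ J (c0 σ τ π) := by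
      rw [← map_mul, ← map_mul, ← map_mul, hπ']
    have h2 := z0_add_T_mul_sh r
    simp only [ρ]
    rw [mul_add, hca, ← mul_assoc, h1, map_sub, inJ_X]
    exact aux_sub h2
  have hρM : ∀ ν, cfu ν ρ ∈ M := fun ν => by
    refine hM.sat c hc0 _ ?_
    rw [← cfu_c_mul, hcρ, map_sub, cfu_c_mul]
    exact Ideal.sub_mem _ (hrM ν) (Ideal.mul_mem_right _ _ hM.tpi)
  obtain ⟨G, hG⟩ := exists_combination _ (redJ ρ) (fun ν => by
    rw [cfu_redJ]
    exact hspan _ (hρM ν) (cfu_mem_Q0 hρQ ν))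
  have hρa : redJ ρ = redJ a := by
    simp only [ρ]
    rw [map_add, map_mul, redJ_c_eq_zero hπ'1, zero_mul, add_zero]
  have hza : redJ a = ∑ i, z0 (G (some i)) * incl (Option τ) J _ (z0 (red0 (f i))) := by
    have h1 : z0 (redJ a) = redJ a := (z0_map _ a).trans (by rw [haz])
    rw [← h1, ← hρa, hG, map_sum, Fintype.sum_option]
    simp only [Option.elim_none, Option.elim_some]
    rw [MvPowerSeries.map_X, mul_comm, z0_T_mul, zero_add]
    refine Finset.sum_congr rfl fun i _ => ?_
    rw [z0_mul, z0_map]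
  obtain ⟨p, hp0, hpadd, hpmul, hpid, hpE⟩ := exists_proj s hc0
  have hm : ∃ m : Kap K → Ro K, m 0 = 0 ∧ ∀ x, rd (m x) = p x ∧ c * m x ∈ Loc s := by
    have : ∀ x, ∃ y : Ro K, (x = 0 → y = 0) ∧ rd y = p x ∧ c * y ∈ Loc s := fun x => by
      by_cases hx : x = 0
      · exact ⟨0, fun _ => rfl, by rw [hx, hp0, map_zero], by simp⟩
      · obtain ⟨y, hy, hyc, hpy⟩ := hpE x
        exact ⟨dv c y, fun h => absurd h hx, hpy.symm, by rwa [mul_dv hyc]⟩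
    choose m hm1 hm2 using this
    exact ⟨m, hm1 0 rfl, hm2⟩
  obtain ⟨m, hm0, hm⟩ := hm
  let P : Fin l → RJ K σ τ J := fun i => pcw (mp (mp m hm0) (mp_zero m hm0)) (z0 (G (some i)))
  have hPz : ∀ i, z0 (P i) = P i := fun i => z0_pcw hm0 _
  have hPr : redJ a = ∑ i, redJ (P i) * incl (Option τ) J _ (z0 (red0 (f i))) := by
    have h1 : pcw (mp (mp p hp0) (mp_zero p hp0)) (redJ a) = redJ a := by
      refine MvPowerSeries.ext fun e => MvPolynomial.ext _ _ fun ν => MvPolynomial.ext _ _ fun α => ?_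
      rw [coeff_pcw, coeff_mp, coeff_mp, MvPowerSeries.coeff_map, MvPolynomial.coeff_map,
        MvPolynomial.coeff_map]
      change p (rd (tc a e ν α)) = rd (tc a e ν α)
      by_cases he : e none = 0
      · rw [hadv e he]
        exact hpid _ (hrs e he ν α) (hrc e he ν α)
      · rw [← haz, tc_z0, if_neg he, map_zero, hp0]
    rw [← h1, hza, pcw_sum (p := mp (mp p hp0) (mp_zero p hp0)) (mp_zero _ (mp_zero p hp0))
      (mp_add (mp_zero p hp0) (mp_add hp0 hpadd))]
    refine Finset.sum_congr rfl fun i _ => ?_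
    rw [redJ_pcw hp0 hm0 (fun x => (hm x).1),
      pcw_mul (p := mp (mp p hp0) (mp_zero p hp0)) (mp_zero _ (mp_zero p hp0))
      (mp_add (mp_zero p hp0) (mp_add hp0 hpadd))
      (S := polyIn J (polyIn σ ((Loc s).map rd)))]
    · intro F g hg
      exact mp_mul _ (mp_add hp0 hpadd) (fun F g hg => mp_mul hp0 hpadd hpmul F hg) F hg
    · intro e
      rw [MvPowerSeries.coeff_map]
      refine C_mem_polyIn fun α => ?_
      rw [coeff_z0]
      split_ifs with he
      · rw [MvPowerSeries.coeff_map, MvPolynomial.coeff_map]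
        exact ⟨_, hf i e he α, rfl⟩
      · simp
  refine ⟨fun i => inJ J (c0 σ τ c) * P i, fun i => ?_, fun i e he ν α => ?_, fun e he ν α => ?_⟩
  · rw [z0_c_mul, hPz]
  · rw [tc_c]
    simp only [P]
    rw [tc_pcw]
    exact (hm _).2
  · have h1 : tc (r - ∑ i, inJ J (c0 σ τ c) * P i * inJ J (f i)) e ν α =
        c * tc (a - ∑ i, P i * inJ J (z0 (f i))) e ν α := by
      rw [← tc_c, aux_sum _ _ _ hca]
      have h2 : ∀ F : RJ K σ τ J, tc F e ν α = tc (z0 F) e ν α := fun F => by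
        rw [tc_z0, if_pos he]
      rw [h2, map_sub, map_sum]
      congr 2
      refine Finset.sum_congr rfl fun i _ => ?_
      rw [z0_mul, z0_c_mul, hPz]
      congr 1
      exact z0_map _ _
    have h2 : redJ (a - ∑ i, P i * inJ J (z0 (f i))) = 0 := by
      rw [map_sub, map_sum, hPr, sub_eq_zero]
      refine Finset.sum_congr rfl fun i _ => ?_
      rw [map_mul, redJ_inJ]
      congr 2
      exact z0_map _ _
    rw [h1, Ro.norm_mul]
    exact mul_lt_of_lt_one_right (lt_of_le_of_lt (norm_nonneg _) hc) (redJ_eq_zero.1 h2 e ν α)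

lemma level_zero_mul {A : Type*} [CommRing A] {P : Subring A} {F G : MvPowerSeries (Option τ) A}
    (hF : ∀ e : Option τ →₀ ℕ, e none = 0 → MvPowerSeries.coeff e F ∈ P)
    (hG : ∀ e : Option τ →₀ ℕ, e none = 0 → MvPowerSeries.coeff e G ∈ P) :
    ∀ e : Option τ →₀ ℕ, e none = 0 → MvPowerSeries.coeff e (F * G) ∈ P := by
  classical
  intro e he
  rw [MvPowerSeries.coeff_mul]
  refine Subring.sum_mem _ fun x hx => ?_
  rw [Finset.HasAntidiagonal.mem_antidiagonal] at hx
  have hx1 : x.1 none + x.2 none = e none := by rw [← hx]; rfl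
  exact Subring.mul_mem _ (hF _ (by omega)) (hG _ (by omega))

lemma f_mem {l : ℕ} {f : Fin l → RS K σ τ} (hfQ : ∀ i, f i ∈ Q0 K σ τ) {Q : Fin l → RJ K σ τ J}
    (hQ : ∀ i, Q i ∈ QJ K σ τ J) : ∑ i, Q i * inJ J (f i) ∈ QJ K σ τ J :=
  Subring.sum_mem _ fun i _ => Subring.mul_mem _ (hQ i) (inJ_mem (hfQ i))

lemma cfu_f_mem {M : Ideal (RS K σ τ)} {l : ℕ} {f : Fin l → RS K σ τ} (hfM : ∀ i, f i ∈ M)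
    (Q : Fin l → RJ K σ τ J) (ν : J →₀ ℕ) : cfu ν (∑ i, Q i * inJ J (f i)) ∈ M := by
  rw [map_sum]
  refine Ideal.sum_mem _ fun i _ => ?_
  rw [cfu_mul_incl]
  exact Ideal.mul_mem_left _ _ (hfM i)

lemma exists_reduction [Finite σ] [Finite τ] {π : Ro K} (hπ0 : π ≠ 0)
    {M : Ideal (RS K σ τ)} (hM : Sat π M) {l : ℕ} (f : Fin l → RS K σ τ)
    (hfM : ∀ i, f i ∈ M) (hfQ : ∀ i, f i ∈ Q0 K σ τ)
    (hspan : ∀ g ∈ M, g ∈ Q0 K σ τ → red0 g ∈ Ideal.span (Set.range fun o : Option (Fin l) =>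
      o.elim (MvPowerSeries.X none) fun i => red0 (f i)))
    {r : RJ K σ τ J} (hr : r ∈ QJ K σ τ J) (hrM : ∀ ν, cfu ν r ∈ M) :
    ∃ Q : Fin l → RJ K σ τ J, (∀ i, z0 (Q i) = Q i) ∧ (∀ i, Q i ∈ QJ K σ τ J) ∧
      (∀ e : Option τ →₀ ℕ, e none = 0 → ∀ ν α,
        ‖(tc (r - ∑ i, Q i * inJ J (f i)) e ν α : K)‖ ≤ ‖(π : K)‖) := by
  classical
  obtain ⟨s, hf, hrs⟩ : ∃ s : Finset (Ro K), (∀ i, ∀ e : Option τ →₀ ℕ, e none = 0 → ∀ α,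
      (MvPowerSeries.coeff e (f i)).coeff α ∈ Loc s) ∧
      ∀ e : Option τ →₀ ℕ, e none = 0 → ∀ ν α, tc r e ν α ∈ Loc s := by
    choose s1 hs1 using fun i => exists_level_zero (hfQ i)
    obtain ⟨s2, hs2⟩ := mem_QJ.1 hr 0
    refine ⟨s2 ∪ Finset.univ.biUnion s1, fun i e he α => Loc.mono ?_ (hs1 i e he α),
      fun e he ν α => Loc.mono Finset.subset_union_left (hs2 e he.le ν α)⟩
    exact (Finset.subset_biUnion_of_mem s1 (Finset.mem_univ i)).trans Finset.subset_union_right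
  have hπ : 0 < ‖(π : K)‖ := by simpa using hπ0
  have hfin := Loc.finite_norms s hπ
  have key : ∀ V : Finset ℝ, ∀ r : RJ K σ τ J, r ∈ QJ K σ τ J → (∀ ν, cfu ν r ∈ M) →
      (∀ e : Option τ →₀ ℕ, e none = 0 → ∀ ν α, tc r e ν α ∈ Loc s) →
      (∀ w, ‖(π : K)‖ < w → (∃ c ∈ Loc s, ‖(c : K)‖ = w) →
        (∃ e : Option τ →₀ ℕ, e none = 0 ∧ ∃ ν α, w ≤ ‖(tc r e ν α : K)‖) → w ∈ V) →
      ∃ Q : Fin l → RJ K σ τ J, (∀ i, z0 (Q i) = Q i) ∧ (∀ i, Q i ∈ QJ K σ τ J) ∧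
        (∀ e : Option τ →₀ ℕ, e none = 0 → ∀ ν α,
          ‖(tc (r - ∑ i, Q i * inJ J (f i)) e ν α : K)‖ ≤ ‖(π : K)‖) := by
    intro V
    induction V using Finset.strongInduction with
    | H V ih =>
    intro r hr hrM hrs hV
    by_cases hall : ∀ e : Option τ →₀ ℕ, e none = 0 → ∀ ν α, ‖(tc r e ν α : K)‖ ≤ ‖(π : K)‖
    · refine ⟨fun _ => 0, by simp, fun _ => Subring.zero_mem _, ?_⟩
      simpa using hall
    push Not at hall
    obtain ⟨e1, he1, ν1, α1, h1⟩ := hall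
    let N := V.filter fun w => ∃ e : Option τ →₀ ℕ, e none = 0 ∧ ∃ ν α, ‖(tc r e ν α : K)‖ = w
    have hN : ∀ e : Option τ →₀ ℕ, e none = 0 → ∀ ν α, ‖(π : K)‖ < ‖(tc r e ν α : K)‖ →
        ‖(tc r e ν α : K)‖ ∈ N := fun e he ν α hlt => Finset.mem_filter.2
      ⟨hV _ hlt ⟨_, hrs e he ν α, rfl⟩ ⟨e, he, ν, α, le_rfl⟩, e, he, ν, α, rfl⟩
    have hNne : N.Nonempty := ⟨_, hN e1 he1 ν1 α1 h1⟩
    obtain ⟨hvV, e2, he2, ν2, α2, hv⟩ := Finset.mem_filter.1 (N.max'_mem hNne)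
    have hlt : ‖(π : K)‖ < ‖(tc r e2 ν2 α2 : K)‖ := by
      rw [hv]
      exact lt_of_lt_of_le h1 (N.le_max' _ (hN e1 he1 ν1 α1 h1))
    have hle : ∀ e : Option τ →₀ ℕ, e none = 0 → ∀ ν α,
        ‖(tc r e ν α : K)‖ ≤ ‖(tc r e2 ν2 α2 : K)‖ := by
      intro e he ν α
      rcases le_or_gt ‖(tc r e ν α : K)‖ ‖(π : K)‖ with h | h
      · exact h.trans hlt.le
      · rw [hv]
        exact N.le_max' _ (hN e he ν α h)
    obtain ⟨Q, hQz, hQs, hQ⟩ := exists_reduction_step hM f hspan hf hr hrM hrs hlt hle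
    have hQQ : ∀ i, Q i ∈ QJ K σ τ J := fun i => mem_QJ_of_level_zero (hQz i) (hQs i)
    obtain ⟨Q', hQ'z, hQ'Q, hQ'⟩ := ih (V.erase (N.max' hNne)) (Finset.erase_ssubset hvV)
      (r - ∑ i, Q i * inJ J (f i)) (Subring.sub_mem _ hr (f_mem hfQ hQQ))
      (fun ν => by
        rw [map_sub]
        exact Ideal.sub_mem _ (hrM ν) (cfu_f_mem hfM Q ν))
      (fun e he ν α => by
        have h3 : MvPowerSeries.coeff e (∑ i, Q i * inJ J (f i)) ∈ polyIn J (polyIn σ (Loc s)) := by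
          rw [map_sum]
          refine Subring.sum_mem _ fun i _ => level_zero_mul (P := polyIn J (polyIn σ (Loc s)))
            (F := Q i) (G := inJ J (f i)) (fun e he ν α => hQs i e he ν α) ?_ e he
          intro e he
          have h7 : MvPowerSeries.coeff e (inJ J (f i)) =
            MvPolynomial.C (MvPowerSeries.coeff e (f i)) := MvPowerSeries.coeff_map _ _ _
          rw [h7]
          exact C_mem_polyIn (hf i e he)
        rw [tc_sub]
        exact Subring.sub_mem _ (hrs e he ν α) (h3 ν α))
      (fun w hw hwc ⟨e, he, ν, α, hwe⟩ => by
        have h4 := hQ e he ν α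
        refine Finset.mem_erase.2 ⟨?_, hV w hw hwc ⟨e2, he2, ν2, α2, hwe.trans h4.le⟩⟩
        rw [← hv]
        exact (hwe.trans_lt h4).ne)
    refine ⟨fun i => Q i + Q' i, fun i => by rw [map_add, hQz, hQ'z],
      fun i => Subring.add_mem _ (hQQ i) (hQ'Q i), ?_⟩
    have h5 : r - ∑ i, (Q i + Q' i) * inJ J (f i) =
        r - ∑ i, Q i * inJ J (f i) - ∑ i, Q' i * inJ J (f i) := by
      simp only [add_mul, Finset.sum_add_distrib]
      ring
    rw [h5]
    exact hQ'
  refine key hfin.toFinset r hr hrM hrs fun w hw hc _ => ?_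
  rw [Set.Finite.mem_toFinset]
  exact ⟨hw.le, hc⟩

/-- One step of successive approximation. -/
lemma exists_iteration_step [Finite σ] [Finite τ] {π : Ro K} (hπ0 : π ≠ 0)
    {M : Ideal (RS K σ τ)} (hM : Sat π M) {l : ℕ} (f : Fin l → RS K σ τ)
    (hfM : ∀ i, f i ∈ M) (hfQ : ∀ i, f i ∈ Q0 K σ τ)
    (hspan : ∀ g ∈ M, g ∈ Q0 K σ τ → red0 g ∈ Ideal.span (Set.range fun o : Option (Fin l) =>
      o.elim (MvPowerSeries.X none) fun i => red0 (f i)))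
    {r : RJ K σ τ J} (hr : r ∈ QJ K σ τ J) (hrM : ∀ ν, cfu ν r ∈ M) :
    ∃ (Q : Fin l → RJ K σ τ J) (a r' : RJ K σ τ J), (∀ i, z0 (Q i) = Q i) ∧
      (∀ i, Q i ∈ QJ K σ τ J) ∧ z0 a = a ∧ r' ∈ QJ K σ τ J ∧ (∀ ν, cfu ν r' ∈ M) ∧
      r = ∑ i, Q i * inJ J (f i) - inJ J (Tpi σ τ π) * a + MvPowerSeries.X none * r' := by
  obtain ⟨Q, hQz, hQQ, hQ⟩ := exists_reduction hπ0 hM f hfM hfQ hspan hr hrM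
  obtain ⟨r1, hr1⟩ : ∃ r1, r1 = r - ∑ i, Q i * inJ J (f i) := ⟨_, rfl⟩
  rw [← hr1] at hQ
  have hr1Q : r1 ∈ QJ K σ τ J := hr1 ▸ Subring.sub_mem _ hr (f_mem hfQ hQQ)
  have hr1M : ∀ ν, cfu ν r1 ∈ M := fun ν => by
    rw [hr1, map_sub]
    exact Ideal.sub_mem _ (hrM ν) (cfu_f_mem hfM Q ν)
  obtain ⟨a, haQ, haz, ha, -⟩ := exists_div_level_zero hπ0 hr1Q hQ
  have h2 := z0_add_T_mul_sh r1
  have h3 : r1 = MvPowerSeries.X none * (a + sh r1) - inJ J (Tpi σ τ π) * a := by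
    rw [map_sub, inJ_X]
    linear_combination -h2 - ha
  refine ⟨Q, a, a + sh r1, hQz, hQQ, haz, Subring.add_mem _ haQ (sh_mem hr1Q), fun ν => ?_, ?_⟩
  · have h4 : MvPowerSeries.X none * cfu ν (a + sh r1) ∈ M := by
      rw [← cfu_c_mul, inJ_X]
      have h5 : MvPowerSeries.X none * (a + sh r1) = r1 + inJ J (Tpi σ τ π) * a := by
        linear_combination -h3
      rw [h5, map_add, cfu_c_mul]
      exact Ideal.add_mem _ (hr1M ν) (Ideal.mul_mem_right _ _ hM.tpi)
    refine hM.sat π hπ0 _ ?_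
    have h6 : c0 σ τ π * cfu ν (a + sh r1) =
        MvPowerSeries.X none * cfu ν (a + sh r1) - Tpi σ τ π * cfu ν (a + sh r1) := by ring
    rw [h6]
    exact Ideal.sub_mem _ h4 (Ideal.mul_mem_right _ _ hM.tpi)
  · linear_combination h3 - hr1

lemma stack_mem {g : ℕ → RJ K σ τ J} (hg : ∀ n, g n ∈ QJ K σ τ J) : stack g 0 ∈ QJ K σ τ J := by
  refine mem_QJ_of_levels fun n => ?_
  obtain ⟨s, hs⟩ := mem_QJ.1 (hg n) 0
  refine ⟨s, fun e he ν α => ?_⟩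
  have h : tc (stack g 0) e ν α = tc (g n) (e.erase none) ν α := by
    rw [tc, coeff_stack, he, zero_add]; rfl
  rw [h]
  exact hs _ (by simp) ν α

/-- Quasi-noetherianity: a saturated ideal is generated, up to `T - π`, by finitely many of its
elements, compatibly with adjoining variables. -/
theorem exists_generators [Finite σ] [Finite τ] {π : Ro K} (hπ0 : π ≠ 0)
    {M : Ideal (RS K σ τ)} (hM : Sat π M) :
    ∃ (l : ℕ) (f : Fin l → RS K σ τ), (∀ i, f i ∈ M) ∧ (∀ i, f i ∈ Q0 K σ τ) ∧
      ∀ (J : Type) (G : RJ K σ τ J), G ∈ QJ K σ τ J → (∀ ν, cfu ν G ∈ M) →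
        ∃ (Q : Fin l → RJ K σ τ J) (H : RJ K σ τ J), (∀ i, Q i ∈ QJ K σ τ J) ∧
          G = ∑ i, Q i * inJ J (f i) + inJ J (Tpi σ τ π) * H := by
  classical
  let S : Set (MvPowerSeries (Option τ) (MvPolynomial σ (Kap K))) :=
    red0 '' {g | g ∈ M ∧ g ∈ Q0 K σ τ}
  obtain ⟨S', hS', hspan'⟩ := (Submodule.fg_span_iff_fg_span_finset_subset S).1
    (IsNoetherian.noetherian (Ideal.span S))
  have : ∃ (l : ℕ) (f : Fin l → RS K σ τ), (∀ i, f i ∈ M ∧ f i ∈ Q0 K σ τ) ∧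
      (S' : Set _) ⊆ Set.range fun i => red0 (f i) := by
    have h : ∀ x : S', ∃ g : RS K σ τ, (g ∈ M ∧ g ∈ Q0 K σ τ) ∧ red0 g = x := fun x => hS' x.2
    choose f hf using h
    refine ⟨S'.card, fun i => f (S'.equivFin.symm i), fun i => (hf _).1, ?_⟩
    intro x hx
    refine ⟨S'.equivFin ⟨x, hx⟩, ?_⟩
    simp only [Equiv.symm_apply_apply]
    exact (hf _).2
  obtain ⟨l, f, hf, hfS⟩ := this
  have hspan : ∀ g ∈ M, g ∈ Q0 K σ τ → red0 g ∈ Ideal.span (Set.range fun o : Option (Fin l) =>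
      o.elim (MvPowerSeries.X none) fun i => red0 (f i)) := by
    intro g hg hgQ
    have h1 : red0 g ∈ Ideal.span S := Ideal.subset_span ⟨g, ⟨hg, hgQ⟩, rfl⟩
    have h2 : Ideal.span S = Ideal.span S' := hspan'
    rw [h2] at h1
    refine Ideal.span_mono (hfS.trans ?_) h1
    rintro _ ⟨i, rfl⟩
    exact ⟨some i, rfl⟩
  refine ⟨l, f, fun i => (hf i).1, fun i => (hf i).2, fun J G hG hGM => ?_⟩
  have hstep : ∀ r : {r : RJ K σ τ J // r ∈ QJ K σ τ J ∧ ∀ ν, cfu ν r ∈ M},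
      ∃ (Q : Fin l → RJ K σ τ J) (a : RJ K σ τ J)
        (r' : {r : RJ K σ τ J // r ∈ QJ K σ τ J ∧ ∀ ν, cfu ν r ∈ M}), (∀ i, z0 (Q i) = Q i) ∧
      (∀ i, Q i ∈ QJ K σ τ J) ∧ z0 a = a ∧
      r.1 = ∑ i, Q i * inJ J (f i) - inJ J (Tpi σ τ π) * a + MvPowerSeries.X none * r'.1 := by
    rintro ⟨r, hr, hrM⟩
    obtain ⟨Q, a, r', h1, h2, h3, h4, h5, h6⟩ :=
      exists_iteration_step hπ0 hM f (fun i => (hf i).1) (fun i => (hf i).2) hspan hr hrM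
    exact ⟨Q, a, ⟨r', h4, h5⟩, h1, h2, h3, h6⟩
  choose Q a nx hQz hQQ haz heq using hstep
  let rr : ℕ → {r : RJ K σ τ J // r ∈ QJ K σ τ J ∧ ∀ ν, cfu ν r ∈ M} :=
    fun n => nx^[n] ⟨G, hG, hGM⟩
  have hrr : ∀ n, rr (n + 1) = nx (rr n) := fun n => Function.iterate_succ_apply' _ _ _
  refine ⟨fun i => stack (fun n => Q (rr n) i) 0, - stack (fun n => a (rr n)) 0,
    fun i => stack_mem fun n => hQQ _ i, ?_⟩
  have h0 := eq_zero_of_T_mul (fun n => (rr n).1 -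
    ∑ i, stack (fun n => Q (rr n) i) n * inJ J (f i) +
      inJ J (Tpi σ τ π) * stack (fun n => a (rr n)) n) (fun n => by
    have e1 := heq (rr n)
    rw [← hrr] at e1
    have e2 := stack_eq (fun n => a (rr n)) (fun n => haz _) n
    have e3 : ∑ i, stack (fun n => Q (rr n) i) n * inJ J (f i) = ∑ i, Q (rr n) i * inJ J (f i) +
        MvPowerSeries.X none * ∑ i, stack (fun n => Q (rr n) i) (n + 1) * inJ J (f i) := by
      rw [Finset.mul_sum, ← Finset.sum_add_distrib]
      refine Finset.sum_congr rfl fun i _ => ?_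
      rw [stack_eq (fun n => Q (rr n) i) (fun n => hQz _ i) n]
      ring
    rw [e3]
    linear_combination e1 + inJ J (Tpi σ τ π) * e2)
  have h1 : (rr 0).1 = G := rfl
  linear_combination h0 - h1

end

section

variable {X σ τ σ' τ' J J' : Type}

/-- Values of the parameters over a base. -/
structure Dat (π : Ro K) (X σ τ : Type) where
  /-- closed parameters -/
  y : X → σ → Ro K
  /-- open parameters -/
  ξ : X → Option τ → Ro K
  hξ : ∀ x t, ‖(ξ x t : K)‖ < 1
  hT : ∀ x, ξ x none = π

namespace Dat

variable {π : Ro K}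

lemma norm_pi_lt (D : Dat π X σ τ) (x : X) : ‖(π : K)‖ < 1 := by
  have := D.hξ x none
  rwa [D.hT] at this

/-- Evaluation of series without variables. -/
def ev [Finite τ] (D : Dat π X σ τ) (x : X) : RS K σ τ →+* Ro K :=
  (exists_evO (MvPolynomial.eval (D.y x)) (D.ξ x) (D.hξ x)).choose

lemma ev_C [Finite τ] (D : Dat π X σ τ) (x : X) (a) :
    D.ev x (MvPowerSeries.C a) = MvPolynomial.eval (D.y x) a :=
  (exists_evO (MvPolynomial.eval (D.y x)) (D.ξ x) (D.hξ x)).choose_spec.1 a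

lemma ev_X [Finite τ] (D : Dat π X σ τ) (x : X) (t) : D.ev x (MvPowerSeries.X t) = D.ξ x t :=
  (exists_evO (MvPolynomial.eval (D.y x)) (D.ξ x) (D.hξ x)).choose_spec.2 t

/-- Evaluation of polynomials. -/
def pv (N : ℕ) (D : Dat π X σ τ) (x : X) :
    MvPolynomial (Fin N) (MvPolynomial σ (Ro K)) →+* Pow K N :=
  MvPolynomial.coeToMvPowerSeries.ringHom.comp (MvPolynomial.map (MvPolynomial.eval (D.y x)))

/-- Evaluation of series with variables. -/
def Ev [Finite τ] (N : ℕ) (D : Dat π X σ τ) (x : X) : RJ K σ τ (Fin N) →+* Pow K N :=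
  (exists_evPow (D.pv N x) (D.ξ x) (D.hξ x)).choose

variable {N N' : ℕ}

lemma Ev_C [Finite τ] (D : Dat π X σ τ) (x : X) (a) :
    D.Ev N x (MvPowerSeries.C a) = D.pv N x a :=
  (exists_evPow (D.pv N x) (D.ξ x) (D.hξ x)).choose_spec.1 a

lemma Ev_X [Finite τ] (D : Dat π X σ τ) (x : X) (t) :
    D.Ev N x (MvPowerSeries.X t) = MvPowerSeries.C (D.ξ x t) :=
  (exists_evPow (D.pv N x) (D.ξ x) (D.hξ x)).choose_spec.2 t

lemma coeff_pv (D : Dat π X σ τ) (x : X) (p) (ν) :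
    MvPowerSeries.coeff ν (D.pv N x p) = MvPolynomial.eval (D.y x) (p.coeff ν) := by
  change MvPowerSeries.coeff ν ((MvPolynomial.map (MvPolynomial.eval (D.y x)) p :
    MvPolynomial (Fin N) (Ro K)) : MvPowerSeries (Fin N) (Ro K)) = _
  rw [MvPolynomial.coeff_coe, MvPolynomial.coeff_map]

lemma addHom_ext_O {I : Type} [Finite I] {A : Type} [CommRing A] {ξ : I → Ro K}
    (hξ : ∀ t, ‖(ξ t : K)‖ < 1) {L L' : MvPowerSeries I A →+ Ro K}
    (hX : ∀ t F, L (MvPowerSeries.X t * F) = ξ t * L F)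
    (hX' : ∀ t F, L' (MvPowerSeries.X t * F) = ξ t * L' F)
    (hC : ∀ a, L (MvPowerSeries.C a) = L' (MvPowerSeries.C a)) : L = L' := by
  obtain ⟨c, hc, -, hcξ⟩ := exists_max_dvd (0 : Ro K) (by simp) ξ hξ
  exact mvPowerSeries_addHom_ext hcξ (fun b => Ro.pow_dvd_eq_zero hc) L L' hX hX' hC

lemma addHom_ext_Pow {I : Type} [Finite I] {A : Type} [CommRing A] {ξ : I → Ro K}
    (hξ : ∀ t, ‖(ξ t : K)‖ < 1) {L L' : MvPowerSeries I A →+ Pow K N}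
    (hX : ∀ t F, L (MvPowerSeries.X t * F) = MvPowerSeries.C (ξ t) * L F)
    (hX' : ∀ t F, L' (MvPowerSeries.X t * F) = MvPowerSeries.C (ξ t) * L' F)
    (hC : ∀ a, L (MvPowerSeries.C a) = L' (MvPowerSeries.C a)) : L = L' := by
  obtain ⟨c, hc, -, hcξ⟩ := exists_max_dvd (0 : Ro K) (by simp) ξ hξ
  exact mvPowerSeries_addHom_ext (c := MvPowerSeries.C c) (fun t => map_dvd _ (hcξ t))
    (fun b => Pow.pow_dvd_eq_zero hc) L L' hX hX' hC

lemma cfu_X_mul {I A : Type} [CommRing A] (t : I) (F : MvPowerSeries I (MvPolynomial J A)) (ν) :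
    cfu ν (MvPowerSeries.X t * F) = MvPowerSeries.X t * cfu ν F := by
  have : (MvPowerSeries.X t : MvPowerSeries I (MvPolynomial J A)) = incl I J A (MvPowerSeries.X t) :=
    (MvPowerSeries.map_X _ _).symm
  rw [mul_comm, this, cfu_mul_incl, mul_comm]

lemma coeff_Ev [Finite τ] (D : Dat π X σ τ) (x : X) (F : RJ K σ τ (Fin N)) (ν : Fin N →₀ ℕ) :
    MvPowerSeries.coeff ν (D.Ev N x F) = D.ev x (cfu ν F) := by
  have := addHom_ext_O (D.hξ x)
    (L := (MvPowerSeries.coeff ν).toAddMonoidHom.comp (D.Ev N x).toAddMonoidHom)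
    (L' := (D.ev x).toAddMonoidHom.comp (cfu ν))
    (fun t F => by
      change MvPowerSeries.coeff ν (D.Ev N x _) = _ * MvPowerSeries.coeff ν (D.Ev N x F)
      rw [map_mul, Ev_X, MvPowerSeries.coeff_C_mul])
    (fun t F => by
      change D.ev x (cfu ν _) = _ * D.ev x (cfu ν F)
      rw [cfu_X_mul, map_mul, ev_X])
    (fun a => by
      change MvPowerSeries.coeff ν (D.Ev N x _) = D.ev x (cfu ν _)
      classical
      have : cfu ν (MvPowerSeries.C a : RJ K σ τ (Fin N)) = MvPowerSeries.C (a.coeff ν) := by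
        ext1 e
        rw [coeff_cfu, MvPowerSeries.coeff_C, MvPowerSeries.coeff_C]
        split_ifs <;> simp
      rw [Ev_C, this, ev_C, coeff_pv])
  exact congrArg (fun L => L F) this

/-- Lifting of series along a change of the parameters. -/
def lift [Finite τ] (a : σ → σ') (b : τ → τ') (J : Type) :
    RJ K σ τ J →+* RJ K σ' τ' J :=
  haveI : Filter.TendstoCofinite (Option.map b) := Filter.tendstoCofinite_of_finite _
  (MvPowerSeries.rename (R := MvPolynomial J (MvPolynomial σ' (Ro K))) (Option.map b)).toRingHom.comp
    (MvPowerSeries.map (MvPolynomial.map (MvPolynomial.rename a).toRingHom))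

lemma lift_C [Finite τ] (a : σ → σ') (b : τ → τ') (p) :
    lift (K := K) a b J (MvPowerSeries.C p) =
      MvPowerSeries.C (MvPolynomial.map (MvPolynomial.rename a).toRingHom p) := by
  have : Filter.TendstoCofinite (Option.map b) := Filter.tendstoCofinite_of_finite _
  change MvPowerSeries.rename _ (MvPowerSeries.map _ _) = _
  rw [MvPowerSeries.map_C, MvPowerSeries.rename_C]

lemma lift_X [Finite τ] (a : σ → σ') (b : τ → τ') (t) :
    lift (K := K) a b J (MvPowerSeries.X t) = MvPowerSeries.X (Option.map b t) := by
  have : Filter.TendstoCofinite (Option.map b) := Filter.tendstoCofinite_of_finite _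
  change MvPowerSeries.rename _ (MvPowerSeries.map _ _) = _
  rw [MvPowerSeries.map_X, MvPowerSeries.rename_X]

lemma constantCoeff_lift [Finite τ] (a : σ → σ') (b : τ → τ') (F) :
    MvPowerSeries.constantCoeff (lift (K := K) a b J F) =
      MvPolynomial.map (MvPolynomial.rename a).toRingHom (MvPowerSeries.constantCoeff F) := by
  have : Filter.TendstoCofinite (Option.map b) := Filter.tendstoCofinite_of_finite _
  change MvPowerSeries.constantCoeff (MvPowerSeries.rename _ (MvPowerSeries.map _ _)) = _
  rw [MvPowerSeries.constantCoeff_rename, MvPowerSeries.constantCoeff_map]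

lemma Ev_lift [Finite τ] [Finite τ'] (D : Dat π X σ τ) (D' : Dat π X σ' τ') (a : σ → σ') (b : τ → τ')
    (x : X) (ha : ∀ i, D'.y x (a i) = D.y x i) (hb : ∀ t, D'.ξ x (some (b t)) = D.ξ x (some t))
    (F : RJ K σ τ (Fin N)) : D'.Ev N x (lift a b _ F) = D.Ev N x F := by
  have := addHom_ext_Pow (D.hξ x)
    (L := (D'.Ev N x).toAddMonoidHom.comp (lift a b _).toAddMonoidHom)
    (L' := (D.Ev N x).toAddMonoidHom)
    (fun t F => by
      change D'.Ev N x (lift a b _ _) = _ * D'.Ev N x (lift a b _ F)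
      rw [map_mul, map_mul, lift_X, Ev_X]
      cases t with
      | none => rw [Option.map_none, D'.hT, D.hT]
      | some t => rw [Option.map_some, hb])
    (fun t F => by
      change D.Ev N x _ = _ * D.Ev N x _
      rw [map_mul, Ev_X])
    (fun p => by
      change D'.Ev N x (lift a b _ _) = D.Ev N x _
      rw [lift_C, Ev_C, Ev_C]
      ext1 ν
      rw [coeff_pv, coeff_pv, MvPolynomial.coeff_map]
      change MvPolynomial.eval _ (MvPolynomial.rename a _) = _
      rw [MvPolynomial.eval_rename]
      congr 2
      exact funext ha)
  exact congrArg (fun L => L F) this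

lemma rename_mem_polyIn {P : Subring (Ro K)} {a : σ → σ'} (ha : Function.Injective a)
    {p : MvPolynomial σ (Ro K)} (hp : p ∈ polyIn σ P) : MvPolynomial.rename a p ∈ polyIn σ' P := by
  intro e
  by_cases he : ∃ u : σ →₀ ℕ, u.mapDomain a = e
  · obtain ⟨u, rfl⟩ := he
    rw [MvPolynomial.coeff_rename_mapDomain a ha]
    exact hp u
  · rw [MvPolynomial.coeff_rename_eq_zero _ _ _ fun u hu => absurd ⟨u, hu⟩ he]
    exact P.zero_mem

lemma map_mem_QJ {g : MvPolynomial J (MvPolynomial σ (Ro K)) →+*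
      MvPolynomial J' (MvPolynomial σ' (Ro K))}
    (hg : ∀ s : Finset (Ro K), ∃ s' : Finset (Ro K), ∀ p ∈ polyIn J (polyIn σ (Loc s)),
      g p ∈ polyIn J' (polyIn σ' (Loc s'))) {F : RJ K σ τ J} (hF : F ∈ QJ K σ τ J) :
    MvPowerSeries.map g F ∈ QJ K σ' τ J' := by
  rw [mem_QJ] at *
  intro n
  obtain ⟨s, hs⟩ := hF n
  obtain ⟨s', hs'⟩ := hg s
  refine ⟨s', fun e he ν α => ?_⟩
  rw [tc, MvPowerSeries.coeff_map]
  exact hs' _ (fun ν α => hs e he ν α) ν α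

lemma lift_mem [Finite τ] {a : σ → σ'} {b : τ → τ'} (ha : Function.Injective a)
    (hb : Function.Injective b) {F : RJ K σ τ J} (hF : F ∈ QJ K σ τ J) :
    lift a b J F ∈ QJ K σ' τ' J := by
  have : Filter.TendstoCofinite (Option.map b) := Filter.tendstoCofinite_of_finite _
  have h1 : MvPowerSeries.map (MvPolynomial.map (MvPolynomial.rename a).toRingHom) F ∈
      QJ K σ' τ J := by
    refine map_mem_QJ (fun s => ⟨s, fun p hp ν => ?_⟩) hF
    rw [MvPolynomial.coeff_map]
    exact rename_mem_polyIn ha (hp ν)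
  rw [mem_QJ] at *
  intro n
  obtain ⟨s, hs⟩ := h1 n
  refine ⟨s, fun e he ν α => ?_⟩
  have hb' : Function.Injective (Option.map b) := Option.map_injective hb
  change ((MvPowerSeries.coeff e (MvPowerSeries.rename (Option.map b)
    (MvPowerSeries.map (MvPolynomial.map (MvPolynomial.rename a).toRingHom) F))).coeff ν).coeff α ∈ _
  by_cases h : e ∈ Set.range (Finsupp.mapDomain (Option.map b))
  · obtain ⟨u, rfl⟩ := h
    have h2 := MvPowerSeries.coeff_embDomain_rename (⟨_, hb'⟩ : Option τ ↪ Option τ')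
      (MvPowerSeries.map (MvPolynomial.map (MvPolynomial.rename a).toRingHom) F) u
    rw [Finsupp.embDomain_eq_mapDomain] at h2
    have h3 : (MvPowerSeries.coeff (Finsupp.mapDomain (Option.map b) u)
      (MvPowerSeries.rename (Option.map b)
        (MvPowerSeries.map (MvPolynomial.map (MvPolynomial.rename a).toRingHom) F))) = _ := h2
    rw [h3]
    have h4 : u none ≤ n := by
      rw [← Finsupp.mapDomain_apply hb' u none] 
      exact he
    exact hs u h4 ν α
  · rw [MvPowerSeries.coeff_rename_eq_zero _ _ h]
    simp

end Dat

end

section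

variable {X σ τ σ' τ' J J' : Type} {π : Ro K} {N : ℕ}

lemma mem_QJ_C {p : MvPolynomial J (MvPolynomial σ (Ro K))}
    (h : ∃ s : Finset (Ro K), p ∈ polyIn J (polyIn σ (Loc s))) :
    (MvPowerSeries.C p : RJ K σ τ J) ∈ QJ K σ τ J := by
  classical
  exact C_mem_chain (hP := polyIn_Loc_mono J σ) h

lemma mem_QJ_X (t : Option τ) : (MvPowerSeries.X t : RJ K σ τ J) ∈ QJ K σ τ J := by
  classical
  exact X_mem_chain (hP := polyIn_Loc_mono J σ) t

/-- Extension by further parameters. -/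
def Dat.extend (D : Dat π X σ τ) (y : X → σ' → Ro K) (ξ : X → τ' → Ro K)
    (hξ : ∀ x t, ‖(ξ x t : K)‖ < 1) : Dat π X (σ ⊕ σ') (τ ⊕ τ') where
  y x := Sum.elim (D.y x) (y x)
  ξ x o := o.elim π (Sum.elim (fun t => D.ξ x (some t)) (ξ x))
  hξ x t := by
    rcases t with _ | t | t
    · exact D.norm_pi_lt x
    · exact D.hξ x _
    · exact hξ x t
  hT _ := rfl

/-- The trivial data. -/
def Dat.zero (X : Type) (hπ : ‖(π : K)‖ < 1) : Dat π X Empty Empty where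
  y _ := Empty.elim
  ξ _ _ := π
  hξ _ _ := hπ
  hT _ := rfl

lemma Dat.Ev_CC [Finite τ] (D : Dat π X σ τ) (x : X) (p : MvPolynomial σ (Ro K)) :
    D.Ev N x (MvPowerSeries.C (MvPolynomial.C p)) =
      MvPowerSeries.C (MvPolynomial.eval (D.y x) p) := by
  rw [Dat.Ev_C]
  change ((MvPolynomial.map (MvPolynomial.eval (D.y x)) (MvPolynomial.C p) :
    MvPolynomial (Fin N) (Ro K)) : MvPowerSeries (Fin N) (Ro K)) = _
  rw [MvPolynomial.map_C, MvPolynomial.coe_C]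

lemma Dat.Ev_CX [Finite τ] (D : Dat π X σ τ) (x : X) (i : Fin N) :
    D.Ev N x (MvPowerSeries.C (MvPolynomial.X i)) = MvPowerSeries.X i := by
  rw [Dat.Ev_C]
  change ((MvPolynomial.map (MvPolynomial.eval (D.y x)) (MvPolynomial.X i) :
    MvPolynomial (Fin N) (Ro K)) : MvPowerSeries (Fin N) (Ro K)) = _
  rw [MvPolynomial.map_X, MvPolynomial.coe_X]

/-- Families of power series given by a single quasi-noetherian series. -/
def Tame (π : Ro K) (S : Set X) (f : X → Pow K N) : Prop :=
  ∃ (σ τ : Type) (_ : Finite σ) (_ : Finite τ) (D : Dat π X σ τ) (F : RJ K σ τ (Fin N)),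
    F ∈ QJ K σ τ (Fin N) ∧ ∀ x ∈ S, f x = D.Ev N x F

namespace Tame

variable {S : Set X} {f g : X → Pow K N}

lemma mono {S' : Set X} (h : S' ⊆ S) (hf : Tame π S f) : Tame π S' f := by
  obtain ⟨σ, τ, _, _, D, F, hF, h1⟩ := hf
  exact ⟨σ, τ, ‹_›, ‹_›, D, F, hF, fun x hx => h1 x (h hx)⟩

lemma merge (hf : Tame π S f) (hg : Tame π S g) :
    ∃ (σ τ : Type) (_ : Finite σ) (_ : Finite τ) (D : Dat π X σ τ) (F G : RJ K σ τ (Fin N)),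
    F ∈ QJ K σ τ (Fin N) ∧ G ∈ QJ K σ τ (Fin N) ∧ (∀ x ∈ S, f x = D.Ev N x F) ∧
      ∀ x ∈ S, g x = D.Ev N x G := by
  obtain ⟨σ, τ, _, _, D, F, hF, h1⟩ := hf
  obtain ⟨σ', τ', _, _, D', F', hF', h1'⟩ := hg
  refine ⟨σ ⊕ σ', τ ⊕ τ', inferInstance, inferInstance,
    D.extend D'.y (fun x t => D'.ξ x (some t)) (fun x t => D'.hξ _ _),
    Dat.lift Sum.inl Sum.inl _ F, Dat.lift Sum.inr Sum.inr _ F',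
    Dat.lift_mem Sum.inl_injective Sum.inl_injective hF,
    Dat.lift_mem Sum.inr_injective Sum.inr_injective hF', fun x hx => ?_, fun x hx => ?_⟩
  · rw [h1 x hx, Dat.Ev_lift D]
    · intro i; rfl
    · intro i; rfl
  · rw [h1' x hx, Dat.Ev_lift D']
    · intro i; rfl
    · intro i; rfl

lemma add (hf : Tame π S f) (hg : Tame π S g) : Tame π S fun x => f x + g x := by
  obtain ⟨σ, τ, _, _, D, F, G, hF, hG, h1, h2⟩ := hf.merge hg
  exact ⟨σ, τ, ‹_›, ‹_›, D, F + G, Subring.add_mem _ hF hG, fun x hx => by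
    change f x + g x = _
    rw [map_add, h1 x hx, h2 x hx]⟩

lemma mul (hf : Tame π S f) (hg : Tame π S g) : Tame π S fun x => f x * g x := by
  obtain ⟨σ, τ, _, _, D, F, G, hF, hG, h1, h2⟩ := hf.merge hg
  exact ⟨σ, τ, ‹_›, ‹_›, D, F * G, Subring.mul_mem _ hF hG, fun x hx => by
    change f x * g x = _
    rw [map_mul, h1 x hx, h2 x hx]⟩

lemma C_fun (hπ : ‖(π : K)‖ < 1) (a : X → Ro K) : Tame π S fun x => (MvPowerSeries.C (a x) : Pow K N) := by
  refine ⟨Empty ⊕ Unit, Empty ⊕ Empty, inferInstance, inferInstance,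
    (Dat.zero X hπ).extend (fun x _ => a x) (fun x t => t.elim) (fun x t => t.elim),
    MvPowerSeries.C (MvPolynomial.C (MvPolynomial.X (Sum.inr ()))),
    mem_QJ_C ⟨∅, C_mem_polyIn (X_mem_polyIn _)⟩, fun x _ => ?_⟩
  rw [Dat.Ev_CC, MvPolynomial.eval_X]
  rfl

lemma sum {ι : Type*} (s : Finset ι) (hπ : ‖(π : K)‖ < 1) {f : ι → X → Pow K N}
    (h : ∀ i ∈ s, Tame π S (f i)) : Tame π S fun x => ∑ i ∈ s, f i x := by
  classical
  induction s using Finset.induction_on with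
  | empty => simpa using C_fun (N := N) (S := S) hπ fun _ : X => 0
  | insert a s ha ih =>
    simp only [Finset.sum_insert ha]
    exact (h a (Finset.mem_insert_self _ _)).add (ih fun i hi => h i (Finset.mem_insert_of_mem hi))

end Tame

lemma Dat.Ev_inJ [Finite τ] (D : Dat π X σ τ) (x : X) (F : RS K σ τ) :
    D.Ev N x (inJ (Fin N) F) = MvPowerSeries.C (D.ev x F) := by
  classical
  ext1 ν
  rw [Dat.coeff_Ev, MvPowerSeries.coeff_C]
  have : cfu ν (inJ (Fin N) F) = if ν = 0 then F else 0 := by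
    ext1 e
    rw [coeff_cfu, MvPowerSeries.coeff_map, MvPolynomial.coeff_C]
    by_cases h : 0 = ν
    · rw [if_pos h, if_pos h.symm]
    · rw [if_neg h, if_neg (Ne.symm h), map_zero]
  rw [this]
  split_ifs <;> simp

/-- A tame family is, up to scalars, bounded away from zero where it is nonzero. -/
lemma Tame.exists_normalized (hπ0 : π ≠ 0) (hπ : ‖(π : K)‖ < 1) {S : Set X} {f : X → Pow K N}
    (hf : Tame π S f) : ∃ (q : ℕ) (a : X → Ro K) (g : X → Pow K N), Tame π S g ∧
      ∀ x ∈ S, f x = MvPowerSeries.C (a x) * g x ∧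
        (f x ≠ 0 → ∃ ν, ‖(π : K)‖ ^ q ≤ ‖((MvPowerSeries.coeff ν (g x) : Ro K) : K)‖) := by
  classical
  obtain ⟨σ, τ, _, _, D, F, hF, h1⟩ := hf
  have hπp : 0 < ‖(π : K)‖ := by simpa using hπ0
  let M : Ideal (RS K σ τ) :=
    { carrier := {g | ∃ q : ℕ, ∀ x ∈ S, ∃ ν,
        ‖(π : K)‖ ^ q * ‖(D.ev x g : K)‖ ≤ ‖(D.ev x (cfu ν F) : K)‖}
      zero_mem' := ⟨0, fun x _ => ⟨0, by simp⟩⟩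
      add_mem' := by
        rintro g g' ⟨q, hq⟩ ⟨q', hq'⟩
        refine ⟨q + q', fun x hx => ?_⟩
        obtain ⟨ν, hν⟩ := hq x hx
        obtain ⟨ν', hν'⟩ := hq' x hx
        have e1 : ‖(D.ev x (g + g') : K)‖ ≤ max ‖(D.ev x g : K)‖ ‖(D.ev x g' : K)‖ := by
          rw [map_add]
          exact IsUltrametricDist.norm_add_le_max _ _
        have h3 : ‖(π : K)‖ ^ (q + q') ≤ ‖(π : K)‖ ^ q :=
          pow_le_pow_of_le_one hπp.le hπ.le (by omega)
        have h3' : ‖(π : K)‖ ^ (q + q') ≤ ‖(π : K)‖ ^ q' :=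
          pow_le_pow_of_le_one hπp.le hπ.le (by omega)
        rcases le_max_iff.1 e1 with h | h
        · refine ⟨ν, le_trans ?_ hν⟩
          gcongr
        · refine ⟨ν', le_trans ?_ hν'⟩
          gcongr
      smul_mem' := by
        rintro c g ⟨q, hq⟩
        refine ⟨q, fun x hx => ?_⟩
        obtain ⟨ν, hν⟩ := hq x hx
        refine ⟨ν, le_trans ?_ hν⟩
        have e1 : ‖(D.ev x (c * g) : K)‖ ≤ ‖(D.ev x g : K)‖ := by
          rw [map_mul, Ro.norm_mul]
          exact mul_le_of_le_one_left (norm_nonneg _) (Ro.norm_le _)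
        rw [smul_eq_mul]
        gcongr }
  have hM : Sat π M := by
    refine ⟨?_, ⟨0, fun x _ => ⟨0, ?_⟩⟩⟩
    · rintro c hc g ⟨q, hq⟩
      obtain ⟨k, hk⟩ := Ro.exists_pow_dvd (c := c) (d := π) hπ hc
      refine ⟨q + k, fun x hx => ?_⟩
      obtain ⟨ν, hν⟩ := hq x hx
      refine ⟨ν, le_trans ?_ hν⟩
      have h2 := Ro.dvd_iff.1 hk
      rw [map_mul, Dat.ev_C, MvPolynomial.eval_C, Ro.norm_mul, ← mul_assoc, pow_add]
      have h3 : ‖(π : K)‖ ^ k ≤ ‖(c : K)‖ := by simpa using h2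
      gcongr
    · rw [map_sub, Dat.ev_X, Dat.ev_C, MvPolynomial.eval_C, D.hT, sub_self]
      simp
  obtain ⟨l, g, hgM, -, hgen⟩ := exists_generators hπ0 hM
  obtain ⟨Q, H, hQ, hFQ⟩ := hgen (Fin N) F hF fun ν => ⟨0, fun x _ => ⟨ν, by simp⟩⟩
  have hT : ∀ x, D.ev x (Tpi σ τ π) = 0 := fun x => by
    rw [map_sub, Dat.ev_X, Dat.ev_C, MvPolynomial.eval_C, D.hT, sub_self]
  have hval : ∀ x ∈ S, f x = ∑ i, D.Ev N x (Q i) * MvPowerSeries.C (D.ev x (g i)) := fun x hx => by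
    rw [h1 x hx, hFQ, map_add, map_sum, map_mul, Dat.Ev_inJ, hT, map_zero, zero_mul, add_zero]
    refine Finset.sum_congr rfl fun i _ => ?_
    rw [map_mul, Dat.Ev_inJ]
  rcases Nat.eq_zero_or_pos l with rfl | hl
  · refine ⟨0, fun _ => 0, fun _ => 0, by simpa using Tame.C_fun (N := N) (S := S) hπ fun _ => 0,
      fun x hx => ?_⟩
    have : f x = 0 := by simpa using hval x hx
    simp [this]
  have : Nonempty (Fin l) := ⟨⟨0, hl⟩⟩
  have hmax : ∀ x, ∃ i0, ∀ i, D.ev x (g i0) ∣ D.ev x (g i) := fun x => by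
    obtain ⟨i0, -, h⟩ := Finset.exists_max_image Finset.univ (fun i => ‖(D.ev x (g i) : K)‖)
      Finset.univ_nonempty
    exact ⟨i0, fun i => Ro.dvd_iff.2 (h i (Finset.mem_univ _))⟩
  choose i0 hi0 using hmax
  choose t ht using hi0
  choose q hq using hgM
  refine ⟨Finset.univ.sup q, fun x => D.ev x (g (i0 x)),
    fun x => ∑ i, D.Ev N x (Q i) * MvPowerSeries.C (t x i),
    Tame.sum _ hπ fun i _ => Tame.mul ⟨σ, τ, ‹_›, ‹_›, D, Q i, hQ i, fun _ _ => rfl⟩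
      (Tame.C_fun hπ _), fun x hx => ?_⟩
  have e1 : f x = MvPowerSeries.C (D.ev x (g (i0 x))) *
      ∑ i, D.Ev N x (Q i) * MvPowerSeries.C (t x i) := by
    rw [hval x hx, Finset.mul_sum]
    refine Finset.sum_congr rfl fun i _ => ?_
    rw [ht x i, map_mul]
    ring
  refine ⟨e1, fun hne => ?_⟩
  have ha : D.ev x (g (i0 x)) ≠ 0 := fun h => hne (by rw [e1, h, map_zero, zero_mul])
  obtain ⟨ν, hν⟩ := hq (i0 x) x hx
  refine ⟨ν, ?_⟩
  rw [← Dat.coeff_Ev, ← h1 x hx, e1, MvPowerSeries.coeff_C_mul, Ro.norm_mul, mul_comm] at hν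
  have hp : 0 < ‖(D.ev x (g (i0 x)) : K)‖ := by simpa using ha
  refine le_trans ?_ (le_of_mul_le_mul_left hν hp)
  exact pow_le_pow_of_le_one hπp.le hπ.le (Finset.le_sup (Finset.mem_univ _))

/-- The inclusion of series with coefficients in a local subring. -/
abbrev incLoc (σ τ J : Type) (s : Finset (Ro K)) :
    MvPowerSeries (Option τ) (MvPolynomial J (MvPolynomial σ (Loc s))) →+* RJ K σ τ J :=
  MvPowerSeries.map (MvPolynomial.map (MvPolynomial.map (Loc s).subtype))

lemma tc_incLoc (s : Finset (Ro K)) (F) (e ν α) :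
    tc (incLoc σ τ J s F) e ν α = (((MvPowerSeries.coeff e F).coeff ν).coeff α : Loc s) := by
  rw [tc, MvPowerSeries.coeff_map, MvPolynomial.coeff_map, MvPolynomial.coeff_map]
  rfl

lemma exists_incLoc {s : Finset (Ro K)} {G : RJ K σ τ J} (h : ∀ e ν α, tc G e ν α ∈ Loc s) :
    ∃ G0, incLoc σ τ J s G0 = G := by
  classical
  let p : Ro K → Loc s := fun a => if h : a ∈ Loc s then ⟨a, h⟩ else 0
  have hp0 : p 0 = 0 := by simp [p]
  refine ⟨mvMk fun e => mp (mp p hp0) (mp_zero p hp0) (MvPowerSeries.coeff e G), tc_ext fun e ν α => ?_⟩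
  rw [tc_incLoc, coeff_mvMk, coeff_mp, coeff_mp]
  have : (MvPolynomial.coeff α (MvPolynomial.coeff ν (MvPowerSeries.coeff e G))) ∈ Loc s := h e ν α
  simp only [p, dif_pos this]
  rfl

lemma incLoc_mem (s : Finset (Ro K)) (F) : incLoc σ τ J s F ∈ QJ K σ τ J :=
  mem_QJ.2 fun _ => ⟨s, fun e _ ν α => by rw [tc_incLoc]; exact Subtype.prop _⟩

lemma exists_truncation (n : ℕ) : ∀ G : RJ K σ τ J, G ∈ QJ K σ τ J →
    ∃ (s : Finset (Ro K)) (A : _) (B : RJ K σ τ J), B ∈ QJ K σ τ J ∧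
      G = incLoc σ τ J s A + MvPowerSeries.X none ^ n * B := by
  classical
  induction n with
  | zero => exact fun G hG => ⟨∅, 0, G, hG, by simp⟩
  | succ n ih =>
    intro G hG
    obtain ⟨s, A, B, hB, h⟩ := ih (sh G) (sh_mem hG)
    obtain ⟨s', hs'⟩ := mem_QJ.1 hG 0
    have h1 : ∀ e ν α, tc (z0 G + MvPowerSeries.X none * incLoc σ τ J s A) e ν α ∈ Loc (s ∪ s') := by
      intro e ν α
      rw [tc_add, tc_z0]
      refine Subring.add_mem _ ?_ ?_
      · split_ifs with he
        · exact Loc.mono Finset.subset_union_right (hs' e he.le ν α)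
        · exact Subring.zero_mem _
      · have h2 : (MvPowerSeries.X none * incLoc σ τ J s A) = incLoc σ τ J s (MvPowerSeries.X none * A) := by
          rw [map_mul, MvPowerSeries.map_X]
        rw [h2, tc_incLoc]
        exact Loc.mono Finset.subset_union_left (Subtype.prop _)
    obtain ⟨A', hA'⟩ := exists_incLoc h1
    refine ⟨_, A', B, hB, ?_⟩
    rw [hA', pow_succ']
    have h3 := z0_add_T_mul_sh G
    linear_combination (MvPowerSeries.X none) * h - h3

lemma exists_finite_span {R ι : Type*} [CommRing R] [IsNoetherianRing R] (b : ι → R) :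
    ∃ J : Finset ι, ∀ ν, b ν ∈ Ideal.span (Set.range fun μ : J => b μ) := by
  classical
  obtain ⟨S', hS', h⟩ := (Submodule.fg_span_iff_fg_span_finset_subset (Set.range b)).1
    (IsNoetherian.noetherian (Ideal.span (Set.range b)))
  have hc : ∀ x : S', ∃ ν, b ν = x := fun x => hS' x.2
  choose c hc using hc
  refine ⟨Finset.univ.image c, fun ν => ?_⟩
  have h1 : b ν ∈ Ideal.span (Set.range b) := Ideal.subset_span ⟨ν, rfl⟩
  have h2 : Ideal.span (Set.range b) = Ideal.span S' := h
  rw [h2] at h1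
  refine Ideal.span_mono ?_ h1
  intro x hx
  exact ⟨⟨c ⟨x, hx⟩, Finset.mem_image_of_mem _ (Finset.mem_univ _)⟩, hc ⟨x, hx⟩⟩

lemma exists_finite_combination [Finite σ] [Finite τ] {G : RJ K σ τ J} (hG : G ∈ QJ K σ τ J) (n : ℕ) :
    ∃ (I : Finset (J →₀ ℕ)) (A B : RJ K σ τ J) (C : (J →₀ ℕ) → RJ K σ τ J), B ∈ QJ K σ τ J ∧
      (∀ μ, C μ ∈ QJ K σ τ J) ∧ (∀ μ, (MvPowerSeries.constantCoeff (C μ)).support ⊆ I) ∧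
      G = A + MvPowerSeries.X none ^ n * B ∧ A = ∑ μ ∈ I, C μ * inJ J (cfu μ A) := by
  classical
  obtain ⟨s, A, B, hB, h⟩ := exists_truncation n G hG
  have := Loc.isNoetherianRing s
  have : IsNoetherianRing (MvPowerSeries (Option τ) (MvPolynomial σ (Loc s))) := inferInstance
  obtain ⟨I, hI⟩ := exists_finite_span fun ν => cfu ν A
  obtain ⟨C, hC⟩ := exists_combination (fun μ : I => cfu (μ : J →₀ ℕ) A) A hI
  let C' : (J →₀ ℕ) → RJ K σ τ J := fun μ => if h : μ ∈ I then incLoc σ τ J s (C ⟨μ, h⟩) else 0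
  have hC' : ∀ μ, μ ∉ I → C' μ = 0 := fun μ h => dif_neg h
  have hcfu : ∀ μ, inJ J (cfu μ (incLoc σ τ J s A)) = incLoc σ τ J s (incl _ _ _ (cfu μ A)) := by
    intro μ
    ext1 e
    rw [MvPowerSeries.coeff_map, MvPowerSeries.coeff_map, MvPowerSeries.coeff_map, coeff_cfu,
      coeff_cfu, MvPolynomial.map_C, MvPowerSeries.coeff_map, MvPolynomial.coeff_map]
  refine ⟨I ∪ I.biUnion fun μ => (MvPowerSeries.constantCoeff (C' μ)).support, incLoc σ τ J s A, B,
    C', hB, fun μ => ?_, fun μ => ?_, h, ?_⟩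
  · by_cases h : μ ∈ I
    · simp only [C', dif_pos h]
      exact incLoc_mem _ _
    · rw [hC' _ h]; exact Subring.zero_mem _
  · by_cases h : μ ∈ I
    · exact (Finset.subset_biUnion_of_mem
        (fun μ => (MvPowerSeries.constantCoeff (C' μ)).support) h).trans Finset.subset_union_right
    · rw [hC' _ h]; simp
  · rw [← Finset.sum_subset Finset.subset_union_left fun μ _ hμ => by rw [hC' _ hμ, zero_mul],
      ← Finset.sum_coe_sort]
    conv_lhs => rw [hC, map_sum]
    refine Finset.sum_congr rfl fun μ _ => ?_
    rw [map_mul, hcfu]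
    simp only [C', dif_pos μ.2]

open Classical in
/-- Replace elements of norm one by zero. -/
def small (a : Ro K) : Ro K := if ‖(a : K)‖ < 1 then a else 0

lemma small_lt (a : Ro K) : ‖(small a : K)‖ < 1 := by
  rw [small]; split_ifs with h
  exacts [h, by simp]

lemma small_eq {a : Ro K} (h : ‖(a : K)‖ < 1) : small a = a := if_pos h

lemma dv_lt {c a : Ro K} (h : ‖(a : K)‖ < ‖(c : K)‖) : ‖(dv c a : K)‖ < 1 := by
  have h1 := mul_dv h.le
  rw [← h1, Ro.norm_mul] at h
  by_contra! h2
  have := mul_le_mul_of_nonneg_left h2 (norm_nonneg (c : K))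
  linarith

lemma exists_norm_sum_le {ι : Type*} {s : Finset ι} (g : ι → Ro K) (h : ((∑ i ∈ s, g i : Ro K) : K) ≠ 0) :
    ∃ i ∈ s, ‖((∑ i ∈ s, g i : Ro K) : K)‖ ≤ ‖(g i : K)‖ := by
  classical
  by_contra! hc
  have hne : s.Nonempty := by
    by_contra hs
    rw [Finset.not_nonempty_iff_eq_empty] at hs
    simp [hs] at h
  obtain ⟨i, hi, hle⟩ := IsUltrametricDist.exists_norm_finsetSum_le_of_nonempty hne
    (fun i => (g i : K))
  have h1 : ((∑ i ∈ s, g i : Ro K) : K) = ∑ i ∈ s, (g i : K) := by simp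
  rw [← h1] at hle
  exact absurd (hc i hi) (not_lt.2 hle)

/-- The numerical part of the normal form. -/
lemma dominant_of_truncation {ι : Type*} {I : Finset ι} {q : ℕ} (hπ0 : π ≠ 0) (hπ : ‖(π : K)‖ < 1)
    (b c e : ι → Ro K) (hb : ∀ ν, b ν = c ν + π ^ (q + 1) * e ν) (d : ι → ι → Ro K)
    (hc : ∀ ν, c ν = ∑ μ ∈ I, d ν μ * c μ) (hq : ∃ ν, ‖(π : K)‖ ^ q ≤ ‖(b ν : K)‖) :
    ∀ ν, ∃ μ ∈ I, ‖(b ν : K)‖ ≤ ‖(b μ : K)‖ ∧ ‖(π : K)‖ ^ q ≤ ‖(b μ : K)‖ := by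
  have hπp : 0 < ‖(π : K)‖ := by simpa using hπ0
  have hlt : ‖(π : K)‖ ^ (q + 1) < ‖(π : K)‖ ^ q := by
    rw [pow_succ]
    exact mul_lt_of_lt_one_right (pow_pos hπp _) hπ
  have hsm : ∀ ν, ‖((π ^ (q + 1) * e ν : Ro K) : K)‖ ≤ ‖(π : K)‖ ^ (q + 1) := fun ν => by
    rw [Ro.norm_mul]
    refine (mul_le_of_le_one_right (norm_nonneg _) (Ro.norm_le _)).trans ?_
    simp
  have key : ∀ ν, ‖(π : K)‖ ^ q ≤ ‖(b ν : K)‖ → ∃ μ ∈ I, ‖(b ν : K)‖ ≤ ‖(b μ : K)‖ := by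
    intro ν hν
    have h1 : ‖(b ν : K)‖ ≤ ‖(c ν : K)‖ := by
      have h2 : ‖(b ν : K)‖ ≤ max ‖(c ν : K)‖ ‖((π ^ (q + 1) * e ν : Ro K) : K)‖ := by
        rw [hb]
        exact IsUltrametricDist.norm_add_le_max _ _
      rcases le_max_iff.1 h2 with h | h
      · exact h
      · exact absurd (hν.trans (h.trans (hsm ν))) (not_le.2 hlt)
    have h3 : (c ν : K) ≠ 0 := by
      intro h0
      rw [h0, norm_zero] at h1
      exact absurd (hν.trans h1) (not_le.2 (pow_pos hπp _))
    rw [hc ν] at h3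
    obtain ⟨μ, hμ, hle⟩ := exists_norm_sum_le _ h3
    rw [← hc ν, Ro.norm_mul] at hle
    have h4 : ‖(c ν : K)‖ ≤ ‖(c μ : K)‖ :=
      hle.trans (mul_le_of_le_one_left (norm_nonneg _) (Ro.norm_le _))
    refine ⟨μ, hμ, h1.trans (h4.trans ?_)⟩
    have h5 : ‖(c μ : K)‖ ≤ max ‖(b μ : K)‖ ‖((π ^ (q + 1) * e μ : Ro K) : K)‖ := by
      have h6 : (c μ : K) = b μ - (π ^ (q + 1) * e μ : Ro K) := by
        rw [hb]; push_cast; ring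
      rw [h6, sub_eq_add_neg]
      refine (IsUltrametricDist.norm_add_le_max _ _).trans ?_
      rw [norm_neg]
    rcases le_max_iff.1 h5 with h | h
    · exact h
    · exact absurd (hν.trans (h1.trans (h4.trans (h.trans (hsm μ))))) (not_le.2 hlt)
  intro ν
  rcases le_or_gt (‖(π : K)‖ ^ q) ‖(b ν : K)‖ with h | h
  · obtain ⟨μ, hμ, hle⟩ := key ν h
    exact ⟨μ, hμ, hle, h.trans hle⟩
  · obtain ⟨ν', hν'⟩ := hq
    obtain ⟨μ, hμ, hle⟩ := key ν' hν'
    exact ⟨μ, hμ, h.le.trans (hν'.trans hle), hν'.trans hle⟩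

/-- The formal normal form. -/
lemma exists_formal_normal_form [Finite σ] [Finite τ] (D : Dat π X σ τ) {I : Finset (Fin N →₀ ℕ)}
    {B : RJ K σ τ (Fin N)} {C : (Fin N →₀ ℕ) → RJ K σ τ (Fin N)} (hB : B ∈ QJ K σ τ (Fin N))
    (hC : ∀ μ, C μ ∈ QJ K σ τ (Fin N))
    (hCI : ∀ μ, (MvPowerSeries.constantCoeff (C μ)).support ⊆ I)
    (wt : (Fin N →₀ ℕ) → ℕ) (hwt : Set.InjOn wt I) {ν0 : Fin N →₀ ℕ} (hν0 : ν0 ∈ I)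
    (t : X → (Fin N →₀ ℕ) → Ro K) (p : X → Ro K) (Y : X → (Fin N →₀ ℕ) → Ro K) :
    ∃ (σ' τ' : Type) (_ : Finite σ') (_ : Finite τ') (D' : Dat π X σ' τ') (F : RJ K σ' τ' (Fin N))
      (a : (Fin N →₀ ℕ) → MvPolynomial σ' (Ro K)), F ∈ QJ K σ' τ' (Fin N) ∧
      MvPowerSeries.constantCoeff F = MvPolynomial.monomial ν0 1 +
        ∑ ν ∈ I with wt ν < wt ν0, MvPolynomial.monomial ν (a ν) ∧
      ∀ x, ‖(p x : K)‖ < 1 → Y x ν0 = 1 → (∀ ν ∈ I, wt ν0 < wt ν → ‖(Y x ν : K)‖ < 1) →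
        (∀ ν ∈ I, Y x ν = MvPowerSeries.coeff ν (∑ μ ∈ I, MvPowerSeries.C (t x μ) * D.Ev N x (C μ) +
          MvPowerSeries.C (p x) * D.Ev N x B)) →
        D'.Ev N x F = ∑ μ ∈ I, MvPowerSeries.C (t x μ) * D.Ev N x (C μ) +
          MvPowerSeries.C (p x) * D.Ev N x B := by
  classical
  let D' : Dat π X (σ ⊕ (I ⊕ I)) (τ ⊕ Option I) := D.extend
    (fun x => Sum.elim (fun μ : I => t x μ) (fun ν : I => Y x ν))
    (fun x => fun o => o.elim (small (p x)) fun ν => small (Y x ν))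
    (fun x o => by cases o <;> exact small_lt _)
  let L : RJ K σ τ (Fin N) →+* RJ K (σ ⊕ (I ⊕ I)) (τ ⊕ Option I) (Fin N) :=
    Dat.lift Sum.inl Sum.inl (Fin N)
  have hL : ∀ F ∈ QJ K σ τ (Fin N), L F ∈ QJ K (σ ⊕ (I ⊕ I)) (τ ⊕ Option I) (Fin N) := fun F hF =>
    Dat.lift_mem Sum.inl_injective Sum.inl_injective hF
  have hLE : ∀ x F, D'.Ev N x (L F) = D.Ev N x F := fun x F =>
    Dat.Ev_lift D D' _ _ x (fun _ => rfl) (fun _ => rfl) F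
  let F' : RJ K (σ ⊕ (I ⊕ I)) (τ ⊕ Option I) (Fin N) :=
    ∑ μ : I, MvPowerSeries.C (MvPolynomial.C (MvPolynomial.X (Sum.inr (Sum.inl μ)))) * L (C μ) +
      MvPowerSeries.X (some (Sum.inr none)) * L B
  have hF'mem : F' ∈ QJ K (σ ⊕ (I ⊕ I)) (τ ⊕ Option I) (Fin N) :=
    Subring.add_mem _ (Subring.sum_mem _ fun μ _ => Subring.mul_mem _
      (mem_QJ_C ⟨∅, C_mem_polyIn (X_mem_polyIn _)⟩) (hL _ (hC _)))
      (Subring.mul_mem _ (mem_QJ_X _) (hL _ hB))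
  have hF'E : ∀ x, ‖(p x : K)‖ < 1 → D'.Ev N x F' =
      ∑ μ ∈ I, MvPowerSeries.C (t x μ) * D.Ev N x (C μ) + MvPowerSeries.C (p x) * D.Ev N x B := by
    intro x hp
    rw [map_add, map_sum, map_mul, hLE, Dat.Ev_X, ← Finset.sum_coe_sort I]
    congr 1
    · refine Finset.sum_congr rfl fun μ _ => ?_
      rw [map_mul, hLE, Dat.Ev_CC, MvPolynomial.eval_X]
      rfl
    · change MvPowerSeries.C (small (p x)) * _ = _
      rw [small_eq hp]
  have hF'c : (MvPowerSeries.constantCoeff F').support ⊆ I := by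
    have h1 : MvPowerSeries.constantCoeff F' = ∑ μ : I,
        MvPolynomial.C (MvPolynomial.X (Sum.inr (Sum.inl μ))) *
          MvPolynomial.map (MvPolynomial.rename Sum.inl).toRingHom
            (MvPowerSeries.constantCoeff (C μ)) := by
      simp only [F', map_add, map_sum, map_mul, MvPowerSeries.constantCoeff_X,
        MvPowerSeries.constantCoeff_C, zero_mul, add_zero]
      refine Finset.sum_congr rfl fun μ _ => ?_
      rw [Dat.constantCoeff_lift]
    intro ν hν
    by_contra hνI
    rw [MvPolynomial.mem_support_iff] at hν
    refine hν ?_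
    rw [h1, MvPolynomial.coeff_sum]
    refine Finset.sum_eq_zero fun μ _ => ?_
    rw [MvPolynomial.coeff_C_mul, MvPolynomial.coeff_map]
    have h2 : (MvPowerSeries.constantCoeff (C μ)).coeff ν = 0 := by
      by_contra h3
      exact hνI (hCI μ (MvPolynomial.mem_support_iff.2 h3))
    rw [h2, map_zero, mul_zero]
  let c : I → RS K (σ ⊕ (I ⊕ I)) (τ ⊕ Option I) := fun ν =>
    if (ν : Fin N →₀ ℕ) = ν0 then 1 else
      if wt ν < wt ν0 then MvPowerSeries.C (MvPolynomial.X (Sum.inr (Sum.inr ν))) else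
        MvPowerSeries.X (some (Sum.inr (some ν)))
  have hcmem : ∀ ν, inJ (Fin N) (c ν) ∈ QJ K (σ ⊕ (I ⊕ I)) (τ ⊕ Option I) (Fin N) := by
    intro ν
    simp only [c]
    split_ifs
    · rw [map_one]; exact Subring.one_mem _
    · rw [MvPowerSeries.map_C]
      exact mem_QJ_C ⟨∅, C_mem_polyIn (X_mem_polyIn _)⟩
    · rw [MvPowerSeries.map_X]
      exact mem_QJ_X _
  have hcfumem : ∀ ν, inJ (Fin N) (cfu ν F') ∈ QJ K (σ ⊕ (I ⊕ I)) (τ ⊕ Option I) (Fin N) :=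
    fun ν => inJ_mem (cfu_mem_Q0 hF'mem ν)
  let m : (Fin N →₀ ℕ) → RJ K (σ ⊕ (I ⊕ I)) (τ ⊕ Option I) (Fin N) := fun ν =>
    MvPowerSeries.C (MvPolynomial.monomial ν 1)
  refine ⟨σ ⊕ (I ⊕ I), τ ⊕ Option I, inferInstance, inferInstance, D',
    F' + ∑ ν : I, (inJ (Fin N) (c ν) - inJ (Fin N) (cfu (ν : Fin N →₀ ℕ) F')) * m ν,
    fun ν => if h : ν ∈ I then MvPolynomial.X (Sum.inr (Sum.inr ⟨ν, h⟩)) else 0,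
    Subring.add_mem _ hF'mem (Subring.sum_mem _ fun ν _ => Subring.mul_mem _
      (Subring.sub_mem _ (hcmem ν) (hcfumem _))
      (mem_QJ_C ⟨∅, monomial_mem_polyIn (Subring.one_mem _) _⟩)), ?_, ?_⟩
  · have h1 : MvPowerSeries.constantCoeff F' = ∑ ν : I,
        MvPolynomial.monomial (ν : Fin N →₀ ℕ) ((MvPowerSeries.constantCoeff F').coeff ν) := by
      conv_lhs => rw [MvPolynomial.as_sum (MvPowerSeries.constantCoeff F')]
      rw [Finset.sum_coe_sort I fun ν => MvPolynomial.monomial (ν : Fin N →₀ ℕ)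
        ((MvPowerSeries.constantCoeff F').coeff ν)]
      refine Finset.sum_subset hF'c fun ν _ hν => ?_
      rw [MvPolynomial.notMem_support_iff.1 hν, map_zero]
    have h2 : ∀ ν, MvPowerSeries.constantCoeff (inJ (Fin N) (cfu ν F')) =
        MvPolynomial.C ((MvPowerSeries.constantCoeff F').coeff ν) := fun ν => by
      rw [MvPowerSeries.constantCoeff_map]; rfl
    have h3 : ∀ ν : I, MvPowerSeries.constantCoeff (inJ (Fin N) (c ν)) =
        MvPolynomial.C (if (ν : Fin N →₀ ℕ) = ν0 then 1 else
      if wt ν < wt ν0 then (MvPolynomial.X (Sum.inr (Sum.inr ν))) else 0) := fun ν => by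
      rw [MvPowerSeries.constantCoeff_map]
      simp only [c]
      split_ifs
      · rw [map_one]
      · rw [MvPowerSeries.constantCoeff_C]
      · rw [MvPowerSeries.constantCoeff_X]
    rw [map_add, map_sum]
    have h4 : ∀ ν : I, MvPowerSeries.constantCoeff
        ((inJ (Fin N) (c ν) - inJ (Fin N) (cfu (ν : Fin N →₀ ℕ) F')) * m ν) =
        MvPolynomial.monomial (ν : Fin N →₀ ℕ) (if (ν : Fin N →₀ ℕ) = ν0 then 1 else
          if wt ν < wt ν0 then (MvPolynomial.X (Sum.inr (Sum.inr ν))) else 0) -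
        MvPolynomial.monomial (ν : Fin N →₀ ℕ) ((MvPowerSeries.constantCoeff F').coeff ν) := by
      intro ν
      rw [map_mul, map_sub, h2, h3, MvPowerSeries.constantCoeff_C, sub_mul,
        MvPolynomial.C_mul_monomial, MvPolynomial.C_mul_monomial, mul_one, mul_one]
    rw [Finset.sum_congr rfl fun ν _ => h4 ν, Finset.sum_sub_distrib, ← h1,
      add_sub_cancel]
    let φ : (Fin N →₀ ℕ) → MvPolynomial (Fin N) (MvPolynomial (σ ⊕ (I ⊕ I)) (Ro K)) := fun ν' =>
      (if ν' = ν0 then MvPolynomial.monomial ν' 1 else 0) +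
        (if wt ν' < wt ν0 then MvPolynomial.monomial ν' (if h : ν' ∈ I then
          (MvPolynomial.X (Sum.inr (Sum.inr (⟨ν', h⟩ : I)))) else 0) else 0)
    have h5 : ∀ ν : I, MvPolynomial.monomial (ν : Fin N →₀ ℕ) (if (ν : Fin N →₀ ℕ) = ν0 then
        (1 : MvPolynomial (σ ⊕ (I ⊕ I)) (Ro K)) else
          if wt ν < wt ν0 then (MvPolynomial.X (Sum.inr (Sum.inr ν))) else 0) = φ ν := by
      intro ν
      by_cases hν : (ν : Fin N →₀ ℕ) = ν0
      · simp [hν, φ]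
      · by_cases h : wt ν < wt ν0 <;> simp [hν, h, φ]
    rw [Finset.sum_congr rfl fun ν _ => h5 ν, Finset.sum_coe_sort I φ]
    simp only [φ]
    rw [Finset.sum_add_distrib, Finset.sum_ite_eq' I, if_pos hν0, Finset.sum_filter]
  · intro x hp hY0 hYlt hY
    rw [← hF'E x hp] at hY ⊢
    rw [map_add, map_sum]
    refine add_eq_left.2 (Finset.sum_eq_zero fun ν _ => ?_)
    rw [map_mul, map_sub, Dat.Ev_inJ, Dat.Ev_inJ, ← Dat.coeff_Ev, ← hY ν ν.2]
    have : D'.ev x (c ν) = Y x ν := by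
      simp only [c]
      split_ifs with h1 h2
      · rw [h1, hY0, map_one]
      · rw [Dat.ev_C, MvPolynomial.eval_X]; rfl
      · rw [Dat.ev_X]
        have h3 : wt ν0 < wt ν := by
          refine lt_of_le_of_ne (not_lt.1 h2) fun h => h1 (hwt ν.2 hν0 h.symm)
        change small (Y x ν) = _
        exact small_eq (hYlt ν ν.2 h3)
    rw [this, sub_self, zero_mul]

/-- The normal form of a tame family. -/
theorem Tame.exists_normal_form (hπ0 : π ≠ 0) (hπ : ‖(π : K)‖ < 1) {S : Set X} {f : X → Pow K N}
    (hf : Tame π S f) : ∃ I : Finset (Fin N →₀ ℕ),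
      (∀ x ∈ S, f x ≠ 0 → ∃ ν0 ∈ I, MvPowerSeries.coeff ν0 (f x) ≠ 0 ∧ ∀ ν,
        ‖((MvPowerSeries.coeff ν (f x) : Ro K) : K)‖ ≤
          ‖((MvPowerSeries.coeff ν0 (f x) : Ro K) : K)‖) ∧
      ∀ wt : (Fin N →₀ ℕ) → ℕ, Set.InjOn wt I → ∀ ν0 ∈ I,
      ∃ (σ τ : Type) (_ : Finite σ) (_ : Finite τ) (D : Dat π X σ τ) (F : RJ K σ τ (Fin N))
        (a : (Fin N →₀ ℕ) → MvPolynomial σ (Ro K)), F ∈ QJ K σ τ (Fin N) ∧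
        MvPowerSeries.constantCoeff F = MvPolynomial.monomial ν0 1 +
          ∑ ν ∈ I with wt ν < wt ν0, MvPolynomial.monomial ν (a ν) ∧
        ∀ x ∈ S, MvPowerSeries.coeff ν0 (f x) ≠ 0 →
          (∀ ν ∈ I, ‖((MvPowerSeries.coeff ν (f x) : Ro K) : K)‖ ≤
            ‖((MvPowerSeries.coeff ν0 (f x) : Ro K) : K)‖) →
          (∀ ν ∈ I, wt ν0 < wt ν → ‖((MvPowerSeries.coeff ν (f x) : Ro K) : K)‖ <
            ‖((MvPowerSeries.coeff ν0 (f x) : Ro K) : K)‖) →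
          f x = MvPowerSeries.C (MvPowerSeries.coeff ν0 (f x)) * D.Ev N x F := by
  classical
  obtain ⟨q, s, g, ⟨σ, τ, _, _, D, G, hG, hgG⟩, hg⟩ := hf.exists_normalized hπ0 hπ
  obtain ⟨I, A, B, C, hB, hC, hCI, hGA, hA⟩ := exists_finite_combination hG (q + 1)
  have hπp : 0 < ‖(π : K)‖ := by simpa using hπ0
  let b : X → (Fin N →₀ ℕ) → Ro K := fun x ν => MvPowerSeries.coeff ν (g x)
  let c : X → (Fin N →₀ ℕ) → Ro K := fun x ν => D.ev x (cfu ν A)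
  have hAx : ∀ x, D.Ev N x A = ∑ μ ∈ I, D.Ev N x (C μ) * MvPowerSeries.C (c x μ) := by
    intro x
    conv_lhs => rw [hA, map_sum]
    refine Finset.sum_congr rfl fun μ _ => ?_
    rw [map_mul, Dat.Ev_inJ]
  have hgx : ∀ x ∈ S, g x = D.Ev N x A + MvPowerSeries.C (π ^ (q + 1)) * D.Ev N x B := by
    intro x hx
    rw [hgG x hx, hGA, map_add, map_mul, map_pow, Dat.Ev_X, D.hT, ← map_pow]
  have hb : ∀ x ∈ S, ∀ ν, b x ν = c x ν + π ^ (q + 1) * MvPowerSeries.coeff ν (D.Ev N x B) := by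
    intro x hx ν
    simp only [b, c]
    rw [hgx x hx, map_add, MvPowerSeries.coeff_C_mul, Dat.coeff_Ev]
  have hc : ∀ x ν, c x ν = ∑ μ ∈ I, MvPowerSeries.coeff ν (D.Ev N x (C μ)) * c x μ := by
    intro x ν
    conv_lhs => rw [show c x ν = MvPowerSeries.coeff ν (D.Ev N x A) from (Dat.coeff_Ev D x A ν).symm, hAx,
      map_sum]
    refine Finset.sum_congr rfl fun μ _ => ?_
    rw [mul_comm, MvPowerSeries.coeff_C_mul, mul_comm]
  have hdom : ∀ x ∈ S, f x ≠ 0 → ∀ ν, ∃ μ ∈ I, ‖(b x ν : K)‖ ≤ ‖(b x μ : K)‖ ∧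
      ‖(π : K)‖ ^ q ≤ ‖(b x μ : K)‖ := fun x hx hne =>
    dominant_of_truncation hπ0 hπ (b x) (c x) _ (hb x hx) _ (hc x) ((hg x hx).2 hne)
  have hfb : ∀ x ∈ S, ∀ ν, MvPowerSeries.coeff ν (f x) = s x * b x ν := by
    intro x hx ν
    conv_lhs => rw [(hg x hx).1]
    rw [MvPowerSeries.coeff_C_mul]
  refine ⟨I, fun x hx hne => ?_, fun wt hwt ν0 hν0 => ?_⟩
  · obtain ⟨μ1, hμ1, -⟩ := hdom x hx hne 0
    obtain ⟨ν0, hν0, hmax⟩ := Finset.exists_max_image I (fun ν => ‖(b x ν : K)‖) ⟨μ1, hμ1⟩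
    have hall : ∀ ν, ‖(b x ν : K)‖ ≤ ‖(b x ν0 : K)‖ := fun ν => by
      obtain ⟨μ, hμ, h1, -⟩ := hdom x hx hne ν
      exact h1.trans (hmax μ hμ)
    refine ⟨ν0, hν0, fun h0 => hne ?_, fun ν => ?_⟩
    · rw [hfb x hx] at h0
      rcases mul_eq_zero.1 h0 with h | h
      · rw [(hg x hx).1, h, map_zero, zero_mul]
      · have h2 : g x = 0 := by
          ext1 ν
          have := hall ν
          rw [h] at this
          simpa using this
        rw [(hg x hx).1, h2, mul_zero]
    · rw [hfb x hx, hfb x hx, Ro.norm_mul, Ro.norm_mul]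
      exact mul_le_mul_of_nonneg_left (hall ν) (norm_nonneg _)
  · obtain ⟨σ', τ', i1, i2, D', F, a, hF, hFc, hFE⟩ := exists_formal_normal_form D hB hC hCI wt hwt hν0
      (fun x μ => dv (b x ν0) (c x μ)) (fun x => dv (b x ν0) (π ^ (q + 1)))
      (fun x ν => dv (b x ν0) (b x ν))
    refine ⟨σ', τ', i1, i2, D', F, a, hF, hFc, fun x hx h0 hle hlt => ?_⟩
    have hfne : f x ≠ 0 := fun h => h0 (by rw [h, map_zero])
    rw [hfb x hx] at h0
    have hs0 : 0 < ‖(s x : K)‖ := by simpa using left_ne_zero_of_mul h0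
    have hb0 : b x ν0 ≠ 0 := right_ne_zero_of_mul h0
    have hle' : ∀ ν ∈ I, ‖(b x ν : K)‖ ≤ ‖(b x ν0 : K)‖ := fun ν hν => by
      have := hle ν hν
      rw [hfb x hx, hfb x hx, Ro.norm_mul, Ro.norm_mul] at this
      exact le_of_mul_le_mul_left this hs0
    have hlt' : ∀ ν ∈ I, wt ν0 < wt ν → ‖(b x ν : K)‖ < ‖(b x ν0 : K)‖ := fun ν hν hw => by
      have := hlt ν hν hw
      rw [hfb x hx, hfb x hx, Ro.norm_mul, Ro.norm_mul] at this
      exact lt_of_mul_lt_mul_left this hs0.le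
    have hbig : ‖(π : K)‖ ^ q ≤ ‖(b x ν0 : K)‖ := by
      obtain ⟨μ, hμ, -, h2⟩ := hdom x hx hfne 0
      exact h2.trans (hle' μ hμ)
    have hall : ∀ ν, ‖(b x ν : K)‖ ≤ ‖(b x ν0 : K)‖ := fun ν => by
      obtain ⟨μ, hμ, h1, -⟩ := hdom x hx hfne ν
      exact h1.trans (hle' μ hμ)
    have hplt : ‖((π ^ (q + 1) : Ro K) : K)‖ < ‖(b x ν0 : K)‖ := by
      refine lt_of_lt_of_le ?_ hbig
      have : ‖((π ^ (q + 1) : Ro K) : K)‖ = ‖(π : K)‖ ^ (q + 1) := by simp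
      rw [this, pow_succ]
      exact mul_lt_of_lt_one_right (pow_pos hπp _) hπ
    have hcle : ∀ μ, ‖(c x μ : K)‖ ≤ ‖(b x ν0 : K)‖ := fun μ => by
      have h6 : (c x μ : K) = b x μ + -((π ^ (q + 1) * MvPowerSeries.coeff μ (D.Ev N x B) : Ro K) : K) := by
        rw [hb x hx]; push_cast; ring
      rw [h6]
      refine (IsUltrametricDist.norm_add_le_max _ _).trans (max_le (hall μ) ?_)
      rw [norm_neg, Ro.norm_mul]
      exact (mul_le_of_le_one_right (norm_nonneg _) (Ro.norm_le _)).trans hplt.le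
    have hval : MvPowerSeries.C (b x ν0) * (∑ μ ∈ I, MvPowerSeries.C (dv (b x ν0) (c x μ)) *
        D.Ev N x (C μ) + MvPowerSeries.C (dv (b x ν0) (π ^ (q + 1))) * D.Ev N x B) = g x := by
      rw [hgx x hx, hAx, mul_add, ← mul_assoc, ← map_mul, mul_dv hplt.le, Finset.mul_sum]
      congr 1
      refine Finset.sum_congr rfl fun μ _ => ?_
      rw [← mul_assoc, ← map_mul, mul_dv (hcle μ), mul_comm]
    have hE := hFE x (dv_lt hplt) (by simpa using dv_cancel (1 : Ro K) hb0)
      (fun ν hν hw => dv_lt (hlt' ν hν hw)) (fun ν _ => by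
        refine mul_left_cancel₀ hb0 ?_
        rw [mul_dv (hall ν), ← MvPowerSeries.coeff_C_mul, hval])
    rw [hE, hfb x hx, map_mul, mul_assoc, hval]
    exact (hg x hx).1

end

section WP
variable {I A : Type} [CommRing A]

/-- Polynomials in one variable with coefficients in a subring. -/
def upolyIn (P : Subring A) : Subring (Polynomial A) := (Polynomial.mapRingHom P.subtype).range

lemma mem_upolyIn {P : Subring A} {p : Polynomial A} : p ∈ upolyIn P ↔ ∀ i, p.coeff i ∈ P := by
  constructor
  · rintro ⟨q, rfl⟩ i
    rw [Polynomial.coe_mapRingHom, Polynomial.coeff_map]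
    exact (q.coeff i).2
  · intro h
    refine ⟨p.toSubring P fun c hc => ?_, Polynomial.map_toSubring _ _ _⟩
    obtain ⟨i, -, rfl⟩ := Polynomial.mem_coeffs_iff.1 (Finset.mem_coe.1 hc)
    exact h i

lemma div_mem_upolyIn {P : Subring A} {f p : Polynomial A} (hp : p.Monic) (hpP : p ∈ upolyIn P)
    (hf : f ∈ upolyIn P) : f /ₘ p ∈ upolyIn P ∧ f %ₘ p ∈ upolyIn P := by
  obtain ⟨f', rfl⟩ := hf
  have h : (p.coeffs : Set A) ⊆ P := fun c hc => by
    obtain ⟨i, -, rfl⟩ := Polynomial.mem_coeffs_iff.1 (Finset.mem_coe.1 hc)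
    exact mem_upolyIn.1 hpP i
  have h1 : (p.toSubring P h).Monic := (Polynomial.monic_toSubring p P h).2 hp
  have h2 := Polynomial.map_toSubring p P h
  constructor
  · refine ⟨f' /ₘ p.toSubring P h, ?_⟩
    rw [Polynomial.coe_mapRingHom, Polynomial.map_divByMonic _ h1, h2]
  · refine ⟨f' %ₘ p.toSubring P h, ?_⟩
    rw [Polynomial.coe_mapRingHom, Polynomial.map_modByMonic _ h1, h2]

open Classical in
/-- The coefficients of the factors in the preparation theorem. -/
def wpAux (F : MvPowerSeries I (Polynomial A)) : (I →₀ ℕ) → Polynomial A × Polynomial A :=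
  WellFounded.fix (r := fun a b : I →₀ ℕ => a.degree < b.degree) (InvImage.wf _ Nat.lt_wfRel.wf)
    fun e W =>
    if e = 0 then (1, MvPowerSeries.constantCoeff F) else
      let G := MvPowerSeries.coeff e F - ∑ ab ∈ Finset.HasAntidiagonal.antidiagonal e,
        if h : ab.1.degree < e.degree ∧ ab.2.degree < e.degree then
          (W ab.1 h.1).1 * (W ab.2 h.2).2 else 0
      (G /ₘ MvPowerSeries.constantCoeff F, G %ₘ MvPowerSeries.constantCoeff F)

open Classical in
/-- The remainder in the recursion of the preparation theorem. -/
def wpRem (F : MvPowerSeries I (Polynomial A)) (e : I →₀ ℕ) : Polynomial A :=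
  MvPowerSeries.coeff e F - ∑ ab ∈ Finset.HasAntidiagonal.antidiagonal e,
    if ab.1.degree < e.degree ∧ ab.2.degree < e.degree then
      (wpAux F ab.1).1 * (wpAux F ab.2).2 else 0

lemma wpAux_zero (F : MvPowerSeries I (Polynomial A)) :
    wpAux F 0 = (1, MvPowerSeries.constantCoeff F) := by
  rw [wpAux, WellFounded.fix_eq, if_pos rfl]

lemma wpAux_ne (F : MvPowerSeries I (Polynomial A)) {e : I →₀ ℕ} (he : e ≠ 0) :
    wpAux F e = (wpRem F e /ₘ MvPowerSeries.constantCoeff F,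
      wpRem F e %ₘ MvPowerSeries.constantCoeff F) := by
  rw [wpAux, WellFounded.fix_eq, if_neg he]
  simp only [wpRem, dite_eq_ite]
  rfl

lemma degree_lt_of_antidiagonal {e : I →₀ ℕ} {ab : (I →₀ ℕ) × (I →₀ ℕ)} (h : ab.1 + ab.2 = e) :
    (ab.1.degree < e.degree ∧ ab.2.degree < e.degree) ↔ (ab.1 ≠ 0 ∧ ab.2 ≠ 0) := by
  rw [← h, map_add, Ne, Ne, ← Finsupp.degree_eq_zero_iff, ← Finsupp.degree_eq_zero_iff]
  omega

lemma wpAux_mem (F : MvPowerSeries I (Polynomial A)) (hp : (MvPowerSeries.constantCoeff F).Monic)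
    (P : Subring A) (n : ℕ) : ∀ e : I →₀ ℕ, e.degree < n →
    (∀ e' ≤ e, MvPowerSeries.coeff e' F ∈ upolyIn P) →
    (wpAux F e).1 ∈ upolyIn P ∧ (wpAux F e).2 ∈ upolyIn P := by
  classical
  induction n with
  | zero => intro e he; omega
  | succ n ih =>
    intro e he h
    by_cases he0 : e = 0
    · rw [he0, wpAux_zero]
      exact ⟨Subring.one_mem _, h 0 (by simp)⟩
    · rw [wpAux_ne _ he0]
      refine div_mem_upolyIn hp (h 0 (by simp)) (Subring.sub_mem (upolyIn P) (h e le_rfl)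
        (Subring.sum_mem _ fun ab hab => ?_))
      rw [Finset.HasAntidiagonal.mem_antidiagonal] at hab
      split_ifs with hd
      · have h1 : ab.1 ≤ e := hab ▸ le_self_add
        have h2 : ab.2 ≤ e := hab ▸ le_add_self
        exact Subring.mul_mem _ (ih _ (by omega) fun e' he' => h e' (he'.trans h1)).1
          (ih _ (by omega) fun e' he' => h e' (he'.trans h2)).2
      · exact Subring.zero_mem _

/-- Formal Weierstrass preparation. -/
lemma exists_preparation [Nontrivial A] (F : MvPowerSeries I (Polynomial A))
    (hp : (MvPowerSeries.constantCoeff F).Monic) :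
    ∃ U P : MvPowerSeries I (Polynomial A), F = U * P ∧ MvPowerSeries.constantCoeff U = 1 ∧
      MvPowerSeries.constantCoeff P = MvPowerSeries.constantCoeff F ∧
      (∀ e ≠ 0, (MvPowerSeries.coeff e P).degree < (MvPowerSeries.constantCoeff F).degree) ∧
      ∀ (Q : Subring A) (e : I →₀ ℕ), (∀ e' ≤ e, MvPowerSeries.coeff e' F ∈ upolyIn Q) →
        MvPowerSeries.coeff e U ∈ upolyIn Q ∧ MvPowerSeries.coeff e P ∈ upolyIn Q := by
  classical
  refine ⟨mvMk fun e => (wpAux F e).1, mvMk fun e => (wpAux F e).2, ?_, ?_, ?_, ?_, ?_⟩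
  · ext1 e
    rw [MvPowerSeries.coeff_mul]
    simp only [coeff_mvMk]
    by_cases he : e = 0
    · rw [he]
      simp [wpAux_zero]
    · have h1 : ∀ ab ∈ Finset.HasAntidiagonal.antidiagonal e, (wpAux F ab.1).1 * (wpAux F ab.2).2 =
          (if ab.1.degree < e.degree ∧ ab.2.degree < e.degree then
            (wpAux F ab.1).1 * (wpAux F ab.2).2 else 0) +
          ((if ab = (0, e) then (wpAux F e).2 else 0) +
            if ab = (e, 0) then (wpAux F e).1 * MvPowerSeries.constantCoeff F else 0) := by
        rintro ⟨a, b⟩ hab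
        rw [Finset.HasAntidiagonal.mem_antidiagonal] at hab
        rw [if_congr (degree_lt_of_antidiagonal hab) rfl rfl]
        simp only at hab ⊢
        by_cases ha : a = 0
        · have hb : b = e := by rw [← hab, ha, zero_add]
          have : ¬ ((0 : I →₀ ℕ) = e) := fun h => he h.symm
          simp [ha, hb, wpAux_zero, this]
        · by_cases hb : b = 0
          · have ha' : a = e := by rw [← hab, hb, add_zero]
            simp [ha', hb, wpAux_zero, he]
          · simp [ha, hb]
      rw [Finset.sum_congr rfl h1, Finset.sum_add_distrib, Finset.sum_add_distrib,
        Finset.sum_ite_eq', Finset.sum_ite_eq', if_pos (by simp), if_pos (by simp),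
        wpAux_ne _ he]
      simp only
      have h2 := Polynomial.modByMonic_add_div (wpRem F e) (MvPowerSeries.constantCoeff F)
      rw [mul_comm (_ /ₘ _), h2, wpRem]
      ring
  · rw [← MvPowerSeries.coeff_zero_eq_constantCoeff_apply, coeff_mvMk, wpAux_zero]
  · rw [← MvPowerSeries.coeff_zero_eq_constantCoeff_apply, coeff_mvMk, wpAux_zero]
  · intro e he
    rw [coeff_mvMk, wpAux_ne _ he]
    exact Polynomial.degree_modByMonic_lt _ hp
  · intro Q e h
    exact wpAux_mem F hp Q _ e (Nat.lt_succ_self _) h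

end WP

section Prep
variable {σ τ : Type} {N : ℕ}

lemma finSucc_mem_upolyIn {A : Type} [CommRing A] {P : Subring A} {p : MvPolynomial (Fin (N + 1)) A} :
    MvPolynomial.finSuccEquiv A N p ∈ upolyIn (polyIn (Fin N) P) ↔ p ∈ polyIn (Fin (N + 1)) P := by
  rw [mem_upolyIn]
  constructor
  · intro h d
    rw [← Finsupp.cons_tail d, ← MvPolynomial.finSuccEquiv_coeff_coeff]
    exact h _ _
  · intro h i d
    rw [MvPolynomial.finSuccEquiv_coeff_coeff]
    exact h _

lemma rename_succ_eq {A : Type} [CommRing A] (p : MvPolynomial (Fin N) A) :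
    (MvPolynomial.finSuccEquiv A N).symm (Polynomial.C p) = MvPolynomial.rename Fin.succ p := by
  rw [AlgEquiv.symm_apply_eq]
  induction p using MvPolynomial.induction_on with
  | C a => simp [MvPolynomial.finSuccEquiv_apply]
  | add p q hp hq => rw [map_add, map_add, hp, hq, map_add]
  | mul_X p i hp =>
    rw [map_mul, map_mul, map_mul, hp, MvPolynomial.rename_X, MvPolynomial.finSuccEquiv_X_succ]

lemma as_sum_of_coeff_eq_zero {A : Type} [CommRing A] {s : ℕ} {p : Polynomial A}
    (h : ∀ i, s ≤ i → p.coeff i = 0) :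
    p = ∑ i ∈ Finset.range s, Polynomial.C (p.coeff i) * Polynomial.X ^ i := by
  ext i
  simp only [Polynomial.finsetSum_coeff, Polynomial.coeff_C_mul, Polynomial.coeff_X_pow, mul_ite,
    mul_one, mul_zero, Finset.sum_ite_eq, Finset.mem_range]
  split_ifs with hi
  · rfl
  · exact h i (not_lt.1 hi)

/-- Weierstrass preparation for quasi-noetherian series. -/
lemma exists_preparation_QJ {F : RJ K σ τ (Fin (N + 1))} (hF : F ∈ QJ K σ τ (Fin (N + 1))) (s : ℕ)
    (hm : (MvPolynomial.finSuccEquiv _ N (MvPowerSeries.constantCoeff F)).Monic)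
    (hs : (MvPolynomial.finSuccEquiv _ N (MvPowerSeries.constantCoeff F)).natDegree = s) :
    ∃ (U : RJ K σ τ (Fin (N + 1))) (c : Fin s → RJ K σ τ (Fin N)), MvPowerSeries.constantCoeff U = 1 ∧
      (∀ j, c j ∈ QJ K σ τ (Fin N)) ∧
      F = U * (MvPowerSeries.C (MvPolynomial.X 0) ^ s + ∑ j,
        MvPowerSeries.map (MvPolynomial.rename Fin.succ).toRingHom (c j) *
          MvPowerSeries.C (MvPolynomial.X 0) ^ (j : ℕ)) := by
  classical
  let E := (MvPolynomial.finSuccEquiv (MvPolynomial σ (Ro K)) N)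
  let F' := MvPowerSeries.map E.toRingEquiv.toRingHom F
  have hF'0 : MvPowerSeries.constantCoeff F' = E (MvPowerSeries.constantCoeff F) := by
    rw [MvPowerSeries.constantCoeff_map]; rfl
  obtain ⟨U, P, hUP, hU, hP, hPd, hmem⟩ := exists_preparation F' (by rw [hF'0]; exact hm)
  have hsymm : ∀ G : RJ K σ τ (Fin (N + 1)), MvPowerSeries.map E.symm.toRingEquiv.toRingHom
      (MvPowerSeries.map E.toRingEquiv.toRingHom G) = G := fun G => by
    ext1 e
    rw [MvPowerSeries.coeff_map, MvPowerSeries.coeff_map]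
    exact E.symm_apply_apply _
  refine ⟨MvPowerSeries.map E.symm.toRingEquiv.toRingHom U,
    fun j => mvMk fun e => (MvPowerSeries.coeff e P).coeff j, ?_, fun j => ?_, ?_⟩
  · rw [MvPowerSeries.constantCoeff_map, hU, map_one]
  · rw [mem_QJ] at hF ⊢
    intro n
    obtain ⟨s, hs⟩ := hF n
    refine ⟨s, fun e he ν α => ?_⟩
    have h1 := (hmem (polyIn (Fin N) (polyIn σ (Loc s))) e fun e' he' => by
      rw [MvPowerSeries.coeff_map]
      exact finSucc_mem_upolyIn.2 fun ν α => hs e' ((he' none).trans he) ν α).2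
    exact mem_upolyIn.1 h1 j ν α
  · rw [← hsymm F]
    change MvPowerSeries.map _ F' = _
    rw [hUP, map_mul]
    congr 1
    ext1 e
    have h2 : MvPowerSeries.coeff e P = MvPowerSeries.coeff e (MvPowerSeries.C (Polynomial.X ^ s)) +
        ∑ j : Fin s, Polynomial.C ((MvPowerSeries.coeff e P).coeff j) * Polynomial.X ^ (j : ℕ) := by
      rw [Fin.sum_univ_eq_sum_range (fun j => Polynomial.C ((MvPowerSeries.coeff e P).coeff j) *
        Polynomial.X ^ j), MvPowerSeries.coeff_C]
      by_cases he : e = 0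
      · rw [if_pos he, he, MvPowerSeries.coeff_zero_eq_constantCoeff_apply, hP, hF'0, ← hs]
        exact hm.as_sum
      · rw [if_neg he, zero_add]
        refine as_sum_of_coeff_eq_zero fun i hi => Polynomial.coeff_eq_zero_of_degree_lt
          (lt_of_lt_of_le (hPd e he) ?_)
        rw [hF'0]
        exact (Polynomial.degree_le_natDegree).trans (by exact_mod_cast hs.le.trans hi)
    have h4 : E.symm Polynomial.X = MvPolynomial.X 0 := by
      rw [AlgEquiv.symm_apply_eq]
      exact MvPolynomial.finSuccEquiv_X_zero.symm
    rw [MvPowerSeries.coeff_map, h2]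
    change E.symm _ = _
    rw [map_add, map_sum, map_add, map_sum]
    congr 1
    · rw [← map_pow, MvPowerSeries.coeff_C, MvPowerSeries.coeff_C]
      split_ifs
      · rw [map_pow, h4]
      · exact map_zero _
    · refine Finset.sum_congr rfl fun j _ => ?_
      rw [← map_pow, MvPowerSeries.coeff_mul_C, MvPowerSeries.coeff_map, map_mul, map_pow, h4]
      congr 1
      exact rename_succ_eq _

end Prep

section Shear
variable {A : Type} [CommRing A] {N : ℕ}

/-- The images of the variables under the shear. -/
def shearVar (A : Type) [CommRing A] (N d : ℕ) (i : Fin (N + 1)) :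
    MvPolynomial (Fin (N + 1)) A :=
  if i = 0 then MvPolynomial.X 0 else MvPolynomial.X i + MvPolynomial.X 0 ^ d ^ (i : ℕ)

/-- The shear `u_i ↦ u_i + u_0 ^ (d ^ i)`. -/
def shear (A : Type) [CommRing A] (N d : ℕ) :
    MvPolynomial (Fin (N + 1)) A →ₐ[A] MvPolynomial (Fin (N + 1)) A :=
  MvPolynomial.aeval (shearVar A N d)

/-- The weight of an exponent. -/
def wt (N d : ℕ) (ν : Fin (N + 1) →₀ ℕ) : ℕ := ∑ i, ν i * d ^ (i : ℕ)

lemma monic_shearVar [Nontrivial A] {d : ℕ} (hd : 0 < d) (i : Fin (N + 1)) :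
    (MvPolynomial.finSuccEquiv A N (shearVar A N d i)).Monic ∧
      (MvPolynomial.finSuccEquiv A N (shearVar A N d i)).natDegree = d ^ (i : ℕ) := by
  rw [shearVar]
  cases i using Fin.cases with
  | zero =>
    rw [if_pos rfl, MvPolynomial.finSuccEquiv_X_zero]
    exact ⟨Polynomial.monic_X, by simp⟩
  | succ i =>
    rw [if_neg (Fin.succ_ne_zero i), map_add, map_pow, MvPolynomial.finSuccEquiv_X_zero,
      MvPolynomial.finSuccEquiv_X_succ, add_comm]
    have h : 0 < d ^ ((i.succ : Fin (N + 1)) : ℕ) := pow_pos hd _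
    exact ⟨Polynomial.monic_X_pow_add_C _ h.ne', Polynomial.natDegree_X_pow_add_C⟩

lemma shear_monomial (d : ℕ) (ν : Fin (N + 1) →₀ ℕ) (a : A) :
    shear A N d (MvPolynomial.monomial ν a) = MvPolynomial.C a * ∏ i, shearVar A N d i ^ ν i := by
  rw [shear, MvPolynomial.aeval_monomial, Finsupp.prod_fintype _ _ fun i => pow_zero _]
  rfl

lemma monic_shear_monomial [Nontrivial A] {d : ℕ} (hd : 0 < d) (ν : Fin (N + 1) →₀ ℕ) :
    (MvPolynomial.finSuccEquiv A N (shear A N d (MvPolynomial.monomial ν 1))).Monic ∧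
      (MvPolynomial.finSuccEquiv A N (shear A N d (MvPolynomial.monomial ν 1))).natDegree = wt N d ν := by
  rw [shear_monomial, map_one, one_mul, map_prod]
  simp only [map_pow]
  have h : ∀ i ∈ Finset.univ, (MvPolynomial.finSuccEquiv A N (shearVar A N d i) ^ ν i).Monic :=
    fun i _ => (monic_shearVar hd i).1.pow _
  refine ⟨Polynomial.monic_prod_of_monic _ _ h, ?_⟩
  rw [Polynomial.natDegree_prod_of_monic _ _ h, wt]
  refine Finset.sum_congr rfl fun i _ => ?_
  rw [(monic_shearVar hd i).1.natDegree_pow, (monic_shearVar hd i).2]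

lemma degree_shear_monomial [Nontrivial A] {d : ℕ} (hd : 0 < d) (ν : Fin (N + 1) →₀ ℕ) (a : A) :
    (MvPolynomial.finSuccEquiv A N (shear A N d (MvPolynomial.monomial ν a))).degree ≤ wt N d ν := by
  have h : MvPolynomial.monomial ν a = a • MvPolynomial.monomial ν (1 : A) := by
    rw [MvPolynomial.smul_monomial, smul_eq_mul, mul_one]
  rw [h, map_smul, map_smul]
  refine (Polynomial.degree_smul_le _ _).trans (Polynomial.degree_le_natDegree.trans ?_)
  rw [(monic_shear_monomial hd ν).2]

lemma monic_shear [Nontrivial A] {d : ℕ} (hd : 0 < d) (ν0 : Fin (N + 1) →₀ ℕ)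
    (I : Finset (Fin (N + 1) →₀ ℕ)) (a : (Fin (N + 1) →₀ ℕ) → A) :
    (MvPolynomial.finSuccEquiv A N (shear A N d (MvPolynomial.monomial ν0 1 +
        ∑ ν ∈ I with wt N d ν < wt N d ν0, MvPolynomial.monomial ν (a ν)))).Monic ∧
      (MvPolynomial.finSuccEquiv A N (shear A N d (MvPolynomial.monomial ν0 1 +
        ∑ ν ∈ I with wt N d ν < wt N d ν0, MvPolynomial.monomial ν (a ν)))).natDegree = wt N d ν0 := by
  rw [map_add, map_add, map_sum, map_sum]
  obtain ⟨h1, h2⟩ := monic_shear_monomial (A := A) hd ν0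
  have h3 : (∑ ν ∈ I with wt N d ν < wt N d ν0, MvPolynomial.finSuccEquiv A N
      (shear A N d (MvPolynomial.monomial ν (a ν)))).degree <
      (MvPolynomial.finSuccEquiv A N (shear A N d (MvPolynomial.monomial ν0 1))).degree := by
    rw [Polynomial.degree_eq_natDegree h1.ne_zero, h2]
    refine (Polynomial.degree_sum_le _ _).trans_lt ((Finset.sup_lt_iff (WithBot.bot_lt_coe _)).2
      fun ν hν => (degree_shear_monomial hd ν _).trans_lt ?_)
    exact_mod_cast (Finset.mem_filter.1 hν).2
  exact ⟨h1.add_of_left h3, by rw [Polynomial.natDegree_add_eq_left_of_degree_lt h3, h2]⟩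

lemma shear_mem_polyIn (P : Subring A) (d : ℕ) {p : MvPolynomial (Fin (N + 1)) A}
    (hp : p ∈ polyIn (Fin (N + 1)) P) : shear A N d p ∈ polyIn (Fin (N + 1)) P := by
  rw [MvPolynomial.as_sum p, map_sum]
  refine Subring.sum_mem _ fun ν _ => ?_
  rw [shear_monomial]
  refine Subring.mul_mem _ (C_mem_polyIn (hp ν)) (Subring.prod_mem _ fun i _ => Subring.pow_mem _ ?_ _)
  rw [shearVar]
  split_ifs
  · exact X_mem_polyIn _
  · exact Subring.add_mem _ (X_mem_polyIn _) (Subring.pow_mem _ (X_mem_polyIn _) _)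

lemma map_shear {B : Type} [CommRing B] (f : A →+* B) (d : ℕ) (p : MvPolynomial (Fin (N + 1)) A) :
    MvPolynomial.map f (shear A N d p) = shear B N d (MvPolynomial.map f p) := by
  induction p using MvPolynomial.induction_on with
  | C a => simp [shear]
  | add p q hp hq => simp only [map_add, hp, hq]
  | mul_X p i hp =>
    rw [map_mul, map_mul, map_mul, hp, map_mul, MvPolynomial.map_X]
    congr 1
    rw [shear, MvPolynomial.aeval_X, shear, MvPolynomial.aeval_X, shearVar, shearVar]
    split_ifs <;> simp

lemma wt_injOn (N d : ℕ) : Set.InjOn (wt N d) {ν | ∀ i, ν i < d} := by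
  have h : ∀ (M : ℕ) (a b : Fin M → ℕ), (∀ i, a i < d) → (∀ i, b i < d) →
      ∑ i, a i * d ^ (i : ℕ) = ∑ i, b i * d ^ (i : ℕ) → a = b := by
    intro M
    induction M with
    | zero => intro a b _ _ _; exact Subsingleton.elim _ _
    | succ M ih =>
      intro a b ha hb hab
      rw [Fin.sum_univ_succ, Fin.sum_univ_succ] at hab
      have h2 : ∀ c : Fin (M + 1) → ℕ, ∑ i : Fin M, c i.succ * d ^ ((i.succ : Fin (M + 1)) : ℕ) =
          d * ∑ i : Fin M, c i.succ * d ^ (i : ℕ) := fun c => by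
        rw [Finset.mul_sum]
        refine Finset.sum_congr rfl fun i _ => ?_
        rw [Fin.val_succ, pow_succ]
        ring
      rw [h2, h2] at hab
      simp only [Fin.val_zero, pow_zero, mul_one] at hab
      have h3 : a 0 = b 0 := by
        have := congrArg (· % d) hab
        simp only [Nat.add_mul_mod_self_left] at this
        rwa [Nat.mod_eq_of_lt (ha 0), Nat.mod_eq_of_lt (hb 0)] at this
      rw [h3] at hab
      have hd : 0 < d := (Nat.zero_le _).trans_lt (ha 0)
      have h4 := ih (fun i => a i.succ) (fun i => b i.succ) (fun i => ha _) (fun i => hb _)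
        (Nat.eq_of_mul_eq_mul_left hd (Nat.add_left_cancel hab))
      funext i
      cases i using Fin.cases with
      | zero => exact h3
      | succ i => exact congrFun h4 i
  intro ν hν μ hμ hw
  exact DFunLike.coe_injective (h _ ν μ hν hμ hw)

end Shear

section

variable {X σ τ : Type} {N N' : ℕ}

/-- The value of a power series at a point with coordinates in an algebra over the valuation
ring, characterised through polynomial approximations. -/
def EvalTo {B : Type} [Ring B] [Algebra (Ro K) B] (f : Pow K N)
    (ψ : MvPolynomial (Fin N) (Ro K) →ₐ[Ro K] B) (Y : B) : Prop :=
  ∀ d : Ro K, d ≠ 0 → ∃ (p : MvPolynomial (Fin N) (Ro K)) (g : Pow K N) (Z : B),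
    f = (p : MvPowerSeries (Fin N) (Ro K)) + MvPowerSeries.C d * g ∧ Y = ψ p + d • Z

/-- Separated algebras in which power series with small arguments can be summed. -/
structure Good (K : Type) [NormedField K] [CompleteSpace K] [IsAlgClosed K] [IsUltrametricDist K]
    (B : Type) [Ring B] [Algebra (Ro K) B] : Prop where
  sep : ∀ b : B, (∀ d : Ro K, d ≠ 0 → ∃ z, b = d • z) → b = 0
  ex : ∀ (I A : Type) [Finite I] [CommRing A] (φ : A →+ B) (ξ : I → Ro K),
    (∀ t, ‖(ξ t : K)‖ < 1) → ∃ L : MvPowerSeries I A →+ B,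
      (∀ t F, L (MvPowerSeries.X t * F) = ξ t • L F) ∧ ∀ a, L (MvPowerSeries.C a) = φ a

namespace EvalTo

variable {B : Type} [Ring B] [Algebra (Ro K) B] {B' : Type} [Ring B'] [Algebra (Ro K) B']
  {f g : Pow K N} {ψ : MvPolynomial (Fin N) (Ro K) →ₐ[Ro K] B} {Y Z : B}

lemma poly (p : MvPolynomial (Fin N) (Ro K)) (ψ : MvPolynomial (Fin N) (Ro K) →ₐ[Ro K] B) :
    EvalTo (p : MvPowerSeries (Fin N) (Ro K)) ψ (ψ p) := fun d _ =>
  ⟨p, 0, 0, by simp, by simp⟩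

lemma C (a : Ro K) (ψ : MvPolynomial (Fin N) (Ro K) →ₐ[Ro K] B) :
    EvalTo (MvPowerSeries.C a : Pow K N) ψ (algebraMap _ B a) := by
  have := poly (MvPolynomial.C a) ψ
  rwa [MvPolynomial.coe_C, ← MvPolynomial.algebraMap_eq, AlgHom.commutes] at this

lemma zero (ψ : MvPolynomial (Fin N) (Ro K) →ₐ[Ro K] B) : EvalTo (0 : Pow K N) ψ 0 := by
  have := C 0 ψ
  rwa [map_zero, map_zero] at this

lemma add (hf : EvalTo f ψ Y) (hg : EvalTo g ψ Z) : EvalTo (f + g) ψ (Y + Z) := fun d hd => by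
  obtain ⟨p, f', Y', rfl, rfl⟩ := hf d hd
  obtain ⟨q, g', Z', rfl, rfl⟩ := hg d hd
  refine ⟨p + q, f' + g', Y' + Z', ?_, ?_⟩
  · push_cast; ring
  · rw [map_add, smul_add]; abel

lemma mul (hf : EvalTo f ψ Y) (hg : EvalTo g ψ Z) : EvalTo (f * g) ψ (Y * Z) := fun d hd => by
  obtain ⟨p, f', Y', rfl, rfl⟩ := hf d hd
  obtain ⟨q, g', Z', rfl, rfl⟩ := hg d hd
  refine ⟨p * q, (p : MvPowerSeries (Fin N) (Ro K)) * g' + f' * (q : MvPowerSeries (Fin N) (Ro K)) +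
      MvPowerSeries.C d * (f' * g'),
    ψ p * Z' + Y' * ψ q + d • (Y' * Z'), ?_, ?_⟩
  · push_cast; ring
  · rw [map_mul]
    simp only [mul_add, add_mul, smul_add, mul_smul_comm, smul_mul_assoc]
    abel

lemma C_mul (a : Ro K) (hf : EvalTo f ψ Y) : EvalTo (MvPowerSeries.C a * f) ψ (a • Y) := by
  have := (C a ψ).mul hf
  rwa [← Algebra.smul_def] at this

lemma sum {ι : Type} (s : Finset ι) {f : ι → Pow K N} {Y : ι → B} (h : ∀ i ∈ s, EvalTo (f i) ψ (Y i)) :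
    EvalTo (∑ i ∈ s, f i) ψ (∑ i ∈ s, Y i) := by
  classical
  induction s using Finset.induction_on with
  | empty => simpa using zero ψ
  | insert a s ha ih =>
    rw [Finset.sum_insert ha, Finset.sum_insert ha]
    exact (h _ (Finset.mem_insert_self _ _)).add (ih fun i hi => h i (Finset.mem_insert_of_mem hi))

lemma pow (hf : EvalTo f ψ Y) (n : ℕ) : EvalTo (f ^ n) ψ (Y ^ n) := by
  induction n with
  | zero =>
    have := C 1 ψ
    simpa using this
  | succ n ih => rw [pow_succ, pow_succ]; exact ih.mul hf

lemma map (ρ : B →ₐ[Ro K] B') (hf : EvalTo f ψ Y) : EvalTo f (ρ.comp ψ) (ρ Y) := fun d hd => by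
  obtain ⟨p, g, Z, rfl, rfl⟩ := hf d hd
  exact ⟨p, g, ρ Z, rfl, by simp⟩

lemma commute (hB : Good K B) (hf : EvalTo f ψ Y) {M : B} (hM : ∀ i, M * ψ (MvPolynomial.X i) =
    ψ (MvPolynomial.X i) * M) : M * Y = Y * M := by
  have h : ∀ p, M * ψ p = ψ p * M := fun p => by
    induction p using MvPolynomial.induction_on with
    | C a =>
      rw [← MvPolynomial.algebraMap_eq, AlgHom.commutes]
      exact (Algebra.commutes a M).symm
    | add p q hp hq => rw [map_add, mul_add, add_mul, hp, hq]
    | mul_X p i hp => rw [map_mul, ← mul_assoc, hp, mul_assoc, hM, mul_assoc]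
  rw [← sub_eq_zero]
  refine hB.sep _ fun d hd => ?_
  obtain ⟨p, g, Z, rfl, rfl⟩ := hf d hd
  refine ⟨M * Z - Z * M, ?_⟩
  rw [mul_add, add_mul, h, mul_smul_comm, smul_mul_assoc, smul_sub]
  abel

lemma unique (hB : Good K B) (hf : EvalTo f ψ Y) (hf' : EvalTo f ψ Z) : Y = Z := by
  rw [← sub_eq_zero]
  refine hB.sep _ fun d hd => ?_
  obtain ⟨p, g, Y', hp, rfl⟩ := hf d hd
  obtain ⟨q, g', Z', hq, rfl⟩ := hf' d hd
  have h1 : MvPolynomial.C d ∣ p - q := by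
    rw [MvPolynomial.C_dvd_iff_dvd_coeff]
    intro ν
    have h2 : MvPowerSeries.coeff ν ((p : MvPowerSeries (Fin N) (Ro K)) + MvPowerSeries.C d * g) =
      MvPowerSeries.coeff ν ((q : MvPowerSeries (Fin N) (Ro K)) + MvPowerSeries.C d * g') := by
      rw [← hp, ← hq]
    rw [map_add, map_add, MvPowerSeries.coeff_C_mul, MvPowerSeries.coeff_C_mul,
      MvPolynomial.coeff_coe, MvPolynomial.coeff_coe] at h2
    rw [MvPolynomial.coeff_sub]
    exact ⟨MvPowerSeries.coeff ν g' - MvPowerSeries.coeff ν g, by linear_combination h2⟩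
  obtain ⟨r, hr⟩ := h1
  refine ⟨ψ r + Y' - Z', ?_⟩
  have h3 : ψ p - ψ q = d • ψ r := by
    rw [← map_sub, hr, ← MvPolynomial.smul_eq_C_mul, map_smul]
  rw [smul_sub, smul_add, ← h3]
  abel

end EvalTo

lemma good_O {π : Ro K} (hπ0 : π ≠ 0) (hπ : ‖(π : K)‖ < 1) : Good K (Ro K) where
  sep b h := Ro.pow_dvd_eq_zero hπ fun n => by
    obtain ⟨z, hz⟩ := h (π ^ n) (pow_ne_zero _ hπ0)
    exact ⟨z, hz⟩
  ex I A _ _ φ ξ hξ := by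
    obtain ⟨L, hC, hX⟩ := exists_evO (RingHom.id (Ro K)) ξ hξ
    let P : MvPowerSeries I A →+ MvPowerSeries I (Ro K) :=
      { toFun := fun F => mvMk fun e => φ (MvPowerSeries.coeff e F)
        map_zero' := by ext1 e; simp
        map_add' := fun F G => by ext1 e; simp }
    refine ⟨L.toAddMonoidHom.comp P, fun t F => ?_, fun a => ?_⟩
    · have : P (MvPowerSeries.X t * F) = MvPowerSeries.X t * P F := by
        classical
        ext1 e
        change φ (MvPowerSeries.coeff e _) = _
        rw [MvPowerSeries.X, MvPowerSeries.X, MvPowerSeries.coeff_monomial_mul,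
          MvPowerSeries.coeff_monomial_mul]
        split_ifs
        · rw [one_mul, one_mul]; rfl
        · simp
      change L (P _) = _ • L (P F)
      rw [this, map_mul, hX, smul_eq_mul]
    · have : P (MvPowerSeries.C a) = MvPowerSeries.C (φ a) := by
        classical
        ext1 e
        change φ (MvPowerSeries.coeff e _) = _
        rw [MvPowerSeries.coeff_C, MvPowerSeries.coeff_C]
        split_ifs <;> simp
      change L (P _) = _
      rw [this, hC]
      rfl

lemma Good.matrix {B : Type} [Ring B] [Algebra (Ro K) B] (hB : Good K B) (κ : Type) [Fintype κ]
    [DecidableEq κ] : Good K (Matrix κ κ B) where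
  sep b h := by
    ext i j
    refine hB.sep _ fun d hd => ?_
    obtain ⟨z, rfl⟩ := h d hd
    exact ⟨z i j, rfl⟩
  ex I A _ _ φ ξ hξ := by
    have h : ∀ i j, ∃ L : MvPowerSeries I A →+ B,
      (∀ t F, L (MvPowerSeries.X t * F) = ξ t • L F) ∧ ∀ a, L (MvPowerSeries.C a) = φ a i j :=
      fun i j => hB.ex I A ((Matrix.entryAddMonoidHom B i j).comp φ) ξ hξ
    choose L hX hC using h
    refine ⟨{ toFun := fun F => Matrix.of fun i j => L i j F
              map_zero' := ?_
              map_add' := ?_ }, fun t F => ?_, fun a => ?_⟩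
    · ext i j; simp
    · intro F G; ext i j; simp
    · ext i j; exact hX i j t F
    · ext i j; exact hC i j a

/-- Existence of values, and their behaviour under substitutions. -/
theorem Dat.exists_evalTo {π : Ro K} [Finite τ] {B : Type} [Ring B] [Algebra (Ro K) B] (hB : Good K B)
    (D : Dat π X σ τ) (x : X) (F : RJ K σ τ (Fin N)) (ψ : MvPolynomial (Fin N) (Ro K) →ₐ[Ro K] B) :
    ∃ Y : B, ∀ (X' σ' : Type) (x' : X') (N' : ℕ) (D' : Dat π X' σ' τ)
      (g : MvPolynomial (Fin N) (MvPolynomial σ (Ro K)) →+*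
        MvPolynomial (Fin N') (MvPolynomial σ' (Ro K)))
      (ψ' : MvPolynomial (Fin N') (Ro K) →ₐ[Ro K] B), D'.ξ x' = D.ξ x →
      (∀ p, ψ' (MvPolynomial.map (MvPolynomial.eval (D'.y x')) (g p)) =
        ψ (MvPolynomial.map (MvPolynomial.eval (D.y x)) p)) →
      EvalTo (D'.Ev N' x' (MvPowerSeries.map g F)) ψ' Y := by
  obtain ⟨L, hX, hC⟩ := hB.ex (Option τ) _ (ψ.toRingHom.comp
    (MvPolynomial.map (MvPolynomial.eval (D.y x)))).toAddMonoidHom (D.ξ x) (D.hξ x)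
  refine ⟨L F, fun X' σ' x' N' D' g ψ' hξ hg d hd => ?_⟩
  obtain ⟨c, hc, -, hcξ⟩ := exists_max_dvd (0 : Ro K) (by simp) (D.ξ x) (D.hξ x)
  have key : ∀ n : ℕ, ∀ F : RJ K σ τ (Fin N), ∃ (p : MvPolynomial (Fin N') (Ro K)) (f : Pow K N') (Z : B),
      D'.Ev N' x' (MvPowerSeries.map g F) = (p : MvPowerSeries (Fin N') (Ro K)) +
        MvPowerSeries.C (c ^ n) * f ∧ L F = ψ' p + c ^ n • Z := by
    intro n
    induction n with
    | zero => exact fun F => ⟨0, D'.Ev N' x' (MvPowerSeries.map g F), L F, by simp, by simp⟩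
    | succ n ih =>
      intro F
      have := Fintype.ofFinite τ
      obtain ⟨G, hG, -⟩ := mvPowerSeries_decomp F
      rw [finsum_eq_sum_of_fintype] at hG
      have h1 : ∀ t, ∃ a, D.ξ x t = c * a := hcξ
      choose a ha using h1
      have h2 : ∀ t, ∃ (p : MvPolynomial (Fin N') (Ro K)) (f : Pow K N') (Z : B),
        D'.Ev N' x' (MvPowerSeries.map g (G t)) = (p : MvPowerSeries (Fin N') (Ro K)) +
        MvPowerSeries.C (c ^ n) * f ∧ L (G t) = ψ' p + c ^ n • Z := fun t => ih (G t)
      choose p f Z hf hZ using h2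
      set q := MvPolynomial.map (MvPolynomial.eval (D'.y x')) (g (MvPowerSeries.constantCoeff F)) with hq
      refine ⟨q + ∑ t, MvPolynomial.C (D.ξ x t) * p t, ∑ t, MvPowerSeries.C (a t) * f t,
        ∑ t, a t • Z t, ?_, ?_⟩
      · conv_lhs => rw [hG]
        rw [map_add, map_add, MvPowerSeries.map_C, Dat.Ev_C, map_sum, map_sum,
          MvPolynomial.coe_add, Finset.mul_sum, add_assoc]
        congr 1
        have : ((∑ t, MvPolynomial.C (D.ξ x t) * p t : MvPolynomial (Fin N') (Ro K)) :
            MvPowerSeries (Fin N') (Ro K)) =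
            ∑ t, MvPowerSeries.C (D.ξ x t) * (p t : MvPowerSeries (Fin N') (Ro K)) := by
          change MvPolynomial.coeToMvPowerSeries.ringHom _ = _
          rw [map_sum]
          refine Finset.sum_congr rfl fun t _ => ?_
          rw [map_mul]
          change (MvPolynomial.C _ : MvPolynomial (Fin N') (Ro K)).toMvPowerSeries * _ = _
          rw [MvPolynomial.coe_C]
          rfl
        rw [this, ← Finset.sum_add_distrib]
        refine Finset.sum_congr rfl fun t _ => ?_
        rw [map_mul, map_mul, MvPowerSeries.map_X, Dat.Ev_X, hf, hξ]
        conv_lhs => rw [ha t]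
        conv_rhs => rw [ha t]
        simp only [map_mul, map_pow]
        ring
      · conv_lhs => rw [hG]
        rw [map_add, hC, map_sum, map_add, map_sum, Finset.smul_sum, add_assoc, ← Finset.sum_add_distrib]
        congr 1
        · exact (hg _).symm
        · refine Finset.sum_congr rfl fun t _ => ?_
          rw [hX, hZ, smul_add, ← MvPolynomial.smul_eq_C_mul, map_smul]
          congr 1
          conv_lhs => rw [ha t]
          rw [smul_smul, smul_smul, pow_succ]
          congr 1
          ring
  obtain ⟨n, e, he⟩ := Ro.exists_pow_dvd hc hd
  obtain ⟨p, f, Z, h1, h2⟩ := key n F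
  refine ⟨p, MvPowerSeries.C e * f, e • Z, ?_, ?_⟩
  · rw [h1, he, map_mul, mul_assoc]
  · rw [h2, he, smul_smul]

end

section

variable {X σ τ : Type} {N N' : ℕ} {π : Ro K}

/-- Substitution of the last variables. -/
def tailHom {B : Type} [Ring B] [Algebra (Ro K) B]
    (ψ : MvPolynomial (Fin (N + 1)) (Ro K) →ₐ[Ro K] B) : MvPolynomial (Fin N) (Ro K) →ₐ[Ro K] B :=
  ψ.comp (MvPolynomial.rename Fin.succ)

lemma Dat.exists_evalTo_self [Finite τ] {B : Type} [Ring B] [Algebra (Ro K) B] (hB : Good K B)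
    (D : Dat π X σ τ) (x : X) (F : RJ K σ τ (Fin N)) (ψ : MvPolynomial (Fin N) (Ro K) →ₐ[Ro K] B) :
    ∃ Y : B, EvalTo (D.Ev N x F) ψ Y := by
  obtain ⟨Y, hY⟩ := D.exists_evalTo hB x F ψ
  have := hY X σ x N D (RingHom.id _) ψ rfl fun p => rfl
  rw [MvPowerSeries.map_id] at this
  exact ⟨Y, this⟩

lemma Tame.exists_evalTo {S : Set X} {f : X → Pow K N} (hf : Tame π S f)
    {B : Type} [Ring B] [Algebra (Ro K) B] (hB : Good K B) {x : X} (hx : x ∈ S)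
    (ψ : MvPolynomial (Fin N) (Ro K) →ₐ[Ro K] B) : ∃ Y : B, EvalTo (f x) ψ Y := by
  obtain ⟨σ, τ, _, _, D, F, -, h⟩ := hf
  rw [h x hx]
  exact D.exists_evalTo_self hB x F ψ

lemma Dat.exists_unit_value [Finite τ] {B : Type} [Ring B] [Algebra (Ro K) B] (hB : Good K B)
    (D : Dat π X σ τ) (x : X) {U : RJ K σ τ (Fin N)} (hU : MvPowerSeries.constantCoeff U = 1)
    (ψ : MvPolynomial (Fin N) (Ro K) →ₐ[Ro K] B) :
    ∃ (e : Ro K) (Z : B), ‖(e : K)‖ < 1 ∧ EvalTo (D.Ev N x U) ψ (1 + e • Z) := by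
  have := Fintype.ofFinite τ
  obtain ⟨G, hG, -⟩ := mvPowerSeries_decomp U
  rw [finsum_eq_sum_of_fintype, hU, map_one] at hG
  obtain ⟨e, he, -, heξ⟩ := exists_max_dvd (0 : Ro K) (by simp) (D.ξ x) (D.hξ x)
  have h1 : ∀ t, ∃ a, D.ξ x t = e * a := heξ
  choose a ha using h1
  have h2 : ∀ t, ∃ Z : B, EvalTo (D.Ev N x (G t)) ψ Z := fun t => D.exists_evalTo_self hB x _ ψ
  choose Z hZ using h2
  refine ⟨e, ∑ t, a t • Z t, he, ?_⟩
  rw [hG, map_add, map_one, map_sum, Finset.smul_sum]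
  have h3 := EvalTo.C (N := N) 1 ψ
  rw [map_one, map_one] at h3
  refine h3.add (EvalTo.sum _ fun t _ => ?_)
  rw [map_mul, Dat.Ev_X, smul_smul, ← ha]
  exact (hZ t).C_mul _

/-- Weierstrass preparation for tame families, on the level of values. -/
theorem Tame.exists_weierstrass (hπ0 : π ≠ 0) (hπ : ‖(π : K)‖ < 1) {S : Set X}
    {f : X → Pow K (N + 1)} (hf : Tame π S f) : ∃ I : Finset (Fin (N + 1) →₀ ℕ),
      (∀ x ∈ S, f x ≠ 0 → ∃ ν0 ∈ I, MvPowerSeries.coeff ν0 (f x) ≠ 0 ∧ ∀ ν,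
        ‖((MvPowerSeries.coeff ν (f x) : Ro K) : K)‖ ≤
          ‖((MvPowerSeries.coeff ν0 (f x) : Ro K) : K)‖) ∧
      ∀ d, 0 < d → (∀ ν ∈ I, ∀ i, ν i < d) → ∀ ν0 ∈ I,
      ∃ (s : ℕ) (c : Fin s → X → Pow K N), (∀ j, Tame π Set.univ (c j)) ∧
        ∀ x ∈ S, MvPowerSeries.coeff ν0 (f x) ≠ 0 →
          (∀ ν ∈ I, ‖((MvPowerSeries.coeff ν (f x) : Ro K) : K)‖ ≤
            ‖((MvPowerSeries.coeff ν0 (f x) : Ro K) : K)‖) →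
          (∀ ν ∈ I, wt N d ν0 < wt N d ν → ‖((MvPowerSeries.coeff ν (f x) : Ro K) : K)‖ <
            ‖((MvPowerSeries.coeff ν0 (f x) : Ro K) : K)‖) →
          ∀ (B : Type) [Ring B] [Algebra (Ro K) B], Good K B →
          ∀ (ψ : MvPolynomial (Fin (N + 1)) (Ro K) →ₐ[Ro K] B) (Cv : Fin s → B),
          (∀ j, EvalTo (c j x) (tailHom ψ) (Cv j)) →
          ∃ (e : Ro K) (Z : B), ‖(e : K)‖ < 1 ∧ EvalTo (f x) (ψ.comp (shear (Ro K) N d))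
            (MvPowerSeries.coeff ν0 (f x) • ((1 + e • Z) *
              (ψ (MvPolynomial.X 0) ^ s + ∑ j, Cv j * ψ (MvPolynomial.X 0) ^ (j : ℕ)))) := by
  obtain ⟨I, hI, h⟩ := hf.exists_normal_form hπ0 hπ
  refine ⟨I, hI, fun d hd hId ν0 hν0 => ?_⟩
  obtain ⟨σ, τ, _, _, D, F, a, hF, hF0, hfF⟩ := h (wt N d)
    ((wt_injOn N d).mono fun ν hν => hId ν hν) ν0 hν0
  set sh : MvPolynomial (Fin (N + 1)) (MvPolynomial σ (Ro K)) →+* _ :=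
    (shear (MvPolynomial σ (Ro K)) N d).toRingHom with hsh
  have hF' : MvPowerSeries.map sh F ∈ QJ K σ τ (Fin (N + 1)) :=
    Dat.map_mem_QJ (fun s => ⟨s, fun p hp => shear_mem_polyIn _ d hp⟩) hF
  have hm := monic_shear (A := MvPolynomial σ (Ro K)) hd ν0 I a
  have hcc : MvPowerSeries.constantCoeff (MvPowerSeries.map sh F) =
      shear (MvPolynomial σ (Ro K)) N d (MvPolynomial.monomial ν0 1 +
        ∑ ν ∈ I with wt N d ν < wt N d ν0, MvPolynomial.monomial ν (a ν)) := by
    rw [MvPowerSeries.constantCoeff_map, hF0]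
    rfl
  obtain ⟨U, c, hU, hc, hUc⟩ := exists_preparation_QJ hF' (wt N d ν0) (by rw [hcc]; exact hm.1)
    (by rw [hcc]; exact hm.2)
  refine ⟨wt N d ν0, fun j x => D.Ev N x (c j),
    fun j => ⟨σ, τ, ‹_›, ‹_›, D, c j, hc j, fun x _ => rfl⟩, ?_⟩
  intro x hx h1 h2 h3 B _ _ hB ψ Cv hCv
  obtain ⟨e, Z, he, heZ⟩ := D.exists_unit_value hB x hU ψ
  refine ⟨e, Z, he, ?_⟩
  conv => arg 1; rw [hfF x hx h1 h2 h3]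
  refine EvalTo.C_mul _ ?_
  obtain ⟨Y, hY⟩ := D.exists_evalTo hB x F (ψ.comp (shear (Ro K) N d))
  have hY1 := hY X σ x _ D (RingHom.id _) (ψ.comp (shear (Ro K) N d)) rfl fun p => rfl
  rw [MvPowerSeries.map_id] at hY1
  have hY2 := hY X σ x _ D sh ψ rfl fun p => by
    have := map_shear (MvPolynomial.eval (D.y x)) d p
    change ψ (MvPolynomial.map _ (shear _ N d p)) = _
    rw [this]
    rfl
  have hX : EvalTo (MvPowerSeries.X 0 : Pow K (N + 1)) ψ (ψ (MvPolynomial.X 0)) := by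
    have := EvalTo.poly (MvPolynomial.X 0) ψ
    rwa [MvPolynomial.coe_X] at this
  have hcj : ∀ j, EvalTo (D.Ev (N + 1) x (MvPowerSeries.map
      (MvPolynomial.rename Fin.succ).toRingHom (c j))) ψ (Cv j) := fun j => by
    obtain ⟨W, hW⟩ := D.exists_evalTo hB x (c j) (tailHom ψ)
    have hW1 := hW X σ x _ D (RingHom.id _) (tailHom ψ) rfl fun p => rfl
    rw [MvPowerSeries.map_id] at hW1
    rw [(hCv j).unique hB hW1]
    refine hW X σ x _ D (MvPolynomial.rename Fin.succ).toRingHom ψ rfl fun p => ?_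
    change ψ (MvPolynomial.map _ (MvPolynomial.rename Fin.succ p)) = ψ (MvPolynomial.rename Fin.succ _)
    rw [MvPolynomial.map_rename]
  have hY3 : EvalTo (D.Ev (N + 1) x (MvPowerSeries.map sh F)) ψ ((1 + e • Z) *
      (ψ (MvPolynomial.X 0) ^ wt N d ν0 + ∑ j, Cv j * ψ (MvPolynomial.X 0) ^ (j : ℕ))) := by
    rw [hUc, map_mul, map_add, map_pow, map_sum, Dat.Ev_CX]
    refine heZ.mul ((hX.pow _).add (EvalTo.sum _ fun j _ => ?_))
    rw [map_mul, map_pow, Dat.Ev_CX]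
    exact (hcj j).mul (hX.pow _)
  rwa [hY2.unique hB hY3] at hY1

end

section

variable {ι κ β : Type}

/-- The value of a polynomial at an integral point. -/
def pe (p : MvPolynomial ι K) (x : ι → Ro K) : K :=
  MvPolynomial.eval (fun i => (x i : K)) p

/-- Strictly convergent power series, as uniform limits of polynomials on the polydisc. -/
def An (K : Type) [NormedField K] [CompleteSpace K] [IsAlgClosed K] [IsUltrametricDist K] (ι : Type) :
    Set ((ι → Ro K) → K) :=
  {f | ∀ ε : ℝ, 0 < ε → ∃ p : MvPolynomial ι K, ∀ x, ‖f x - pe p x‖ ≤ ε}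

lemma pe_mem_An (p : MvPolynomial ι K) : pe p ∈ An K ι := fun ε hε => ⟨p, fun x => by simpa using hε.le⟩

lemma An.limit {f : (ι → Ro K) → K}
    (h : ∀ ε : ℝ, 0 < ε → ∃ g ∈ An K ι, ∀ x, ‖f x - g x‖ ≤ ε) : f ∈ An K ι := fun ε hε => by
  obtain ⟨g, hg, h1⟩ := h ε hε
  obtain ⟨p, hp⟩ := hg ε hε
  refine ⟨p, fun x => ?_⟩
  have := IsUltrametricDist.norm_add_le_max (f x - g x) (g x - pe p x)
  rw [sub_add_sub_cancel] at this
  exact this.trans (max_le (h1 x) (hp x))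

lemma exists_pe_le (p : MvPolynomial ι K) : ∃ M : ℝ, 1 ≤ M ∧ ∀ x : ι → Ro K, ‖pe p x‖ ≤ M := by
  induction p using MvPolynomial.induction_on with
  | C a => exact ⟨max 1 ‖a‖, le_max_left _ _, fun x => by simp [pe]⟩
  | add p q hp hq =>
    obtain ⟨M, hM, h1⟩ := hp
    obtain ⟨M', hM', h2⟩ := hq
    refine ⟨max M M', hM.trans (le_max_left _ _), fun x => ?_⟩
    simp only [pe, map_add] at *
    exact (IsUltrametricDist.norm_add_le_max _ _).trans (max_le_max (h1 x) (h2 x))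
  | mul_X p i hp =>
    obtain ⟨M, hM, h1⟩ := hp
    refine ⟨M, hM, fun x => ?_⟩
    simp only [pe, map_mul, MvPolynomial.eval_X, norm_mul] at *
    exact (mul_le_of_le_one_right (norm_nonneg _) (x i).2).trans (h1 x)

lemma An.exists_le {f : (ι → Ro K) → K} (hf : f ∈ An K ι) : ∃ M : ℝ, 1 ≤ M ∧ ∀ x, ‖f x‖ ≤ M := by
  obtain ⟨p, hp⟩ := hf 1 one_pos
  obtain ⟨M, hM, h1⟩ := exists_pe_le p
  refine ⟨M, hM, fun x => ?_⟩
  have := IsUltrametricDist.norm_add_le_max (f x - pe p x) (pe p x)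
  rw [sub_add_cancel] at this
  exact this.trans (max_le ((hp x).trans hM) (h1 x))

lemma An.const (c : K) : (fun _ => c) ∈ An K ι := by
  have := pe_mem_An (MvPolynomial.C c : MvPolynomial ι K)
  convert this using 2
  simp [pe]

lemma An.coord (i : ι) : (fun x => (x i : K)) ∈ An K ι := by
  have := pe_mem_An (MvPolynomial.X i : MvPolynomial ι K)
  convert this using 2
  simp [pe]

lemma An.sub {f g : (ι → Ro K) → K} (hf : f ∈ An K ι) (hg : g ∈ An K ι) :
    (fun x => f x - g x) ∈ An K ι := fun ε hε => by
  obtain ⟨p, hp⟩ := hf ε hε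
  obtain ⟨q, hq⟩ := hg ε hε
  refine ⟨p - q, fun x => ?_⟩
  have h1 : f x - g x - pe (p - q) x = (f x - pe p x) - (g x - pe q x) := by
    simp only [pe, map_sub]; ring
  rw [h1, sub_eq_add_neg]
  refine (IsUltrametricDist.norm_add_le_max _ _).trans (max_le (hp x) ?_)
  rw [norm_neg]
  exact hq x

lemma An.mul {f g : (ι → Ro K) → K} (hf : f ∈ An K ι) (hg : g ∈ An K ι) :
    (fun x => f x * g x) ∈ An K ι := fun ε hε => by
  obtain ⟨M, hM, h1⟩ := An.exists_le hf
  have hM0 : 0 < M := one_pos.trans_le hM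
  obtain ⟨q, hq⟩ := hg (ε / M) (by positivity)
  obtain ⟨M', hM', h2⟩ := exists_pe_le q
  have hM0' : 0 < M' := one_pos.trans_le hM'
  obtain ⟨p, hp⟩ := hf (ε / M') (by positivity)
  refine ⟨p * q, fun x => ?_⟩
  have h3 : f x * g x - pe (p * q) x = f x * (g x - pe q x) + (f x - pe p x) * pe q x := by
    simp only [pe, map_mul]; ring
  rw [h3]
  refine (IsUltrametricDist.norm_add_le_max _ _).trans (max_le ?_ ?_)
  · rw [norm_mul]
    calc _ ≤ M * (ε / M) := mul_le_mul (h1 x) (hq x) (norm_nonneg _) hM0.le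
      _ = ε := by field_simp
  · rw [norm_mul]
    calc _ ≤ (ε / M') * M' := mul_le_mul (hp x) (h2 x) (norm_nonneg _) (by positivity)
      _ = ε := by field_simp

lemma An.add {f g : (ι → Ro K) → K} (hf : f ∈ An K ι) (hg : g ∈ An K ι) :
    (fun x => f x + g x) ∈ An K ι := by
  have := An.sub hf (An.sub (An.const 0) hg)
  simpa using this

/-- Integral valued analytic functions. -/
def AnO (K : Type) [NormedField K] [CompleteSpace K] [IsAlgClosed K] [IsUltrametricDist K] (ι : Type) :
    Subring ((ι → Ro K) → Ro K) where
  carrier := {f | (fun x => (f x : K)) ∈ An K ι}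
  zero_mem' := An.const 0
  one_mem' := An.const 1
  add_mem' hf hg := An.add hf hg
  mul_mem' hf hg := An.mul hf hg
  neg_mem' hf := by simpa using An.sub (An.const 0) hf

lemma AnO.coord (i : ι) : (fun x => x i) ∈ AnO K ι := An.coord i

lemma AnO.const (c : Ro K) : (fun _ => c) ∈ AnO K ι := An.const (c : K)

/-- Maps with analytic components. -/
def AnMap (φ : (ι → Ro K) → κ → Ro K) : Prop := ∀ k, (fun x => φ x k) ∈ AnO K ι

lemma An.comp {f : (κ → Ro K) → K} (hf : f ∈ An K κ) {φ : (ι → Ro K) → κ → Ro K} (hφ : AnMap φ) :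
    f ∘ φ ∈ An K ι := by
  refine An.limit fun ε hε => ?_
  obtain ⟨p, hp⟩ := hf ε hε
  refine ⟨pe p ∘ φ, ?_, fun x => hp _⟩
  clear hp
  induction p using MvPolynomial.induction_on with
  | C a => convert An.const a using 2; simp [pe]
  | add p q hp hq =>
    convert An.add hp hq using 2
    simp [pe]
  | mul_X p i hp =>
    convert An.mul hp (hφ i) using 2
    simp [pe]

lemma AnMap.comp {ι' : Type} {φ : (ι → Ro K) → κ → Ro K} {φ' : (κ → Ro K) → ι' → Ro K}
    (hφ' : AnMap φ') (hφ : AnMap φ) : AnMap (φ' ∘ φ) := fun k => An.comp (hφ' k) hφ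

lemma AnMap.reindex (a : κ → ι) : AnMap (K := K) fun (x : ι → Ro K) k => x (a k) :=
  fun k => AnO.coord (a k)

lemma AnMap.sumElim {ι' : Type} {φ : (ι → Ro K) → κ → Ro K} {φ' : (ι → Ro K) → ι' → Ro K}
    (hφ : AnMap φ) (hφ' : AnMap φ') : AnMap fun x => Sum.elim (φ x) (φ' x) := by
  rintro (k | k)
  · exact hφ k
  · exact hφ' k

lemma VB.preimage_An {S : Set (κ → Ro K)} (hS : VB (An K κ) S) {φ : (ι → Ro K) → κ → Ro K}
    (hφ : AnMap φ) : VB (An K ι) (φ ⁻¹' S) :=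
  VB.preimage φ (fun _ hf => An.comp hf hφ) hS

/-- Existentially definable subsets of polydiscs. -/
def Ex (S : Set (ι → Ro K)) : Prop :=
  ∃ (β : Type) (_ : Finite β) (T : Set (ι ⊕ β → Ro K)), VB (An K (ι ⊕ β)) T ∧
    ∀ x, x ∈ S ↔ ∃ z : β → Ro K, Sum.elim x z ∈ T

namespace Ex

lemma of_VB {S : Set (ι → Ro K)} (hS : VB (An K ι) S) : Ex S :=
  ⟨Empty, inferInstance, (fun y i => y (Sum.inl i)) ⁻¹' S, hS.preimage_An (AnMap.reindex _),
    fun x => ⟨fun h => ⟨Empty.elim, h⟩, fun ⟨_, h⟩ => h⟩⟩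

lemma preimage {S : Set (κ → Ro K)} (hS : Ex S) {φ : (ι → Ro K) → κ → Ro K} (hφ : AnMap φ) :
    Ex (φ ⁻¹' S) := by
  obtain ⟨β, _, T, hT, h⟩ := hS
  refine ⟨β, ‹_›, (fun y => Sum.elim (φ fun i => y (Sum.inl i)) fun b => y (Sum.inr b)) ⁻¹' T,
    hT.preimage_An ?_, fun x => h _⟩
  exact AnMap.sumElim (hφ.comp (AnMap.reindex _)) (AnMap.reindex _)

lemma ex [Finite β] {p : (ι → Ro K) → (β → Ro K) → Prop}
    (h : Ex {y : ι ⊕ β → Ro K | p (fun i => y (Sum.inl i)) (fun b => y (Sum.inr b))}) :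
    Ex {x | ∃ z, p x z} := by
  obtain ⟨γ, _, T, hT, h⟩ := h
  refine ⟨β ⊕ γ, inferInstance, (fun y => Sum.elim (Sum.elim (fun i => y (Sum.inl i))
    fun b => y (Sum.inr (Sum.inl b))) fun c => y (Sum.inr (Sum.inr c))) ⁻¹' T,
    hT.preimage_An ?_, fun x => ⟨?_, ?_⟩⟩
  · exact AnMap.sumElim (AnMap.sumElim (AnMap.reindex _) (AnMap.reindex _)) (AnMap.reindex _)
  · rintro ⟨z, hz⟩
    obtain ⟨w, hw⟩ := (h (Sum.elim x z)).1 hz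
    exact ⟨Sum.elim z w, hw⟩
  · rintro ⟨z, hz⟩
    exact ⟨fun b => z (Sum.inl b), (h (Sum.elim x fun b => z (Sum.inl b))).2
      ⟨fun c => z (Sum.inr c), hz⟩⟩

lemma and {p q : (ι → Ro K) → Prop} (hp : Ex {x | p x}) (hq : Ex {x | q x}) :
    Ex {x | p x ∧ q x} := by
  obtain ⟨β, _, T, hT, h⟩ := hp
  obtain ⟨γ, _, T', hT', h'⟩ := hq
  refine ⟨β ⊕ γ, inferInstance,
    ((fun y => Sum.elim (fun i => y (Sum.inl i)) fun b => y (Sum.inr (Sum.inl b))) ⁻¹' T) ∩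
    ((fun y => Sum.elim (fun i => y (Sum.inl i)) fun b => y (Sum.inr (Sum.inr b))) ⁻¹' T'),
    (hT.preimage_An ?_).inter (hT'.preimage_An ?_), fun x => ⟨?_, ?_⟩⟩
  · exact AnMap.sumElim (AnMap.reindex _) (AnMap.reindex _)
  · exact AnMap.sumElim (AnMap.reindex _) (AnMap.reindex _)
  · rintro ⟨h1, h2⟩
    obtain ⟨z, hz⟩ := (h x).1 h1
    obtain ⟨w, hw⟩ := (h' x).1 h2
    exact ⟨Sum.elim z w, hz, hw⟩
  · rintro ⟨z, h1, h2⟩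
    exact ⟨(h x).2 ⟨_, h1⟩, (h' x).2 ⟨_, h2⟩⟩

lemma or {p q : (ι → Ro K) → Prop} (hp : Ex {x | p x}) (hq : Ex {x | q x}) :
    Ex {x | p x ∨ q x} := by
  obtain ⟨β, _, T, hT, h⟩ := hp
  obtain ⟨γ, _, T', hT', h'⟩ := hq
  refine ⟨β ⊕ γ, inferInstance,
    ((fun y => Sum.elim (fun i => y (Sum.inl i)) fun b => y (Sum.inr (Sum.inl b))) ⁻¹' T) ∪
    ((fun y => Sum.elim (fun i => y (Sum.inl i)) fun b => y (Sum.inr (Sum.inr b))) ⁻¹' T'),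
    (hT.preimage_An ?_).union (hT'.preimage_An ?_), fun x => ⟨?_, ?_⟩⟩
  · exact AnMap.sumElim (AnMap.reindex _) (AnMap.reindex _)
  · exact AnMap.sumElim (AnMap.reindex _) (AnMap.reindex _)
  · rintro (h1 | h1)
    · obtain ⟨z, hz⟩ := (h x).1 h1
      exact ⟨Sum.elim z 0, Or.inl hz⟩
    · obtain ⟨z, hz⟩ := (h' x).1 h1
      exact ⟨Sum.elim 0 z, Or.inr hz⟩
  · rintro ⟨z, h1 | h1⟩
    · exact Or.inl ((h x).2 ⟨_, h1⟩)
    · exact Or.inr ((h' x).2 ⟨_, h1⟩)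

lemma all [Finite β] {p : β → (ι → Ro K) → Prop} (h : ∀ b, Ex {x | p b x}) :
    Ex {x | ∀ b, p b x} := by
  classical
  have := Fintype.ofFinite β
  have key : ∀ s : Finset β, Ex {x | ∀ b ∈ s, p b x} := fun s => by
    induction s using Finset.induction_on with
    | empty => simpa using of_VB (VB.univ (F := An K ι))
    | insert a s ha ih =>
      simp only [Finset.forall_mem_insert]
      exact (h a).and ih
  simpa using key Finset.univ

lemma any [Finite β] {p : β → (ι → Ro K) → Prop} (h : ∀ b, Ex {x | p b x}) :
    Ex {x | ∃ b, p b x} := by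
  classical
  have := Fintype.ofFinite β
  have key : ∀ s : Finset β, Ex {x | ∃ b ∈ s, p b x} := fun s => by
    induction s using Finset.induction_on with
    | empty => simpa using of_VB (VB.empty (F := An K ι))
    | insert a s ha ih =>
      simp only [Finset.exists_mem_insert]
      exact (h a).or ih
  simpa using key Finset.univ

lemma eq {f g : (ι → Ro K) → Ro K} (hf : f ∈ AnO K ι) (hg : g ∈ AnO K ι) : Ex {x | f x = g x} := by
  have := VB.eq_zero (An.sub hf hg) (An.const 0)
  convert of_VB this using 3 with x
  rw [sub_eq_zero, Subtype.ext_iff]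

end Ex

/-- Sets which are existentially definable together with their complements. -/
def Df (S : Set (ι → Ro K)) : Prop := Ex S ∧ Ex Sᶜ

namespace Df

lemma of_VB {S : Set (ι → Ro K)} (hS : VB (An K ι) S) : Df S := ⟨Ex.of_VB hS, Ex.of_VB hS.compl⟩

lemma not {p : (ι → Ro K) → Prop} (hp : Df {x | p x}) : Df {x | ¬ p x} :=
  ⟨hp.2, by simpa [Set.compl_ofPred] using hp.1⟩

lemma and {p q : (ι → Ro K) → Prop} (hp : Df {x | p x}) (hq : Df {x | q x}) :
    Df {x | p x ∧ q x} := by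
  refine ⟨hp.1.and hq.1, ?_⟩
  have := Ex.or (p := fun x => ¬ p x) (q := fun x => ¬ q x) hp.2 hq.2
  simpa only [Set.compl_ofPred, not_and_or] using this

lemma all [Finite β] {p : β → (ι → Ro K) → Prop} (h : ∀ b, Df {x | p b x}) :
    Df {x | ∀ b, p b x} := by
  refine ⟨Ex.all fun b => (h b).1, ?_⟩
  have := Ex.any (p := fun b x => ¬ p b x) fun b => (h b).2
  simpa only [Set.compl_ofPred, not_forall] using this

lemma any [Finite β] {p : β → (ι → Ro K) → Prop} (h : ∀ b, Df {x | p b x}) :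
    Df {x | ∃ b, p b x} := by
  have := (all fun b => (h b).not).not
  simpa only [not_forall, not_not] using this

end Df

end

section

variable {ι κ β : Type} {N : ℕ}

lemma exists_algHom_of_commute {R B I : Type} [CommRing R] [Ring B] [Algebra R B] (m : I → B)
    (h : ∀ i j, m i * m j = m j * m i) :
    ∃ ψ : MvPolynomial I R →ₐ[R] B, ∀ i, ψ (MvPolynomial.X i) = m i := by
  let : CommRing (Algebra.adjoin R (Set.range m)) := Algebra.adjoinCommRingOfComm R (by
    rintro _ ⟨i, rfl⟩ _ ⟨j, rfl⟩
    exact h i j)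
  refine ⟨(Algebra.adjoin R (Set.range m)).val.comp (MvPolynomial.aeval fun i =>
    (⟨m i, Algebra.subset_adjoin ⟨i, rfl⟩⟩ : Algebra.adjoin R (Set.range m))), fun i => ?_⟩
  simp

lemma Good.cancel {B : Type} [Ring B] [Algebra (Ro K) B] (hB : Good K B) {e : Ro K}
    (he : ‖(e : K)‖ < 1) {Z P : B} (h : (1 + e • Z) * P = 0) : P = 0 := by
  have h1 : P = e • (-(Z * P)) := by
    rw [add_mul, one_mul, smul_mul_assoc] at h
    rw [smul_neg]
    exact eq_neg_of_add_eq_zero_left h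
  have h2 : ∀ n : ℕ, ∃ Q, P = e ^ n • Q := fun n => by
    induction n with
    | zero => exact ⟨P, by simp⟩
    | succ n ih =>
      obtain ⟨Q, hQ⟩ := ih
      refine ⟨-(Z * Q), ?_⟩
      conv_lhs => rw [h1, hQ]
      rw [mul_smul_comm, ← smul_neg, smul_smul, pow_succ']
  refine hB.sep _ fun d hd => ?_
  obtain ⟨n, a, ha⟩ := Ro.exists_pow_dvd he hd
  obtain ⟨Q, hQ⟩ := h2 n
  exact ⟨a • Q, by rw [smul_smul, ← ha, ← hQ]⟩

section Companion

variable {B : Type} [Ring B] {s : ℕ}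

/-- The companion matrix of a monic polynomial. -/
def companion (C : Fin (s + 1) → B) : Matrix (Fin (s + 1)) (Fin (s + 1)) B := Matrix.of fun i j =>
  (if (i : ℕ) = j + 1 then 1 else 0) - if (j : ℕ) = s then C i else 0

lemma mul_companion_pow (C : Fin (s + 1) → B) (A : Matrix (Fin (s + 1)) (Fin (s + 1)) B) (i : Fin (s + 1)) :
    ∀ k : ℕ, (hk : k < s + 1) → (A * companion C ^ k) i 0 = A i ⟨k, hk⟩ := by
  intro k
  induction k generalizing A with
  | zero => intro hk; simp
  | succ k ih =>
    intro hk
    rw [pow_succ', ← mul_assoc, ih _ (by omega), Matrix.mul_apply]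
    rw [Finset.sum_eq_single ⟨k + 1, hk⟩]
    · have : k ≠ s := by omega
      simp [companion, this]
    · intro j _ hj
      have h1 : k ≠ s := by omega
      have h2 : (j : ℕ) ≠ k + 1 := fun h => hj (Fin.ext h)
      simp [companion, h1, h2]
    · simp

lemma companion_top (C : Fin (s + 1) → B) (i : Fin (s + 1)) :
    (companion C ^ (s + 1)) i 0 = -C i := by
  rw [pow_succ', mul_companion_pow _ _ _ _ (Nat.lt_succ_self s)]
  have : (i : ℕ) ≠ s + 1 := by omega
  simp [companion, this]

lemma companion_poly (C C' : Fin (s + 1) → B) (i : Fin (s + 1)) :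
    (companion C ^ (s + 1) + ∑ j, Matrix.scalar (Fin (s + 1)) (C' j) * companion C ^ (j : ℕ)) i 0 =
      C' i - C i := by
  rw [Matrix.add_apply, companion_top, Matrix.sum_apply]
  have h : ∀ j : Fin (s + 1), (Matrix.scalar (Fin (s + 1)) (C' j) * companion C ^ (j : ℕ)) i 0 =
      if i = j then C' j else 0 := fun j => by
    rw [mul_companion_pow _ _ _ _ j.2, Matrix.scalar_apply, Matrix.diagonal_apply]
  simp only [h, Finset.sum_ite_eq, Finset.mem_univ, if_true]
  abel

lemma scalar_commute_companion (C : Fin (s + 1) → B) (b : B) (hb : ∀ j, b * C j = C j * b) :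
    Matrix.scalar (Fin (s + 1)) b * companion C = companion C * Matrix.scalar (Fin (s + 1)) b := by
  ext i j
  rw [Matrix.scalar_apply, Matrix.diagonal_mul, Matrix.mul_diagonal]
  simp only [companion, Matrix.of_apply, mul_sub, sub_mul, mul_ite, ite_mul, mul_one, one_mul,
    mul_zero, zero_mul, hb]

/-- A Cayley–Hamilton identity. -/
lemma companion_annihilates (C : Fin (s + 1) → B) (hC : ∀ i j, C i * C j = C j * C i) :
    companion C ^ (s + 1) + ∑ j, Matrix.scalar (Fin (s + 1)) (C j) * companion C ^ (j : ℕ) = 0 := by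
  set P := companion C ^ (s + 1) + ∑ j, Matrix.scalar (Fin (s + 1)) (C j) * companion C ^ (j : ℕ)
    with hP
  have h1 : Commute P (companion C) := by
    rw [hP]
    refine Commute.add_left (Commute.pow_left (Commute.refl _) _) (Commute.sum_left _ _ _ fun j _ => ?_)
    exact Commute.mul_left (scalar_commute_companion C _ fun i => hC _ _)
      (Commute.pow_left (Commute.refl _) _)
  ext i k
  have h2 := mul_companion_pow C P i k k.2
  rw [(h1.pow_right (k : ℕ)).eq, Matrix.mul_apply] at h2
  rw [← h2, Matrix.zero_apply]
  refine Finset.sum_eq_zero fun j _ => ?_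
  rw [hP, companion_poly, sub_self, mul_zero]

end Companion

/-- Matrix valued functions with analytic entries. -/
def AnM (A : (ι → Ro K) → Matrix κ κ (Ro K)) : Prop := ∀ a b, (fun x => A x a b) ∈ AnO K ι

namespace AnM

variable {A A' : (ι → Ro K) → Matrix κ κ (Ro K)}

lemma add (hA : AnM A) (hA' : AnM A') : AnM fun x => A x + A' x := fun a b =>
  (AnO K ι).add_mem (hA a b) (hA' a b)

lemma mul [Fintype κ] (hA : AnM A) (hA' : AnM A') : AnM fun x => A x * A' x := fun a b => by
  have : (fun x => (A x * A' x) a b) = ∑ c, (fun x => A x a c) * fun x => A' x c b := by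
    ext1 x
    rw [Matrix.mul_apply, Finset.sum_apply]
    rfl
  rw [this]
  exact (AnO K ι).sum_mem fun c _ => (AnO K ι).mul_mem (hA a c) (hA' c b)

lemma const (A : Matrix κ κ (Ro K)) : AnM fun _ : ι → Ro K => A := fun a b => AnO.const _

lemma pow [Fintype κ] [DecidableEq κ] (hA : AnM A) (n : ℕ) : AnM fun x => A x ^ n := by
  induction n with
  | zero => simpa using const 1
  | succ n ih => simpa only [pow_succ] using ih.mul hA

lemma eq [Finite κ] (hA : AnM A) (hA' : AnM A') : Ex {x | A x = A' x} := by
  have : {x | A x = A' x} = {x | ∀ a b, A x a b = A' x a b} := by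
    ext x
    exact Matrix.ext_iff.symm
  rw [this]
  exact Ex.all fun a => Ex.all fun b => Ex.eq (hA a b) (hA' a b)

end AnM

/-- The point with given coordinates. -/
def pt (x : ι → Ro K) (M : Fin N → Matrix κ κ (Ro K)) (Y : Matrix κ κ (Ro K)) :
    (ι ⊕ (Fin N × κ × κ)) ⊕ (κ × κ) → Ro K :=
  Sum.elim (Sum.elim x fun t => M t.1 t.2.1 t.2.2) fun t => Y t.1 t.2

lemma AnMap.pt {ι' : Type} {x : (ι' → Ro K) → ι → Ro K} {M : (ι' → Ro K) → Fin N → Matrix κ κ (Ro K)}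
    {Y : (ι' → Ro K) → Matrix κ κ (Ro K)} (hx : AnMap x) (hM : ∀ i, AnM fun z => M z i) (hY : AnM Y) :
    AnMap fun z => SubQE.pt (x z) (M z) (Y z) :=
  AnMap.sumElim (AnMap.sumElim hx fun t => hM _ _ _) fun t => hY _ _

/-- Families of power series whose matrix values are existentially definable. -/
def Dfn (S : Set (ι → Ro K)) (f : (ι → Ro K) → Pow K N) : Prop :=
  ∀ (κ : Type) [Fintype κ] [DecidableEq κ], ∃ E : Set ((ι ⊕ (Fin N × κ × κ)) ⊕ (κ × κ) → Ro K), Ex E ∧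
    ∀ x ∈ S, ∀ (ψ : MvPolynomial (Fin N) (Ro K) →ₐ[Ro K] Matrix κ κ (Ro K)) (Y : Matrix κ κ (Ro K)),
      pt x (fun i => ψ (MvPolynomial.X i)) Y ∈ E ↔ EvalTo (f x) ψ Y

/-- Functions with existentially definable graph. -/
def DfnO (S : Set (ι → Ro K)) (b : (ι → Ro K) → Ro K) : Prop :=
  ∃ E : Set (ι ⊕ Unit → Ro K), Ex E ∧ ∀ x ∈ S, ∀ y, Sum.elim x (fun _ => y) ∈ E ↔ y = b x

lemma Dfn.mono {S S' : Set (ι → Ro K)} (h : S' ⊆ S) {f : (ι → Ro K) → Pow K N} (hf : Dfn S f) :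
    Dfn S' f := fun κ _ _ => by
  obtain ⟨E, hE, h1⟩ := hf κ
  exact ⟨E, hE, fun x hx => h1 x (h hx)⟩

lemma DfnO.mono {S S' : Set (ι → Ro K)} (h : S' ⊆ S) {b : (ι → Ro K) → Ro K} (hf : DfnO S b) :
    DfnO S' b := by
  obtain ⟨E, hE, h1⟩ := hf
  exact ⟨E, hE, fun x hx => h1 x (h hx)⟩

lemma Ex.pt_setOf {p : (ι → Ro K) → (Fin N → Matrix κ κ (Ro K)) → Matrix κ κ (Ro K) → Prop}
    (h : Ex {z : (ι ⊕ (Fin N × κ × κ)) ⊕ (κ × κ) → Ro K | p (fun i => z (Sum.inl (Sum.inl i)))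
      (fun i => Matrix.of fun a b => z (Sum.inl (Sum.inr (i, a, b))))
      (Matrix.of fun a b => z (Sum.inr (a, b)))}) :
    ∃ E : Set ((ι ⊕ (Fin N × κ × κ)) ⊕ (κ × κ) → Ro K), Ex E ∧
      ∀ x M Y, SubQE.pt x M Y ∈ E ↔ p x M Y :=
  ⟨_, h, fun _ _ _ => Iff.rfl⟩

/-- Truncated shift matrices. -/
def shiftMat (A : Type) [CommRing A] (ν : Fin N →₀ ℕ) (i : Fin N) :
    Matrix (Finset.Iic ν) (Finset.Iic ν) A :=
  Matrix.of fun α γ => if (α : Fin N →₀ ℕ) = γ.1 + Finsupp.single i 1 then 1 else 0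

lemma shiftMat_mul_apply {A : Type} [CommRing A] (ν : Fin N →₀ ℕ) (i : Fin N)
    (M : Matrix (Finset.Iic ν) (Finset.Iic ν) A) (α γ : Finset.Iic ν) (F : (Fin N →₀ ℕ) → A)
    (hF : ∀ δ : Finset.Iic ν, M δ γ = F δ) :
    (shiftMat A ν i * M) α γ =
      if i ∈ (α : Fin N →₀ ℕ).support then F (α.1 - Finsupp.single i 1) else 0 := by
  rw [Matrix.mul_apply]
  split_ifs with h
  · have h1 : Finsupp.single i 1 ≤ (α : Fin N →₀ ℕ) := by
      rw [Finsupp.single_le_iff]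
      exact Nat.one_le_iff_ne_zero.2 (Finsupp.mem_support_iff.1 h)
    rw [Finset.sum_eq_single ⟨α.1 - Finsupp.single i 1, Finset.mem_Iic.2
      (tsub_le_self.trans (Finset.mem_Iic.1 α.2))⟩]
    · rw [hF]
      simp [shiftMat, tsub_add_cancel_of_le h1]
    · rintro ⟨δ, hδ⟩ _ hne
      rw [shiftMat, Matrix.of_apply, if_neg, zero_mul]
      intro h2
      exact hne (Subtype.ext (by simp only at h2 ⊢; rw [h2]; simp))
    · simp
  · refine Finset.sum_eq_zero fun δ _ => ?_
    rw [shiftMat, Matrix.of_apply, if_neg, zero_mul]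
    intro h2
    apply h
    rw [h2]
    simp

lemma shiftMat_commute (A : Type) [CommRing A] (ν : Fin N →₀ ℕ) (i j : Fin N) :
    shiftMat A ν i * shiftMat A ν j = shiftMat A ν j * shiftMat A ν i := by
  ext α γ
  rw [shiftMat_mul_apply ν i _ α γ (fun δ => if δ = γ.1 + Finsupp.single j 1 then 1 else 0)
    fun δ => rfl, shiftMat_mul_apply ν j _ α γ (fun δ => if δ = γ.1 + Finsupp.single i 1 then 1 else 0)
    fun δ => rfl]
  have key : ∀ i j : Fin N, (if i ∈ (α : Fin N →₀ ℕ).support then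
      if (α : Fin N →₀ ℕ) - Finsupp.single i 1 = γ.1 + Finsupp.single j 1 then (1 : A) else 0 else 0) =
      if (α : Fin N →₀ ℕ) = γ.1 + (Finsupp.single j 1 + Finsupp.single i 1) then 1 else 0 := by
    intro i j
    rw [← ite_and]
    congr 1
    refine propext ⟨fun ⟨h1, h2⟩ => ?_, fun h => ?_⟩
    · have h1 : Finsupp.single i 1 ≤ (α : Fin N →₀ ℕ) := by
        rw [Finsupp.single_le_iff]
        exact Nat.one_le_iff_ne_zero.2 (Finsupp.mem_support_iff.1 h1)
      rw [← add_assoc, ← h2, tsub_add_cancel_of_le h1]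
    · rw [h, ← add_assoc]
      simp
  rw [key, key, add_comm (Finsupp.single i 1)]

lemma exists_coeff_hom (ν : Fin N →₀ ℕ) :
    ∃ ψ : MvPolynomial (Fin N) (Ro K) →ₐ[Ro K] Matrix (Finset.Iic ν) (Finset.Iic ν) (Ro K),
      (∀ i, ψ (MvPolynomial.X i) = shiftMat (Ro K) ν i) ∧
      ∀ p (α : Finset.Iic ν), ψ p α ⟨0, Finset.mem_Iic.2 (by simp)⟩ = MvPolynomial.coeff α p := by
  obtain ⟨ψ, hψ⟩ := exists_algHom_of_commute (R := Ro K) (shiftMat (Ro K) ν) (shiftMat_commute _ ν)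
  refine ⟨ψ, hψ, fun p => ?_⟩
  induction p using MvPolynomial.induction_on with
  | C a =>
    intro α
    rw [← MvPolynomial.algebraMap_eq, AlgHom.commutes, Matrix.algebraMap_matrix_apply,
      MvPolynomial.algebraMap_eq, MvPolynomial.coeff_C]
    simp [Subtype.ext_iff, eq_comm]
  | add p q hp hq =>
    intro α
    rw [map_add, Matrix.add_apply, hp, hq, MvPolynomial.coeff_add]
  | mul_X p i hp =>
    intro α
    rw [mul_comm, map_mul, hψ, shiftMat_mul_apply ν i _ α _ (fun δ => MvPolynomial.coeff δ p) hp,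
      mul_comm, MvPolynomial.coeff_mul_X']

lemma EvalTo.coeff_eq {π : Ro K} (hπ0 : π ≠ 0) (hπ : ‖(π : K)‖ < 1) (ν : Fin N →₀ ℕ)
    {ψ : MvPolynomial (Fin N) (Ro K) →ₐ[Ro K] Matrix (Finset.Iic ν) (Finset.Iic ν) (Ro K)}
    (hψ : ∀ p (α : Finset.Iic ν), ψ p α ⟨0, Finset.mem_Iic.2 (by simp)⟩ = MvPolynomial.coeff α p)
    {f : Pow K N} {Y : Matrix (Finset.Iic ν) (Finset.Iic ν) (Ro K)} (h : EvalTo f ψ Y) :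
    Y ⟨ν, Finset.mem_Iic.2 le_rfl⟩ ⟨0, Finset.mem_Iic.2 (by simp)⟩ = MvPowerSeries.coeff ν f := by
  rw [← sub_eq_zero]
  refine (good_O hπ0 hπ).sep _ fun d hd => ?_
  obtain ⟨p, g, Z, rfl, rfl⟩ := h d hd
  refine ⟨Z ⟨ν, Finset.mem_Iic.2 le_rfl⟩ ⟨0, Finset.mem_Iic.2 (by simp)⟩ -
    MvPowerSeries.coeff ν g, ?_⟩
  rw [Matrix.add_apply, hψ, map_add, MvPolynomial.coeff_coe, MvPowerSeries.coeff_C_mul,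
    Matrix.smul_apply, smul_eq_mul, smul_eq_mul]
  ring

lemma Dfn.coeff {π : Ro K} (hπ0 : π ≠ 0) (hπ : ‖(π : K)‖ < 1) {S : Set (ι → Ro K)}
    {f : (ι → Ro K) → Pow K N} (hf : Dfn S f) (hT : Tame π S f) (ν : Fin N →₀ ℕ) :
    DfnO S fun x => MvPowerSeries.coeff ν (f x) := by
  classical
  obtain ⟨E, hE, h⟩ := hf (Finset.Iic ν)
  obtain ⟨ψ, hψ, hψc⟩ := exists_coeff_hom (K := K) ν
  refine ⟨{z | ∃ Y : Finset.Iic ν × Finset.Iic ν → Ro K,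
    pt (fun i => z (Sum.inl i)) (shiftMat (Ro K) ν) (Matrix.of fun α γ => Y (α, γ)) ∈ E ∧
      Y (⟨ν, Finset.mem_Iic.2 le_rfl⟩, ⟨0, Finset.mem_Iic.2 (by simp)⟩) = z (Sum.inr ())}, ?_, ?_⟩
  · refine Ex.ex (Ex.and (hE.preimage (φ := fun y : (ι ⊕ Unit) ⊕ (Finset.Iic ν × Finset.Iic ν) → Ro K =>
      pt (fun i => y (Sum.inl (Sum.inl i))) (shiftMat (Ro K) ν)
        (Matrix.of fun α γ => y (Sum.inr (α, γ))))
      (AnMap.pt (AnMap.reindex _) (fun i => AnM.const _) fun α γ => AnO.coord _))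
      (Ex.eq (AnO.coord _) (AnO.coord _)))
  · intro x hx y
    have hψ' : (fun i => ψ (MvPolynomial.X i)) = shiftMat (Ro K) ν := funext hψ
    have h' := h x hx ψ
    rw [hψ'] at h'
    constructor
    · rintro ⟨Y, h1, h2⟩
      exact h2.symm.trans (EvalTo.coeff_eq hπ0 hπ ν hψc ((h' _).1 h1))
    · rintro rfl
      obtain ⟨Y, hY⟩ := hT.exists_evalTo ((good_O hπ0 hπ).matrix _) hx ψ
      exact ⟨fun t => Y t.1 t.2, (h' Y).2 hY, EvalTo.coeff_eq hπ0 hπ ν hψc hY⟩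

lemma DfnO.C {π : Ro K} (hπ0 : π ≠ 0) (hπ : ‖(π : K)‖ < 1) {S : Set (ι → Ro K)}
    {b : (ι → Ro K) → Ro K} (hb : DfnO S b) :
    Dfn S fun x => (MvPowerSeries.C (b x) : Pow K N) := by
  intro κ _ _
  obtain ⟨E, hE, h⟩ := hb
  obtain ⟨E', hE', h'⟩ := Ex.pt_setOf (N := N) (κ := κ) (p := fun x _ Y =>
      ∃ y : Unit → Ro K, Sum.elim x y ∈ E ∧ Y = algebraMap (Ro K) (Matrix κ κ (Ro K)) (y ())) (by
    refine Ex.ex (Ex.and (hE.preimage (AnMap.sumElim (AnMap.reindex _) (AnMap.reindex _)))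
      (AnM.eq (fun _ _ => AnO.coord _) fun a c => ?_))
    simp only [Matrix.algebraMap_matrix_apply]
    split_ifs
    · exact AnO.coord _
    · exact AnO.const 0)
  refine ⟨E', hE', fun x hx ψ Y => (h' _ _ _).trans ⟨?_, fun hY => ?_⟩⟩
  · rintro ⟨y, h1, rfl⟩
    have h2 : y () = b x := (h x hx (y ())).1 h1
    rw [h2]
    exact EvalTo.C _ ψ
  · exact ⟨fun _ => b x, (h x hx _).2 rfl, EvalTo.unique ((good_O hπ0 hπ).matrix κ) hY (EvalTo.C _ ψ)⟩

end

section

variable {ι κ β : Type} {N : ℕ} {π : Ro K}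

/-- The sheared coordinates built from a companion matrix and scalar matrices. -/
def shearedMat [Fintype κ] [DecidableEq κ] (d : ℕ) {s : ℕ}
    (C : Fin (s + 1) → Matrix κ κ (Ro K)) (M : Fin N → Matrix κ κ (Ro K)) :
    Fin (N + 1) → Matrix (Fin (s + 1) × κ) (Fin (s + 1) × κ) (Ro K) :=
  Fin.cases (Matrix.compAlgEquiv (Fin (s + 1)) κ (Ro K) (Ro K) (companion C)) fun i =>
    Matrix.compAlgEquiv (Fin (s + 1)) κ (Ro K) (Ro K) (Matrix.scalar (Fin (s + 1)) (M i)) +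
      Matrix.compAlgEquiv (Fin (s + 1)) κ (Ro K) (Ro K) (companion C) ^ d ^ ((i : ℕ) + 1)

lemma AnM.shearedMat [Fintype κ] [DecidableEq κ] (d : ℕ) {s : ℕ}
    {C : (ι → Ro K) → Fin (s + 1) → Matrix κ κ (Ro K)} (hC : ∀ i, AnM fun x => C x i)
    {M : (ι → Ro K) → Fin N → Matrix κ κ (Ro K)} (hM : ∀ i, AnM fun x => M x i) (i : Fin (N + 1)) :
    AnM fun x => shearedMat d (C x) (M x) i := by
  have hW : AnM fun x => Matrix.compAlgEquiv (Fin (s + 1)) κ (Ro K) (Ro K) (companion (C x)) := by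
    rintro ⟨i, a⟩ ⟨j, b⟩
    simp only [Matrix.compAlgEquiv_apply, Matrix.comp_apply, companion, Matrix.of_apply,
      Matrix.sub_apply]
    refine (AnO K ι).sub_mem (x := fun _ => _) (y := fun _ => _) (AnO.const _) ?_
    split_ifs
    · exact hC i a b
    · exact AnO.const 0
  cases i using Fin.cases with
  | zero => exact hW
  | succ i =>
    refine AnM.add ?_ (hW.pow _)
    rintro ⟨k, a⟩ ⟨l, b⟩
    simp only [Matrix.compAlgEquiv_apply, Matrix.comp_apply, Matrix.scalar_apply,
      Matrix.diagonal_apply]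
    split_ifs
    · exact hM i a b
    · exact AnO.const 0

/-- The graph of the coefficients of a Weierstrass polynomial is determined by the vanishing of
the series on the associated companion matrix. -/
lemma evalTo_shearedMat_iff (hπ0 : π ≠ 0) (hπ : ‖(π : K)‖ < 1) {f : Pow K (N + 1)} {s d : ℕ}
    {c : Fin (s + 1) → Pow K N} {b : Ro K} (hb : b ≠ 0)
    (hW : ∀ (B : Type) [Ring B] [Algebra (Ro K) B], Good K B →
          ∀ (ψ : MvPolynomial (Fin (N + 1)) (Ro K) →ₐ[Ro K] B) (Cv : Fin (s + 1) → B),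
          (∀ j, EvalTo (c j) (tailHom ψ) (Cv j)) →
          ∃ (e : Ro K) (Z : B), ‖(e : K)‖ < 1 ∧ EvalTo f (ψ.comp (shear (Ro K) N d))
            (b • ((1 + e • Z) *
              (ψ (MvPolynomial.X 0) ^ (s + 1) + ∑ j, Cv j * ψ (MvPolynomial.X 0) ^ (j : ℕ)))))
    [Fintype κ] [DecidableEq κ] (ψ : MvPolynomial (Fin N) (Ro K) →ₐ[Ro K] Matrix κ κ (Ro K))
    {C C' : Fin (s + 1) → Matrix κ κ (Ro K)} (hC' : ∀ j, EvalTo (c j) ψ (C' j))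
    (hCC : ∀ i j, C i * C j = C j * C i)
    (hMC : ∀ i j, ψ (MvPolynomial.X i) * C j = C j * ψ (MvPolynomial.X i)) :
    ∃ Φ : MvPolynomial (Fin (N + 1)) (Ro K) →ₐ[Ro K]
      Matrix (Fin (s + 1) × κ) (Fin (s + 1) × κ) (Ro K),
      (fun i => Φ (MvPolynomial.X i)) = shearedMat d C (fun i => ψ (MvPolynomial.X i)) ∧
      (EvalTo f Φ 0 ↔ C = C') := by
  have hG := good_O hπ0 hπ
  set sc := Matrix.scalarAlgHom (α := Matrix κ κ (Ro K)) (Fin (s + 1)) (Ro K) with hsc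
  obtain ⟨ψ', hψ'⟩ := exists_algHom_of_commute (R := Ro K)
    (Fin.cases (companion C) (fun i => Matrix.scalar (Fin (s + 1)) (ψ (MvPolynomial.X i))) :
      Fin (N + 1) → Matrix (Fin (s + 1)) (Fin (s + 1)) (Matrix κ κ (Ro K))) (by
    intro i j
    cases i using Fin.cases with
    | zero =>
      cases j using Fin.cases with
      | zero => rfl
      | succ j => exact (scalar_commute_companion C _ fun k => hMC j k).symm
    | succ i =>
      cases j using Fin.cases with
      | zero => exact scalar_commute_companion C _ fun k => hMC i k
      | succ j =>
        simp only [Fin.cases_succ]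
        rw [← map_mul, ← map_mul, ← map_mul, ← map_mul, mul_comm])
  have h0 : ψ' (MvPolynomial.X 0) = companion C := hψ' 0
  have hs : ∀ i : Fin N, ψ' (MvPolynomial.X i.succ) =
    Matrix.scalar (Fin (s + 1)) (ψ (MvPolynomial.X i)) := fun i => hψ' i.succ
  have htail : tailHom ψ' = sc.comp ψ := by
    refine MvPolynomial.algHom_ext fun i => ?_
    rw [tailHom, AlgHom.comp_apply, MvPolynomial.rename_X, hs]
    rfl
  obtain ⟨e, Z, he, hZ⟩ := hW _ (hG.matrix κ |>.matrix (Fin (s + 1))) ψ' (fun j => sc (C' j))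
    fun j => by rw [htail]; exact (hC' j).map sc
  rw [h0] at hZ
  refine ⟨(Matrix.compAlgEquiv (Fin (s + 1)) κ (Ro K) (Ro K)).toAlgHom.comp
    (ψ'.comp (shear (Ro K) N d)), funext fun i => ?_, ?_⟩
  · rw [AlgHom.comp_apply, AlgHom.comp_apply, shear, MvPolynomial.aeval_X, shearVar]
    cases i using Fin.cases with
    | zero => rw [if_pos rfl, h0]; rfl
    | succ i =>
      rw [if_neg (Fin.succ_ne_zero i), map_add, map_pow, h0, hs, map_add, map_pow]
      rfl
  · have hZ' := hZ.map (Matrix.compAlgEquiv (Fin (s + 1)) κ (Ro K) (Ro K)).toAlgHom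
    have hCv : C = C' → companion C ^ (s + 1) + ∑ j, sc (C' j) * companion C ^ (j : ℕ) = 0 := by
      rintro rfl
      exact companion_annihilates C hCC
    constructor
    · intro h
      have h1 := h.unique (hG.matrix _) hZ'
      have h2 := (Matrix.compAlgEquiv (Fin (s + 1)) κ (Ro K) (Ro K)).injective
        ((map_zero _).trans h1)
      have h3 : (1 + e • Z) * (companion C ^ (s + 1) + ∑ j, sc (C' j) * companion C ^ (j : ℕ)) = 0 := by
        ext i j k l
        have h4 := congrFun (congrFun (congrFun (congrFun h2 i) j) k) l
        rw [Matrix.smul_apply, Matrix.smul_apply, smul_eq_mul] at h4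
        exact congrArg Subtype.val ((mul_eq_zero.1 h4.symm).resolve_left hb)
      have h4 := Good.cancel (hG.matrix κ |>.matrix (Fin (s + 1))) he h3
      funext i
      have h5 := companion_poly C C' i
      have h6 := congrFun (congrFun h4 i) 0
      exact (sub_eq_zero.1 (h5.symm.trans h6)).symm
    · intro h
      rw [hCv h, mul_zero, smul_zero, map_zero] at hZ'
      exact hZ'

lemma Dfn.weierstrass (hπ0 : π ≠ 0) (hπ : ‖(π : K)‖ < 1) {S : Set (ι → Ro K)}
    {f : (ι → Ro K) → Pow K (N + 1)} (hf : Dfn S f) {s d : ℕ} {c : Fin s → (ι → Ro K) → Pow K N}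
    (hc : ∀ j, Tame π Set.univ (c j)) {b : (ι → Ro K) → Ro K} (hb : ∀ x ∈ S, b x ≠ 0)
    (hW : ∀ x ∈ S, ∀ (B : Type) [Ring B] [Algebra (Ro K) B], Good K B →
          ∀ (ψ : MvPolynomial (Fin (N + 1)) (Ro K) →ₐ[Ro K] B) (Cv : Fin s → B),
          (∀ j, EvalTo (c j x) (tailHom ψ) (Cv j)) →
          ∃ (e : Ro K) (Z : B), ‖(e : K)‖ < 1 ∧ EvalTo (f x) (ψ.comp (shear (Ro K) N d))
            (b x • ((1 + e • Z) *
              (ψ (MvPolynomial.X 0) ^ s + ∑ j, Cv j * ψ (MvPolynomial.X 0) ^ (j : ℕ)))))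
    (j : Fin s) : Dfn S (c j) := by
  cases s with
  | zero => exact j.elim0
  | succ s =>
  intro κ _ _
  have hG := (good_O hπ0 hπ).matrix κ
  obtain ⟨E, hE, hEf⟩ := hf (Fin (s + 1) × κ)
  obtain ⟨E', hE', h'⟩ := Ex.pt_setOf (N := N) (κ := κ) (p := fun x M Y =>
      ∃ C : Fin (s + 1) × κ × κ → Ro K,
        (Matrix.of fun a b => C (j, a, b)) = Y ∧
        (∀ i k, ((Matrix.of fun a b => C (i, a, b)) * Matrix.of fun a b => C (k, a, b)) =
          (Matrix.of fun a b => C (k, a, b)) * Matrix.of fun a b => C (i, a, b)) ∧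
        (∀ i k, (M i * Matrix.of fun a b => C (k, a, b)) = (Matrix.of fun a b => C (k, a, b)) * M i) ∧
        pt x (shearedMat d (fun i => Matrix.of fun a b => C (i, a, b)) M) 0 ∈ E) (by
    refine Ex.ex (Ex.and (AnM.eq (fun _ _ => AnO.coord _) (fun _ _ => AnO.coord _)) (Ex.and ?_
      (Ex.and ?_ ?_)))
    · exact Ex.all fun i => Ex.all fun k => AnM.eq
        (AnM.mul (fun _ _ => AnO.coord _) (fun _ _ => AnO.coord _))
        (AnM.mul (fun _ _ => AnO.coord _) (fun _ _ => AnO.coord _))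
    · exact Ex.all fun i => Ex.all fun k => AnM.eq
        (AnM.mul (fun _ _ => AnO.coord _) (fun _ _ => AnO.coord _))
        (AnM.mul (fun _ _ => AnO.coord _) (fun _ _ => AnO.coord _))
    · exact hE.preimage (AnMap.pt (AnMap.reindex _) (AnM.shearedMat d
        (fun i _ _ => AnO.coord _) (fun i _ _ => AnO.coord _)) (AnM.const 0)))
  refine ⟨E', hE', fun x hx ψ Y => (h' _ _ _).trans ?_⟩
  have hex : ∀ k, ∃ Y, EvalTo (c k x) ψ Y := fun k => (hc k).exists_evalTo hG (Set.mem_univ x) ψ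
  choose C' hC' using hex
  constructor
  · rintro ⟨C, rfl, h1, h2, h3⟩
    obtain ⟨Φ, hΦ, hΦ'⟩ := evalTo_shearedMat_iff hπ0 hπ (hb x hx) (hW x hx) ψ hC' h1 h2
    rw [← hΦ, hEf x hx, hΦ'] at h3
    rw [congrFun h3 j]
    exact hC' j
  · intro hY
    have h2 : ∀ i k, ψ (MvPolynomial.X i) * C' k = C' k * ψ (MvPolynomial.X i) := fun i k =>
      (hC' k).commute hG fun l => by rw [← map_mul, mul_comm, map_mul]
    have h1 : ∀ i k, C' i * C' k = C' k * C' i := fun i k =>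
      (hC' k).commute hG fun l => (h2 l i).symm
    obtain ⟨Φ, hΦ, hΦ'⟩ := evalTo_shearedMat_iff hπ0 hπ (hb x hx) (hW x hx) ψ hC' h1 h2
    refine ⟨fun t => C' t.1 t.2.1 t.2.2, (hC' j).unique hG hY, h1, h2, ?_⟩
    have h3 := (hEf x hx Φ 0).2 (hΦ'.2 rfl)
    rw [hΦ] at h3
    exact h3

end

section

variable {ι κ β ρ : Type} {N : ℕ} {π : Ro K}

lemma polynomial_mem_An (p : MvPolynomial ρ K) :
    (fun y : ρ → Ro K => MvPolynomial.eval (fun i => (y i : K)) p) ∈ An K ρ := pe_mem_An p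

lemma Df.of_values [Finite ρ] {S : Set (ι → Ro K)} (hS : Df S) {b : ρ → (ι → Ro K) → Ro K}
    (hb : ∀ i, DfnO S (b i)) {B : Set (ρ → K)} (hB : VB (PB K ρ) B) :
    Df {x | x ∈ S ∧ (fun i => (b i x : K)) ∈ B} := by
  have key : ∀ {B : Set (ρ → K)}, VB (PB K ρ) B → Ex {x | x ∈ S ∧ (fun i => (b i x : K)) ∈ B} := by
    intro B hB
    choose E hE hEb using hb
    have h1 : VB (An K ρ) {y : ρ → Ro K | (fun i => (y i : K)) ∈ B} := by
      refine VB.preimage (fun (y : ρ → Ro K) i => (y i : K)) ?_ hB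
      rintro _ ⟨p, rfl⟩
      exact polynomial_mem_An p
    have h2 : Ex {x | x ∈ S ∧ ∃ y : ρ → Ro K, (∀ i, Sum.elim x (fun _ => y i) ∈ E i) ∧
        (fun i => (y i : K)) ∈ B} := by
      refine Ex.and hS.1 (Ex.ex (Ex.and (Ex.all fun i => (hE i).preimage
        (AnMap.sumElim (AnMap.reindex _) fun _ => AnO.coord _)) ?_))
      exact (Ex.of_VB h1).preimage (AnMap.reindex Sum.inr)
    refine (congrArg Ex (Set.ext fun x => and_congr_right fun hx => ?_)).mp h2
    constructor
    · rintro ⟨y, h3, h4⟩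
      have : y = fun i => b i x := funext fun i => (hEb i x hx _).1 (h3 i)
      rwa [this] at h4
    · exact fun h => ⟨fun i => b i x, fun i => (hEb i x hx _).2 rfl, h⟩
  refine ⟨key hB, ?_⟩
  have h3 : Ex {x | x ∈ Sᶜ ∨ (x ∈ S ∧ (fun i => (b i x : K)) ∈ Bᶜ)} := Ex.or hS.2 (key hB.compl)
  refine (congrArg Ex (Set.ext fun x => ?_)).mp h3
  simp only [Set.mem_ofPred_eq, Set.mem_compl_iff]
  tauto

/-- Families which are tame and have definable values. -/
def TD (π : Ro K) (S : Set (ι → Ro K)) (f : (ι → Ro K) → Pow K N) : Prop := Tame π S f ∧ Dfn S f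

namespace TD

variable {S S' : Set (ι → Ro K)} {f g : (ι → Ro K) → Pow K N}

lemma mono (h : S' ⊆ S) (hf : TD π S f) : TD π S' f := ⟨hf.1.mono h, hf.2.mono h⟩

lemma C (hπ0 : π ≠ 0) (hπ : ‖(π : K)‖ < 1) {b : (ι → Ro K) → Ro K} (hb : DfnO S b) :
    TD π S fun x => (MvPowerSeries.C (b x) : Pow K N) := ⟨Tame.C_fun hπ b, hb.C hπ0 hπ⟩

lemma const (hπ0 : π ≠ 0) (hπ : ‖(π : K)‖ < 1) (a : Ro K) :
    TD π S fun _ => (MvPowerSeries.C a : Pow K N) :=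
  TD.C hπ0 hπ (b := fun _ => a) ⟨{z | z (Sum.inr ()) = a}, Ex.eq (AnO.coord _) (AnO.const a),
    fun _ _ _ => Iff.rfl⟩

lemma add (hπ0 : π ≠ 0) (hπ : ‖(π : K)‖ < 1) (hf : TD π S f) (hg : TD π S g) :
    TD π S fun x => f x + g x := by
  refine ⟨hf.1.add hg.1, fun κ _ _ => ?_⟩
  have hG := (good_O hπ0 hπ).matrix κ
  obtain ⟨E, hE, h⟩ := hf.2 κ
  obtain ⟨E', hE', h'⟩ := hg.2 κ
  obtain ⟨E'', hE'', h''⟩ := Ex.pt_setOf (N := N) (κ := κ) (p := fun x M Y =>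
    ∃ Z : (κ × κ) ⊕ (κ × κ) → Ro K, pt x M (Matrix.of fun a b => Z (Sum.inl (a, b))) ∈ E ∧
      pt x M (Matrix.of fun a b => Z (Sum.inr (a, b))) ∈ E' ∧
      Y = (Matrix.of fun a b => Z (Sum.inl (a, b))) + Matrix.of fun a b => Z (Sum.inr (a, b))) (by
    refine Ex.ex (Ex.and (hE.preimage (AnMap.pt (AnMap.reindex _) (fun i _ _ => AnO.coord _)
      fun _ _ => AnO.coord _)) (Ex.and (hE'.preimage (AnMap.pt (AnMap.reindex _)
      (fun i _ _ => AnO.coord _) fun _ _ => AnO.coord _)) ?_))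
    exact AnM.eq (fun _ _ => AnO.coord _) (AnM.add (fun _ _ => AnO.coord _) fun _ _ => AnO.coord _))
  refine ⟨E'', hE'', fun x hx ψ Y => (h'' _ _ _).trans ⟨?_, fun hY => ?_⟩⟩
  · rintro ⟨Z, h1, h2, rfl⟩
    exact ((h x hx ψ _).1 h1).add ((h' x hx ψ _).1 h2)
  · obtain ⟨Y1, h1⟩ := hf.1.exists_evalTo hG hx ψ
    obtain ⟨Y2, h2⟩ := hg.1.exists_evalTo hG hx ψ
    exact ⟨Sum.elim (fun t => Y1 t.1 t.2) (fun t => Y2 t.1 t.2), (h x hx ψ _).2 h1,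
      (h' x hx ψ _).2 h2, hY.unique hG (h1.add h2)⟩

lemma mul (hπ0 : π ≠ 0) (hπ : ‖(π : K)‖ < 1) (hf : TD π S f) (hg : TD π S g) :
    TD π S fun x => f x * g x := by
  refine ⟨hf.1.mul hg.1, fun κ _ _ => ?_⟩
  have hG := (good_O hπ0 hπ).matrix κ
  obtain ⟨E, hE, h⟩ := hf.2 κ
  obtain ⟨E', hE', h'⟩ := hg.2 κ
  obtain ⟨E'', hE'', h''⟩ := Ex.pt_setOf (N := N) (κ := κ) (p := fun x M Y =>
    ∃ Z : (κ × κ) ⊕ (κ × κ) → Ro K, pt x M (Matrix.of fun a b => Z (Sum.inl (a, b))) ∈ E ∧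
      pt x M (Matrix.of fun a b => Z (Sum.inr (a, b))) ∈ E' ∧
      Y = (Matrix.of fun a b => Z (Sum.inl (a, b))) * Matrix.of fun a b => Z (Sum.inr (a, b))) (by
    refine Ex.ex (Ex.and (hE.preimage (AnMap.pt (AnMap.reindex _) (fun i _ _ => AnO.coord _)
      fun _ _ => AnO.coord _)) (Ex.and (hE'.preimage (AnMap.pt (AnMap.reindex _)
      (fun i _ _ => AnO.coord _) fun _ _ => AnO.coord _)) ?_))
    exact AnM.eq (fun _ _ => AnO.coord _) (AnM.mul (fun _ _ => AnO.coord _) fun _ _ => AnO.coord _))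
  refine ⟨E'', hE'', fun x hx ψ Y => (h'' _ _ _).trans ⟨?_, fun hY => ?_⟩⟩
  · rintro ⟨Z, h1, h2, rfl⟩
    exact ((h x hx ψ _).1 h1).mul ((h' x hx ψ _).1 h2)
  · obtain ⟨Y1, h1⟩ := hf.1.exists_evalTo hG hx ψ
    obtain ⟨Y2, h2⟩ := hg.1.exists_evalTo hG hx ψ
    exact ⟨Sum.elim (fun t => Y1 t.1 t.2) (fun t => Y2 t.1 t.2), (h x hx ψ _).2 h1,
      (h' x hx ψ _).2 h2, hY.unique hG (h1.mul h2)⟩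

lemma aeval (hπ0 : π ≠ 0) (hπ : ‖(π : K)‖ < 1) {h : ρ → (ι → Ro K) → Pow K N}
    (hh : ∀ i, TD π S (h i)) (p : MvPolynomial ρ (Ro K)) :
    TD π S fun x => MvPolynomial.aeval (fun i => h i x) p := by
  induction p using MvPolynomial.induction_on with
  | C a =>
    simp only [MvPolynomial.aeval_C]
    exact const hπ0 hπ a
  | add p q hp hq =>
    simp only [map_add]
    exact add hπ0 hπ hp hq
  | mul_X p i hp =>
    simp only [map_mul, MvPolynomial.aeval_X]
    exact mul hπ0 hπ hp (hh i)

end TD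

lemma EvalTo.aeval {B : Type} [CommRing B] [Algebra (Ro K) B] {h : ρ → Pow K N}
    {ψ : MvPolynomial (Fin N) (Ro K) →ₐ[Ro K] B} {v : ρ → B} (hh : ∀ i, EvalTo (h i) ψ (v i))
    (p : MvPolynomial ρ (Ro K)) :
    EvalTo (MvPolynomial.aeval h p) ψ (MvPolynomial.aeval v p) := by
  induction p using MvPolynomial.induction_on with
  | C a =>
    simp only [MvPolynomial.aeval_C]
    exact EvalTo.C a ψ
  | add p q hp hq =>
    simp only [map_add]
    exact hp.add hq
  | mul_X p i hp =>
    simp only [map_mul, MvPolynomial.aeval_X]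
    exact hp.mul (hh i)

/-- A common denominator for finitely many polynomials. -/
lemma exists_integral_scaling (hπ0 : π ≠ 0) (hπ : ‖(π : K)‖ < 1) {r : ℕ} (p : Fin r → MvPolynomial ρ K) :
    ∃ (c : K) (q : Fin r → MvPolynomial ρ (Ro K)), c ≠ 0 ∧
      ∀ k, MvPolynomial.C c * p k = MvPolynomial.map (Ro K).subtype (q k) := by
  classical
  obtain ⟨n, hn⟩ : ∃ n : ℕ, ∀ k, ∀ m ∈ (p k).support, ‖(π : K) ^ n * (p k).coeff m‖ ≤ 1 := by
    have h1 : ∀ k m, ∃ n : ℕ, ‖(π : K) ^ n * (p k).coeff m‖ ≤ 1 := fun k m => by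
      have h := (tendsto_pow_atTop_nhds_zero_of_lt_one (norm_nonneg _) hπ).mul_const ‖(p k).coeff m‖
      rw [zero_mul] at h
      obtain ⟨n, hn⟩ := (h.eventually (gt_mem_nhds one_pos)).exists
      exact ⟨n, by rw [norm_mul, norm_pow]; exact hn.le⟩
    choose n hn using h1
    refine ⟨Finset.univ.sup fun k => (p k).support.sup fun m => n k m, fun k m hm => ?_⟩
    have h2 : n k m ≤ Finset.univ.sup fun k => (p k).support.sup fun m => n k m :=
      (Finset.le_sup (f := fun m => n k m) hm).trans
        (Finset.le_sup (f := fun k => (p k).support.sup fun m => n k m) (Finset.mem_univ k))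
    obtain ⟨j, hj⟩ := Nat.exists_eq_add_of_le h2
    rw [hj, add_comm, pow_add, mul_assoc, norm_mul, norm_pow]
    exact mul_le_one₀ (pow_le_one₀ (norm_nonneg _) hπ.le) (norm_nonneg _) (hn k m)
  refine ⟨(π : K) ^ n, fun k => ∑ m : (p k).support,
    MvPolynomial.monomial m.1 (⟨(π : K) ^ n * (p k).coeff m.1, hn k m.1 m.2⟩ : Ro K),
    pow_ne_zero _ fun h => hπ0 (Subtype.ext h), fun k => ?_⟩
  rw [map_sum]
  simp only [MvPolynomial.map_monomial]
  conv_lhs => rw [(p k).as_sum, Finset.mul_sum]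
  rw [← Finset.sum_coe_sort]
  refine Finset.sum_congr rfl fun m _ => ?_
  rw [MvPolynomial.C_mul_monomial]
  rfl

lemma Ro.norm_one_add_mul {e : Ro K} (he : ‖(e : K)‖ < 1) (Z : Ro K) :
    ‖((1 + e * Z : Ro K) : K)‖ = 1 := by
  have h : ‖((e * Z : Ro K) : K)‖ < ‖(1 : K)‖ := by
    rw [norm_one]
    refine (norm_mul_le (e : K) Z).trans_lt ?_
    exact (mul_le_of_le_one_right (norm_nonneg _) (Ro.norm_le Z)).trans_lt he
  rw [Subring.coe_add, Subring.coe_one, IsUltrametricDist.norm_add_eq_max_of_norm_ne_norm h.ne',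
    max_eq_left h.le, norm_one]

lemma DfnO.df [Finite ρ] {S : Set (ι → Ro K)} (hS : Df S) {b : ρ → (ι → Ro K) → Ro K}
    (hb : ∀ i, DfnO S (b i)) {p : (ρ → K) → Prop} (hp : VB (PB K ρ) {y | p y}) :
    Df {x | x ∈ S ∧ p fun i => (b i x : K)} := Df.of_values hS hb hp

/-- The sheared point. -/
def shearPt (d : ℕ) (u : Fin (N + 1) → Ro K) : Fin (N + 1) → Ro K := fun i =>
  if i = 0 then u 0 else u i + u 0 ^ d ^ (i : ℕ)

lemma shearPt_surjective (d : ℕ) : Function.Surjective (shearPt (K := K) (N := N) d) := fun u => by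
  refine ⟨fun i => if i = 0 then u 0 else u i - u 0 ^ d ^ (i : ℕ), funext fun i => ?_⟩
  rw [shearPt]
  by_cases h : i = 0
  · simp [h]
  · simp [h]

lemma TD.exists_cells (hπ0 : π ≠ 0) (hπ : ‖(π : K)‖ < 1) {S : Set (ι → Ro K)} (hS : Df S)
    {f : (ι → Ro K) → Pow K (N + 1)} (hf : TD π S f) : ∃ I : Finset (Fin (N + 1) →₀ ℕ),
    ∀ d, 0 < d → (∀ ν ∈ I, ∀ i, ν i < d) → ∃ D : Option I → Set (ι → Ro K),
      (∀ t, Df (D t)) ∧ (∀ t, D t ⊆ S) ∧ (∀ x ∈ S, ∃ t, x ∈ D t) ∧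
      ∀ t, ∃ (s : ℕ) (b : (ι → Ro K) → Ro K) (c : Fin s → (ι → Ro K) → Pow K N),
        DfnO (D t) b ∧ (∀ j, TD π (D t) (c j)) ∧ ∀ x ∈ D t, ∀ (u : Fin (N + 1) → Ro K) (y : Fin s → Ro K),
          (∀ j, EvalTo (c j x) (MvPolynomial.aeval fun i : Fin N => u i.succ) (y j)) →
          ∃ w : Ro K, ‖(w : K)‖ = ‖((b x * (u 0 ^ s + ∑ j, y j * u 0 ^ (j : ℕ)) : Ro K) : K)‖ ∧
            EvalTo (f x) (MvPolynomial.aeval (shearPt d u)) w := by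
  classical
  obtain ⟨I, hI, hW⟩ := hf.1.exists_weierstrass hπ0 hπ
  refine ⟨I, fun d hd hId => ?_⟩
  let D : Option I → Set (ι → Ro K) := fun t => {x | x ∈ S ∧ match t with
    | none => ∀ ν : I, ((MvPowerSeries.coeff ν.1 (f x) : Ro K) : K) = 0
    | some ν0 => ((MvPowerSeries.coeff ν0.1 (f x) : Ro K) : K) ≠ 0 ∧
      (∀ ν : I, ‖((MvPowerSeries.coeff ν.1 (f x) : Ro K) : K)‖ ≤
            ‖((MvPowerSeries.coeff ν0.1 (f x) : Ro K) : K)‖) ∧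
      (∀ ν : I, wt N d ν0 < wt N d ν → ‖((MvPowerSeries.coeff ν.1 (f x) : Ro K) : K)‖ <
            ‖((MvPowerSeries.coeff ν0.1 (f x) : Ro K) : K)‖)}
  have hcf : ∀ ν : I, DfnO S fun x => MvPowerSeries.coeff ν.1 (f x) := fun ν =>
    hf.2.coeff hπ0 hπ hf.1 ν.1
  have hDS : ∀ t, D t ⊆ S := fun t x hx => hx.1
  have hco : ∀ ν : I, (fun y : I → K => y ν) ∈ PB K I := fun ν => ⟨MvPolynomial.X ν, by ext; simp⟩
  have h0 : (fun _ : I → K => (0 : K)) ∈ PB K I := isAlg_PB.const 0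
  refine ⟨D, fun t => ?_, hDS, fun x hx => ?_, fun t => ?_⟩
  · cases t with
    | none =>
      exact DfnO.df hS hcf (p := fun y => ∀ ν, y ν = 0) (VB.all fun ν => VB.eq_zero (hco ν) h0)
    | some ν0 =>
      exact DfnO.df hS hcf (p := fun y => y ν0 ≠ 0 ∧ (∀ ν, ‖y ν‖ ≤ ‖y ν0‖) ∧
        ∀ ν : I, wt N d ν0 < wt N d ν → ‖y ν‖ < ‖y ν0‖)
        ((VB.eq_zero (hco ν0) h0).not.and ((VB.all fun ν => VB.le (hco ν) (hco ν0)).and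
          (VB.all fun ν => VB.imp (VB.const _) (VB.lt (hco ν) (hco ν0)))))
  · by_cases h : ∀ ν : I, ((MvPowerSeries.coeff ν.1 (f x) : Ro K) : K) = 0
    · exact ⟨none, hx, h⟩
    · push Not at h
      obtain ⟨ν1, h1⟩ := h
      obtain ⟨ν2, -, h2⟩ := Finset.exists_max_image (Finset.univ : Finset I)
        (fun ν => ‖((MvPowerSeries.coeff ν.1 (f x) : Ro K) : K)‖) ⟨ν1, Finset.mem_univ _⟩
      obtain ⟨ν3, h3, h4⟩ := Finset.exists_max_image (Finset.univ.filter fun ν : I =>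
        ‖((MvPowerSeries.coeff ν.1 (f x) : Ro K) : K)‖ = ‖((MvPowerSeries.coeff ν2.1 (f x) : Ro K) : K)‖)
        (fun ν => wt N d ν) ⟨ν2, by simp⟩
      have h3 := (Finset.mem_filter.1 h3).2
      refine ⟨some ν3, hx, ?_, fun ν => h3 ▸ h2 ν (Finset.mem_univ _), fun ν hν => ?_⟩
      · rw [← norm_pos_iff, h3]
        exact (norm_pos_iff.2 h1).trans_le (h2 ν1 (Finset.mem_univ _))
      · refine lt_of_le_of_ne (h3 ▸ h2 ν (Finset.mem_univ _)) fun h5 => ?_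
        exact absurd (h4 ν (Finset.mem_filter.2 ⟨Finset.mem_univ _, h5.trans h3⟩)) (not_le.2 hν)
  · cases t with
    | none =>
      have hz : ∀ x ∈ D none, f x = 0 := fun x hx => by
        by_contra h
        obtain ⟨ν0, h1, h2, -⟩ := hI x hx.1 h
        exact h2 (Subtype.ext (hx.2 ⟨ν0, h1⟩))
      refine ⟨0, fun _ => 0, Fin.elim0, ⟨{z | z (Sum.inr ()) = 0}, Ex.eq (AnO.coord _) (AnO.const 0),
        fun _ _ _ => Iff.rfl⟩, fun j => j.elim0, fun x hx u y _ => ⟨0, by simp, ?_⟩⟩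
      rw [hz x hx]
      exact EvalTo.zero _
    | some ν0 =>
      obtain ⟨s, c, hc, hcx⟩ := hW d hd hId ν0.1 ν0.2
      have hW' : ∀ x ∈ D (some ν0), ∀ (B : Type) [Ring B] [Algebra (Ro K) B], Good K B →
          ∀ (ψ : MvPolynomial (Fin (N + 1)) (Ro K) →ₐ[Ro K] B) (Cv : Fin s → B),
          (∀ j, EvalTo (c j x) (tailHom ψ) (Cv j)) →
          ∃ (e : Ro K) (Z : B), ‖(e : K)‖ < 1 ∧ EvalTo (f x) (ψ.comp (shear (Ro K) N d))
            (MvPowerSeries.coeff ν0.1 (f x) • ((1 + e • Z) *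
              (ψ (MvPolynomial.X 0) ^ s + ∑ j, Cv j * ψ (MvPolynomial.X 0) ^ (j : ℕ)))) :=
        fun x hx => hcx x hx.1 (fun h => hx.2.1 (congrArg Subtype.val h))
          (fun ν hν => hx.2.2.1 ⟨ν, hν⟩) (fun ν hν => hx.2.2.2 ⟨ν, hν⟩)
      refine ⟨s, fun x => MvPowerSeries.coeff ν0.1 (f x), c, (hcf ν0).mono (hDS (some ν0)), fun j =>
        ⟨(hc j).mono (Set.subset_univ _), Dfn.weierstrass hπ0 hπ (hf.2.mono (hDS (some ν0))) hc
          (fun x hx h => hx.2.1 (congrArg Subtype.val h)) hW' j⟩, fun x hx u y hy => ?_⟩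
      have htail : tailHom (MvPolynomial.aeval u : MvPolynomial (Fin (N + 1)) (Ro K) →ₐ[Ro K] Ro K) =
          MvPolynomial.aeval fun i : Fin N => u i.succ := by
        refine MvPolynomial.algHom_ext fun i => ?_
        rw [tailHom, AlgHom.comp_apply, MvPolynomial.rename_X, MvPolynomial.aeval_X,
          MvPolynomial.aeval_X]
      have hsh : (MvPolynomial.aeval u : MvPolynomial (Fin (N + 1)) (Ro K) →ₐ[Ro K] Ro K).comp
          (shear (Ro K) N d) = MvPolynomial.aeval (shearPt d u) := by
        refine MvPolynomial.algHom_ext fun i => ?_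
        rw [AlgHom.comp_apply, shear, MvPolynomial.aeval_X, MvPolynomial.aeval_X, shearVar, shearPt]
        split_ifs <;> simp
      obtain ⟨e, Z, he, hZ⟩ := hW' x hx (Ro K) (good_O hπ0 hπ) (MvPolynomial.aeval u) y
        fun j => by rw [htail]; exact hy j
      rw [hsh] at hZ
      refine ⟨_, ?_, hZ⟩
      rw [smul_eq_mul, smul_eq_mul, MvPolynomial.aeval_X, mul_left_comm, Subring.coe_mul, norm_mul,
        Ro.norm_one_add_mul he, one_mul]

/-- Elimination of existential quantifiers over the arguments of tame families. -/
def Elim (π : Ro K) (ι : Type) (N : ℕ) : Prop :=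
  ∀ (ρ : Type) [Finite ρ] (S : Set (ι → Ro K)), Df S → ∀ h : ρ → (ι → Ro K) → Pow K N,
    (∀ i, TD π S (h i)) → ∀ B : Set (ρ → K), VB (PB K ρ) B →
    Df {x | x ∈ S ∧ ∃ (u : Fin N → Ro K) (v : ρ → Ro K),
      (∀ i, EvalTo (h i x) (MvPolynomial.aeval u) (v i)) ∧ (fun i => (v i : K)) ∈ B}

lemma elim_zero (hπ0 : π ≠ 0) (hπ : ‖(π : K)‖ < 1) : Elim π ι 0 := by
  intro ρ _ S hS h hh B hB
  refine (congrArg Df (Set.ext fun x => and_congr_right fun hx => ?_)).mp (Df.of_values hS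
    (fun i => (hh i).2.coeff hπ0 hπ (hh i).1 0) hB)
  have key : ∀ i (u : Fin 0 → Ro K),
      EvalTo (h i x) (MvPolynomial.aeval u) (MvPowerSeries.coeff 0 (h i x)) := fun i u => by
    have : h i x = MvPowerSeries.C (MvPowerSeries.coeff 0 (h i x)) := by
      ext ν
      rw [Subsingleton.elim ν 0]
      simp
    conv => arg 1; rw [this]
    exact EvalTo.C _ _
  constructor
  · exact fun h1 => ⟨Fin.elim0, _, fun i => key i _, h1⟩
  · rintro ⟨u, v, h1, h2⟩
    have : v = fun i => MvPowerSeries.coeff 0 (h i x) := funext fun i =>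
      (h1 i).unique (good_O hπ0 hπ) (key i u)
    rwa [this] at h2

/-- Quantifiers over the unit disc are eliminated among polynomial conditions. -/
lemma exists_eval_mem_unit [Finite ρ] {r : ℕ} (p : Fin r → Polynomial (MvPolynomial ρ K))
    {B : Set (Fin r → K)} (hB : VBc K B) :
    VB (PB K ρ) {y | ∃ w : Ro K, (fun i => ((p i).map (MvPolynomial.eval y)).eval (w : K)) ∈ B} := by
  have hB' : VBc K {z : Fin (r + 2) → K | (fun i : Fin r => z (Fin.castAdd 2 i)) ∈ B ∧
      ‖z (Fin.natAdd r 0)‖ ≤ ‖z (Fin.natAdd r 1)‖} :=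
    VB.and (VB.of_coord hB fun i => ⟨_, rfl⟩) (VB.le ⟨_, rfl⟩ ⟨_, rfl⟩)
  have h := exists_eval_mem (Fin.append p ![Polynomial.X, 1]) hB'
  refine (congrArg (VB (PB K ρ)) (Set.ext fun y => ?_)).mp h
  simp only [Set.mem_ofPred_eq, Fin.append_left, Fin.append_right]
  constructor
  · rintro ⟨w, h1, h2⟩
    have h3 : ‖w‖ ≤ 1 := by simpa using h2
    exact ⟨⟨w, h3⟩, h1⟩
  · rintro ⟨w, hw⟩
    exact ⟨w, hw, by simpa using Ro.norm_le w⟩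

lemma elim_succ_coord (hπ0 : π ≠ 0) (hπ : ‖(π : K)‖ < 1) (hE : Elim π ι N) {r : ℕ} {S : Set (ι → Ro K)}
    (hS : Df S) {h : Fin r → (ι → Ro K) → Pow K (N + 1)} (hh : ∀ i, TD π S (h i))
    {B : Set (Fin r → K)} (hB : VBc K B) :
    Df {x | x ∈ S ∧ ∃ (u : Fin (N + 1) → Ro K) (v : Fin r → Ro K),
      (∀ i, EvalTo (h i x) (MvPolynomial.aeval u) (v i)) ∧ (fun i => (v i : K)) ∈ B} := by
  classical
  have hG := good_O hπ0 hπ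
  have hcells := fun k => (hh k).exists_cells hπ0 hπ hS
  choose I hI using hcells
  obtain ⟨d, hd0, hd⟩ : ∃ d, 0 < d ∧ ∀ k, ∀ ν ∈ I k, ∀ i, ν i < d := by
    refine ⟨(Finset.univ.sup fun k => (I k).sup fun ν => Finset.univ.sup fun i => ν i) + 1,
      Nat.succ_pos _, fun k ν hν i => Nat.lt_succ_of_le ?_⟩
    exact (Finset.le_sup (f := fun i => ν i) (Finset.mem_univ i)).trans
      ((Finset.le_sup (f := fun ν : Fin (N + 1) →₀ ℕ => Finset.univ.sup fun i => ν i) hν).trans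
      (Finset.le_sup (f := fun k => (I k).sup fun ν => Finset.univ.sup fun i => ν i)
        (Finset.mem_univ k)))
  have hI' := fun k => hI k d hd0 (hd k)
  choose D hD hDS hcov hfac using hI'
  suffices hcell : ∀ t : ∀ k, Option (I k), Df {x | (x ∈ S ∧ ∀ k, x ∈ D k (t k)) ∧
      ∃ (u : Fin (N + 1) → Ro K) (v : Fin r → Ro K),
      (∀ i, EvalTo (h i x) (MvPolynomial.aeval u) (v i)) ∧ (fun i => (v i : K)) ∈ B} by
    refine (congrArg Df (Set.ext fun x => ?_)).mp (Df.any hcell)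
    constructor
    · rintro ⟨t, h1, h2⟩
      exact ⟨h1.1, h2⟩
    · rintro ⟨h1, h2⟩
      have h3 := fun k => hcov k x h1
      choose t ht using h3
      exact ⟨t, ⟨h1, ht⟩, h2⟩
  intro t
  have hfac' := fun k => hfac k (t k)
  choose s b c hb hc hw using hfac'
  set S' : Set (ι → Ro K) := {x | x ∈ S ∧ ∀ k, x ∈ D k (t k)} with hS'
  have hdf : Df S' := Df.and hS (Df.all fun k => hD k (t k))
  let g : (Σ k : Fin r, Option (Fin (s k))) → (ι → Ro K) → Pow K N := fun j =>
    match j with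
    | ⟨k, none⟩ => fun x => MvPowerSeries.C (b k x)
    | ⟨k, some j⟩ => c k j
  have hg : ∀ j, TD π S' (g j) := by
    rintro ⟨k, _ | j⟩
    · exact TD.C hπ0 hπ ((hb k).mono fun x hx => hx.2 k)
    · exact (hc k j).mono fun x hx => hx.2 k
  let p : Fin r → Polynomial (MvPolynomial (Σ k : Fin r, Option (Fin (s k))) K) := fun k =>
    Polynomial.C (MvPolynomial.X ⟨k, none⟩) * (Polynomial.X ^ s k +
      ∑ j : Fin (s k), Polynomial.C (MvPolynomial.X ⟨k, some j⟩) * Polynomial.X ^ (j : ℕ))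
  have hp : ∀ k (y : (Σ k : Fin r, Option (Fin (s k))) → K) (w : K),
      ((p k).map (MvPolynomial.eval y)).eval w =
        y ⟨k, none⟩ * (w ^ s k + ∑ j : Fin (s k), y ⟨k, some j⟩ * w ^ (j : ℕ)) := by
    intro k y w
    simp [p, Polynomial.map_sum, Polynomial.eval_finsetSum, Polynomial.map_mul, Polynomial.map_add,
      Polynomial.map_pow]
  refine (congrArg Df (Set.ext fun x => and_congr_right fun hx => ?_)).mp
    (hE _ S' hdf g hg _ (exists_eval_mem_unit p hB))
  have hval : ∀ (u : Fin (N + 1) → Ro K) (y : (Σ k : Fin r, Option (Fin (s k))) → Ro K),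
      (∀ j, EvalTo (g j x) (MvPolynomial.aeval fun i : Fin N => u i.succ) (y j)) →
      ∀ v : Fin r → Ro K, (∀ i, EvalTo (h i x) (MvPolynomial.aeval (shearPt d u)) (v i)) →
      ((fun i => (v i : K)) ∈ B ↔
        (fun i => ((p i).map (MvPolynomial.eval fun j => (y j : K))).eval (u 0 : K)) ∈ B) := by
    intro u y hy v hv
    have hn : ∀ i, ‖(v i : K)‖ = ‖((p i).map (MvPolynomial.eval fun j => (y j : K))).eval (u 0 : K)‖ := by
      intro i
      obtain ⟨w, hw1, hw2⟩ := hw i x (hx.2 i) u (fun j => y ⟨i, some j⟩) fun j => hy ⟨i, some j⟩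
      rw [(hv i).unique hG hw2, hw1, hp]
      have hb' : y ⟨i, none⟩ = b i x := (hy ⟨i, none⟩).unique hG (EvalTo.C _ _)
      rw [hb']
      push_cast
      rfl
    exact VB.congr_coord hB fun i j => by rw [hn, hn]
  constructor
  · rintro ⟨u', y, h1, w, h2⟩
    let u : Fin (N + 1) → Ro K := Fin.cons w u'
    have hu : (fun i : Fin N => u i.succ) = u' := funext fun i => Fin.cons_succ _ _ _
    have hv := fun i => (hh i).1.exists_evalTo hG hx.1 (MvPolynomial.aeval (shearPt d u))
    choose v hv using hv
    exact ⟨shearPt d u, v, hv, (hval u y (by rwa [hu]) v hv).2 h2⟩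
  · rintro ⟨u', v, h1, h2⟩
    obtain ⟨u, rfl⟩ := shearPt_surjective d u'
    have hy := fun j => (hg j).1.exists_evalTo hG hx (MvPolynomial.aeval fun i : Fin N => u i.succ)
    choose y hy using hy
    exact ⟨fun i => u i.succ, y, hy, u 0, (hval u y hy v h1).1 h2⟩

lemma elim_succ (hπ0 : π ≠ 0) (hπ : ‖(π : K)‖ < 1) (hE : Elim π ι N) : Elim π ι (N + 1) := by
  intro ρ _ S hS h hh B hB
  have hG := good_O hπ0 hπ
  obtain ⟨r, Q, B', hQ, hB', rfl⟩ := hB.exists_coord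
  choose P hP using hQ
  obtain ⟨a, q, ha, hq⟩ := exists_integral_scaling hπ0 hπ P
  refine (congrArg Df (Set.ext fun x => and_congr_right fun hx => ?_)).mp
    (elim_succ_coord hπ0 hπ hE hS (fun k => TD.aeval hπ0 hπ hh (q k)) hB')
  refine exists_congr fun u => ?_
  have hQq : ∀ (v : ρ → Ro K) k, ((MvPolynomial.aeval v (q k) : Ro K) : K) =
      a * Q k fun i => (v i : K) := by
    intro v k
    have h1 := congrArg (MvPolynomial.eval fun i => (v i : K)) (hq k)
    rw [map_mul, MvPolynomial.eval_C, MvPolynomial.eval_map] at h1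
    rw [← hP k]
    refine Eq.trans ?_ h1.symm
    have := Fintype.ofFinite ρ
    rw [MvPolynomial.aeval_def, MvPolynomial.eval₂_eq', MvPolynomial.eval₂_eq']
    push_cast
    rfl
  have hmem : ∀ v : ρ → Ro K, (fun k => ((MvPolynomial.aeval v (q k) : Ro K) : K)) ∈ B' ↔
      (fun k => Q k fun i => (v i : K)) ∈ B' := fun v => VB.congr_coord hB' fun i j => by
    rw [hQq, hQq, norm_mul, norm_mul]
    exact mul_le_mul_iff_right₀ (norm_pos_iff.2 ha)
  constructor
  · rintro ⟨w, h1, h2⟩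
    have hv := fun i => (hh i).1.exists_evalTo hG hx (MvPolynomial.aeval u)
    choose v hv using hv
    have hw : w = fun k => MvPolynomial.aeval v (q k) := funext fun k =>
      (h1 k).unique hG (EvalTo.aeval hv (q k))
    rw [hw] at h2
    exact ⟨v, hv, (hmem v).1 h2⟩
  · rintro ⟨v, hv, h2⟩
    exact ⟨_, fun k => EvalTo.aeval hv (q k), (hmem v).2 h2⟩

theorem elim (hπ0 : π ≠ 0) (hπ : ‖(π : K)‖ < 1) : ∀ N, Elim π ι N
  | 0 => elim_zero hπ0 hπ
  | N + 1 => elim_succ hπ0 hπ (elim hπ0 hπ N)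

end

section

variable {ι κ ρ : Type} {π : Ro K} {N : ℕ}

lemma coeff_le_of_pe_le : ∀ {n : ℕ} (p : MvPolynomial (Fin n) K), (∀ x : Fin n → Ro K, ‖pe p x‖ ≤ 1) →
    ∀ ν, ‖p.coeff ν‖ ≤ 1
  | 0, p, h, ν => by
    have h1 := h 0
    rw [MvPolynomial.eq_C_of_isEmpty p, pe, MvPolynomial.eval_C] at h1
    rwa [Subsingleton.elim ν 0]
  | n + 1, p, h, ν => by
    rw [← Finsupp.cons_tail ν, ← MvPolynomial.finSuccEquiv_coeff_coeff]
    refine coeff_le_of_pe_le _ (fun x => ?_) _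
    set P := (MvPolynomial.finSuccEquiv K n p).map (MvPolynomial.eval fun i => (x i : K)) with hP
    obtain ⟨Z, hZ, h1, h2⟩ := exists_unit_nodes (K := K) (P.natDegree + 1)
    have := coeff_le_of_nodes (p := P) (Polynomial.degree_lt_iff_coeff_zero _ _ |>.2 fun m hm =>
      Polynomial.coeff_eq_zero_of_natDegree_lt (by omega)) zero_le_one hZ h1 h2 (fun z hz => by
        have h3 := h (Fin.cons (⟨z, h1 z hz⟩ : Ro K) x)
        rw [pe] at h3
        rw [hP, ← MvPolynomial.eval_eq_eval_mv_eval']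
        convert h3 using 4
        funext i
        exact Fin.cases rfl (fun i => rfl) i) (ν 0)
    rwa [hP, Polynomial.coeff_map] at this

/-- The Gauss norm: polynomials with integral values have integral coefficients. -/
lemma exists_integral_of_pe_le [Finite ρ] (p : MvPolynomial ρ K) (h : ∀ x, ‖pe p x‖ ≤ 1) :
    ∃ q : MvPolynomial ρ (Ro K), ∀ x, pe p x = (MvPolynomial.eval x q : Ro K) := by
  classical
  obtain ⟨n, ⟨e⟩⟩ := Finite.exists_equiv_fin ρ
  have hc : ∀ ν, ‖p.coeff ν‖ ≤ 1 := fun ν => by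
    rw [← MvPolynomial.coeff_rename_mapDomain e e.injective]
    refine coeff_le_of_pe_le _ (fun x => ?_) _
    rw [pe, MvPolynomial.eval_rename]
    exact h fun i => x (e i)
  refine ⟨∑ m ∈ p.support, MvPolynomial.monomial m (⟨p.coeff m, hc m⟩ : Ro K), fun x => ?_⟩
  rw [pe, map_sum]
  conv_lhs => rw [p.as_sum, map_sum]
  push_cast
  refine Finset.sum_congr rfl fun m _ => ?_
  rw [MvPolynomial.eval_monomial, MvPolynomial.eval_monomial]
  simp [Finsupp.prod]

lemma AnO.exists_step [Finite ρ] (hπ0 : π ≠ 0) {f : (ρ → Ro K) → Ro K} (hf : f ∈ AnO K ρ) :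
    ∃ q : MvPolynomial ρ (Ro K), ∃ g ∈ AnO K ρ, ∀ x, f x = MvPolynomial.eval x q + π * g x := by
  have hπ1 : (π : K) ≠ 0 := fun h => hπ0 (Subtype.ext h)
  obtain ⟨p, hp⟩ := hf ‖(π : K)‖ (norm_pos_iff.2 hπ1)
  obtain ⟨q, hq⟩ := exists_integral_of_pe_le p fun x => by
    have := IsUltrametricDist.norm_add_le_max (pe p x - f x) (f x)
    rw [sub_add_cancel] at this
    exact this.trans (max_le (by rw [norm_sub_rev]; exact (hp x).trans π.2) (f x).2)
  have hd : ∀ x, ‖((f x : K) - pe p x) * (π : K)⁻¹‖ ≤ 1 := fun x => by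
    rw [norm_mul, norm_inv]
    exact mul_inv_le_one_of_le₀ (hp x) (norm_nonneg _)
  refine ⟨q, fun x => ⟨_, hd x⟩, An.mul (An.sub hf (pe_mem_An p)) (An.const _), fun x => ?_⟩
  refine Subtype.ext ?_
  push_cast
  rw [← hq]
  field_simp
  ring

lemma AnO.exists_expansion [Finite ρ] (hπ0 : π ≠ 0) {f : (ρ → Ro K) → Ro K} (hf : f ∈ AnO K ρ) :
    ∃ A : ℕ → MvPolynomial ρ (Ro K), ∀ n x, ∃ z,
      f x = ∑ q ∈ Finset.range n, π ^ q * MvPolynomial.eval x (A q) + π ^ n * z := by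
  have h : ∀ f : AnO K ρ, ∃ (q : MvPolynomial ρ (Ro K)) (g : AnO K ρ),
      ∀ x, f.1 x = MvPolynomial.eval x q + π * g.1 x := fun f => by
    obtain ⟨q, g, hg, h⟩ := AnO.exists_step hπ0 f.2
    exact ⟨q, ⟨g, hg⟩, h⟩
  choose q g hg using h
  refine ⟨fun n => q (g^[n] ⟨f, hf⟩), fun n x => ⟨(g^[n] ⟨f, hf⟩).1 x, ?_⟩⟩
  induction n with
  | zero => simp
  | succ n ih =>
    rw [ih, Finset.sum_range_succ, hg, Function.iterate_succ_apply']
    ring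

section Ser

variable {A B : Type} [CommRing A] [CommRing B]

/-- A power series in one variable. -/
def ser (a : ℕ → A) : MvPowerSeries (Option Empty) A := mvMk fun e => a (e none)

lemma ser_eq (a : ℕ → A) :
    ser a = MvPowerSeries.C (a 0) + MvPowerSeries.X none * ser fun n => a (n + 1) := by
  classical
  ext e
  rw [map_add, MvPowerSeries.X, MvPowerSeries.coeff_monomial_mul, MvPowerSeries.coeff_C]
  simp only [ser, coeff_mvMk, one_mul]
  have h0 : e none = 0 ↔ e = 0 := ⟨fun h => Finsupp.ext fun t => by
    match t with
    | none => exact h, fun h => by rw [h]; rfl⟩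
  by_cases he : e = 0
  · subst he
    simp
  · have h1 : 1 ≤ e none := Nat.one_le_iff_ne_zero.2 (mt h0.1 he)
    rw [if_neg he, if_pos (Finsupp.single_le_iff.2 h1), zero_add]
    simp [Nat.sub_add_cancel h1]

lemma map_ser (L : MvPowerSeries (Option Empty) A →+* B) (n : ℕ) (a : ℕ → A) : ∃ z,
    L (ser a) = ∑ q ∈ Finset.range n, L (MvPowerSeries.X none) ^ q * L (MvPowerSeries.C (a q)) +
      L (MvPowerSeries.X none) ^ n * z := by
  induction n generalizing a with
  | zero => exact ⟨L (ser a), by simp⟩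
  | succ n ih =>
    obtain ⟨z, hz⟩ := ih fun n => a (n + 1)
    refine ⟨z, ?_⟩
    rw [ser_eq, map_add, map_mul, hz, Finset.sum_range_succ', mul_add, Finset.mul_sum]
    simp only [pow_succ']
    ring_nf

end Ser

/-- Sums of geometrically decreasing series of analytic functions. -/
lemma AnO.exists_sum (hπ : ‖(π : K)‖ < 1) {a : ℕ → (ι → Ro K) → Ro K} (ha : ∀ n, a n ∈ AnO K ι) :
    ∃ f ∈ AnO K ι, ∀ n x, ∃ z, f x = ∑ q ∈ Finset.range n, π ^ q * a q x + π ^ n * z := by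
  obtain ⟨L, hC, hX⟩ := exists_evO (RingHom.id (Ro K)) (fun _ : Option Empty => π) fun _ => hπ
  have key : ∀ n x, ∃ z, L (ser fun n => a n x) = ∑ q ∈ Finset.range n, π ^ q * a q x + π ^ n * z :=
    fun n x => by
      obtain ⟨z, hz⟩ := map_ser L n fun n => a n x
      exact ⟨z, by simpa only [hX, hC, RingHom.id_apply] using hz⟩
  refine ⟨fun x => L (ser fun n => a n x), An.limit fun ε hε => ?_, key⟩
  obtain ⟨n, hn⟩ := exists_pow_lt_of_lt_one hε hπ
  have h : (∑ q ∈ Finset.range n, (fun _ => π ^ q) * a q) ∈ AnO K ι :=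
    (AnO K ι).sum_mem fun q _ => (AnO K ι).mul_mem (AnO.const _) (ha q)
  refine ⟨_, h, fun x => ?_⟩
  obtain ⟨z, hz⟩ := key n x
  beta_reduce
  rw [hz, Finset.sum_apply]
  simp only [Pi.mul_apply, Subring.coe_add, add_sub_cancel_left, Subring.coe_mul, Subring.coe_pow,
    norm_mul, norm_pow]
  exact (mul_le_of_le_one_right (by positivity) z.2).trans hn.le

lemma AnO.eval (c : MvPolynomial κ (Ro K)) {φ : (ι → Ro K) → κ → Ro K} (hφ : AnMap φ) :
    (fun x => MvPolynomial.eval (φ x) c) ∈ AnO K ι := by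
  induction c using MvPolynomial.induction_on with
  | C a => simpa using AnO.const a
  | add p q hp hq => simp only [map_add]; exact (AnO K ι).add_mem hp hq
  | mul_X p i hp => simp only [map_mul, MvPolynomial.eval_X]; exact (AnO K ι).mul_mem hp (hφ i)

/-- Separation of the variables of a polynomial. -/
def sepVars (N : ℕ) : MvPolynomial (ι ⊕ Fin N) (Ro K) →ₐ[Ro K]
    MvPolynomial (Fin N) (MvPolynomial ι (Ro K)) :=
  MvPolynomial.aeval (Sum.elim (fun i => MvPolynomial.C (MvPolynomial.X i)) MvPolynomial.X)

lemma aeval_sepVars (p : MvPolynomial (ι ⊕ Fin N) (Ro K)) (x : ι → Ro K) (u : Fin N → Ro K) :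
    MvPolynomial.aeval u (MvPolynomial.map (MvPolynomial.eval x) (sepVars N p)) =
      MvPolynomial.eval (Sum.elim x u) p := by
  induction p using MvPolynomial.induction_on with
  | C a => simp [sepVars, MvPolynomial.algebraMap_apply]
  | add p q hp hq => rw [map_add, map_add, map_add, map_add, hp, hq]
  | mul_X p i hp =>
    rw [map_mul, map_mul, map_mul, map_mul, hp]
    rcases i with i | i <;> simp [sepVars]

/-- Ordered evaluation of a polynomial at matrices. -/
def ordEval [Fintype κ] [DecidableEq κ] (P : MvPolynomial (Fin N) (MvPolynomial ι (Ro K)))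
    (x : ι → Ro K) (M : Fin N → Matrix κ κ (Ro K)) : Matrix κ κ (Ro K) :=
  ∑ ν ∈ P.support, MvPolynomial.eval x (P.coeff ν) • (List.ofFn fun i => M i ^ ν i).prod

lemma ordEval_eq [Fintype κ] [DecidableEq κ] (P : MvPolynomial (Fin N) (MvPolynomial ι (Ro K)))
    (x : ι → Ro K) (ψ : MvPolynomial (Fin N) (Ro K) →ₐ[Ro K] Matrix κ κ (Ro K)) :
    ordEval P x (fun i => ψ (MvPolynomial.X i)) = ψ (MvPolynomial.map (MvPolynomial.eval x) P) := by
  conv_rhs => rw [P.as_sum, map_sum, map_sum]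
  refine Finset.sum_congr rfl fun ν _ => ?_
  rw [MvPolynomial.map_monomial, ← mul_one (MvPolynomial.eval x _), ← smul_eq_mul,
    ← MvPolynomial.smul_monomial, map_smul, smul_eq_mul, mul_one, MvPolynomial.monomial_eq, map_one,
    one_mul, Finsupp.prod_fintype _ _ (fun _ => pow_zero _), ← List.prod_ofFn, map_list_prod,
    List.map_ofFn]
  congr 3
  funext i
  simp

lemma ordEval_mem [Fintype κ] [DecidableEq κ] (P : MvPolynomial (Fin N) (MvPolynomial ι (Ro K)))
    {ρ : Type} {φ : (ρ → Ro K) → ι → Ro K} (hφ : AnMap φ) {M : (ρ → Ro K) → Fin N → Matrix κ κ (Ro K)}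
    (hM : ∀ i, AnM fun z => M z i) : AnM fun z => ordEval P (φ z) (M z) := fun a b => by
  have h : ∀ l : List (Fin N × ℕ), AnM fun z => (l.map fun t => M z t.1 ^ t.2).prod := fun l => by
    induction l with
    | nil => simpa using AnM.const 1
    | cons t l ih => simpa using ((hM t.1).pow t.2).mul ih
  have h1 : (fun z => ordEval P (φ z) (M z) a b) = ∑ ν ∈ P.support,
      (fun z => MvPolynomial.eval (φ z) (P.coeff ν)) *
        fun z => (List.ofFn fun i => M z i ^ ν i).prod a b := by
    funext z
    rw [ordEval, Matrix.sum_apply, Finset.sum_apply]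
    rfl
  rw [h1]
  refine (AnO K ρ).sum_mem fun ν _ => (AnO K ρ).mul_mem (AnO.eval _ hφ) ?_
  have h2 := h (List.ofFn fun i => (i, ν i)) a b
  simp only [List.map_ofFn] at h2
  exact h2

section Family

variable (hπ : ‖(π : K)‖ < 1)

/-- Parameters given by the coordinates. -/
def coordDat (ι : Type) (hπ : ‖(π : K)‖ < 1) : Dat π (ι → Ro K) ι Empty where
  y x := x
  ξ _ _ := π
  hξ _ _ := hπ
  hT _ := rfl

lemma evalTo_ser (G : ℕ → MvPolynomial (Fin N) (MvPolynomial ι (Ro K))) {x : ι → Ro K}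
    {B : Type} [Ring B] [Algebra (Ro K) B] {ψ : MvPolynomial (Fin N) (Ro K) →ₐ[Ro K] B} {Y : B}
    (h : ∀ n, ∃ Z, Y = ∑ q ∈ Finset.range n, π ^ q • ψ (MvPolynomial.map (MvPolynomial.eval x) (G q)) +
      π ^ n • Z) : EvalTo ((coordDat ι hπ).Ev N x (ser G)) ψ Y := fun d hd => by
  obtain ⟨n, a, ha⟩ := Ro.exists_pow_dvd hπ hd
  obtain ⟨z, hz⟩ := map_ser ((coordDat ι hπ).Ev N x) n G
  obtain ⟨Z, hZ⟩ := h n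
  refine ⟨∑ q ∈ Finset.range n, π ^ q • MvPolynomial.map (MvPolynomial.eval x) (G q),
    MvPowerSeries.C a * z, a • Z, ?_, ?_⟩
  · rw [hz, ← mul_assoc, ← map_mul, ← ha, map_pow, (coordDat ι hπ).Ev_X]
    congr 1
    rw [← MvPolynomial.coeToMvPowerSeries.ringHom_apply, map_sum]
    refine Finset.sum_congr rfl fun q _ => ?_
    rw [MvPolynomial.smul_eq_C_mul, map_mul, (coordDat ι hπ).Ev_C,
      MvPolynomial.coeToMvPowerSeries.ringHom_apply, MvPolynomial.coe_C, map_pow]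
    rfl
  · rw [hZ, smul_smul, ← ha, map_sum]
    simp only [map_smul]

lemma ser_mem_QJ (G : ℕ → MvPolynomial (Fin N) (MvPolynomial ι (Ro K))) :
    ser G ∈ QJ K ι Empty (Fin N) := by
  classical
  refine mem_QJ_of_levels fun n => ⟨insert 0 ((G n).support.biUnion fun ν =>
    ((G n).coeff ν).support.image fun α => ((G n).coeff ν).coeff α), fun e he ν α => Loc.subset ?_⟩
  have h1 : tc (ser G) e ν α = ((G n).coeff ν).coeff α := by
    rw [tc, ser, coeff_mvMk, he]
  rw [h1]
  by_cases h0 : ((G n).coeff ν).coeff α = 0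
  · rw [h0]
    exact Finset.mem_insert_self _ _
  · refine Finset.mem_insert_of_mem (Finset.mem_biUnion.2 ⟨ν, ?_, Finset.mem_image.2 ⟨α, ?_, rfl⟩⟩)
    · rw [MvPolynomial.mem_support_iff]
      rintro h
      exact h0 (by rw [h, MvPolynomial.coeff_zero])
    · exact MvPolynomial.mem_support_iff.2 h0

lemma dfn_ser (hπ0 : π ≠ 0) (G : ℕ → MvPolynomial (Fin N) (MvPolynomial ι (Ro K))) :
    Dfn Set.univ fun x => (coordDat ι hπ).Ev N x (ser G) := fun κ _ _ => by
  have h1 : ∀ a b, ∃ f ∈ AnO K ((ι ⊕ (Fin N × κ × κ)) ⊕ (κ × κ)), ∀ n z, ∃ w, f z =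
      ∑ q ∈ Finset.range n, π ^ q * ordEval (G q) (fun i => z (Sum.inl (Sum.inl i)))
        (fun i => Matrix.of fun a b => z (Sum.inl (Sum.inr (i, a, b)))) a b + π ^ n * w := fun a b =>
    AnO.exists_sum hπ fun n => ordEval_mem (G n) (AnMap.reindex _) (fun i a b => AnO.coord _) a b
  choose f hf hfw using h1
  refine ⟨{z | ∀ a b, z (Sum.inr (a, b)) = f a b z}, Ex.all fun a => Ex.all fun b =>
    Ex.eq (AnO.coord _) (hf a b), fun x _ ψ Y => ?_⟩
  have h2 : EvalTo ((coordDat ι hπ).Ev N x (ser G)) ψ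
      (Matrix.of fun a b => f a b (pt x (fun i => ψ (MvPolynomial.X i)) Y)) := by
    refine evalTo_ser hπ G fun n => ?_
    have h3 := fun a b => hfw a b n (pt x (fun i => ψ (MvPolynomial.X i)) Y)
    choose w hw using h3
    refine ⟨Matrix.of w, ?_⟩
    ext1 a b
    rw [Matrix.of_apply, hw, Matrix.add_apply, Matrix.sum_apply]
    simp only [← ordEval_eq]
    rfl
  constructor
  · intro h
    convert h2 using 1
    ext1 a b
    exact h a b
  · intro h a b
    have h3 := h.unique ((good_O hπ0 hπ).matrix κ) h2
    exact congrArg (fun Y : Matrix κ κ (Ro K) => Y a b) h3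

/-- Analytic functions as families of power series. -/
theorem exists_TD [Finite ι] (hπ : ‖(π : K)‖ < 1) (hπ0 : π ≠ 0) {f : (ι ⊕ Fin N → Ro K) → Ro K} (hf : f ∈ AnO K (ι ⊕ Fin N)) :
    ∃ F : (ι → Ro K) → Pow K N, TD π Set.univ F ∧
      ∀ x u, EvalTo (F x) (MvPolynomial.aeval u) (f (Sum.elim x u)) := by
  obtain ⟨A, hA⟩ := AnO.exists_expansion hπ0 hf
  refine ⟨_, ⟨⟨ι, Empty, ‹_›, inferInstance, coordDat ι hπ, ser fun q => sepVars N (A q),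
    ser_mem_QJ _, fun _ _ => rfl⟩, dfn_ser hπ hπ0 _⟩, fun x u => evalTo_ser hπ _ fun n => ?_⟩
  simp only [aeval_sepVars]
  exact hA n _

end Family

lemma An.exists_scaling (hπ : ‖(π : K)‖ < 1) {r : ℕ} {f : Fin r → (κ → Ro K) → K} (hf : ∀ i, f i ∈ An K κ) :
    ∃ n : ℕ, ∃ g : Fin r → (κ → Ro K) → Ro K, (∀ i, g i ∈ AnO K κ) ∧ ∀ i x, (g i x : K) = π ^ n * f i x := by
  have h1 : ∀ i, ∃ n : ℕ, ∀ x, ‖(π : K) ^ n * f i x‖ ≤ 1 := fun i => by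
    obtain ⟨M, hM, h⟩ := An.exists_le (hf i)
    obtain ⟨n, hn⟩ := exists_pow_lt_of_lt_one (inv_pos.2 (one_pos.trans_le hM)) hπ
    refine ⟨n, fun x => ?_⟩
    rw [norm_mul, norm_pow]
    calc _ ≤ M⁻¹ * M := mul_le_mul hn.le (h x) (norm_nonneg _) (by positivity)
      _ = 1 := inv_mul_cancel₀ (by positivity)
  choose n hn using h1
  have h2 : ∀ i x, ‖(π : K) ^ (Finset.univ.sup n) * f i x‖ ≤ 1 := fun i x => by
    obtain ⟨j, hj⟩ := Nat.exists_eq_add_of_le (Finset.le_sup (f := n) (Finset.mem_univ i))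
    rw [hj, add_comm, pow_add, mul_assoc, norm_mul, norm_pow]
    exact mul_le_one₀ (pow_le_one₀ (norm_nonneg _) hπ.le) (norm_nonneg _) (hn i x)
  exact ⟨_, fun i x => ⟨_, h2 i x⟩, fun i => An.mul (An.const _) (hf i), fun _ _ => rfl⟩

lemma Ex.compl_of_nontrivial [Finite ι] (hπ0 : π ≠ 0) (hπ : ‖(π : K)‖ < 1) {S : Set (ι → Ro K)} (hS : Ex S) :
    Ex Sᶜ := by
  obtain ⟨β, _, T, hT, h⟩ := hS
  obtain ⟨N, ⟨e⟩⟩ := Finite.exists_equiv_fin β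
  obtain ⟨r, f, B, hf, hB, rfl⟩ := hT.exists_coord
  obtain ⟨n, g, hg, hgf⟩ := An.exists_scaling (r := r) (κ := ι ⊕ Fin N) hπ
    (f := fun i y => f i fun t => y (Sum.map id e t)) fun i =>
      An.comp (hf i) (AnMap.reindex (Sum.map id e))
  have h1 := fun i => exists_TD hπ hπ0 (hg i)
  choose F hF hFg using h1
  have hG := good_O hπ0 hπ
  have key := elim hπ0 hπ N (Fin r) Set.univ (Df.of_VB VB.univ) F hF B
    (hB.mono (by rintro _ ⟨i, rfl⟩; exact ⟨MvPolynomial.X i, by ext; simp⟩))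
  have hπ1 : (π : K) ≠ 0 := fun h => hπ0 (Subtype.ext h)
  have hmem : ∀ x (u : Fin N → Ro K), (fun i => (g i (Sum.elim x u) : K)) ∈ B ↔
      Sum.elim x (fun b => u (e b)) ∈ {x | (fun i => f i x) ∈ B} := fun x u => by
    refine VB.congr_coord hB fun i j => ?_
    rw [hgf, hgf, norm_mul, norm_mul, mul_le_mul_iff_right₀ (norm_pos_iff.2 (pow_ne_zero n hπ1))]
    have h2 : (fun t => Sum.elim x u (Sum.map id e t)) = Sum.elim x fun b => u (e b) := by
      funext t
      rcases t with t | t <;> rfl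
    rw [h2]
  refine (congrArg Ex (Set.ext fun x => not_congr ?_)).mp key.2
  rw [h]
  constructor
  · rintro ⟨-, u, v, hv, hvB⟩
    have h2 : v = fun i => g i (Sum.elim x u) := funext fun i => (hv i).unique hG (hFg i x u)
    rw [h2] at hvB
    exact ⟨_, (hmem x u).1 hvB⟩
  · rintro ⟨z, hz⟩
    refine ⟨trivial, fun j => z (e.symm j), _, fun i => hFg i x _, (hmem x _).2 ?_⟩
    simpa using hz

lemma exists_mem_PB : ∀ {N : ℕ} {T : Set (ι ⊕ Fin N → K)}, VB (PB K (ι ⊕ Fin N)) T →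
    VB (PB K ι) {x | ∃ z, Sum.elim x z ∈ T}
  | 0, T, hT => by
    have : {x : ι → K | ∃ z, Sum.elim x z ∈ T} = (fun x => Sum.elim x Fin.elim0) ⁻¹' T := by
      ext x
      exact ⟨fun ⟨z, hz⟩ => by rwa [Subsingleton.elim z Fin.elim0] at hz, fun h => ⟨_, h⟩⟩
    rw [this]
    refine VB.preimage _ ?_ hT
    rintro _ ⟨p, rfl⟩
    refine ⟨MvPolynomial.aeval (Sum.elim MvPolynomial.X Fin.elim0) p, ?_⟩
    funext y
    induction p using MvPolynomial.induction_on with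
    | C a => simp
    | add p q hp hq => simp_all
    | mul_X p i hp => rcases i with i | i; · simp_all
                      exact i.elim0
  | N + 1, T, hT => by
    obtain ⟨r, f, B, hf, hB, rfl⟩ := hT.exists_coord
    choose p hp using hf
    let Φ : MvPolynomial (ι ⊕ Fin (N + 1)) K →ₐ[K] Polynomial (MvPolynomial (ι ⊕ Fin N) K) :=
      MvPolynomial.aeval (Sum.elim (fun i => Polynomial.C (MvPolynomial.X (Sum.inl i)))
        (Fin.cons Polynomial.X fun i => Polynomial.C (MvPolynomial.X (Sum.inr i))))
    have hΦ : ∀ (q) (y : ι ⊕ Fin N → K) (w : K), ((Φ q).map (MvPolynomial.eval y)).eval w =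
        MvPolynomial.eval (Sum.elim (fun i => y (Sum.inl i)) (Fin.cons w fun i => y (Sum.inr i))) q := by
      intro q y w
      induction q using MvPolynomial.induction_on with
      | C a => simp [Φ, MvPolynomial.algebraMap_eq]
      | add p q hp hq => rw [map_add, Polynomial.map_add, Polynomial.eval_add, hp, hq, map_add]
      | mul_X p i hp =>
        rw [map_mul, Polynomial.map_mul, Polynomial.eval_mul, hp, map_mul]
        congr 1
        rcases i with i | i
        · simp [Φ]
        · refine Fin.cases ?_ (fun i => ?_) i <;> simp [Φ]
    have h1 := exists_mem_PB (exists_eval_mem (fun i => Φ (p i)) hB)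
    refine (congrArg (VB (PB K ι)) (Set.ext fun x => ?_)).mp h1
    simp only [hΦ, Set.mem_ofPred_eq, Sum.elim_inl, Sum.elim_inr]
    rw [Fin.exists_fin_succ_pi, exists_comm]
    simp only [← hp]

lemma Ex.compl_of_trivial (h1 : ∀ x : K, x ≠ 0 → ‖x‖ = 1) {S : Set (ι → Ro K)} (hS : Ex S) : Ex Sᶜ := by
  obtain ⟨β, _, T, hT, h⟩ := hS
  obtain ⟨N, ⟨e⟩⟩ := Finite.exists_equiv_fin β
  have hle : ∀ x : K, ‖x‖ ≤ 1 := fun x => by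
    by_cases hx : x = 0
    · simp [hx]
    · exact (h1 x hx).le
  let φ : (ι ⊕ Fin N → K) → ι ⊕ β → Ro K := fun y t => ⟨y (Sum.map id e t), hle _⟩
  have h2 : VB (PB K (ι ⊕ Fin N)) (φ ⁻¹' T) := by
    refine VB.preimage φ (fun f hf => ?_) hT
    obtain ⟨p, hp⟩ := hf (1 / 2) (by norm_num)
    refine ⟨MvPolynomial.rename (Sum.map id e) p, ?_⟩
    funext y
    have h3 : f (φ y) = pe p (φ y) := by
      by_contra h4
      have h5 := hp (φ y)
      rw [h1 _ (sub_ne_zero.2 h4)] at h5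
      norm_num at h5
    beta_reduce
    rw [Function.comp_apply, h3, MvPolynomial.eval_rename]
    rfl
  have h3 : VB (An K ι) S := by
    refine (congrArg (VB (An K ι)) (Set.ext fun x => ?_)).mp
      (VB.preimage (fun (x : ι → Ro K) i => (x i : K)) ?_ (exists_mem_PB h2))
    · rw [h]
      have h4 : ∀ (z : Fin N → K), φ (Sum.elim (fun i => (x i : K)) z) =
          Sum.elim x fun b => (⟨z (e b), hle _⟩ : Ro K) := fun z => by
        funext t
        rcases t with t | t <;> rfl
      constructor
      · rintro ⟨z, hz⟩
        exact ⟨fun b => ⟨z (e b), hle _⟩, by rw [← h4]; exact hz⟩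
      · rintro ⟨z, hz⟩
        refine ⟨fun j => z (e.symm j), ?_⟩
        change φ _ ∈ T
        rw [h4]
        simpa using hz
    · rintro _ ⟨p, rfl⟩
      exact pe_mem_An p
  exact Ex.of_VB h3.compl

variable (K) in
lemma exists_small_or_trivial :
    (∃ π : Ro K, π ≠ 0 ∧ ‖(π : K)‖ < 1) ∨ ∀ x : K, x ≠ 0 → ‖x‖ = 1 := by
  by_contra! h
  obtain ⟨h, x, hx0, hx⟩ := h
  rcases lt_or_gt_of_ne hx with h1 | h1
  · exact (h ⟨x, h1.le⟩ fun h => hx0 (congrArg Subtype.val h)).not_gt h1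
  · have h2 : ‖x⁻¹‖ < 1 := by
      rw [norm_inv]
      exact inv_lt_one_of_one_lt₀ h1
    exact (h ⟨x⁻¹, h2.le⟩ fun h => inv_ne_zero hx0 (congrArg Subtype.val h)).not_gt h2

/-- Quantifier simplification: complements of existentially definable sets are existentially
definable. -/
theorem Ex.compl [Finite ι] {S : Set (ι → Ro K)} (hS : Ex S) : Ex Sᶜ := by
  rcases exists_small_or_trivial K with ⟨π, hπ0, hπ⟩ | h
  · exact hS.compl_of_nontrivial hπ0 hπ
  · exact hS.compl_of_trivial h

lemma expansion_unique (hπ : ‖(π : K)‖ < 1) {a : ℕ → Ro K} {b c : Ro K}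
    (hb : ∀ n, ∃ z, b = ∑ q ∈ Finset.range n, π ^ q * a q + π ^ n * z)
    (hc : ∀ n, ∃ z, c = ∑ q ∈ Finset.range n, π ^ q * a q + π ^ n * z) : b = c := by
  refine sub_eq_zero.1 (Ro.pow_dvd_eq_zero (c := π) hπ fun n => ?_)
  obtain ⟨z, hz⟩ := hb n
  obtain ⟨w, hw⟩ := hc n
  exact ⟨z - w, by rw [hz, hw]; ring⟩

lemma ev_ser (hπ : ‖(π : K)‖ < 1) (a : ℕ → MvPolynomial ι (Ro K)) (x : ι → Ro K) (n : ℕ) :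
    ∃ z, (coordDat ι hπ).ev x (ser a) =
      ∑ q ∈ Finset.range n, π ^ q * MvPolynomial.eval x (a q) + π ^ n * z := by
  obtain ⟨z, hz⟩ := map_ser ((coordDat ι hπ).ev x) n a
  simp only [Dat.ev_C, Dat.ev_X] at hz
  exact ⟨z, hz⟩

/-- Zero loci of analytic functions are cut out by finitely many of them. -/
theorem exists_finite_zeros [Finite ι] (hπ0 : π ≠ 0) (hπ : ‖(π : K)‖ < 1) (C : Set (ι → Ro K)) :
    ∃ (l : ℕ) (h : Fin l → (ι → Ro K) → Ro K), (∀ i, h i ∈ AnO K ι) ∧ (∀ i, ∀ x ∈ C, h i x = 0) ∧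
      ∀ g ∈ AnO K ι, (∀ x ∈ C, g x = 0) → ∀ x, (∀ i, h i x = 0) → g x = 0 := by
  let D := coordDat ι hπ
  have hT : ∀ x, D.ev x (Tpi ι Empty π) = 0 := fun x => by
    rw [map_sub, Dat.ev_X, Dat.ev_C, MvPolynomial.eval_C, D.hT, sub_self]
  let M : Ideal (RS K ι Empty) := ⨅ x : C, RingHom.ker (D.ev x.1)
  have hM : ∀ F, F ∈ M ↔ ∀ x ∈ C, D.ev x F = 0 := fun F => by
    simp [M, RingHom.mem_ker]
  have hsat : Sat π M := by
    refine ⟨fun c hc g hg => (hM _).2 fun x hx => ?_, (hM _).2 fun x _ => hT x⟩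
    have h1 := (hM _).1 hg x hx
    rw [map_mul, Dat.ev_C, MvPolynomial.eval_C] at h1
    exact (mul_eq_zero.1 h1).resolve_left hc
  obtain ⟨l, f, hfM, -, hgen⟩ := exists_generators hπ0 hsat
  have hser : ∀ F : RS K ι Empty, ser (fun n => F (Finsupp.single none n)) = F := fun F => by
    funext e
    refine congrArg F (Finsupp.ext fun t => ?_)
    match t with
    | none => simp
  refine ⟨l, fun i x => D.ev x (f i), fun i => ?_, fun i x hx => (hM _).1 (hfM i) x hx,
    fun g hg hgC x hx => ?_⟩
  · obtain ⟨F, hF, h⟩ := AnO.exists_sum (ι := ι) hπ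
      (a := fun n x => MvPolynomial.eval x ((f i) (Finsupp.single none n))) fun n =>
        AnO.eval _ fun i => AnO.coord i
    have : (fun x => D.ev x (f i)) = F := funext fun x => by
      rw [← hser (f i)]
      exact expansion_unique hπ (ev_ser hπ _ x) fun n => h n x
    exact (congrArg (· ∈ AnO K ι) this).mpr hF
  · obtain ⟨A, hA⟩ := AnO.exists_expansion hπ0 hg
    have hev : ∀ x, D.ev x (ser A) = g x := fun x =>
      expansion_unique hπ (ev_ser hπ A x) fun n => hA n x
    have hA0 : cfu 0 (ser fun q => (MvPolynomial.C (A q) : MvPolynomial (Fin 0) _)) = ser A := by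
      ext e
      simp [ser, coeff_mvMk]
    obtain ⟨Q, H, -, hQ⟩ := hgen (Fin 0) (ser fun q => MvPolynomial.C (A q)) (ser_mem_QJ _)
      fun ν => (hM _).2 fun x hx => by
        rw [show ν = 0 from Subsingleton.elim _ _, hA0, hev, hgC x hx]
    have h2 := congrArg (fun F => D.ev x (cfu 0 F)) hQ
    simp only [hA0, hev, map_add, map_sum, mul_comm (Q _), cfu_c_mul, map_mul, hT, hx, zero_mul,
      Finset.sum_const_zero, add_zero] at h2
    exact h2

end

section

open scoped BoundedContinuousFunction
variable {m N : ℕ}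

/-- The coordinates of a point of the polydisc. -/
def bx (x : UnitBall K m) : Fin m → Ro K := fun i => ⟨x.1 i, x.2 i⟩

/-- The point of the polydisc with given coordinates. -/
def bi (y : Fin m → Ro K) : UnitBall K m := ⟨fun i => y i, fun i => (y i).2⟩

lemma exists_aeval_coordFn {f : UnitBall K m →ᵇ K} :
    f ∈ Algebra.adjoin K (Set.range (coordFn K m)) ↔ ∃ p, ∀ x, f x = pe p (bx x) := by
  have h : ∀ p x, MvPolynomial.aeval (coordFn K m) p x = pe p (bx x) := fun p x => by
    induction p using MvPolynomial.induction_on with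
    | C a => simp [pe]
    | add p q hp hq => simp_all [pe]
    | mul_X p i hp => simp_all [pe]; exact Or.inl rfl
  rw [Algebra.adjoin_range_eq_range_aeval]
  constructor
  · rintro ⟨p, rfl⟩
    exact ⟨p, h p⟩
  · rintro ⟨p, hp⟩
    exact ⟨p, by ext x; exact (h p x).trans (hp x).symm⟩

lemma An_of_mem_TateAlg {f : UnitBall K m →ᵇ K} (hf : f ∈ TateAlg K m) :
    (fun y => f (bi y)) ∈ An K (Fin m) := fun ε hε => by
  obtain ⟨g, hg, h⟩ := Metric.mem_closure_iff.1 hf ε hε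
  obtain ⟨p, hp⟩ := exists_aeval_coordFn.1 hg
  refine ⟨p, fun y => ?_⟩
  have := hp (bi y) ▸ (f.dist_coe_le_dist (g := g) (bi y)).trans h.le
  rwa [dist_eq_norm] at this

lemma exists_TateAlg {f : (Fin m → Ro K) → K} (hf : f ∈ An K (Fin m)) :
    ∃ g ∈ TateAlg K m, ∀ x, g x = f (bx x) := by
  have hpol : ∀ p : MvPolynomial (Fin m) K, ∃ g ∈ Algebra.adjoin K (Set.range (coordFn K m)),
      ∀ x, g x = pe p (bx x) := fun p => by
    have h : Continuous fun x : UnitBall K m => pe p (bx x) :=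
      (MvPolynomial.continuous_eval p).comp continuous_subtype_val
    obtain ⟨M, -, hM⟩ := An.exists_le (pe_mem_An p)
    exact ⟨.ofNormedAddCommGroup _ h M fun x => hM _, exists_aeval_coordFn.2 ⟨p, fun _ => rfl⟩, fun _ => rfl⟩
  have hc : Continuous fun x : UnitBall K m => f (bx x) := by
    refine continuous_of_uniform_approx_of_continuous fun u hu => ?_
    obtain ⟨ε, hε, hu⟩ := Metric.mem_uniformity_dist.1 hu
    obtain ⟨p, hp⟩ := hf (ε / 2) (by positivity)
    obtain ⟨g, -, hg⟩ := hpol p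
    refine ⟨g, g.continuous, fun y => hu ?_⟩
    rw [hg, dist_eq_norm]
    exact (hp _).trans_lt (by linarith)
  obtain ⟨M, -, hM⟩ := An.exists_le hf
  refine ⟨.ofNormedAddCommGroup _ hc M fun x => hM _, Metric.mem_closure_iff.2 fun ε hε => ?_, fun _ => rfl⟩
  obtain ⟨p, hp⟩ := hf (ε / 2) (by positivity)
  obtain ⟨g, hg, hgp⟩ := hpol p
  refine ⟨g, hg, lt_of_le_of_lt ((BoundedContinuousFunction.dist_le (by positivity)).2 fun x => ?_) (half_lt_self hε)⟩
  rw [hgp, dist_eq_norm]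
  exact hp _

lemma VB_zeros {S : Set ((Fin m → Ro K) → K)} (hS : S ⊆ An K (Fin m)) :
    VB (An K (Fin m)) {y | ∀ f ∈ S, f y = 0} := by
  rcases exists_small_or_trivial K with ⟨π, hπ0, hπ⟩ | htriv
  · obtain ⟨l, h, hh, hhC, hg⟩ := exists_finite_zeros hπ0 hπ {y | ∀ f ∈ S, f y = 0}
    refine (congrArg (VB _) (Set.ext fun y => ?_)).mp
      (VB.all fun i => VB.eq_zero (f := fun y => (h i y : K)) (hh i) (An.const 0))
    refine ⟨fun hy f hf => ?_, fun hy i => congrArg Subtype.val (hhC i y hy)⟩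
    obtain ⟨n, g, hgA, hgf⟩ := An.exists_scaling (r := 1) (f := fun _ => f) hπ fun _ => hS hf
    have h1 := hg (g 0) (hgA 0) (fun x hx => Subtype.ext (by rw [hgf, hx f hf]; simp)) y
      fun i => Subtype.ext (hy i)
    have h2 := hgf 0 y
    rw [h1] at h2
    exact (mul_eq_zero.1 h2.symm).resolve_left (pow_ne_zero n fun h => hπ0 (Subtype.ext h))
  · let M : Ideal (MvPolynomial (Fin m) K) := Ideal.span {p | pe p ∈ S}
    obtain ⟨T, hT⟩ := (isNoetherianRing_iff_ideal_fg _).1 inferInstance M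
    have hz : ∀ (U : Set (MvPolynomial (Fin m) K)) (y : Fin m → Ro K), (∀ p ∈ U, pe p y = 0) ↔
        Ideal.span U ≤ RingHom.ker (MvPolynomial.eval fun i => (y i : K)) := fun U y => by
      rw [Ideal.span_le]
      exact Iff.rfl
    refine (congrArg (VB _) (Set.ext fun y => ?_)).mp
      (VB.all fun p : T => VB.eq_zero (pe_mem_An p.1) (An.const 0))
    refine Iff.trans (b := ∀ p ∈ (T : Set (MvPolynomial (Fin m) K)), pe p y = 0) ⟨fun h p hp => h ⟨p, hp⟩, fun h p => h p p.2⟩ ?_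
    rw [hz, hT, ← hz]
    refine ⟨fun h f hf => ?_, fun h p hp => h _ hp⟩
    obtain ⟨p, hp⟩ := hS hf (1 / 2) (by norm_num)
    have h1 : f = pe p := funext fun x => by
      by_contra h2
      have := hp x
      rw [htriv _ (sub_ne_zero.2 h2)] at this
      norm_num at this
    rw [h1] at hf ⊢
    exact h p hf

lemma VB_carrier (X : Affinoid K) : VB (An K (Fin X.m)) {y | bi y ∈ X.carrier} := by
  obtain ⟨S, hS, hX⟩ := X.isZeroLocus
  refine (congrArg (VB _) (Set.ext fun y => ?_)).mp
    (VB_zeros (S := (fun f y => f (bi y)) '' S) (by rintro _ ⟨f, hf, rfl⟩; exact An_of_mem_TateAlg (hS f hf)))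
  rw [hX]
  exact Set.forall_mem_image

end

section

open scoped BoundedContinuousFunction
variable {m N : ℕ} {X : Affinoid K}

/-- Semianalytic sets, with the inequalities given by lists. -/
def Sem (X : Affinoid K) (S : Set X.carrier) : Prop :=
  ∃ L : List (List (X.O × X.O) × List (X.O × X.O)), ∀ x, x ∈ S ↔ ∃ t ∈ L,
    (∀ s ∈ t.1, ‖s.1.1 x‖ ≤ ‖s.2.1 x‖) ∧ ∀ s ∈ t.2, ‖s.1.1 x‖ < ‖s.2.1 x‖

lemma Sem.union {S T : Set X.carrier} (hS : Sem X S) (hT : Sem X T) : Sem X (S ∪ T) := by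
  obtain ⟨L, hL⟩ := hS
  obtain ⟨M, hM⟩ := hT
  refine ⟨L ++ M, fun x => ?_⟩
  simp only [Set.mem_union, hL, hM, List.mem_append, or_and_right, exists_or]

lemma Sem.inter {S T : Set X.carrier} (hS : Sem X S) (hT : Sem X T) : Sem X (S ∩ T) := by
  obtain ⟨L, hL⟩ := hS
  obtain ⟨M, hM⟩ := hT
  refine ⟨(L.product M).map fun t => (t.1.1 ++ t.2.1, t.1.2 ++ t.2.2), fun x => ?_⟩
  simp only [Set.mem_inter_iff, hL, hM, List.mem_map, Prod.exists, List.pair_mem_product]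
  constructor
  · rintro ⟨⟨a, b, h, h1, h2⟩, c, d, h', h3, h4⟩
    exact ⟨_, _, ⟨a, b, c, d, ⟨h, h'⟩, rfl⟩, List.forall_mem_append.2 ⟨h1, h3⟩, List.forall_mem_append.2 ⟨h2, h4⟩⟩
  · rintro ⟨_, _, ⟨a, b, c, d, ⟨h, h'⟩, e⟩, h1, h2⟩
    cases e
    rw [List.forall_mem_append] at h1 h2
    exact ⟨⟨a, b, h, h1.1, h2.1⟩, c, d, h', h1.2, h2.2⟩

lemma Sem.of_VB {S : Set X.carrier} (hS : VB {f | f ∈ X.O} S) : Sem X S ∧ Sem X Sᶜ := by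
  induction hS with
  | univ => exact ⟨⟨[([], [])], by simp⟩, [], by simp⟩
  | @base f g hf hg =>
    refine ⟨⟨[([(⟨f, hf⟩, ⟨g, hg⟩)], [])], fun x => ?_⟩, [([], [(⟨g, hg⟩, ⟨f, hf⟩)])], fun x => ?_⟩ <;>
      simp only [List.mem_singleton, exists_eq_left, forall_eq, List.not_mem_nil, false_imp_iff, implies_true,
        and_true, true_and]
    · exact Iff.rfl
    · exact not_le (α := ℝ)
  | compl _ ih => exact ⟨ih.2, by rw [compl_compl]; exact ih.1⟩
  | inter _ _ h1 h2 => exact ⟨h1.1.inter h2.1, by rw [Set.compl_inter]; exact h1.2.union h2.2⟩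

lemma Sem.isSemianalytic {S : Set X.carrier} (hS : Sem X S) : IsSemianalytic X S := by
  obtain ⟨L, hL⟩ := hS
  refine ⟨L.length, fun j => {x | (∀ s ∈ (L.get j).1, ‖s.1.1 x‖ ≤ ‖s.2.1 x‖) ∧
    ∀ s ∈ (L.get j).2, ‖s.1.1 x‖ < ‖s.2.1 x‖}, fun j => ?_, Set.ext fun x => ?_⟩
  · beta_reduce
    generalize L.get j = t
    obtain ⟨a, b⟩ := t
    refine ⟨a.length + b.length, a.length, Fin.append (fun i => (a.get i).1) fun i => (b.get i).1,
      Fin.append (fun i => (a.get i).2) fun i => (b.get i).2, Nat.le_add_right _ _, Set.ext fun x => ?_⟩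
    simp [Fin.forall_fin_add, List.forall_mem_iff_get]
  · rw [hL]
    simp [List.mem_iff_get]

lemma VB_of_isSemianalytic {S : Set X.carrier} (hS : IsSemianalytic X S) :
    VB (An K (Fin X.m)) {y | ∃ h : bi y ∈ X.carrier, ⟨bi y, h⟩ ∈ S} := by
  obtain ⟨k, B, hB, rfl⟩ := hS
  choose a n p q hn hB using hB
  have hO : ∀ f : X.O, ∃ g ∈ An K (Fin X.m), ∀ y (h : bi y ∈ X.carrier), f.1 ⟨bi y, h⟩ = g y := by
    rintro ⟨_, g, hg, rfl⟩
    exact ⟨_, An_of_mem_TateAlg hg, fun _ _ => rfl⟩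
  choose g hg hfg using hO
  refine (congrArg (VB _) (Set.ext fun y => ?_)).mp ((VB_carrier X).inter (VB.all fun j =>
    ((VB.all fun i => (VB.const (i.1 < n j)).imp (VB.le (hg (p j i)) (hg (q j i)))).and
      (VB.all fun i => (VB.const (n j ≤ i.1)).imp (VB.lt (hg (p j i)) (hg (q j i))))).not).compl)
  simp only [hB, Set.mem_iUnion, Set.mem_ofPred_eq, hfg, exists_prop]
  simp

lemma exists_Ex {S : Set X.carrier} (hS : IsSubanalytic X S) :
    ∃ E, Ex E ∧ ∀ x : X.carrier, x ∈ S ↔ bx x.1 ∈ E := by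
  obtain ⟨N, T, hT, rfl⟩ := hS
  let T' : Set (Fin (X.m + N) → Ro K) := {y | ∃ h : bi y ∈ (X.prod K N).carrier, ⟨bi y, h⟩ ∈ T}
  refine ⟨_, ⟨Fin N, inferInstance, _, (VB_of_isSemianalytic hT).preimage_An
    (AnMap.reindex (ι := Fin X.m ⊕ Fin N) finSumFinEquiv.symm), fun y => Iff.rfl⟩, fun x => ?_⟩
  constructor
  · rintro ⟨w, hw, rfl⟩
    have h : (fun k => Sum.elim (bx (X.projFun N w).1) (fun i => bx w.1 (Fin.natAdd X.m i))
        (finSumFinEquiv.symm k)) = bx w.1 := by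
      funext k
      refine Fin.addCases (fun i => ?_) (fun i => ?_) k
      · rw [finSumFinEquiv_symm_apply_castAdd]; rfl
      · rw [finSumFinEquiv_symm_apply_natAdd]; rfl
    exact ⟨fun i => bx w.1 (Fin.natAdd X.m i), (congrArg (· ∈ T') h).mpr ⟨w.2, hw⟩⟩
  · rintro ⟨z, h, hz⟩
    refine ⟨_, hz, Subtype.ext (Subtype.ext (funext fun i => ?_))⟩
    change ((Sum.elim (bx x.1) z (finSumFinEquiv.symm (Fin.castAdd N i)) : Ro K) : K) = _
    rw [finSumFinEquiv_symm_apply_castAdd]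
    rfl

lemma isSubanalytic_of_Ex {S : Set X.carrier} {E : Set (Fin X.m → Ro K)} (hE : Ex E)
    (h : ∀ x : X.carrier, x ∈ S ↔ bx x.1 ∈ E) : IsSubanalytic X S := by
  obtain ⟨β, _, T, hT, hTE⟩ := hE
  obtain ⟨N, ⟨e⟩⟩ := Finite.exists_equiv_fin β
  have h1 := VB.preimage (F := {f | f ∈ (X.prod K N).O}) (fun z : (X.prod K N).carrier => bx z.1)
    (fun f hf => by
      obtain ⟨g, hg, hgf⟩ := exists_TateAlg hf
      exact ⟨g, hg, funext fun z => hgf z.1⟩)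
    (hT.preimage_An (AnMap.reindex (ι := Fin (X.m + N)) (Sum.elim (Fin.castAdd N) fun b => Fin.natAdd X.m (e b))))
  refine ⟨N, _, (Sem.of_VB h1).1.isSemianalytic, Set.ext fun x => ?_⟩
  have hr : ∀ w : Fin (X.m + N) → Ro K, (fun k => w (Sum.elim (Fin.castAdd N) (fun b => Fin.natAdd X.m (e b)) k)) =
      Sum.elim (fun i => w (Fin.castAdd N i)) fun b => w (Fin.natAdd X.m (e b)) := fun w => by
    funext k
    rcases k with k | k <;> rfl
  rw [h, hTE]
  constructor
  · rintro ⟨z, hz⟩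
    let w : Fin (X.m + N) → Ro K := Fin.append (bx x.1) fun i => z (e.symm i)
    have hw : ballProj K X.m N (bi w) = x.1 := Subtype.ext (funext fun i => by
      exact congrArg Subtype.val (Fin.append_left (bx x.1) (fun i => z (e.symm i)) i))
    refine ⟨⟨bi w, (congrArg (· ∈ X.carrier) hw).mpr x.2⟩, (congrArg (· ∈ T) (hr w)).mpr ?_, Subtype.ext hw⟩
    simpa [w] using hz
  · rintro ⟨w, hw, rfl⟩
    exact ⟨_, (congrArg (· ∈ T) (hr (bx w.1))).mp hw⟩

lemma isSubanalytic_compl {S : Set X.carrier} (hS : IsSubanalytic X S) : IsSubanalytic X Sᶜ := by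
  obtain ⟨E, hE, h⟩ := exists_Ex hS
  exact isSubanalytic_of_Ex hE.compl fun x => not_congr (h x)

lemma isSubanalytic_closure {S : Set X.carrier} (hS : IsSubanalytic X S) :
    IsSubanalytic X (closure S) := by
  rcases exists_small_or_trivial K with ⟨π, hπ0, hπ⟩ | htriv
  · obtain ⟨E, hE, h⟩ := exists_Ex hS
    have hE1 := hE.and (Ex.of_VB (VB_carrier X))
    have h1 : Ex {z : ((Fin X.m ⊕ Unit) ⊕ Fin X.m) → Ro K |
        ((fun i => z (.inr i)) ∈ E ∧ bi (fun i => z (.inr i)) ∈ X.carrier) ∧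
        ∀ i, ‖(z (.inl (.inl i)) : K) - z (.inr i)‖ ≤ ‖(z (.inl (.inr ())) : K)‖} :=
      (hE1.preimage (AnMap.reindex Sum.inr)).and (Ex.all fun i => Ex.of_VB
        (VB.le (An.sub (An.coord _) (An.coord _)) (An.coord _)))
    have h2 := (Ex.ex (p := fun (x : Fin X.m ⊕ Unit → Ro K) y => (y ∈ E ∧ bi y ∈ X.carrier) ∧
      ∀ i, ‖(x (.inl i) : K) - y i‖ ≤ ‖(x (.inr ()) : K)‖) h1).compl
    have h3 : Ex {z : Fin X.m ⊕ Unit → Ro K | (z (.inr ()) : K) ≠ 0 ∧ ¬ ∃ y : Fin X.m → Ro K, (y ∈ E ∧ bi y ∈ X.carrier) ∧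
        ∀ i, ‖(z (.inl i) : K) - y i‖ ≤ ‖(z (.inr ()) : K)‖} :=
      Ex.and (Ex.of_VB (VB.not (VB.eq_zero (An.coord (Sum.inr ())) (An.const 0)))) h2
    have h4 := (Ex.ex (p := fun (x : Fin X.m → Ro K) (c : Unit → Ro K) => (c () : K) ≠ 0 ∧
      ¬ ∃ y : Fin X.m → Ro K, (y ∈ E ∧ bi y ∈ X.carrier) ∧
      ∀ i, ‖(x i : K) - y i‖ ≤ ‖(c () : K)‖) h3).compl
    refine isSubanalytic_of_Ex h4 fun x => ?_
    have hd : ∀ (y : X.carrier) (c : ℝ), 0 ≤ c → (dist x y ≤ c ↔ ∀ i, ‖x.1.1 i - y.1.1 i‖ ≤ c) := fun y c hc => by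
      simp only [← dist_eq_norm]
      exact dist_pi_le_iff hc
    rw [Metric.mem_closure_iff]
    constructor
    · rintro hx ⟨c, hc, hn⟩
      obtain ⟨y, hy, hxy⟩ := hx _ (norm_pos_iff.2 hc)
      exact hn ⟨bx y.1, ⟨(h y).1 hy, y.2⟩, (hd y _ (norm_nonneg _)).1 hxy.le⟩
    · intro hx ε hε
      obtain ⟨n, hn⟩ := exists_pow_lt_of_lt_one hε hπ
      by_contra! hne
      refine hx ⟨fun _ => π ^ n, pow_ne_zero n fun e => hπ0 (Subtype.ext e), ?_⟩
      rintro ⟨y, ⟨hyE, hyX⟩, hy⟩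
      have h5 := (hd ⟨bi y, hyX⟩ _ (norm_nonneg _)).2 hy
      refine (hne ⟨bi y, hyX⟩ ((h _).2 hyE)).not_gt (h5.trans_lt ?_)
      rw [← norm_pow] at hn
      exact hn
  · have : closure S = S := by
      refine subset_closure.antisymm' fun x hx => ?_
      obtain ⟨y, hy, hxy⟩ := Metric.mem_closure_iff.1 hx 1 one_pos
      have : x = y := Subtype.ext (Subtype.ext (funext fun i => by
        by_contra hi
        have h1 := htriv _ (sub_ne_zero.2 hi)
        rw [← dist_eq_norm] at h1
        exact (h1.symm.trans_le (dist_le_pi_dist x.1.1 y.1.1 i)).not_gt hxy))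
      rwa [this]
    rwa [this]

end

end SubQE
end

noncomputable section
namespace RigidQE

/-- **Lipshitz–Robinson.**  Let `X` be a reduced quasi-compact rigid analytic variety and
let `Σ` be a subanalytic set in `X`.  Then the complement `X \ Σ` and the closure of `Σ`
in the canonical topology are again subanalytic in `X`. -/
theorem complement_and_closure_subanalytic
    (K : Type) [NormedField K] [CompleteSpace K] [IsAlgClosed K] [IsUltrametricDist K]
    (W : Space K) (hW : W.IsQuasiCompactRigid) (hred : IsReduced W.O)
    (Sig : Set W.P) (hSig : W.IsSubanalyticSp Sig) :
    W.IsSubanalyticSp Sigᶜ ∧ W.IsSubanalyticSp (closure Sig) := by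
  obtain ⟨n, A, j, hA, h⟩ := hSig
  refine ⟨⟨n, A, j, hA, fun i => SubQE.isSubanalytic_compl (h i)⟩, n, A, j, hA, fun i => ?_⟩
  have hc : (j i).toFun ⁻¹' closure Sig = closure ((j i).toFun ⁻¹' Sig) :=
    (hA.1 i).2.1.preimage_closure_eq_closure_preimage (j i).cont Sig
  exact (congrArg (IsSubanalytic (A i)) hc).mpr (SubQE.isSubanalytic_closure (h i))

end RigidQE
end
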